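/- For every ε > 0 there exist δ > 0 and X₀ such that the following holds for all X ≥ X₀. Let h be a squarefree integer with 1 ≤ h ≤ X^{1+δ} and let a be an integer with 1 ≤ a ≤ X^{δ} and gcd(a,h) = 1. Then for all real numbers 0 ≤ α < β ≤ 1, | #{(p,ν) : p ≤ X prime, 0 ≤ ν < p, p ∣ a·ν² + h, α < ν/p ≤ β} − (β − α) · Σ_{p ≤ X, p prime} ϱ_{a,h}(p) | ≤ ε · π(X), where π(X) denotes the number of primes up to X. -/

import Mathlib

open scoped Classical

/-- The local density `ϱ_{a,h}(k) := #{ν ∈ ℤ/kℤ : aν² + h ≡ 0 (mod k)}`. -/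
noncomputable def rhoDensity (a h : ℤ) (k : ℕ) : ℕ :=
  Nat.card {ν : ZMod k // (a : ZMod k) * ν ^ 2 + (h : ZMod k) = 0}

namespace RootEquidist

noncomputable section

section

open Finset Polynomial

variable {p : ℕ} [Fact p.Prime] {K : Type} [Field K] [CharP K p]

lemma prime_one_lt (p : ℕ) [hp : Fact p.Prime] : 1 < p := hp.out.one_lt

/-- The elements of `K` fixed by the `r`-th power of Frobenius. -/
def fixedBy (p : ℕ) (K : Type) [Field K] (r : ℕ) : Finset K :=
  (X ^ p ^ r - X : K[X]).roots.toFinset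

lemma mem_fixedBy {r : ℕ} (hr : r ≠ 0) {x : K} : x ∈ fixedBy p K r ↔ x ^ p ^ r = x := by
  simp [fixedBy, FiniteField.X_pow_card_pow_sub_X_ne_zero K hr (prime_one_lt p), sub_eq_zero]

lemma card_fixedBy [IsAlgClosed K] {r : ℕ} (hr : r ≠ 0) : #(fixedBy p K r) = p ^ r := by
  have hs : (X ^ p ^ r - X : K[X]).Separable := galois_poly_separable p _ (dvd_pow_self p hr)
  rw [fixedBy, Multiset.toFinset_card_of_nodup (nodup_roots hs),
    splits_iff_card_roots.1 (IsAlgClosed.splits _),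
    FiniteField.X_pow_card_pow_sub_X_natDegree_eq K hr (prime_one_lt p)]

/-- The trace from the field with `p ^ r` elements to the prime field. -/
def tr (p : ℕ) (r : ℕ) (x : K) : K := ∑ i ∈ range r, x ^ p ^ i

lemma tr_add (r : ℕ) (x y : K) : tr p r (x + y) = tr p r x + tr p r y := by
  simp [tr, add_pow_char_pow, sum_add_distrib]

lemma tr_two_mul (r : ℕ) (x : K) : tr p (r + r) x = tr p r x + (tr p r x) ^ p ^ r := by
  rw [tr, sum_range_add, tr, sum_pow_char_pow]
  simp_rw [← pow_mul, ← pow_add]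
  simp_rw [add_comm r]

lemma tr_two_mul' (r : ℕ) (x : K) : tr p (r + r) x = tr p r (x + x ^ p ^ r) := by
  rw [tr_two_mul, tr_add, tr, tr, sum_pow_char_pow]
  simp_rw [← pow_mul, mul_comm]

lemma tr_frobenius {r : ℕ} {x : K} (hx : x ^ p ^ r = x) : (tr p r x) ^ p = tr p r x := by
  rw [tr, sum_pow_char]
  simp_rw [← pow_mul, ← pow_succ]
  simpa [sum_range_succ, hx] using (sum_range_succ' (fun i => x ^ p ^ i) r).symm

variable [Algebra (ZMod p) K]

lemma algebraMap_frobenius (r : ℕ) (t : ZMod p) :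
    (algebraMap (ZMod p) K t) ^ p ^ r = algebraMap (ZMod p) K t := by
  rw [← map_pow, ZMod.pow_card_pow]

lemma exists_algebraMap_eq {x : K} (hx : x ^ p = x) : ∃ t, algebraMap (ZMod p) K t = x := by
  have hsub : univ.image (algebraMap (ZMod p) K) ⊆ fixedBy p K 1 := by
    rintro _ h
    obtain ⟨t, -, rfl⟩ := mem_image.1 h
    exact (mem_fixedBy one_ne_zero).2 (algebraMap_frobenius 1 t)
  have hcard : #(fixedBy p K 1) ≤ #(univ.image (algebraMap (ZMod p) K)) := by
    rw [card_image_of_injective _ (algebraMap (ZMod p) K).injective, card_univ, ZMod.card]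
    refine (Multiset.toFinset_card_le _).trans ((card_roots' _).trans ?_)
    rw [FiniteField.X_pow_card_pow_sub_X_natDegree_eq K one_ne_zero (prime_one_lt p), pow_one]
  have hx' : x ∈ fixedBy p K 1 := (mem_fixedBy one_ne_zero).2 (by rwa [pow_one])
  rw [← eq_of_subset_of_card_le hsub hcard] at hx'
  simpa using hx'

/-- The standard additive character of the prime field, extended by zero to `K`. -/
def chi (p : ℕ) [Fact p.Prime] [Algebra (ZMod p) K] (y : K) : ℂ :=
  if h : ∃ t, algebraMap (ZMod p) K t = y then ZMod.stdAddChar h.choose else 0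

lemma chi_algebraMap (t : ZMod p) : chi p (algebraMap (ZMod p) K t) = ZMod.stdAddChar t := by
  have h : ∃ s, algebraMap (ZMod p) K s = algebraMap (ZMod p) K t := ⟨t, rfl⟩
  rw [chi, dif_pos h, (algebraMap (ZMod p) K).injective h.choose_spec]

lemma chi_add {x y : K} (hx : x ^ p = x) (hy : y ^ p = y) : chi p (x + y) = chi p x * chi p y := by
  obtain ⟨s, rfl⟩ := exists_algebraMap_eq hx
  obtain ⟨t, rfl⟩ := exists_algebraMap_eq hy
  rw [← map_add, chi_algebraMap, chi_algebraMap, chi_algebraMap, AddChar.map_add_eq_mul]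

/-- The composition of `chi` with the trace, as an additive character. -/
lemma sum_chi_tr_mul [IsAlgClosed K] {r : ℕ} (hr : r ≠ 0) {c : K} (hc : c ^ p ^ r = c) :
    ∑ u ∈ fixedBy p K r, chi p (tr p r (c * u)) = if c = 0 then (p : ℂ) ^ r else 0 := by
  split_ifs with h0
  · subst h0
    have h1 : tr p r (0 : K) = 0 := by simp [tr, NeZero.ne]
    have h2 : chi p (0 : K) = 1 := by simpa using chi_algebraMap (K := K) (0 : ZMod p)
    simp [h1, h2, card_fixedBy hr]
  -- an element of trace not zero
  obtain ⟨r, rfl⟩ := Nat.exists_eq_succ_of_ne_zero hr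
  have hne : ∃ z ∈ fixedBy p K (r + 1), tr p (r + 1) z ≠ 0 := by
    by_contra! hcon
    let P : K[X] := ∑ i ∈ range (r + 1), X ^ p ^ i
    have hdeg : P.natDegree ≤ p ^ r := by
      refine natDegree_sum_le_of_forall_le _ _ fun i hi => ?_
      rw [natDegree_X_pow]
      exact Nat.pow_le_pow_right (NeZero.pos p) (Nat.lt_succ_iff.1 (mem_range.1 hi))
    have hP0 : P ≠ 0 := by
      intro h
      have : P.coeff 1 = 0 := by rw [h, coeff_zero]
      simp only [P, finsetSum_coeff, coeff_X_pow] at this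
      rw [sum_eq_single 0 (fun i _ hi => if_neg (Nat.one_lt_pow hi (prime_one_lt p)).ne)
        (by simp)] at this
      simp at this
    have := card_le_degree_of_subset_roots (p := P) (Z := fixedBy p K (r + 1)) fun z hz =>
      (mem_roots hP0).2 (by simpa [P, eval_finsetSum, tr] using hcon z (by simpa using hz))
    rw [card_fixedBy hr] at this
    exact (Nat.pow_lt_pow_right (prime_one_lt p) r.lt_succ_self).not_ge (this.trans hdeg)
  obtain ⟨z, hz, hzt⟩ := hne
  rw [mem_fixedBy hr] at hz
  -- scale the element so that the character is nontrivial
  obtain ⟨t, ht⟩ := exists_algebraMap_eq (tr_frobenius hz)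
  have ht0 : t ≠ 0 := by rintro rfl; exact hzt (by rw [← ht, map_zero])
  have hscale : tr p (r + 1) (algebraMap (ZMod p) K t⁻¹ * z) = algebraMap (ZMod p) K 1 := by
    have : tr p (r + 1) (algebraMap (ZMod p) K t⁻¹ * z) =
        algebraMap (ZMod p) K t⁻¹ * tr p (r + 1) z := by
      simp only [tr, mul_sum, mul_pow, algebraMap_frobenius]
    rw [this, ← ht, ← map_mul, inv_mul_cancel₀ ht0]
  set z' := algebraMap (ZMod p) K t⁻¹ * z with hz'
  have hz'f : z' ^ p ^ (r + 1) = z' := by rw [hz', mul_pow, algebraMap_frobenius, hz]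
  have hχ : chi p (tr p (r + 1) z') ≠ 1 := by
    rw [hscale, chi_algebraMap]
    intro h
    exact one_ne_zero (ZMod.injective_stdAddChar (h.trans (AddChar.map_zero_eq_one _).symm))
  set T := ∑ u ∈ fixedBy p K (r + 1), chi p (tr p (r + 1) (c * u)) with hT
  have key : T = chi p (tr p (r + 1) z') * T := by
    rw [hT, mul_sum]
    refine sum_bij' (fun u _ => u - z' / c) (fun u _ => u + z' / c) ?_ ?_ ?_ ?_ ?_
    all_goals intro u hu
    all_goals rw [mem_fixedBy hr] at hu
    · rw [mem_fixedBy hr, sub_pow_char_pow, hu, div_pow, hz'f, hc]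
    · rw [mem_fixedBy hr, add_pow_char_pow, hu, div_pow, hz'f, hc]
    · ring
    · ring
    · have : c * u = z' + c * (u - z' / c) := by field_simp; ring
      rw [← chi_add (tr_frobenius hz'f) (tr_frobenius ?_), ← tr_add, ← this]
      rw [mul_pow, sub_pow_char_pow, hu, div_pow, hz'f, hc]
  exact (mul_left_eq_self₀.1 key.symm).resolve_left hχ

/-- The Kloosterman sum over the field with `p ^ r` elements. -/
def kl (p : ℕ) [Fact p.Prime] {K : Type} [Field K] [Algebra (ZMod p) K]
    (a b : K) (r : ℕ) : ℂ :=
  ∑ x ∈ (fixedBy p K r).filter (· ≠ 0), chi p (tr p r (a * x + b * x⁻¹))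

lemma card_conj_add_card_split [IsAlgClosed K] {r : ℕ} (hr : r ≠ 0) {u v : K}
    (hu : u ^ p ^ r = u) (hv : v ^ p ^ r = v) :
    #((fixedBy p K (r + r)).filter fun y => y + y ^ p ^ r = u ∧ y * y ^ p ^ r = v) +
      #((fixedBy p K r).filter fun y => y * (u - y) = v) = 2 := by
  have hr2 : r + r ≠ 0 := by omega
  obtain ⟨y, hy⟩ : ∃ y : K, y * (u - y) = v := by
    obtain ⟨y, hy⟩ := IsAlgClosed.exists_root (X ^ 2 - C u * X + C v : K[X]) (by
      have : (X ^ 2 - C u * X + C v : K[X]).degree = 2 := by compute_degree!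
      rw [this]; norm_num)
    refine ⟨y, ?_⟩
    simp only [IsRoot, eval_add, eval_sub, eval_pow, eval_X, eval_mul, eval_C] at hy
    linear_combination -hy
  have hroots : ∀ x : K, x * (u - x) = v ↔ x = y ∨ x = u - y := fun x => by
    rw [← sub_eq_zero (b := y), ← sub_eq_zero (b := u - y), ← mul_eq_zero]
    constructor <;> intro h <;> linear_combination hy - h
  have hA : (fixedBy p K (r + r)).filter (fun x => x + x ^ p ^ r = u ∧ x * x ^ p ^ r = v) =
      ({y, u - y} : Finset K).filter fun x => x ^ p ^ r = u - x := by
    ext x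
    simp only [mem_filter, mem_fixedBy hr2, mem_insert, mem_singleton, ← hroots]
    constructor
    · rintro ⟨-, h1, h2⟩
      have : x ^ p ^ r = u - x := by linear_combination h1
      exact ⟨by rw [← this, h2], this⟩
    · rintro ⟨h1, h2⟩
      refine ⟨?_, by rw [h2]; ring, by rw [h2, h1]⟩
      rw [pow_add, pow_mul, h2, sub_pow_char_pow, hu, h2]; ring
  have hB : (fixedBy p K r).filter (fun x => x * (u - x) = v) =
      ({y, u - y} : Finset K).filter fun x => x ^ p ^ r = x := by
    ext x
    simp only [mem_filter, mem_fixedBy hr, mem_insert, mem_singleton, ← hroots]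
    tauto
  have hF : y ^ p ^ r = y ∨ y ^ p ^ r = u - y := by
    rw [← hroots]
    nth_rewrite 1 [← hu]
    rw [← sub_pow_char_pow, ← mul_pow, hy, hv]
  have hF' : (u - y) ^ p ^ r = u - y ^ p ^ r := by rw [sub_pow_char_pow, hu]
  rw [hA, hB]
  by_cases hd : y = u - y
  · rw [← hd]
    have : y ^ p ^ r = y := by rcases hF with h | h <;> [exact h; exact h.trans hd.symm]
    simp [filter_singleton, this, ← hd]
  · rcases hF with h | h
    · have h2 : (u - y) ^ p ^ r = u - y := by rw [hF', h]
      rw [filter_false_of_mem, filter_true_of_mem, card_pair hd]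
      · simp
      · simp [h, h2]
      · simp only [mem_insert, mem_singleton, forall_eq_or_imp, forall_eq, h, h2]
        exact ⟨hd, fun h => hd (by linear_combination -h)⟩
    · have h2 : (u - y) ^ p ^ r = y := by rw [hF', h]; ring
      rw [filter_true_of_mem, filter_false_of_mem, card_pair hd]
      · simp
      · simp only [mem_insert, mem_singleton, forall_eq_or_imp, forall_eq, h, h2]
        exact ⟨fun h => hd h.symm, hd⟩
      · simp [h, h2]

lemma kl_two_mul [IsAlgClosed K] {r : ℕ} (hr : r ≠ 0) {a b : ZMod p} (ha : a ≠ 0) (hb : b ≠ 0) :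
    kl p (algebraMap (ZMod p) K a) (algebraMap (ZMod p) K b) (r + r) =
      2 * (p : ℂ) ^ r - kl p (algebraMap (ZMod p) K a) (algebraMap (ZMod p) K b) r ^ 2 := by
  have hr2 : r + r ≠ 0 := by omega
  set α := algebraMap (ZMod p) K a with hα
  set β := algebraMap (ZMod p) K b with hβ
  have hα0 : α ≠ 0 := by simpa [hα] using ha
  have hβ0 : β ≠ 0 := by simpa [hβ] using hb
  have hαr : ∀ r, α ^ p ^ r = α := fun r => algebraMap_frobenius r a
  have hβr : ∀ r, β ^ p ^ r = β := fun r => algebraMap_frobenius r b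
  let A := fixedBy p K r
  let B := A.filter (· ≠ 0)
  have memA : ∀ {x}, x ∈ A ↔ x ^ p ^ r = x := mem_fixedBy hr
  have memB : ∀ {x}, x ∈ B ↔ x ^ p ^ r = x ∧ x ≠ 0 := by simp [B, memA]
  let f : K × K → ℂ := fun w => chi p (tr p r ((α + β * w.2⁻¹) * w.1))
  -- the sum over the quadratic extension
  have h1 : kl p α β (r + r) = ∑ w ∈ A ×ˢ B,
      (#((fixedBy p K (r + r)).filter
        fun y => y + y ^ p ^ r = w.1 ∧ y * y ^ p ^ r = w.2) : ℂ) * f w := by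
    rw [kl, ← sum_fiberwise_of_maps_to (t := A ×ˢ B)
      (g := fun y => (y + y ^ p ^ r, y * y ^ p ^ r))]
    · refine sum_congr rfl fun w hw => ?_
      rw [mem_product, memA, memB] at hw
      rw [← nsmul_eq_mul, ← sum_const]
      refine sum_congr ?_ ?_
      · ext y
        simp only [mem_filter, Prod.ext_iff]
        constructor
        · tauto
        · rintro ⟨h, h1, h2⟩
          exact ⟨⟨h, fun h => hw.2.2 (by rw [← h2, h, zero_mul])⟩, h1, h2⟩
      · intro y hy
        obtain ⟨-, h1, h2⟩ := mem_filter.1 hy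
        have hy0 : y ≠ 0 := by rintro rfl; exact hw.2.2 (by rw [← h2, zero_mul])
        have hy1 : y ^ p ^ r ≠ 0 := pow_ne_zero _ hy0
        rw [tr_two_mul', add_pow_char_pow, mul_pow, mul_pow, inv_pow, hαr, hβr]
        simp only [f]
        rw [← h1, ← h2]
        congr 2
        field_simp
        ring
    · intro y hy
      simp only [mem_filter, mem_fixedBy hr2] at hy
      have : (y ^ p ^ r) ^ p ^ r = y := by rw [← pow_mul, ← pow_add, hy.1]
      rw [mem_product, memA, memB]
      refine ⟨?_, ?_, mul_ne_zero hy.2 (pow_ne_zero _ hy.2)⟩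
      · simp only [add_pow_char_pow, this]; ring
      · simp only [mul_pow, this]; ring
  -- the square of the sum over the base field
  have h2 : kl p α β r ^ 2 = ∑ w ∈ A ×ˢ B,
      (#(A.filter fun y => y * (w.1 - y) = w.2) : ℂ) * f w := by
    rw [sq, kl, sum_mul_sum, ← sum_product',
      ← sum_fiberwise_of_maps_to (t := A ×ˢ B) (g := fun y => (y.1 + y.2, y.1 * y.2))]
    · refine sum_congr rfl fun w hw => ?_
      rw [mem_product, memA, memB] at hw
      rw [← nsmul_eq_mul, ← sum_const]
      refine sum_bij' (fun y _ => y.1) (fun y _ => (y, w.1 - y)) ?_ ?_ ?_ ?_ ?_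
      · intro y hy
        simp only [mem_filter, mem_product, Prod.ext_iff] at hy ⊢
        exact ⟨hy.1.1.1, by rw [← hy.2.1, ← hy.2.2]; ring⟩
      · intro y hy
        simp only [mem_filter, mem_product, Prod.ext_iff, memA] at hy ⊢
        exact ⟨⟨⟨memA.2 hy.1, fun h => hw.2.2 (by rw [← hy.2, h, zero_mul])⟩,
          memA.2 (by rw [sub_pow_char_pow, hw.1, hy.1]),
          fun h => hw.2.2 (by rw [← hy.2, h, mul_zero])⟩,
          by ring, hy.2⟩
      · intro y hy
        simp only [mem_filter, mem_product, Prod.ext_iff] at hy ⊢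
        simp [← hy.2.1]
      · intro y hy; rfl
      · intro y hy
        simp only [mem_filter, mem_product, Prod.ext_iff, mem_fixedBy hr] at hy
        obtain ⟨⟨⟨e1, n1⟩, e2, n2⟩, s1, s2⟩ := hy
        rw [← chi_add, ← tr_add]
        · simp only [f]
          rw [← s1, ← s2]
          congr 2
          field_simp
          ring
        all_goals
          exact tr_frobenius
            (by simp only [add_pow_char_pow, mul_pow, inv_pow, hαr, hβr, e1, e2])
    · intro y hy
      simp only [mem_filter, mem_product, mem_fixedBy hr] at hy
      rw [mem_product, memA, memB]
      refine ⟨?_, ?_, mul_ne_zero hy.1.2 hy.2.2⟩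
      all_goals simp only [add_pow_char_pow, mul_pow, hy.1.1, hy.2.1]
  have h3 : kl p α β (r + r) + kl p α β r ^ 2 = ∑ w ∈ A ×ˢ B, 2 * f w := by
    rw [h1, h2, ← sum_add_distrib]
    refine sum_congr rfl fun w hw => ?_
    rw [mem_product, memA, memB] at hw
    rw [← add_mul]
    congr 1
    exact_mod_cast card_conj_add_card_split hr hw.1 hw.2.1
  have h4 : ∑ w ∈ A ×ˢ B, 2 * f w = 2 * (p : ℂ) ^ r := by
    rw [← mul_sum, sum_product_right]
    have : ∀ v ∈ B, ∑ u ∈ A, f (u, v) = if v = -(β / α) then (p : ℂ) ^ r else 0 := by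
      intro v hv
      rw [memB] at hv
      have hv0 := hv.2
      simp only [f]
      rw [sum_chi_tr_mul hr (by rw [add_pow_char_pow, mul_pow, inv_pow, hαr, hβr, hv.1])]
      refine if_congr ?_ rfl rfl
      constructor
      · intro h; field_simp at h ⊢; linear_combination h
      · rintro rfl; field_simp; ring
    rw [sum_congr rfl this, sum_ite_eq', if_pos]
    rw [memB]
    exact ⟨by simpa [hα, hβ] using algebraMap_frobenius (K := K) r (-(b / a)),
      neg_ne_zero.2 (div_ne_zero hβ0 hα0)⟩
  rw [h4] at h3
  linear_combination h3

end

section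

open Finset Real Polynomial

section Stepanov

variable {p : ℕ} [Fact p.Prime] {K : Type} [Field K] [CharP K p]

/-- The trace of `α x + β / x`, with its denominator cleared. -/
def clearedTrace (p : ℕ) (α β : K) (m : ℕ) : K[X] :=
  ∑ i ∈ range (m + 1), (C α * X ^ (p ^ m + p ^ i) + C β * X ^ (p ^ m - p ^ i))

lemma pow_pow_eq_self {α : K} (hα : α ^ p = α) : ∀ i, α ^ p ^ i = α
  | 0 => by simp
  | i + 1 => by rw [pow_succ, pow_mul, pow_pow_eq_self hα i, hα]

lemma eval_clearedTrace {α β : K} (hα : α ^ p = α) (hβ : β ^ p = β) (m : ℕ) {x : K} (hx : x ≠ 0) :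
    (clearedTrace p α β m).eval x = x ^ p ^ m * tr p (m + 1) (α * x + β * x⁻¹) := by
  rw [clearedTrace, tr, eval_finsetSum, mul_sum]
  refine sum_congr rfl fun i hi => ?_
  have hi' := Nat.pow_le_pow_right (NeZero.pos p) (Nat.lt_succ_iff.1 (mem_range.1 hi))
  simp only [eval_add, eval_mul, eval_C, eval_pow, eval_X]
  rw [add_pow_char_pow, mul_pow, mul_pow, inv_pow, pow_pow_eq_self hα, pow_pow_eq_self hβ,
    pow_add, pow_sub₀ _ hx hi']
  ring

lemma natDegree_clearedTrace_le (α β : K) (m : ℕ) :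
    (clearedTrace p α β m).natDegree ≤ 2 * p ^ m := by
  refine natDegree_sum_le_of_forall_le _ _ fun i hi => ?_
  have := Nat.pow_le_pow_right (NeZero.pos p) (Nat.lt_succ_iff.1 (mem_range.1 hi))
  refine (natDegree_add_le _ _).trans (max_le ?_ ?_) <;>
    exact (natDegree_C_mul_X_pow_le _ _).trans (by omega)

lemma natDegree_sub_clearedTrace {α : K} (β : K) (hα : α ≠ 0) (t : K) (m : ℕ) :
    (C t * X ^ p ^ m - clearedTrace p α β m).natDegree = 2 * p ^ m := by
  have h1 := prime_one_lt p
  have hpm : 0 < p ^ m := pow_pos (by omega) m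
  refine le_antisymm ((natDegree_sub_le _ _).trans (max_le ((natDegree_C_mul_X_pow_le _ _).trans
    (by omega)) (natDegree_clearedTrace_le α β m))) (le_natDegree_of_ne_zero ?_)
  rw [coeff_sub, coeff_C_mul_X_pow, if_neg (by omega), clearedTrace, finsetSum_coeff,
    sum_eq_single m]
  · rw [coeff_add, coeff_C_mul_X_pow, coeff_C_mul_X_pow, if_pos (by omega), if_neg (by omega)]
    simpa using hα
  · intro i hi him
    have := Nat.pow_lt_pow_right h1 (show i < m by have := mem_range.1 hi; omega)
    rw [coeff_add, coeff_C_mul_X_pow, coeff_C_mul_X_pow, if_neg (by omega), if_neg (by omega),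
      add_zero]
  · simp

/-- The elements of the field with `p ^ (2 m + 2)` elements where `α x + β / x` has trace `t`. -/
def traceFibre (p : ℕ) (α β : K) (m : ℕ) (t : K) : Finset K :=
  (fixedBy p K (m + 1 + (m + 1))).filter fun x =>
    x ≠ 0 ∧ tr p (m + 1 + (m + 1)) (α * x + β * x⁻¹) = t

lemma exists_auxiliary_relation (α β : K) (m : ℕ) :
    ∃ c : Fin (p ^ m) × Fin (p ^ m + 2) × Fin p → K, c ≠ 0 ∧
      ∑ k, c k • (X ^ (k.1 * p ^ (m + 1) + k.2.1 + (p - 1 - k.2.2) * p ^ m) *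
        clearedTrace p α β m ^ (k.2.2 : ℕ) : K[X]) = 0 := by
  have h1 := prime_one_lt p
  have hpm : 0 < p ^ m := pow_pos (by omega) m
  set w := p ^ m with hw
  set s := p ^ (m + 1) with hs
  have hsw : s = w * p := pow_succ p m
  set v : Fin w × Fin (w + 2) × Fin p → K[X] := fun k =>
    X ^ (k.1 * s + k.2.1 + (p - 1 - k.2.2) * w) * clearedTrace p α β m ^ (k.2.2 : ℕ) with hv
  set n := (w - 1) * s + (w + 1) + 2 * (p - 1) * w + 1 with hn
  have hdeg : ∀ k, (v k).natDegree < n := by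
    intro k
    have he : (k.1 : ℕ) * s ≤ (w - 1) * s := Nat.mul_le_mul_right _ (by omega)
    have hj : (p - 1 - k.2.2) * w + k.2.2 * (2 * w) ≤ 2 * (p - 1) * w := by
      rw [← mul_assoc, ← add_mul]
      exact Nat.mul_le_mul_right _ (by omega)
    have : (v k).natDegree ≤ (k.1 * s + k.2.1 + (p - 1 - k.2.2) * w) + k.2.2 * (2 * w) := by
      refine natDegree_mul_le.trans (add_le_add (natDegree_X_pow_le _) ?_)
      exact natDegree_pow_le.trans (Nat.mul_le_mul_left _ (natDegree_clearedTrace_le α β m))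
    omega
  let f : (Fin w × Fin (w + 2) × Fin p → K) →ₗ[K] (Fin n → K) :=
    (LinearMap.pi fun k : Fin n => lcoeff K (k : ℕ)) ∘ₗ Fintype.linearCombination K v
  have hrank : Module.finrank K (Fin n → K) <
      Module.finrank K (Fin w × Fin (w + 2) × Fin p → K) := by
    simp only [Module.finrank_fintype_fun_eq_card, Fintype.card_fin, Fintype.card_prod]
    obtain ⟨w', hw'⟩ : ∃ w', w = w' + 1 := ⟨w - 1, by omega⟩
    obtain ⟨p', hp'⟩ : ∃ p', p = p' + 2 := ⟨p - 2, by omega⟩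
    rw [hn, hsw, hw', hp']
    simp only [Nat.add_sub_cancel, show p' + 2 - 1 = p' + 1 by omega]
    nlinarith [Nat.zero_le (w' * p'), Nat.zero_le w', Nat.zero_le p']
  obtain ⟨c, hc, hc0⟩ := Submodule.exists_mem_ne_zero_of_ne_bot
    (LinearMap.ker_ne_bot_of_finrank_lt (f := f) hrank)
  refine ⟨c, hc0, ?_⟩
  ext k
  have hsum : (∑ k, c k • v k).natDegree < n := by
    refine lt_of_le_of_lt (natDegree_sum_le_of_forall_le _ _ (n := n - 1) fun k _ => ?_) (by omega)
    have := hdeg k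
    exact (natDegree_smul_le _ _).trans (by omega)
  by_cases hk : k < n
  · have := congrFun (LinearMap.mem_ker.1 hc) ⟨k, hk⟩
    simpa [f, Fintype.linearCombination_apply] using this
  · exact coeff_eq_zero_of_natDegree_lt (lt_of_lt_of_le hsum (not_lt.1 hk))

lemma card_traceFibre_le [IsAlgClosed K] {α β : K} (hα : α ^ p = α) (hβ : β ^ p = β) (hα0 : α ≠ 0)
    (m : ℕ) {t : K} (ht : t ^ p = t) :
    #(traceFibre p α β m t) ≤ p ^ (m + 1) * p ^ m + 4 * p ^ (m + 1) := by
  have h1 := prime_one_lt p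
  have hpm : 0 < p ^ m := pow_pos (by omega) m
  obtain ⟨c, hc0, hc⟩ := exists_auxiliary_relation α β m (p := p)
  generalize hw : p ^ m = w at c hc0 hc hpm
  generalize hs : p ^ (m + 1) = s at hc
  have hs0 : 0 < s := hs ▸ pow_pos (by omega) _
  have hsw : s = w * p := by rw [← hs, ← hw, pow_succ]
  have hsub (k : Fin p) : ∃ q : ℕ, p - 1 = q + k := ⟨p - 1 - k, by omega⟩
  choose c' hc' using fun k => IsAlgClosed.exists_pow_nat_eq (c k) hs0
  set W : K[X] := C t * X ^ w - clearedTrace p α β m with hW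
  have hWdeg : W.natDegree = 2 * w := hw ▸ hW ▸ hw ▸ natDegree_sub_clearedTrace β hα0 t m
  have hW0 : W ≠ 0 := by rintro h; rw [h, natDegree_zero] at hWdeg; omega
  let g : Fin w × Fin (w + 2) × Fin p → K[X] := fun k =>
    C (c' k) * (X ^ (k.1 + s * k.2.1 + (p - 1 - k.2.2) * w) * W ^ (k.2.2 : ℕ))
  have hgdeg : ∀ k, c' k ≠ 0 →
      (g k).natDegree = k.1 + w * k.2.2 + s * k.2.1 + (p - 1) * w := by
    intro k hk
    rw [natDegree_C_mul hk, natDegree_mul (pow_ne_zero _ X_ne_zero) (pow_ne_zero _ hW0),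
      natDegree_X_pow, natDegree_pow, hWdeg]
    obtain ⟨q, hq⟩ := hsub k.2.2
    rw [hq, Nat.add_sub_cancel]
    ring
  have hgne : ∀ k, g k ≠ 0 ↔ c' k ≠ 0 := by simp [g, hW0]
  have hdisj : Set.Pairwise {i | i ∈ univ ∧ g i ≠ 0}
      (Function.onFun Ne (natDegree ∘ g)) := by
    rintro ⟨e, i, j⟩ ⟨-, hk⟩ ⟨e', i', j'⟩ ⟨-, hk'⟩ hne heq
    apply hne
    simp only [Function.comp, hgdeg _ ((hgne _).1 hk), hgdeg _ ((hgne _).1 hk'),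
      add_left_inj] at heq
    have hlt (e : Fin w) (j : Fin p) : (e : ℕ) + w * j < s := by
      have : w * (j + 1) ≤ w * p := Nat.mul_le_mul_left _ (by omega)
      rw [hsw]; linarith [e.2]
    have hi : (i : ℕ) = i' := by
      have := congrArg (· / s) heq
      simp only [Nat.add_mul_div_left _ _ hs0, Nat.div_eq_of_lt (hlt _ _)] at this
      omega
    have hej : (e : ℕ) + w * j = e' + w * j' := by rw [hi] at heq; omega
    have hj : (j : ℕ) = j' := by
      have := congrArg (· / w) hej
      simp only [Nat.add_mul_div_left _ _ hpm, Nat.div_eq_of_lt e.2, Nat.div_eq_of_lt e'.2] at this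
      omega
    have he : (e : ℕ) = e' := by rw [hj] at hej; omega
    exact Prod.ext (Fin.ext he) (Prod.ext (Fin.ext hi) (Fin.ext hj))
  set Ψ : K[X] := ∑ k, g k with hΨ
  have hΨ0 : Ψ ≠ 0 := by
    obtain ⟨k, hk⟩ := Function.ne_iff.1 hc0
    have hk' : c' k ≠ 0 := fun h => hk (by rw [← hc' k, h, zero_pow hs0.ne']; rfl)
    intro h0
    have := natDegree_sum_eq_of_disjoint g univ hdisj
    rw [← hΨ, h0, natDegree_zero] at this
    have h2 := le_sup (f := fun i => (g i).natDegree) (mem_univ k)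
    rw [← this, hgdeg k hk'] at h2
    have := Nat.mul_pos (show 0 < p - 1 by omega) hpm
    omega
  have hroot : ∀ x ∈ traceFibre p α β m t, Ψ.eval x = 0 := by
    intro x hx
    obtain ⟨hx1, hx0, hxt⟩ := mem_filter.1 hx
    rw [mem_fixedBy (by omega), pow_add, hs, pow_mul] at hx1
    rw [tr_two_mul, hs] at hxt
    set U := tr p (m + 1) (α * x + β * x⁻¹) with hU
    have hVx : (clearedTrace p α β m).eval x = x ^ w * U := hw ▸ eval_clearedTrace hα hβ m hx0
    have hWx : W.eval x = x ^ w * (t - U) := by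
      rw [hW, eval_sub, hVx]; simp; ring
    have hpw : Ψ.eval x = x ^ ((p - 1) * w) *
        ∑ k : Fin w × Fin (w + 2) × Fin p,
          c' k * x ^ ((k.1 : ℕ) + s * k.2.1) * (t - U) ^ (k.2.2 : ℕ) := by
      rw [hΨ, eval_finsetSum, mul_sum]
      refine sum_congr rfl fun k _ => ?_
      simp only [g, eval_mul, eval_C, eval_pow, eval_X, hWx, mul_pow]
      obtain ⟨q, hq⟩ := hsub k.2.2
      rw [hq, Nat.add_sub_cancel]
      ring
    have hrel : ∑ k : Fin w × Fin (w + 2) × Fin p,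
        c k * x ^ ((k.1 : ℕ) * s + k.2.1) * U ^ (k.2.2 : ℕ) = 0 := by
      have := congrArg (eval x) hc
      rw [eval_finsetSum, eval_zero] at this
      have h2 : x ^ ((p - 1) * w) * ∑ k : Fin w × Fin (w + 2) × Fin p,
          c k * x ^ ((k.1 : ℕ) * s + k.2.1) * U ^ (k.2.2 : ℕ) = 0 := by
        rw [← this, mul_sum]
        refine sum_congr rfl fun k _ => ?_
        simp only [eval_smul, eval_mul, eval_pow, eval_X, hVx, smul_eq_mul]
        obtain ⟨q, hq⟩ := hsub k.2.2
        rw [hq, Nat.add_sub_cancel]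
        ring
      exact (mul_eq_zero.1 h2).resolve_left (pow_ne_zero _ hx0)
    have hzero : (∑ k : Fin w × Fin (w + 2) × Fin p,
          c' k * x ^ ((k.1 : ℕ) + s * k.2.1) * (t - U) ^ (k.2.2 : ℕ)) ^ s = 0 := by
      rw [← hrel, ← hs, sum_pow_char_pow]
      refine sum_congr rfl fun k _ => ?_
      have e1 : (t - U) ^ s = U := by
        rw [← hs, sub_pow_char_pow, pow_pow_eq_self ht, hs]; linear_combination -hxt
      rw [hs, mul_pow, mul_pow, hc', pow_right_comm (t - U), e1]
      congr 2
      rw [pow_add, mul_pow, pow_add, ← pow_mul]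
      congr 1
      rw [pow_mul, pow_right_comm, hx1]
    rw [hpw, pow_eq_zero_iff hs0.ne' |>.1 hzero, mul_zero]
  refine (card_le_degree_of_subset_roots (p := Ψ) fun x hx =>
    (mem_roots hΨ0).2 (hroot x (by simpa using hx))).trans
      (natDegree_sum_le_of_forall_le _ _ fun k _ => ?_)
  by_cases hk : c' k = 0
  · simp [g, hk]
  change (g k).natDegree ≤ _
  rw [hgdeg k hk]
  have e1 : w * (k.2.2 : ℕ) ≤ w * (p - 1) := Nat.mul_le_mul_left _ (by omega)
  have e2 : s * (k.2.1 : ℕ) ≤ s * (w + 1) := Nat.mul_le_mul_left _ (by omega)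
  have e3 : w * (p - 1) + w = s := by
    rw [hsw]; conv_rhs => rw [show p = (p - 1) + 1 by omega]
    ring
  have e4 : (p - 1) * w = w * (p - 1) := mul_comm _ _
  have := k.1.2
  rw [mul_add, mul_one] at e2
  omega

variable [Algebra (ZMod p) K]

lemma norm_kl_even_le [IsAlgClosed K] {a b : ZMod p} (ha : a ≠ 0) (m : ℕ) :
    ‖kl p (algebraMap (ZMod p) K a) (algebraMap (ZMod p) K b) (m + 1 + (m + 1))‖ ≤
      5 * (p : ℝ) ^ 2 * p ^ (m + 1) := by
  have h1 := prime_one_lt p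
  set α := algebraMap (ZMod p) K a with hα
  set β := algebraMap (ZMod p) K b with hβ
  have hαp : α ^ p = α := by simpa using algebraMap_frobenius (K := K) 1 a
  have hβp : β ^ p = β := by simpa using algebraMap_frobenius (K := K) 1 b
  have hα0 : α ≠ 0 := by simpa [hα] using ha
  have hr : m + 1 + (m + 1) ≠ 0 := by omega
  set s := p ^ (m + 1) with hs
  let N : ZMod p → ℝ := fun t => (traceFibre p α β m (algebraMap (ZMod p) K t)).card
  have hN : ∀ t, N t ≤ s * p ^ m + 4 * s := fun t => by
    have := card_traceFibre_le hαp hβp hα0 m (t := algebraMap (ZMod p) K t)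
      (by simpa using algebraMap_frobenius (K := K) 1 t)
    simp only [N, hs]; exact_mod_cast this
  have htr : ∀ x ∈ fixedBy p K (m + 1 + (m + 1)), ∃ t,
      algebraMap (ZMod p) K t = tr p (m + 1 + (m + 1)) (α * x + β * x⁻¹) := by
    intro x hx
    refine exists_algebraMap_eq (tr_frobenius ?_)
    rw [mem_fixedBy hr] at hx
    rw [add_pow_char_pow, mul_pow, mul_pow, inv_pow, hx, algebraMap_frobenius,
      algebraMap_frobenius]
  choose! τ hτ using htr
  have hfib : ∀ t, ((fixedBy p K (m + 1 + (m + 1))).filter (· ≠ 0)).filter (fun x => τ x = t) =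
      traceFibre p α β m (algebraMap (ZMod p) K t) := by
    intro t
    ext x
    simp only [traceFibre, mem_filter]
    constructor
    · rintro ⟨⟨h, h0⟩, rfl⟩
      exact ⟨h, h0, (hτ x h).symm⟩
    · rintro ⟨h, h0, h2⟩
      exact ⟨⟨h, h0⟩, (algebraMap (ZMod p) K).injective ((hτ x h).trans h2)⟩
  have hkl : kl p α β (m + 1 + (m + 1)) = ∑ t : ZMod p, (N t : ℂ) * ZMod.stdAddChar t := by
    rw [kl, ← sum_fiberwise _ τ]
    refine sum_congr rfl fun t _ => ?_
    rw [hfib]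
    rw [sum_congr rfl fun x hx => by rw [(mem_filter.1 hx).2.2, chi_algebraMap], sum_const,
      nsmul_eq_mul]
    simp [N]
  have htot : ∑ t, N t = (s : ℝ) ^ 2 - 1 := by
    have : ∑ t, (traceFibre p α β m (algebraMap (ZMod p) K t)).card =
        #((fixedBy p K (m + 1 + (m + 1))).filter (· ≠ 0)) := by
      rw [card_eq_sum_card_fiberwise (f := τ) (t := univ) (by simp)]
      simp_rw [hfib]
    have h0 : (0 : K) ∈ fixedBy p K (m + 1 + (m + 1)) := by
      rw [mem_fixedBy hr, zero_pow (pow_pos (by omega) _).ne']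
    rw [filter_ne', card_erase_of_mem h0, card_fixedBy hr, pow_add, ← hs] at this
    have hs1 : 1 ≤ s * s := Nat.mul_pos (pow_pos (by omega) _) (pow_pos (by omega) _)
    calc ∑ t, N t = ((∑ t, (traceFibre p α β m (algebraMap (ZMod p) K t)).card : ℕ) : ℝ) := by
          push_cast; rfl
      _ = _ := by rw [this, Nat.cast_sub hs1]; push_cast; ring
  have hsp : (s : ℝ) * p ^ m * p = s ^ 2 := by rw [hs]; push_cast; ring
  set A : ℝ := s * p ^ m + 4 * s with hA
  have hsum0 : ∑ t : ZMod p, ((ZMod.stdAddChar t : ℂ)) = 0 :=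
    AddChar.sum_eq_zero_of_ne_one (by simpa using ZMod.isPrimitive_stdAddChar p one_ne_zero)
  have hkl2 : kl p α β (m + 1 + (m + 1)) = -∑ t : ZMod p, ((A - N t : ℝ) : ℂ) *
      ZMod.stdAddChar t := by
    rw [hkl]
    push_cast
    simp only [sub_mul, sum_sub_distrib, ← mul_sum, hsum0]
    ring
  rw [hkl2, norm_neg]
  calc ‖∑ t : ZMod p, ((A - N t : ℝ) : ℂ) * ZMod.stdAddChar t‖
      ≤ ∑ t : ZMod p, (A - N t) := by
        refine (norm_sum_le _ _).trans (sum_le_sum fun t _ => ?_)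
        rw [norm_mul, Complex.norm_real, AddChar.norm_apply, mul_one, norm_eq_abs,
          abs_of_nonneg (sub_nonneg.2 (hN t))]
    _ = 4 * p * s + 1 := by
        rw [sum_sub_distrib, htot, sum_const, card_univ, ZMod.card,
          nsmul_eq_mul, hA]
        linear_combination hsp
    _ ≤ 5 * (p : ℝ) ^ 2 * p ^ (m + 1) := by
        have h2 : (1 : ℝ) ≤ p := by exact_mod_cast h1.le
        have h3 : (1 : ℝ) ≤ s := by exact_mod_cast Nat.one_le_pow _ _ (by omega)
        rw [hs] at h3 ⊢
        push_cast at h3 ⊢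
        nlinarith [mul_nonneg (sub_nonneg.2 h2) (sub_nonneg.2 h3), mul_nonneg (sub_nonneg.2 h2)
          (sub_nonneg.2 h2), mul_le_mul_of_nonneg_right (show (p : ℝ) ≤ p ^ 2 by nlinarith)
          (show (0 : ℝ) ≤ p ^ (m + 1) by positivity)]

end Stepanov

section Bound

variable {p : ℕ} [Fact p.Prime]

lemma norm_kl_one_le {K : Type} [Field K] [CharP K p] [Algebra (ZMod p) K] [IsAlgClosed K]
    {a b : ZMod p} (ha : a ≠ 0) (hb : b ≠ 0) :
    ‖kl p (algebraMap (ZMod p) K a) (algebraMap (ZMod p) K b) 1‖ ≤ 2 * √(p : ℝ) := by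
  have h1 := prime_one_lt p
  have hp0 : (0 : ℝ) < p := mod_cast NeZero.pos p
  set α := algebraMap (ZMod p) K a
  set β := algebraMap (ZMod p) K b
  let s : ℕ → ℝ := fun j => ‖kl p α β (2 ^ j)‖ / √((p : ℝ) ^ 2 ^ j)
  have hsq : ∀ j, √((p : ℝ) ^ 2 ^ (j + 1)) = (p : ℝ) ^ 2 ^ j := fun j => by
    rw [pow_succ, pow_mul, sqrt_sq (by positivity)]
  have hstep : ∀ j, s j ^ 2 - 2 ≤ s (j + 1) := by
    intro j
    have h2 : kl p α β (2 ^ (j + 1)) = 2 * (p : ℂ) ^ 2 ^ j - kl p α β (2 ^ j) ^ 2 := by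
      rw [pow_succ, mul_two]
      exact kl_two_mul (pow_ne_zero _ two_ne_zero) ha hb
    have h3 : ‖kl p α β (2 ^ j)‖ ^ 2 - 2 * (p : ℝ) ^ 2 ^ j ≤ ‖kl p α β (2 ^ (j + 1))‖ := by
      rw [h2, norm_sub_rev]
      refine le_trans (le_of_eq ?_) (norm_sub_norm_le _ _)
      simp
    simp only [s]
    rwa [hsq, div_pow, sq_sqrt (by positivity), le_div_iff₀ (by positivity), sub_mul,
      div_mul_cancel₀ _ (by positivity)]
  have hbound : ∀ j, s (j + 1) ≤ 5 * (p : ℝ) ^ 2 := by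
    intro j
    simp only [s]
    rw [hsq, div_le_iff₀ (by positivity)]
    obtain ⟨m, hm⟩ : ∃ m, 2 ^ j = m + 1 :=
      ⟨2 ^ j - 1, by have := Nat.one_le_two_pow (n := j); omega⟩
    have := norm_kl_even_le (K := K) (b := b) ha m
    rw [pow_succ, mul_two, hm]
    exact_mod_cast this
  have h0 : s 0 ≤ 2 := by
    by_contra! hcon
    have hgrow : ∀ j : ℕ, 2 + (j + 1) * (s 0 - 2) ≤ s j := fun j => by
      induction j with
      | zero => simp
      | succ j ih =>
        have := hstep j
        have hj : 0 ≤ j * (s 0 - 2) := mul_nonneg (by positivity) (by linarith)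
        push_cast
        nlinarith
    obtain ⟨n, hn⟩ := exists_nat_gt (5 * (p : ℝ) ^ 2 / (s 0 - 2))
    rw [div_lt_iff₀ (by linarith)] at hn
    have e1 := (hgrow (n + 1)).trans (hbound n)
    push_cast at e1
    nlinarith
  simp only [s, pow_zero, pow_one] at h0
  rwa [div_le_iff₀ (by positivity)] at h0

/-- **Weil's bound** for Kloosterman sums to a prime modulus. -/
theorem norm_kloosterman_prime_le {a b : ZMod p} (ha : a ≠ 0) (hb : b ≠ 0) :
    ‖∑ x : (ZMod p)ˣ, (ZMod.stdAddChar (a * x.1 + b * (x⁻¹).1) : ℂ)‖ ≤ 2 * √(p : ℝ) := by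
  have h1 := prime_one_lt p
  let K := AlgebraicClosure (ZMod p)
  refine le_trans (le_of_eq ?_) (norm_kl_one_le (K := K) ha hb)
  congr 1
  rw [kl]
  refine sum_bij' (fun x _ => algebraMap (ZMod p) K x)
    (fun y _ => if h : ∃ t : (ZMod p)ˣ, algebraMap (ZMod p) K t = y then h.choose else 1)
    ?_ ?_ ?_ ?_ ?_
  · intro x _
    simp only [mem_filter, mem_fixedBy one_ne_zero]
    exact ⟨algebraMap_frobenius 1 _, by simp⟩
  · simp
  · intro x _
    have h : ∃ t : (ZMod p)ˣ, algebraMap (ZMod p) K t = algebraMap (ZMod p) K x := ⟨x, rfl⟩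
    simp only [dif_pos h]
    exact Units.ext ((algebraMap (ZMod p) K).injective h.choose_spec)
  · intro y hy
    simp only [mem_filter, mem_fixedBy one_ne_zero, pow_one] at hy
    obtain ⟨t, ht⟩ := exists_algebraMap_eq hy.1
    have ht0 : t ≠ 0 := by rintro rfl; exact hy.2 (by rw [← ht, map_zero])
    have h : ∃ t : (ZMod p)ˣ, algebraMap (ZMod p) K t = y := ⟨Units.mk0 t ht0, ht⟩
    simp only [dif_pos h]
    exact h.choose_spec
  · intro x _
    rw [tr, sum_range_one, pow_zero, pow_one, ← chi_algebraMap (K := K),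
      Units.val_inv_eq_inv_val, map_add, map_mul, map_mul, map_inv₀]

end Bound

end

section

open Finset Real

/-- The Kloosterman sum `∑ ψ(x + x⁻¹)` attached to an additive character. -/
def kloos {c : ℕ} [NeZero c] (ψ : AddChar (ZMod c) ℂ) : ℂ :=
  ∑ x : (ZMod c)ˣ, ψ (x.1 + (x⁻¹).1)

lemma exists_eq_mulShift_stdAddChar {p : ℕ} [NeZero p] (ψ : AddChar (ZMod p) ℂ) :
    ∃ a : ZMod p, ψ = (ZMod.stdAddChar (N := p)).mulShift a := by
  obtain ⟨x, hx⟩ := (AddChar.zmodAddEquiv (n := p)).surjective ψ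
  refine ⟨x, ?_⟩
  rw [← hx]
  ext y
  obtain ⟨x', rfl⟩ := ZMod.intCast_surjective x
  obtain ⟨y', rfl⟩ := ZMod.intCast_surjective y
  rw [AddChar.mulShift_apply, ← Int.cast_mul, ZMod.stdAddChar_coe, AddChar.zmodAddEquiv_apply]
  change ((AddChar.zmod p (x' : ZMod p) (y' : ZMod p) : Circle) : ℂ) = _
  rw [AddChar.zmod_intCast, Circle.coe_exp]
  congr 1
  push_cast
  ring

lemma norm_kloos_prime_le {p : ℕ} [Fact p.Prime] (ψ : AddChar (ZMod p) ℂ) (hψ : ψ 1 ≠ 1) :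
    ‖kloos ψ‖ ≤ 2 * √(p : ℝ) := by
  obtain ⟨a, rfl⟩ := exists_eq_mulShift_stdAddChar ψ
  have ha : a ≠ 0 := by
    rintro rfl
    simp at hψ
  refine le_trans (le_of_eq ?_) (norm_kloosterman_prime_le ha ha)
  congr 1
  refine sum_congr rfl fun x _ => ?_
  rw [AddChar.mulShift_apply, mul_add]

lemma norm_kloos_le_trivial {c : ℕ} [NeZero c] (ψ : AddChar (ZMod c) ℂ) : ‖kloos ψ‖ ≤ c := by
  refine (norm_sum_le _ _).trans ?_
  simp only [AddChar.norm_apply, sum_const, nsmul_eq_mul, mul_one, card_univ]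
  rw [ZMod.card_units_eq_totient]
  exact_mod_cast Nat.totient_le c

/-- The two components of an additive character of `ZMod (m * n)` for coprime `m`, `n`. -/
lemma exists_kloos_mul {m n : ℕ} [NeZero m] [NeZero n] (hmn : m.Coprime n)
    (ψ : AddChar (ZMod (m * n)) ℂ) :
    ∃ ψ₁ : AddChar (ZMod m) ℂ, ∃ ψ₂ : AddChar (ZMod n) ℂ,
      (∀ k : ℕ, ψ (k : ZMod (m * n)) = ψ₁ k * ψ₂ k) ∧ kloos ψ = kloos ψ₁ * kloos ψ₂ := by
  let e := ZMod.chineseRemainder hmn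
  let ψ' : AddChar (ZMod m × ZMod n) ℂ := ψ.compAddMonoidHom e.symm.toAddMonoidHom
  let ψ₁ : AddChar (ZMod m) ℂ := ψ'.compAddMonoidHom (AddMonoidHom.inl _ _)
  let ψ₂ : AddChar (ZMod n) ℂ := ψ'.compAddMonoidHom (AddMonoidHom.inr _ _)
  have h1 : ∀ u v, ψ' (u, v) = ψ₁ u * ψ₂ v := by
    intro u v
    change _ = ψ' (u, 0) * ψ' (0, v)
    rw [← AddChar.map_add_eq_mul]
    simp
  have h2 : ∀ x, ψ x = ψ' (e x) := by
    intro x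
    change _ = ψ (e.symm (e x))
    simp
  refine ⟨ψ₁, ψ₂, fun k => ?_, ?_⟩
  · rw [h2, ← h1]
    congr 1
    simp
    rfl
  · unfold kloos
    rw [sum_mul_sum, ← sum_product', univ_product_univ]
    refine Fintype.sum_equiv
      ((Units.mapEquiv e.toMulEquiv).trans MulEquiv.prodUnits).toEquiv _ _ fun x => ?_
    rw [h2, ← h1]
    congr 1
    rw [map_add]
    rfl

lemma norm_kloos_le (c₁ : ℕ) : ∀ (c₂ c : ℕ) [NeZero c] (_ : c = c₁ * c₂) (_ : c₁.Coprime c₂)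
    (_ : Squarefree c₁) (ψ : AddChar (ZMod c) ℂ)
    (_ : ∀ p : ℕ, p.Prime → p ∣ c₁ → ψ ((c / p : ℕ) : ZMod c) ≠ 1),
    ‖kloos ψ‖ ≤ c₁.divisors.card * √(c₁ : ℝ) * c₂ := by
  induction c₁ using induction_on_primes with
  | zero => intro c₂ c _ hc; simp at hc; exact absurd hc (NeZero.ne c)
  | one =>
    intro c₂ c _ hc _ _ ψ _
    have := norm_kloos_le_trivial ψ
    simp at hc ⊢
    rwa [← hc]
  | prime_mul p a hp ih =>
    intro c₂ c _ hc hco hsq ψ hψ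
    have : Fact p.Prime := ⟨hp⟩
    have hc0 : c ≠ 0 := NeZero.ne c
    have hn0 : a * c₂ ≠ 0 := by
      intro h; apply hc0; rw [hc, mul_assoc, h, mul_zero]
    have : NeZero (a * c₂) := ⟨hn0⟩
    have hpa : p.Coprime a := Nat.coprime_of_squarefree_mul hsq
    have hpn : p.Coprime (a * c₂) := hpa.mul_right (Nat.Coprime.coprime_mul_right hco)
    rw [mul_assoc] at hc
    subst hc
    obtain ⟨ψ₁, ψ₂, hk, hkl⟩ := exists_kloos_mul hpn ψ
    have e1 : ψ₁ 1 ≠ 1 := by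
      intro h1
      apply hψ p hp (dvd_mul_right _ _)
      rw [Nat.mul_div_cancel_left _ hp.pos, hk]
      have z : ((a * c₂ : ℕ) : ZMod (a * c₂)) = 0 := ZMod.natCast_self _
      rw [z, AddChar.map_zero_eq_one, mul_one, ← nsmul_one, AddChar.map_nsmul_eq_pow, h1, one_pow]
    have e2 : ‖kloos ψ₂‖ ≤ a.divisors.card * √(a : ℝ) * c₂ := by
      refine ih c₂ (a * c₂) rfl (Nat.Coprime.coprime_mul_left hco)
        (hsq.squarefree_of_dvd (dvd_mul_left _ _)) ψ₂ fun q hq hqa h1 => ?_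
      have hqn : q ∣ a * c₂ := hqa.mul_right _
      apply hψ q hq (hqa.mul_left _)
      rw [Nat.mul_div_assoc _ hqn, hk]
      have z : ((p * (a * c₂ / q) : ℕ) : ZMod p) = 0 := by simp
      rw [z, AddChar.map_zero_eq_one, one_mul, Nat.cast_mul, ← nsmul_eq_mul,
        AddChar.map_nsmul_eq_pow, h1, one_pow]
    rw [hkl, norm_mul, hpa.card_divisors_mul, Nat.Prime.divisors hp,
      card_pair hp.one_lt.ne]
    push_cast
    rw [sqrt_mul (Nat.cast_nonneg _)]
    calc _ ≤ (2 * √(p : ℝ)) * (a.divisors.card * √(a : ℝ) * c₂) :=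
        mul_le_mul (norm_kloos_prime_le ψ₁ e1) e2 (norm_nonneg _) (by positivity)
      _ = _ := by ring

end

section

open Finset Real

/-- The number of divisors. -/
abbrev tau (n : ℕ) : ℕ := n.divisors.card

lemma one_le_tau {n : ℕ} (hn : n ≠ 0) : 1 ≤ tau n :=
  card_pos.mpr ⟨1, Nat.one_mem_divisors.mpr hn⟩

lemma tau_mul_le (a b : ℕ) : tau (a * b) ≤ tau a * tau b := by
  rw [tau, Nat.divisors_mul]
  exact card_mul_le

lemma tau_le_of_dvd {a b : ℕ} (hb : b ≠ 0) (h : a ∣ b) : tau a ≤ tau b :=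
  card_le_card (Nat.divisors_subset_of_dvd hb h)

lemma exists_tau_le_rpow {ε : ℝ} (hε : 0 < ε) :
    ∃ C : ℝ, 1 ≤ C ∧ ∀ n : ℕ, n ≠ 0 → (tau n : ℝ) ≤ C * (n : ℝ) ^ ε := by
  obtain ⟨P, hP⟩ := exists_nat_ge ((2 : ℝ) ^ (1 / ε))
  set B : ℝ := 1 + 1 / (ε * log 2) with hB
  have hl2 : 0 < log 2 := log_pos (by norm_num)
  have hB1 : 1 ≤ B := by
    have : 0 < 1 / (ε * log 2) := by positivity
    linarith
  have key : ∀ p e : ℕ, p.Prime →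
      ((e + 1 : ℕ) : ℝ) ≤ (if p < P then B else 1) * ((p : ℝ) ^ ε) ^ e := by
    intro p e hp
    have hp2 : (2 : ℝ) ≤ p := mod_cast hp.two_le
    split_ifs with h
    · have h1 : (2 : ℝ) ^ ε ≤ (p : ℝ) ^ ε := rpow_le_rpow (by norm_num) hp2 hε.le
      have h2 : 1 + ε * log 2 ≤ (2 : ℝ) ^ ε := by
        have := add_one_le_exp (log 2 * ε)
        rw [rpow_def_of_pos (by norm_num)]
        linarith
      have h3 : 1 + (e : ℝ) * (ε * log 2) ≤ ((p : ℝ) ^ ε) ^ e := by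
        refine le_trans (one_add_mul_le_pow (by nlinarith [mul_pos hε hl2]) e) ?_
        exact pow_le_pow_left₀ (by positivity) (h2.trans h1) e
      have h4 : ((e + 1 : ℕ) : ℝ) ≤ B * (1 + (e : ℝ) * (ε * log 2)) := by
        have h5 : 0 < ε * log 2 := by positivity
        have h6 : B * (1 + (e : ℝ) * (ε * log 2))
          = 1 + e + 1 / (ε * log 2) + e * (ε * log 2) := by
          rw [hB]; field_simp; ring
        rw [h6]; push_cast
        have : 0 ≤ 1 / (ε * log 2) + e * (ε * log 2) := by positivity
        linarith
      exact h4.trans (mul_le_mul_of_nonneg_left h3 (by linarith))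
    · have hpP : (2 : ℝ) ^ (1 / ε) ≤ p := hP.trans (mod_cast not_lt.mp h)
      have h1 : (2 : ℝ) ≤ (p : ℝ) ^ ε := by
        have := rpow_le_rpow (by positivity) hpP hε.le
        rwa [← rpow_mul (by norm_num), one_div_mul_cancel hε.ne', rpow_one] at this
      rw [one_mul]
      calc ((e + 1 : ℕ) : ℝ) ≤ (2 : ℝ) ^ e := mod_cast Nat.lt_two_pow_self
        _ ≤ _ := pow_le_pow_left₀ (by norm_num) h1 e
  refine ⟨B ^ P, one_le_pow₀ hB1, fun n hn => ?_⟩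
  rw [tau, Nat.card_divisors hn]
  push_cast
  have h1 : (n : ℝ) ^ ε = ∏ p ∈ n.primeFactors, ((p : ℝ) ^ ε) ^ (n.factorization p) := by
    conv_lhs => rw [← Nat.prod_factorization_pow_eq_self hn]
    rw [Finsupp.prod, Nat.support_factorization]
    push_cast
    rw [← finsetProd_rpow _ _ (fun i _ => by positivity)]
    refine prod_congr rfl fun p _ => ?_
    rw [← rpow_natCast, ← rpow_natCast, ← rpow_mul (by positivity),
      ← rpow_mul (by positivity), mul_comm]
  calc ∏ p ∈ n.primeFactors, ((n.factorization p : ℝ) + 1)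
      ≤ ∏ p ∈ n.primeFactors, ((if p < P then B else 1) * ((p : ℝ) ^ ε) ^ (n.factorization p)) := by
        refine prod_le_prod (fun _ _ => by positivity) fun p hp => ?_
        exact_mod_cast key p (n.factorization p) (Nat.prime_of_mem_primeFactors hp)
    _ = (∏ p ∈ n.primeFactors, if p < P then B else 1) * (n : ℝ) ^ ε := by
        rw [prod_mul_distrib, h1]
    _ ≤ B ^ P * (n : ℝ) ^ ε := by
        refine mul_le_mul_of_nonneg_right ?_ (by positivity)
        rw [prod_ite, prod_const, prod_const, one_pow, mul_one]
        refine pow_le_pow_right₀ hB1 ?_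
        calc _ ≤ #(range P) := card_le_card (by
              intro p; simp only [mem_filter, mem_range]; exact fun h => h.2)
          _ = P := card_range P

/-- Summation over `n ≤ N` and its divisors. -/
lemma sum_sum_divisors {M : Type*} [AddCommMonoid M] (N : ℕ) (f : ℕ → ℕ → M) :
    ∑ n ∈ Icc 1 N, ∑ d ∈ n.divisors, f d (n / d)
      = ∑ d ∈ Icc 1 N, ∑ m ∈ Icc 1 (N / d), f d m := by
  rw [sum_sigma', sum_sigma']
  refine sum_bij' (fun x _ => ⟨x.2, x.1 / x.2⟩) (fun x _ => ⟨x.1 * x.2, x.1⟩)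
    ?_ ?_ ?_ ?_ ?_
  · rintro ⟨n, d⟩ h
    simp only [mem_sigma, mem_Icc, Nat.mem_divisors] at h ⊢
    obtain ⟨⟨h1, h2⟩, h3, h4⟩ := h
    have hd := Nat.pos_of_dvd_of_pos h3 h1
    exact ⟨⟨hd, (Nat.le_of_dvd h1 h3).trans h2⟩,
      Nat.div_pos (Nat.le_of_dvd h1 h3) hd, Nat.div_le_div_right h2⟩
  · rintro ⟨d, m⟩ h
    simp only [mem_sigma, mem_Icc, Nat.mem_divisors] at h ⊢
    obtain ⟨⟨h1, h2⟩, h3, h4⟩ := h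
    have := (Nat.le_div_iff_mul_le h1).mp h4
    exact ⟨⟨Nat.mul_pos h1 h3, by rwa [mul_comm]⟩, dvd_mul_right _ _, (Nat.mul_pos h1 h3).ne'⟩
  · rintro ⟨n, d⟩ h
    simp only [mem_sigma, mem_Icc, Nat.mem_divisors] at h
    simp [Nat.mul_div_cancel' h.2.1]
  · rintro ⟨d, m⟩ h
    simp only [mem_sigma, mem_Icc] at h
    simp [Nat.mul_div_cancel_left _ h.1.1]
  · rintro ⟨n, d⟩ _
    rfl

lemma sum_inv_le (N : ℕ) : ∑ n ∈ Icc 1 N, (1 : ℝ) / n ≤ 1 + log N := by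
  have := harmonic_le_one_add_log N
  rw [harmonic_eq_sum_Icc] at this
  push_cast at this
  simpa using this

lemma log_natCast_nonneg (N : ℕ) : 0 ≤ Real.log N := Real.log_natCast_nonneg N

lemma sum_tau_pow_div_le (j N : ℕ) :
    ∑ n ∈ Icc 1 N, (tau n : ℝ) ^ j / n ≤ (1 + log N) ^ 2 ^ j := by
  induction j with
  | zero => simpa using sum_inv_le N
  | succ j ih =>
    calc ∑ n ∈ Icc 1 N, (tau n : ℝ) ^ (j + 1) / n
        = ∑ n ∈ Icc 1 N, ∑ d ∈ n.divisors, (tau n : ℝ) ^ j / n := by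
          refine sum_congr rfl fun n _ => ?_
          rw [sum_const, nsmul_eq_mul, pow_succ]; ring
      _ ≤ ∑ n ∈ Icc 1 N, ∑ d ∈ n.divisors,
            ((tau d : ℝ) ^ j / d) * ((tau (n / d) : ℝ) ^ j / (n / d : ℕ)) := by
          refine sum_le_sum fun n _ => sum_le_sum fun d hd => ?_
          have hdn := Nat.dvd_of_mem_divisors hd
          obtain ⟨m, rfl⟩ := hdn
          have hd0 : 0 < d := Nat.pos_of_mem_divisors hd
          rw [Nat.mul_div_cancel_left _ hd0, div_mul_div_comm, ← mul_pow, Nat.cast_mul]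
          gcongr
          exact_mod_cast tau_mul_le d m
      _ = ∑ d ∈ Icc 1 N, ((tau d : ℝ) ^ j / d) *
            ∑ m ∈ Icc 1 (N / d), ((tau m : ℝ) ^ j / m) := by
          rw [sum_sum_divisors N (fun d m => ((tau d : ℝ) ^ j / d) * ((tau m : ℝ) ^ j / m))]
          simp_rw [mul_sum]
      _ ≤ ∑ d ∈ Icc 1 N, ((tau d : ℝ) ^ j / d) *
            ∑ m ∈ Icc 1 N, ((tau m : ℝ) ^ j / m) := by
          refine sum_le_sum fun d _ => mul_le_mul_of_nonneg_left ?_ (by positivity)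
          exact sum_le_sum_of_subset_of_nonneg
            (Icc_subset_Icc_right (Nat.div_le_self _ _)) fun _ _ _ => by positivity
      _ ≤ (1 + log N) ^ 2 ^ j * (1 + log N) ^ 2 ^ j := by
          rw [← sum_mul]
          exact mul_le_mul ih ih (sum_nonneg fun _ _ => by positivity)
            (by have := log_natCast_nonneg N; positivity)
      _ = _ := by rw [← pow_add, pow_succ, mul_two]

lemma sum_tau_pow_le (j N : ℕ) :
    ∑ n ∈ Icc 1 N, (tau n : ℝ) ^ j ≤ N * (1 + log N) ^ (2 ^ j - 1) := by
  induction j generalizing N with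
  | zero => simp
  | succ j ih =>
    have hN := log_natCast_nonneg N
    calc ∑ n ∈ Icc 1 N, (tau n : ℝ) ^ (j + 1)
        = ∑ n ∈ Icc 1 N, ∑ d ∈ n.divisors, (tau n : ℝ) ^ j := by
          refine sum_congr rfl fun n _ => ?_
          rw [sum_const, nsmul_eq_mul, pow_succ]; ring
      _ ≤ ∑ n ∈ Icc 1 N, ∑ d ∈ n.divisors, (tau d : ℝ) ^ j * (tau (n / d) : ℝ) ^ j := by
          refine sum_le_sum fun n _ => sum_le_sum fun d hd => ?_
          have hdn := Nat.dvd_of_mem_divisors hd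
          obtain ⟨m, rfl⟩ := hdn
          rw [Nat.mul_div_cancel_left _ (Nat.pos_of_mem_divisors hd), ← mul_pow]
          gcongr
          exact_mod_cast tau_mul_le d m
      _ = ∑ d ∈ Icc 1 N, (tau d : ℝ) ^ j * ∑ m ∈ Icc 1 (N / d), (tau m : ℝ) ^ j := by
          rw [sum_sum_divisors N (fun d m => (tau d : ℝ) ^ j * (tau m : ℝ) ^ j)]
          simp_rw [mul_sum]
      _ ≤ ∑ d ∈ Icc 1 N, (tau d : ℝ) ^ j * ((N / d) * (1 + log N) ^ (2 ^ j - 1)) := by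
          refine sum_le_sum fun d hd => mul_le_mul_of_nonneg_left ?_ (by positivity)
          have h0 := log_natCast_nonneg (N / d)
          refine (ih (N / d)).trans (mul_le_mul Nat.cast_div_le (pow_le_pow_left₀ (by linarith)
            ?_ _) (by positivity) (by positivity))
          rcases Nat.eq_zero_or_pos (N / d) with h | h
          · simp [h, hN]
          · have : log (N / d : ℕ) ≤ log N :=
              log_le_log (mod_cast h) (mod_cast Nat.div_le_self _ _)
            linarith
      _ = N * (1 + log N) ^ (2 ^ j - 1) * ∑ d ∈ Icc 1 N, (tau d : ℝ) ^ j / d := by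
          rw [mul_sum]
          refine sum_congr rfl fun d _ => ?_
          ring
      _ ≤ N * (1 + log N) ^ (2 ^ j - 1) * (1 + log N) ^ 2 ^ j :=
          mul_le_mul_of_nonneg_left (sum_tau_pow_div_le j N) (by positivity)
      _ = _ := by
          rw [mul_assoc, ← pow_add]
          congr 2
          have := Nat.one_le_two_pow (n := j)
          rw [pow_succ]; omega

end

section

open Finset Real

/-- The Kloosterman sum `S(q, q; c)`. -/
def klo (q : ℤ) (c : ℕ) : ℂ :=
  if h : c = 0 then 0 else
    have : NeZero c := ⟨h⟩
    kloos ((ZMod.stdAddChar (N := c)).mulShift (q : ZMod c))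

lemma klo_eq (q : ℤ) (c : ℕ) [NeZero c] :
    klo q c = kloos ((ZMod.stdAddChar (N := c)).mulShift (q : ZMod c)) := by
  rw [klo, dif_neg (NeZero.ne c)]

lemma norm_klo_le (q : ℤ) {c₁ c₂ : ℕ} (h1 : Squarefree c₁) (h2 : c₂ ≠ 0) (hco : c₁.Coprime c₂)
    (hq : c₁.Coprime q.natAbs) :
    ‖klo q (c₁ * c₂)‖ ≤ c₁.divisors.card * √(c₁ : ℝ) * c₂ := by
  have h0 : c₁ * c₂ ≠ 0 := mul_ne_zero h1.ne_zero h2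
  have : NeZero (c₁ * c₂) := ⟨h0⟩
  rw [klo_eq]
  refine norm_kloos_le c₁ c₂ _ rfl hco h1 _ fun p hp hpc h => ?_
  have hpc' : p ∣ c₁ * c₂ := hpc.mul_right _
  obtain ⟨m, hm⟩ := hpc'
  have hpr := (ZMod.isPrimitive_stdAddChar (c₁ * c₂)).zmod_char_eq_one_iff
  rw [AddChar.mulShift_apply, hpr, ← Int.cast_natCast, ← Int.cast_mul,
    ZMod.intCast_zmod_eq_zero_iff_dvd, hm, Nat.mul_div_cancel_left _ hp.pos] at h
  have hm0 : m ≠ 0 := by rintro rfl; rw [mul_zero] at hm; exact h0 hm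
  push_cast at h
  have h3 : (p : ℤ) ∣ q := Int.dvd_of_mul_dvd_mul_right (mod_cast hm0) h
  have h4 : p ∣ q.natAbs := Int.natCast_dvd.mp h3
  exact hp.one_lt.ne' (Nat.eq_one_of_dvd_coprimes hq hpc h4)

lemma coprime_div_gcd {k m : ℕ} (hk : Squarefree k) : (k / k.gcd m).Coprime m := by
  have h0 : k = k / k.gcd m * k.gcd m := (Nat.div_mul_cancel (Nat.gcd_dvd_left _ _)).symm
  have h1 : (k / k.gcd m).Coprime (k.gcd m) := Nat.coprime_of_squarefree_mul (h0 ▸ hk)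
  refine Nat.Coprime.symm ?_
  rw [Nat.coprime_iff_gcd_eq_one, ← Nat.dvd_one]
  have h2 : m.gcd (k / k.gcd m) ∣ k.gcd m :=
    Nat.dvd_gcd ((Nat.gcd_dvd_right _ _).trans (Nat.div_dvd_of_dvd (Nat.gcd_dvd_left _ _)))
      (Nat.gcd_dvd_left _ _)
  rw [← h1.gcd_eq_one]
  exact Nat.dvd_gcd (Nat.gcd_dvd_right _ _) h2

lemma norm_klo_div_le {q : ℤ} (hq : q ≠ 0) {a d k x : ℕ} (ha : a ≠ 0) (hx : x ≠ 0)
    (hd : Squarefree d) (hk : Squarefree k) (had : d.Coprime a) :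
    ‖klo q (a * d * (k * x ^ 2))‖ / ((a * d * (k * x ^ 2) : ℕ) : ℝ) ≤
      tau (a * d * (k * x ^ 2)) * ((k.gcd (a * d * q.natAbs * x) : ℕ) / √(k : ℝ)) *
        √((d.gcd q.natAbs : ℕ) / (d : ℝ)) * (d.gcd x : ℕ) := by
  set Q := q.natAbs with hQ
  have hQ0 : Q ≠ 0 := Int.natAbs_ne_zero.mpr hq
  have hd0 := hd.ne_zero
  have hk0 := hk.ne_zero
  set g := k.gcd (a * d * Q * x) with hg
  set f := d.gcd (a * k * Q * x) with hf
  have hgk : g ∣ k := Nat.gcd_dvd_left _ _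
  have hfd : f ∣ d := Nat.gcd_dvd_left _ _
  have hg0 : g ≠ 0 := fun h => hk0 (Nat.eq_zero_of_gcd_eq_zero_left h)
  have hf0 : f ≠ 0 := fun h => hd0 (Nat.eq_zero_of_gcd_eq_zero_left h)
  obtain ⟨k1, hk1⟩ := hgk
  obtain ⟨d1, hd1⟩ := hfd
  have ek : k / g = k1 := by rw [hk1, Nat.mul_div_cancel_left _ hg0.pos]
  have ed : d / f = d1 := by rw [hd1, Nat.mul_div_cancel_left _ hf0.pos]
  have ck : k1.Coprime (a * d * Q * x) := ek ▸ coprime_div_gcd hk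
  have cd : d1.Coprime (a * k * Q * x) := ed ▸ coprime_div_gcd hd
  have ckg : k1.Coprime g := Nat.Coprime.symm (Nat.coprime_of_squarefree_mul (hk1 ▸ hk))
  have cdf : d1.Coprime f := Nat.Coprime.symm (Nat.coprime_of_squarefree_mul (hd1 ▸ hd))
  have sk1 : Squarefree k1 := hk.squarefree_of_dvd ⟨g, by rw [hk1, mul_comm]⟩
  have sd1 : Squarefree d1 := hd.squarefree_of_dvd ⟨f, by rw [hd1, mul_comm]⟩
  simp only [Nat.coprime_mul_iff_right] at ck cd
  obtain ⟨⟨⟨cka, ckd⟩, ckQ⟩, ckx⟩ := ck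
  obtain ⟨⟨⟨cda, cdk⟩, cdQ⟩, cdx⟩ := cd
  have ckd1 : k1.Coprime d1 := ckd.coprime_dvd_right ⟨f, by rw [hd1, mul_comm]⟩
  have ckf : k1.Coprime f := ckd.coprime_dvd_right ⟨d1, hd1⟩
  have cdg : d1.Coprime g := cdk.coprime_dvd_right ⟨k1, hk1⟩
  have hc : a * d * (k * x ^ 2) = (k1 * d1) * (a * g * f * x ^ 2) := by
    calc a * d * (k * x ^ 2) = a * (f * d1) * ((g * k1) * x ^ 2) := by rw [← hk1, ← hd1]
      _ = _ := by ring
  have hc2 : a * g * f * x ^ 2 ≠ 0 := by positivity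
  have hco : (k1 * d1).Coprime (a * g * f * x ^ 2) := by
    simp only [Nat.coprime_mul_iff_right, Nat.coprime_mul_iff_left]
    exact ⟨⟨⟨⟨cka, cda⟩, ckg, cdg⟩, ckf, cdf⟩, ckx.pow_right 2, cdx.pow_right 2⟩
  have hsq : Squarefree (k1 * d1) := (Nat.squarefree_mul ckd1).mpr ⟨sk1, sd1⟩
  have main := norm_klo_le q hsq hc2 hco (Nat.Coprime.mul_left ckQ cdQ)
  have h10 : k1 * d1 ≠ 0 := hsq.ne_zero
  have hk10 : (0 : ℝ) < k1 := mod_cast sk1.ne_zero.pos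
  have hd10 : (0 : ℝ) < d1 := mod_cast sd1.ne_zero.pos
  have hgR : (0 : ℝ) < g := mod_cast hg0.pos
  have hfR : (0 : ℝ) < f := mod_cast hf0.pos
  have hkR : (k : ℝ) = g * k1 := mod_cast hk1
  have hdR : (d : ℝ) = f * d1 := mod_cast hd1
  have hkpos : (0 : ℝ) < k := by rw [hkR]; positivity
  have hdpos : (0 : ℝ) < d := by rw [hdR]; positivity
  have hfle : f ≤ g * (d.gcd Q * d.gcd x) := by
    have h1 : f ∣ d.gcd a * d.gcd k * d.gcd Q * d.gcd x :=
      (Nat.gcd_mul_right_dvd_mul_gcd _ _ _).trans (mul_dvd_mul_right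
        ((Nat.gcd_mul_right_dvd_mul_gcd _ _ _).trans (mul_dvd_mul_right
          (Nat.gcd_mul_right_dvd_mul_gcd _ _ _) _)) _)
    rw [had.gcd_eq_one, one_mul] at h1
    have h2 : d.gcd k ∣ g := Nat.dvd_gcd (Nat.gcd_dvd_right _ _)
      ((Nat.gcd_dvd_left _ _).trans ⟨a * Q * x, by ring⟩)
    refine Nat.le_of_dvd ?_ (h1.trans ?_)
    · have := Nat.gcd_pos_of_pos_left Q hd0.pos
      have := Nat.gcd_pos_of_pos_left x hd0.pos
      positivity
    · rw [mul_assoc]; exact mul_dvd_mul_right h2 _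
  have hfle' : (f : ℝ) ≤ g * ((d.gcd Q : ℕ) * (d.gcd x : ℕ) : ℝ) := mod_cast hfle
  have hgx : (1 : ℝ) ≤ (d.gcd x : ℕ) := by
    exact_mod_cast Nat.gcd_pos_of_pos_left x hd0.pos
  have htau : (tau (k1 * d1) : ℝ) ≤ tau (a * d * (k * x ^ 2)) := by
    rw [hc]
    exact_mod_cast tau_le_of_dvd (mul_ne_zero h10 hc2) (dvd_mul_right _ _)
  rw [← hc] at main
  calc ‖klo q (a * d * (k * x ^ 2))‖ / ((a * d * (k * x ^ 2) : ℕ) : ℝ)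
      ≤ (tau (k1 * d1) * √((k1 * d1 : ℕ) : ℝ) * ((a * g * f * x ^ 2 : ℕ) : ℝ)) /
        (((k1 * d1) * (a * g * f * x ^ 2) : ℕ) : ℝ) := by
        rw [← hc]
        exact div_le_div_of_nonneg_right main (Nat.cast_nonneg _)
    _ = tau (k1 * d1) * √(1 / (k1 * d1)) := by
        have h3 : (0 : ℝ) < ((a * g * f * x ^ 2 : ℕ) : ℝ) := by
          exact_mod_cast hc2.pos
        rw [Nat.cast_mul (k1 * d1), mul_div_mul_right _ _ h3.ne', Nat.cast_mul, one_div,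
          sqrt_inv, mul_div_assoc, sqrt_div_self', one_div]
    _ ≤ tau (a * d * (k * x ^ 2)) *
        √((g / √(k : ℝ)) ^ 2 * ((d.gcd Q : ℕ) / (d : ℝ)) * (d.gcd x : ℕ) ^ 2) := by
        refine mul_le_mul htau (sqrt_le_sqrt ?_) (sqrt_nonneg _) (Nat.cast_nonneg _)
        rw [div_pow, sq_sqrt hkpos.le, hkR, hdR]
        rw [div_mul_div_comm, div_mul_eq_mul_div, div_le_div_iff₀ (by positivity) (by positivity)]
        have : (f : ℝ) ≤ g * ((d.gcd Q : ℕ) * (d.gcd x : ℕ) ^ 2 : ℝ) :=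
          hfle'.trans (by
            refine mul_le_mul_of_nonneg_left (mul_le_mul_of_nonneg_left ?_ (by positivity))
              (by positivity)
            nlinarith)
        calc (1 : ℝ) * (g * k1 * (f * d1)) = (g * (k1 * d1)) * f := by ring
          _ ≤ (g * (k1 * d1)) * (g * ((d.gcd Q : ℕ) * (d.gcd x : ℕ) ^ 2 : ℝ)) := by gcongr
          _ = _ := by ring
    _ = _ := by
        rw [sqrt_mul (by positivity), sqrt_mul (by positivity), sqrt_sq (by positivity),
          sqrt_sq (by positivity)]
        ring

lemma sum_inv_sqrt_le (K : ℕ) : ∑ k ∈ Icc 1 K, 1 / √(k : ℝ) ≤ 2 * √(K : ℝ) := by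
  induction K with
  | zero => simp
  | succ K ih =>
    rw [sum_Icc_succ_top (by omega)]
    have h1 : 0 < √((K + 1 : ℕ) : ℝ) := sqrt_pos.mpr (by positivity)
    have h2 : √((K + 1 : ℕ) : ℝ) ^ 2 = K + 1 := by rw [sq_sqrt (by positivity)]; push_cast; rfl
    have h3 : √(K : ℝ) ^ 2 = K := sq_sqrt (by positivity)
    have h4 : 0 ≤ √(K : ℝ) := sqrt_nonneg _
    have : 1 / √((K + 1 : ℕ) : ℝ) ≤ 2 * √((K + 1 : ℕ) : ℝ) - 2 * √(K : ℝ) := by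
      rw [div_le_iff₀ h1]
      nlinarith [sq_nonneg (√((K + 1 : ℕ) : ℝ) - √(K : ℝ))]
    linarith

lemma gcd_le_sum_divisors {m : ℕ} (hm : m ≠ 0) {n : ℕ} :
    ((n.gcd m : ℕ) : ℝ) ≤ ∑ g ∈ m.divisors, if g ∣ n then (g : ℝ) else 0 := by
  have h : n.gcd m ∈ m.divisors := Nat.mem_divisors.mpr ⟨Nat.gcd_dvd_right _ _, hm⟩
  refine le_trans ?_ (single_le_sum (f := fun g => if g ∣ n then (g : ℝ) else 0)
    (fun g _ => by positivity) h)
  simp [Nat.gcd_dvd_left]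

/-- Multiples of `g` up to `N`. -/
lemma sum_filter_dvd {M : Type*} [AddCommMonoid M] {g : ℕ} (hg : 0 < g) (N : ℕ) (f : ℕ → M) :
    ∑ n ∈ (Icc 1 N).filter (g ∣ ·), f n = ∑ m ∈ Icc 1 (N / g), f (g * m) := by
  symm
  refine sum_bij' (fun m _ => g * m) (fun n _ => n / g) ?_ ?_ ?_ ?_ ?_
  · intro m hm
    simp only [mem_Icc, mem_filter] at hm ⊢
    have := (Nat.le_div_iff_mul_le hg).mp hm.2
    exact ⟨⟨Nat.mul_pos hg hm.1, by rwa [mul_comm]⟩, dvd_mul_right _ _⟩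
  · intro n hn
    simp only [mem_Icc, mem_filter] at hn ⊢
    exact ⟨Nat.div_pos (Nat.le_of_dvd hn.1.1 hn.2) hg, Nat.div_le_div_right hn.1.2⟩
  · intro m _; exact Nat.mul_div_cancel_left _ hg
  · intro n hn
    exact Nat.mul_div_cancel' (mem_filter.mp hn).2
  · intros; rfl

lemma sum_gcd_mul_le {m : ℕ} (hm : m ≠ 0) (N : ℕ) {f : ℕ → ℝ} (hf : ∀ n, 0 ≤ f n) {B : ℝ}
    (hB : ∀ g, 0 < g → ∑ k ∈ Icc 1 (N / g), (g : ℝ) * f (g * k) ≤ B) :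
    ∑ n ∈ Icc 1 N, ((n.gcd m : ℕ) : ℝ) * f n ≤ tau m * B := by
  calc _ ≤ ∑ n ∈ Icc 1 N, ∑ g ∈ m.divisors, (if g ∣ n then (g : ℝ) * f n else 0) := by
        refine sum_le_sum fun n _ => ?_
        refine (mul_le_mul_of_nonneg_right (gcd_le_sum_divisors hm) (hf n)).trans
          (le_of_eq ?_)
        rw [sum_mul]
        refine sum_congr rfl fun g _ => ?_
        split_ifs <;> simp
    _ = ∑ g ∈ m.divisors, ∑ k ∈ Icc 1 (N / g), (g : ℝ) * f (g * k) := by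
        rw [sum_comm]
        refine sum_congr rfl fun g hg => ?_
        rw [← sum_filter, sum_filter_dvd (Nat.pos_of_mem_divisors hg)]
    _ ≤ ∑ g ∈ m.divisors, B :=
        sum_le_sum fun g hg => hB g (Nat.pos_of_mem_divisors hg)
    _ = _ := by rw [sum_const, nsmul_eq_mul]

lemma sum_gcd_div_sqrt_le {m : ℕ} (hm : m ≠ 0) (K : ℕ) :
    ∑ k ∈ Icc 1 K, ((k.gcd m : ℕ) : ℝ) / √(k : ℝ) ≤ tau m * (2 * √(K : ℝ)) := by
  have := sum_gcd_mul_le (f := fun k => 1 / √(k : ℝ)) hm K (fun n => by positivity)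
    (B := 2 * √(K : ℝ)) ?_
  · simpa [div_eq_mul_inv] using this
  · intro g hg
    have hgR : (0 : ℝ) < g := mod_cast hg
    calc _ = √(g : ℝ) * ∑ k ∈ Icc 1 (K / g), 1 / √(k : ℝ) := by
          rw [mul_sum]
          refine sum_congr rfl fun k _ => ?_
          rw [Nat.cast_mul, sqrt_mul hgR.le, mul_one_div, mul_one_div, ← div_div,
            div_sqrt]
      _ ≤ √(g : ℝ) * (2 * √((K / g : ℕ) : ℝ)) := by
          gcongr; exact sum_inv_sqrt_le _
      _ = 2 * √((g : ℝ) * (K / g : ℕ)) := by rw [sqrt_mul hgR.le]; ring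
      _ ≤ _ := by
          gcongr
          exact_mod_cast Nat.mul_div_le K g

lemma sum_gcd_div_le {m : ℕ} (hm : m ≠ 0) (K : ℕ) :
    ∑ k ∈ Icc 1 K, ((k.gcd m : ℕ) : ℝ) / k ≤ tau m * (1 + log K) := by
  have := sum_gcd_mul_le (f := fun k => 1 / (k : ℝ)) hm K (fun n => by positivity)
    (B := 1 + log K) ?_
  · simpa [div_eq_mul_inv] using this
  · intro g hg
    have hgR : (0 : ℝ) < g := mod_cast hg
    calc _ = ∑ k ∈ Icc 1 (K / g), 1 / (k : ℝ) := by
          refine sum_congr rfl fun k _ => ?_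
          rw [Nat.cast_mul]; field_simp
      _ ≤ ∑ k ∈ Icc 1 K, 1 / (k : ℝ) :=
          sum_le_sum_of_subset_of_nonneg
            (Icc_subset_Icc_right (Nat.div_le_self _ _)) fun _ _ _ => by positivity
      _ ≤ _ := sum_inv_le K

/-- Average of Kloosterman sums over moduli divisible by `a * d`. -/
lemma sum_norm_klo_le {q : ℤ} (hq : q ≠ 0) {a d : ℕ} (ha : a ≠ 0) (hd : Squarefree d)
    (had : d.Coprime a) (M : ℕ) {T : ℝ}
    (hT : ∀ n : ℕ, n ≠ 0 → n ≤ a * d * q.natAbs * M → (tau n : ℝ) ≤ T) :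
    ∑ c ∈ Icc 1 M, ‖klo q (a * d * c)‖ / ((a * d * c : ℕ) : ℝ) ≤
      T ^ 3 * (1 + log M) * (2 * √(M : ℝ)) * √((d.gcd q.natAbs : ℕ) / (d : ℝ)) := by
  rcases Nat.eq_zero_or_pos M with rfl | hM
  · simp
  set Q := q.natAbs with hQ
  have hQ0 : Q ≠ 0 := Int.natAbs_ne_zero.mpr hq
  have hd0 := hd.ne_zero
  have hT1 : 1 ≤ T := by
    have := hT 1 one_ne_zero (Nat.one_le_iff_ne_zero.mpr (by positivity))
    rwa [tau, Nat.divisors_one, card_singleton, Nat.cast_one] at this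
  set R := √((d.gcd Q : ℕ) / (d : ℝ)) with hR
  set B : ℕ → ℕ → ℝ := fun k x =>
    T * (((k.gcd (a * d * Q * x) : ℕ) : ℝ) / √(k : ℝ)) * R * (d.gcd x : ℕ) with hB
  have hBnn : ∀ k x, 0 ≤ B k x := fun k x => by simp only [hB]; positivity
  calc ∑ c ∈ Icc 1 M, ‖klo q (a * d * c)‖ / ((a * d * c : ℕ) : ℝ)
      ≤ ∑ c ∈ Icc 1 M, ∑ x ∈ Icc 1 M, ∑ k ∈ Icc 1 (M / x ^ 2),
          (if k * x ^ 2 = c then B k x else 0) := by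
        refine sum_le_sum fun c hc => ?_
        rw [mem_Icc] at hc
        obtain ⟨k, x, hkx, hk⟩ := Nat.sq_mul_squarefree c
        rw [mul_comm] at hkx
        have hx0 : x ≠ 0 := by rintro rfl; simp at hkx; omega
        have hk0 : k ≠ 0 := hk.ne_zero
        have hxM : x ∈ Icc 1 M := by
          rw [mem_Icc]
          refine ⟨hx0.pos, le_trans ?_ hc.2⟩
          rw [← hkx]; nlinarith [hx0.pos, hk0.pos,
            Nat.le_self_pow two_ne_zero x, Nat.le_mul_of_pos_left (x ^ 2) hk0.pos]
        have hkM : k ∈ Icc 1 (M / x ^ 2) := by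
          rw [mem_Icc, Nat.le_div_iff_mul_le (by positivity), hkx]
          exact ⟨hk0.pos, hc.2⟩
        refine le_trans ?_ (single_le_sum (f := fun x => ∑ k ∈ Icc 1 (M / x ^ 2),
          (if k * x ^ 2 = c then B k x else 0)) (fun x _ => sum_nonneg fun k _ => by
            split_ifs <;> simp [hBnn]) hxM)
        refine le_trans ?_ (single_le_sum (f := fun k =>
          (if k * x ^ 2 = c then B k x else 0)) (fun k _ => by split_ifs <;> simp [hBnn]) hkM)
        simp only [hkx, if_true]
        refine (hkx ▸ norm_klo_div_le hq ha hx0 hd hk had).trans ?_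
        simp only [hB]
        gcongr
        refine hT _ (by have := hc.1; positivity) ?_
        calc a * d * c ≤ a * d * M := by gcongr; exact hc.2
          _ ≤ a * d * M * Q := Nat.le_mul_of_pos_right _ hQ0.pos
          _ = _ := by ring
    _ = ∑ x ∈ Icc 1 M, ∑ k ∈ Icc 1 (M / x ^ 2), B k x := by
        rw [sum_comm]
        refine sum_congr rfl fun x hx => ?_
        rw [sum_comm]
        refine sum_congr rfl fun k hk => ?_
        rw [mem_Icc] at hx hk
        rw [sum_ite_eq, if_pos]
        have := (Nat.le_div_iff_mul_le (by have := hx.1; positivity)).mp hk.2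
        have h1 := hx.1
        have h2 := hk.1
        exact mem_Icc.mpr ⟨Nat.one_le_iff_ne_zero.mpr (by positivity), this⟩
    _ ≤ ∑ x ∈ Icc 1 M, (T ^ 2 * R * (2 * √(M : ℝ))) * (((x.gcd d : ℕ) : ℝ) / x) := by
        refine sum_le_sum fun x hx => ?_
        rw [mem_Icc] at hx
        have hx0 : x ≠ 0 := by omega
        have hm0 : a * d * Q * x ≠ 0 := by positivity
        have h1 := sum_gcd_div_sqrt_le hm0 (M / x ^ 2)
        have h2 : (tau (a * d * Q * x) : ℝ) ≤ T := hT _ hm0 (by gcongr; exact hx.2)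
        have h3 : √((M / x ^ 2 : ℕ) : ℝ) ≤ √(M : ℝ) / x := by
          rw [← sqrt_sq (Nat.cast_nonneg x : (0 : ℝ) ≤ x), ← sqrt_div (by positivity)]
          refine sqrt_le_sqrt ?_
          exact_mod_cast Nat.cast_div_le (α := ℝ)
        calc ∑ k ∈ Icc 1 (M / x ^ 2), B k x
            = (T * R * (d.gcd x : ℕ)) * ∑ k ∈ Icc 1 (M / x ^ 2),
                (((k.gcd (a * d * Q * x) : ℕ) : ℝ) / √(k : ℝ)) := by
              rw [mul_sum]
              exact sum_congr rfl fun k _ => by simp only [hB]; ring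
          _ ≤ (T * R * (d.gcd x : ℕ)) * (T * (2 * (√(M : ℝ) / x))) := by
              refine mul_le_mul_of_nonneg_left (h1.trans ?_) (by positivity)
              gcongr
          _ = _ := by rw [Nat.gcd_comm]; ring
    _ ≤ (T ^ 2 * R * (2 * √(M : ℝ))) * (T * (1 + log M)) := by
        rw [← mul_sum]
        refine mul_le_mul_of_nonneg_left ((sum_gcd_div_le hd0 M).trans ?_) (by positivity)
        have := log_natCast_nonneg M
        gcongr
        refine hT d hd0 ?_
        calc d ≤ d * (a * Q * M) := Nat.le_mul_of_pos_right _ (by positivity)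
          _ = _ := by ring
    _ = _ := by ring

end

section

open Finset

/-- The roots of `a ν² + h` modulo `n`. -/
def rts (a h : ℤ) (n : ℕ) : Finset ℕ :=
  (range n).filter fun ν => (n : ℤ) ∣ a * (ν : ℤ) ^ 2 + h

lemma mem_rts {a h : ℤ} {n ν : ℕ} : ν ∈ rts a h n ↔ ν < n ∧ (n : ℤ) ∣ a * (ν : ℤ) ^ 2 + h := by
  simp [rts]

lemma card_rts_one_le {M : ℕ} (hM : M ≠ 0) (D : ℤ) {K : ℕ}
    (hK : ∀ e : ℕ, e ∣ M → (e : ℤ) ^ 2 ∣ 4 * D → e ≤ K) : #(rts 1 D M) ≤ K * tau M := by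
  rcases (rts 1 D M).eq_empty_or_nonempty with h0 | ⟨l₁, hl₁⟩
  · simp [h0]
  rw [mem_rts, one_mul] at hl₁
  refine card_le_mul_card_image_of_maps_to (s := rts 1 D M)
    (f := fun l : ℕ => Int.gcd M ((l : ℤ) - l₁))
    (t := M.divisors) (fun l _ => Nat.mem_divisors.mpr ⟨?_, hM⟩) K fun g hg => ?_
  · exact_mod_cast Int.gcd_dvd_left (a := (M : ℤ)) (b := (l : ℤ) - l₁)
  have hgM := Nat.dvd_of_mem_divisors hg
  obtain ⟨m, rfl⟩ := hgM
  have hg0 : g ≠ 0 := by rintro rfl; simp at hM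
  have hm0 : m ≠ 0 := by rintro rfl; simp at hM
  have key : ∀ l ∈ (rts 1 D (g * m)).filter (fun l : ℕ => Int.gcd (g * m : ℕ) ((l : ℤ) - l₁) = g),
      (g : ℤ) ∣ l - l₁ ∧ (m : ℤ) ∣ l + l₁ := by
    intro l hl
    rw [mem_filter, mem_rts, one_mul] at hl
    obtain ⟨⟨h1, h2⟩, h3⟩ := hl
    have h4 : (g : ℤ) ∣ l - l₁ := by
      conv_lhs => rw [← h3]
      exact Int.gcd_dvd_right _ _
    refine ⟨h4, ?_⟩
    obtain ⟨s, hs⟩ := h4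
    rw [hs] at h3
    push_cast at h3
    rw [Int.gcd_mul_left, Int.natAbs_natCast] at h3
    have h5 : Int.gcd m s = 1 := by
      have := Nat.eq_of_mul_eq_mul_left hg0.pos (h3.trans (mul_one g).symm)
      exact this
    have h6 : (g : ℤ) * m ∣ g * (s * (l + l₁)) := by
      have := dvd_sub h2 hl₁.2
      have e : ((l : ℤ) ^ 2 + D) - ((l₁ : ℤ) ^ 2 + D) = g * (s * (l + l₁)) := by
        rw [← mul_assoc, ← hs]; ring
      rw [e] at this
      exact_mod_cast this
    have h7 := Int.dvd_of_mul_dvd_mul_left (mod_cast hg0) h6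
    exact (Int.isCoprime_iff_gcd_eq_one.mpr h5).dvd_of_dvd_mul_left h7
  rcases eq_empty_or_nonempty
    ((rts 1 D (g * m)).filter (fun l : ℕ => Int.gcd (g * m : ℕ) ((l : ℤ) - l₁) = g))
    with h0 | ⟨l₂, hl₂⟩
  · rw [h0]; simp
  set e := Nat.gcd g m with he
  have heg : e ∣ g := Nat.gcd_dvd_left _ _
  have hem : e ∣ m := Nat.gcd_dvd_right _ _
  have he0 : 0 < e := Nat.gcd_pos_of_pos_left _ hg0.pos
  have heK : e ≤ K := by
    refine hK e (heg.mul_right _) ?_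
    obtain ⟨h1, h2⟩ := key l₂ hl₂
    have h3 : (e : ℤ) ∣ 2 * l₁ := by
      have := dvd_sub ((Int.natCast_dvd_natCast.mpr hem).trans h2)
        ((Int.natCast_dvd_natCast.mpr heg).trans h1)
      rwa [show ((l₂ : ℤ) + l₁) - (l₂ - l₁) = 2 * l₁ by ring] at this
    have h4 : (e : ℤ) ^ 2 ∣ (2 * l₁) ^ 2 := pow_dvd_pow_of_dvd h3 2
    have h5 : (e : ℤ) ^ 2 ∣ (l₁ : ℤ) ^ 2 + D := by
      refine dvd_trans ?_ hl₁.2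
      rw [sq]
      exact_mod_cast mul_dvd_mul heg hem
    have := dvd_sub (h5.mul_left 4) h4
    rwa [show 4 * ((l₁ : ℤ) ^ 2 + D) - (2 * l₁) ^ 2 = 4 * D by ring] at this
  refine le_trans ?_ heK
  have hlcm : Nat.lcm g m * e = g * m := by rw [mul_comm, Nat.gcd_mul_lcm]
  have hl0 : 0 < Nat.lcm g m := Nat.lcm_pos hg0.pos hm0.pos
  calc _ ≤ #(range e) := by
        refine card_le_card_of_injOn (fun l => l / Nat.lcm g m) ?_ ?_
        · intro l hl
          have h1 := (mem_rts.mp (mem_filter.mp hl).1).1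
          simp only [coe_range, Set.mem_Iio]
          rw [Nat.div_lt_iff_lt_mul hl0, mul_comm, hlcm]
          exact h1
        · intro l hl l' hl' hll
          have h1 := key l hl
          have h2 := key l' hl'
          have h3 : (g : ℤ) ∣ l - l' := by
            have := dvd_sub h1.1 h2.1
            rwa [show ((l : ℤ) - l₁) - (l' - l₁) = l - l' by ring] at this
          have h4 : (m : ℤ) ∣ l - l' := by
            have := dvd_sub h1.2 h2.2
            rwa [show ((l : ℤ) + l₁) - (l' + l₁) = l - l' by ring] at this
          have h5 : Nat.lcm g m ∣ ((l : ℤ) - l').natAbs :=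
            Nat.lcm_dvd (Int.natCast_dvd.mp h3) (Int.natCast_dvd.mp h4)
          have h6 : l' ≡ l [MOD Nat.lcm g m] :=
            (Nat.modEq_iff_dvd).mpr (Int.natCast_dvd.mpr h5)
          have h7 : l' % Nat.lcm g m = l % Nat.lcm g m := h6
          have h8 : l / Nat.lcm g m = l' / Nat.lcm g m := hll
          rw [← Nat.div_add_mod l (Nat.lcm g m), ← Nat.div_add_mod l' (Nat.lcm g m), h7, h8]
    _ = e := card_range e

lemma dvd_of_sq_dvd_mul_squarefree {e b h : ℕ} (hb : b ≠ 0) (hh : Squarefree h)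
    (hd : e ^ 2 ∣ b * h) : e ∣ b := by
  have h0 : b * h ≠ 0 := mul_ne_zero hb hh.ne_zero
  have he : e ≠ 0 := by
    rintro rfl
    rw [zero_pow two_ne_zero, zero_dvd_iff] at hd
    exact h0 hd
  rw [← Nat.factorization_le_iff_dvd he hb]
  rw [← Nat.factorization_le_iff_dvd (pow_ne_zero 2 he) h0, Nat.factorization_mul hb hh.ne_zero,
    Nat.factorization_pow] at hd
  intro p
  have h1 := hd p
  have h2 := hh.natFactorization_le_one p
  simp only [Finsupp.smul_apply, Finsupp.add_apply, smul_eq_mul] at h1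
  omega

lemma dvd_four_mul_of_sq_dvd {a h : ℤ} (ha : 1 ≤ a) (hh : Squarefree h) {e : ℕ}
    (he : (e : ℤ) ^ 2 ∣ 4 * (a * h)) : e ∣ 4 * a.natAbs := by
  refine dvd_of_sq_dvd_mul_squarefree (by have : a.natAbs ≠ 0 := by omega
                                          positivity) (Int.squarefree_natAbs.mpr hh) ?_
  have := Int.natCast_dvd.mp (show ((e ^ 2 : ℕ) : ℤ) ∣ 4 * (a * h) by exact_mod_cast he)
  rwa [Int.natAbs_mul, Int.natAbs_mul, ← mul_assoc] at this

lemma card_rts_one_le_mul {a h : ℤ} (ha : 1 ≤ a) (hh : Squarefree h) {M : ℕ} (hM : M ≠ 0) :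
    #(rts 1 (a * h) M) ≤ 4 * a.natAbs * tau M :=
  card_rts_one_le hM _ fun e _ h2 =>
    Nat.le_of_dvd (by have : a.natAbs ≠ 0 := by omega
                      positivity) (dvd_four_mul_of_sq_dvd ha hh h2)

lemma coprime_of_mem_rts {a h : ℤ} (hah : Int.gcd a h = 1) {n ν : ℕ} (hν : ν ∈ rts a h n) :
    IsCoprime (n : ℤ) a := by
  rw [mem_rts] at hν
  obtain ⟨k, hk⟩ := hν.2
  obtain ⟨u, v, huv⟩ := Int.isCoprime_iff_gcd_eq_one.mpr hah
  refine ⟨v * k, u - v * ν ^ 2, ?_⟩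
  linear_combination v * (-hk) + huv

lemma card_rts_le {a h : ℤ} (ha : 1 ≤ a) (hh : Squarefree h) (hah : Int.gcd a h = 1)
    {n : ℕ} (hn : n ≠ 0) : #(rts a h n) ≤ 4 * tau n := by
  rcases (rts a h n).eq_empty_or_nonempty with h0 | ⟨l₁, hl₁⟩
  · simp [h0]
  have hco := coprime_of_mem_rts hah hl₁
  have hn' : (n : ℤ) ≠ 0 := mod_cast hn
  refine le_trans ?_ (card_rts_one_le hn (a * h) (K := 4) fun e he he2 => ?_)
  · refine card_le_card_of_injOn (fun ν => ((a * ν) % (n : ℤ)).toNat) ?_ ?_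
    · intro ν hν
      have hν' := mem_rts.mp hν
      have h1 := Int.emod_nonneg (a * ν) hn'
      have h2 := Int.emod_lt_of_pos (a * ν) (mod_cast hn.pos : (0 : ℤ) < n)
      have h3 : (((a * ν) % (n : ℤ)).toNat : ℤ) = (a * ν) % (n : ℤ) := Int.toNat_of_nonneg h1
      rw [mem_coe, mem_rts]
      refine ⟨by rw [← h3] at h2; exact_mod_cast h2, ?_⟩
      rw [h3, one_mul]
      have h4 : (n : ℤ) ∣ (a * ν) - (a * ν) % (n : ℤ) := Int.dvd_self_sub_emod
      obtain ⟨s, hs⟩ := h4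
      obtain ⟨t, ht⟩ := hν'.2
      have h5 : (a * ν) % (n : ℤ) = a * ν - n * s := by linarith
      refine ⟨a * t - 2 * a * ν * s + n * s ^ 2, ?_⟩
      rw [h5]
      linear_combination a * ht
    · intro ν hν ν' hν' he
      have h1 := Int.emod_nonneg (a * ν) hn'
      have h2 := Int.emod_nonneg (a * ν') hn'
      have h3 : (a * ν) % (n : ℤ) = (a * ν') % (n : ℤ) := by
        have : ((a * ν) % (n : ℤ)).toNat = ((a * ν') % (n : ℤ)).toNat := he
        omega
      have h4 : (n : ℤ) ∣ a * (ν' - ν) := by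
        have := Int.ModEq.dvd (show a * ν ≡ a * ν' [ZMOD n] from h3)
        rwa [← mul_sub] at this
      have h5 := hco.dvd_of_dvd_mul_left h4
      have h6 : ν % n = ν' % n := by
        have : ν ≡ ν' [MOD n] := Nat.modEq_iff_dvd.mpr h5
        exact this
      rwa [Nat.mod_eq_of_lt (mem_rts.mp hν).1, Nat.mod_eq_of_lt (mem_rts.mp hν').1] at h6
  · have h1 := dvd_four_mul_of_sq_dvd ha hh he2
    have h2 : Nat.Coprime e a.natAbs := by
      have := Int.isCoprime_iff_gcd_eq_one.mp hco
      have h3 : Nat.Coprime n a.natAbs := this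
      exact h3.coprime_dvd_left he
    exact Nat.le_of_dvd (by norm_num) (h2.dvd_of_dvd_mul_right h1)

end

section

open MeasureTheory ENNReal ComplexConjugate Complex

variable {G X : Type*} [Group G] [Countable G] [MulAction G X] [MeasurableSpace X]
  [MeasurableConstSMul G X] {μ : Measure X} [SMulInvariantMeasure G X μ]

/-- A weight whose translates by the group sum to one. -/
structure IsWeight (G : Type*) {X : Type*} [Group G] [MulAction G X] [MeasurableSpace X]
    (w : X → ℝ) : Prop where
  measurable : Measurable w
  nonneg : ∀ x, 0 ≤ w x
  tsum_eq : ∀ x, ∑' g : G, ENNReal.ofReal (w (g • x)) = 1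

lemma exists_isWeight (h : X → ℝ) (hm : Measurable h)
    (hfin : ∀ x R, {g : G | h (g • x) ≤ R}.Finite) : ∃ w : X → ℝ, IsWeight G w := by
  let A : Set X := {x | ∀ g : G, h x ≤ h (g • x)}
  let N : X → ℝ≥0∞ := fun x => ∑' g : G, if h (g • x) = h x then 1 else 0
  let w : X → ℝ≥0∞ := fun x => if x ∈ A then (N x)⁻¹ else 0
  have hA : MeasurableSet A := by
    rw [show A = ⋂ g : G, {x | h x ≤ h (g • x)} by ext; simp [A]]
    exact MeasurableSet.iInter fun g => measurableSet_le hm (hm.comp (measurable_const_smul g))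
  have hN : Measurable N := Measurable.tsum fun g =>
    Measurable.ite (measurableSet_eq_fun (hm.comp (measurable_const_smul g)) hm)
      measurable_const measurable_const
  have hw : Measurable w := Measurable.ite hA hN.inv measurable_const
  have hN1 : ∀ x, 1 ≤ N x := fun x => by
    simpa using ENNReal.le_tsum (f := fun g : G => if h (g • x) = h x then (1 : ℝ≥0∞) else 0) 1
  have hNtop : ∀ x, N x ≠ ⊤ := fun x => by
    simp only [N]
    rw [tsum_eq_sum (s := (hfin x (h x)).toFinset) (fun g hg => if_neg fun h' => hg (by
      simp [h'.le]))]
    refine ENNReal.sum_ne_top.mpr fun g _ => ?_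
    split_ifs <;> simp
  have hw1 : ∀ x, w x ≤ 1 := fun x => by
    simp only [w]
    split_ifs <;> simp [hN1]
  have hsum : ∀ x, ∑' g : G, w (g • x) = 1 := by
    intro x
    obtain ⟨g₀, hg₀⟩ : ∃ g₀ : G, ∀ g : G, h (g₀ • x) ≤ h (g • x) := by
      obtain ⟨g₀, h1, h2⟩ := Set.exists_min_image _ (fun g : G => h (g • x)) (hfin x (h x))
        ⟨1, by simp⟩
      exact ⟨g₀, fun g => (le_total (h (g • x)) (h x)).elim (h2 g) h1.trans⟩
    have e1 : ∀ g : G, g • x ∈ A ↔ h (g • x) = h (g₀ • x) := by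
      refine fun g => ⟨fun hg => le_antisymm ?_ (hg₀ g), fun hg g' => ?_⟩
      · simpa [smul_smul] using hg (g₀ * g⁻¹)
      · rw [hg, smul_smul]
        exact hg₀ _
    set C : ℝ≥0∞ := ∑' k : G, if h (k • x) = h (g₀ • x) then 1 else 0 with hC
    have e2 : ∀ g : G, h (g • x) = h (g₀ • x) → N (g • x) = C := by
      intro g hg
      simp only [N, hC]
      rw [← (Equiv.mulRight g).tsum_eq
        (fun k : G => if h (k • x) = h (g₀ • x) then (1 : ℝ≥0∞) else 0)]
      refine tsum_congr fun k => ?_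
      simp only [Equiv.coe_mulRight, smul_smul, hg]
      congr
    have e3 : ∀ g : G, w (g • x) = (if h (g • x) = h (g₀ • x) then 1 else 0) * C⁻¹ := fun g => by
      by_cases hg : h (g • x) = h (g₀ • x) <;> simp [w, e1, hg, e2]
    simp only [e3, ENNReal.tsum_mul_right]
    rw [← hC]
    have h1 : N (g₀ • x) = C := e2 g₀ rfl
    exact ENNReal.mul_inv_cancel (one_pos.trans_le (h1 ▸ hN1 _)).ne' (h1 ▸ hNtop _)
  refine ⟨fun x => (w x).toReal, hw.ennreal_toReal, fun x => toReal_nonneg, fun x => ?_⟩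
  rw [← hsum x]
  exact tsum_congr fun g => ENNReal.ofReal_toReal (ne_top_of_le_ne_top one_ne_top (hw1 _))

variable {w : X → ℝ}

lemma IsWeight.hasSum (hw : IsWeight G w) (x : X) : HasSum (fun g : G => w (g • x)) 1 := by
  have h := ENNReal.hasSum_toReal (f := fun g : G => ENNReal.ofReal (w (g • x)))
    (by rw [hw.tsum_eq]; simp)
  rw [← ENNReal.tsum_toReal_eq (fun g => by simp), hw.tsum_eq] at h
  simpa [hw.nonneg] using h

lemma lintegral_unfold (hw : IsWeight G w) {ψ : X → ℝ≥0∞} (hψ : Measurable ψ) :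
    ∫⁻ x, ψ x ∂μ = ∫⁻ x, ENNReal.ofReal (w x) * ∑' g : G, ψ (g • x) ∂μ := by
  have hwm := hw.measurable.ennreal_ofReal
  calc ∫⁻ x, ψ x ∂μ = ∫⁻ x, ∑' g : G, ENNReal.ofReal (w (g • x)) * ψ x ∂μ := by
        simp_rw [ENNReal.tsum_mul_right, hw.tsum_eq, one_mul]
    _ = ∑' g : G, ∫⁻ x, ENNReal.ofReal (w (g • x)) * ψ x ∂μ :=
        lintegral_tsum fun g => ((hwm.comp (measurable_const_smul g)).mul hψ).aemeasurable
    _ = ∑' g : G, ∫⁻ x, ENNReal.ofReal (w x) * ψ (g • x) ∂μ := by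
        rw [← (Equiv.inv G).tsum_eq]
        refine tsum_congr fun g => ?_
        have := (measurePreserving_smul g μ).lintegral_comp
          (f := fun x => ENNReal.ofReal (w (g⁻¹ • x)) * ψ x)
          ((hwm.comp (measurable_const_smul g⁻¹)).mul hψ)
        simp [← this]
    _ = _ := by
        have hm : ∀ g : G, Measurable fun x => ENNReal.ofReal (w x) * ψ (g • x) :=
          fun g => hwm.mul (hψ.comp (measurable_const_smul g))
        rw [← lintegral_tsum fun g => (hm g).aemeasurable]
        simp_rw [ENNReal.tsum_mul_left]

lemma integral_unfold (hw : IsWeight G w) {φ H : X → ℂ} (hφ : Measurable φ) (hH : Measurable H)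
    (hHinv : ∀ (g : G) x, H (g • x) = H x) (hint : Integrable (fun x => φ x * H x) μ) :
    ∫ x, φ x * H x ∂μ = ∫ x, w x * ((∑' g : G, φ (g • x)) * H x) ∂μ := by
  have hwm := hw.measurable.ennreal_ofReal
  have hwc : Measurable fun x => (w x : ℂ) := measurable_ofReal.comp hw.measurable
  have hpsi : Measurable fun x => ‖φ x * H x‖ₑ := (hφ.mul hH).enorm
  have hn : ∀ x, ‖(w x : ℂ)‖ₑ = ENNReal.ofReal (w x) := fun x => by
    rw [← ofReal_norm, norm_real, Real.norm_of_nonneg (hw.nonneg x)]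
  have hfin : ∫⁻ x, ‖φ x * H x‖ₑ ∂μ ≠ ⊤ := hint.2.ne
  calc ∫ x, φ x * H x ∂μ = ∫ x, ∑' g : G, (w (g • x) : ℂ) * (φ x * H x) ∂μ := by
        refine integral_congr_ae (.of_forall fun x => ?_)
        simpa using ((hasSum_ofReal.mpr (hw.hasSum (G := G) x)).mul_right (φ x * H x)).tsum_eq.symm
    _ = ∑' g : G, ∫ x, (w (g • x) : ℂ) * (φ x * H x) ∂μ := by
        refine integral_tsum (fun g => ((hwc.comp (measurable_const_smul g)).mul
          (hφ.mul hH)).aestronglyMeasurable) ?_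
        simp only [enorm_mul, hn]
        have hm : ∀ g : G, Measurable fun x => ENNReal.ofReal (w (g • x)) * (‖φ x‖ₑ * ‖H x‖ₑ) :=
          fun g => (hwm.comp (measurable_const_smul g)).mul (hφ.enorm.mul hH.enorm)
        rw [← lintegral_tsum fun g => (hm g).aemeasurable]
        simpa only [ENNReal.tsum_mul_right, hw.tsum_eq, one_mul, enorm_mul] using hfin
    _ = ∑' g : G, ∫ x, (w x : ℂ) * (φ (g • x) * H x) ∂μ := by
        rw [← (Equiv.inv G).tsum_eq]
        refine tsum_congr fun g => ?_
        have := (measurePreserving_smul g μ).integral_comp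
          (measurableEmbedding_const_smul g) (fun x => (w (g⁻¹ • x) : ℂ) * (φ x * H x))
        simp [← this, hHinv]
    _ = ∫ x, ∑' g : G, (w x : ℂ) * (φ (g • x) * H x) ∂μ := by
        refine (integral_tsum (fun g => (hwc.mul ((hφ.comp (measurable_const_smul g)).mul
          hH)).aestronglyMeasurable) ?_).symm
        have hm : ∀ g : G, Measurable fun x => ‖(w x : ℂ) * (φ (g • x) * H x)‖ₑ :=
          fun g => (hwc.mul ((hφ.comp (measurable_const_smul g)).mul hH)).enorm
        simp only [Pi.mul_apply, Function.comp_apply]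
        rw [← lintegral_tsum fun g => (hm g).aemeasurable]
        rw [lintegral_unfold (μ := μ) hw hpsi] at hfin
        refine ne_of_eq_of_ne (lintegral_congr fun x => ?_) hfin
        rw [← ENNReal.tsum_mul_left]
        refine tsum_congr fun g => ?_
        rw [enorm_mul, hn, hHinv]
    _ = _ := by
        simp only [tsum_mul_left, tsum_mul_right]

/-- Cauchy--Schwarz on the quotient, against an automorphic function. -/
lemma norm_integral_sq_le (hw : IsWeight G w) {φ : X → ℂ} {Φ : X → ℝ} (hφ : Measurable φ)
    (hΦ : Measurable Φ) (hΦ0 : ∀ x, 0 ≤ Φ x) (hΦinv : ∀ (g : G) x, Φ (g • x) = Φ x)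
    (hfs : ∀ x, (Function.support fun g : G => φ (g • x)).Finite)
    (hint : Integrable (fun x => φ x * Φ x) μ)
    (hint' : Integrable (fun x => φ x * conj (∑' g : G, φ (g • x))) μ) {K : ℝ} (hK0 : 0 ≤ K)
    (hK : ∫⁻ x, ENNReal.ofReal (w x) * ENNReal.ofReal (Φ x) ^ 2 ∂μ ≤ ENNReal.ofReal K) :
    ‖∫ x, φ x * Φ x ∂μ‖ ^ 2 ≤ ‖∫ x, φ x * conj (∑' g : G, φ (g • x)) ∂μ‖ * K := by
  set F : X → ℂ := fun x => ∑' g : G, φ (g • x) with hF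
  have hFm : Measurable F := .tsum fun g => hφ.comp (measurable_const_smul g)
  have hFinv : ∀ (g : G) x, F (g • x) = F x := by
    intro g x
    simp only [hF]
    rw [← (Equiv.mulRight g).tsum_eq (fun k : G => φ (k • x))]
    simp only [Equiv.coe_mulRight, smul_smul]
  have hFle : ∀ x, ‖F x‖ₑ ≤ ∑' g : G, ‖φ (g • x)‖ₑ := by
    intro x
    simp only [hF]
    rw [tsum_eq_sum (s := (hfs x).toFinset) (fun g hg => by simpa using hg)]
    exact (enorm_sum_le _ _).trans (ENNReal.sum_le_tsum _)
  have hwm := hw.measurable.ennreal_ofReal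
  have hΦe := hΦ.ennreal_ofReal
  have hFe := hFm.enorm
  have hΦc : Measurable fun x => (Φ x : ℂ) := measurable_ofReal.comp hΦ
  have hFc : Measurable fun x => conj (F x) := continuous_conj.measurable.comp hFm
  have i1 := integral_unfold (μ := μ) hw hφ hΦc (fun g x => by rw [hΦinv]) hint
  have i2 := integral_unfold (μ := μ) hw hφ hFc (fun g x => by rw [hFinv]) hint'
  have hfin : ∫⁻ x, ENNReal.ofReal (w x) * ‖F x‖ₑ ^ 2 ∂μ < ⊤ := by
    have hlt : ∫⁻ x, ‖φ x‖ₑ * ‖F x‖ₑ ∂μ < ⊤ := by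
      refine lt_of_le_of_lt (le_of_eq (lintegral_congr fun x => ?_)) hint'.2
      rw [enorm_mul, RCLike.enorm_conj]
    have hm : Measurable fun x => ‖φ x‖ₑ * ‖F x‖ₑ := hφ.enorm.mul hFe
    rw [lintegral_unfold (μ := μ) hw hm] at hlt
    refine lt_of_le_of_lt (lintegral_mono fun x => ?_) hlt
    simp only [hFinv]
    rw [ENNReal.tsum_mul_right, sq]
    gcongr
    exact hFle x
  have e2 : ENNReal.ofReal ‖∫ x, φ x * conj (F x) ∂μ‖
      = ∫⁻ x, ENNReal.ofReal (w x) * ‖F x‖ₑ ^ 2 ∂μ := by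
    have e' : ∀ x, ENNReal.ofReal (w x * ‖F x‖ ^ 2) = ENNReal.ofReal (w x) * ‖F x‖ₑ ^ 2 := by
      intro x
      rw [ENNReal.ofReal_mul (hw.nonneg x), ENNReal.ofReal_pow (norm_nonneg _), ofReal_norm]
    have nn : ∀ x, 0 ≤ w x * ‖F x‖ ^ 2 := fun x => mul_nonneg (hw.nonneg x) (by positivity)
    rw [i2]
    have : ∫ x, (w x : ℂ) * ((∑' g : G, φ (g • x)) * conj (F x)) ∂μ
        = ((∫ x, w x * ‖F x‖ ^ 2 ∂μ : ℝ) : ℂ) := by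
      rw [← integral_complex_ofReal]
      congr! with x
      rw [mul_conj, normSq_eq_norm_sq]
      push_cast; rfl
    rw [this, norm_real, Real.norm_of_nonneg (integral_nonneg nn),
      ofReal_integral_eq_lintegral_ofReal ?_ (.of_forall nn)]
    · exact lintegral_congr e'
    · refine ⟨(hw.measurable.mul (hFm.norm.pow_const 2)).aestronglyMeasurable, ?_⟩
      refine lt_of_le_of_lt (le_of_eq (lintegral_congr fun x => ?_)) hfin
      rw [← e', Real.enorm_of_nonneg (nn x)]
  have e1 : ENNReal.ofReal ‖∫ x, φ x * Φ x ∂μ‖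
      ≤ (∫⁻ x, ENNReal.ofReal (w x) * ‖F x‖ₑ ^ 2 ∂μ) ^ (1 / 2 : ℝ)
        * (∫⁻ x, ENNReal.ofReal (w x) * ENNReal.ofReal (Φ x) ^ 2 ∂μ) ^ (1 / 2 : ℝ) := by
    have hs : ∀ ψ : X → ℝ≥0∞, Measurable ψ →
        ∫⁻ x, ψ x ∂(μ.withDensity fun x => ENNReal.ofReal (w x)) =
          ∫⁻ x, ENNReal.ofReal (w x) * ψ x ∂μ := fun ψ hψ =>
      lintegral_withDensity_eq_lintegral_mul μ hwm hψ
    have := ENNReal.lintegral_mul_le_Lp_mul_Lq (μ.withDensity fun x => ENNReal.ofReal (w x))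
      Real.HolderConjugate.two_two hFe.aemeasurable hΦe.aemeasurable
    simp only [Pi.mul_apply, ENNReal.rpow_two] at this
    have hm : Measurable fun x => ‖F x‖ₑ * ENNReal.ofReal (Φ x) := hFe.mul hΦe
    rw [hs _ (hFe.pow_const 2), hs _ (hΦe.pow_const 2), hs _ hm] at this
    refine le_trans ?_ this
    rw [i1, ofReal_norm]
    refine (enorm_integral_le_lintegral_enorm _).trans (le_of_eq (lintegral_congr fun x => ?_))
    rw [enorm_mul, enorm_mul, ← ofReal_norm (w x : ℂ), ← ofReal_norm (Φ x : ℂ), norm_real,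
      norm_real, Real.norm_of_nonneg (hw.nonneg x), Real.norm_of_nonneg (hΦ0 x)]
  rw [← ENNReal.ofReal_le_ofReal_iff (by positivity), ENNReal.ofReal_mul (norm_nonneg _), e2,
    ENNReal.ofReal_pow (norm_nonneg _)]
  refine (pow_le_pow_left' e1 2).trans ?_
  simp_rw [mul_pow, ← ENNReal.rpow_natCast, ← ENNReal.rpow_mul]
  norm_num
  gcongr

end

section

open MeasureTheory UpperHalfPlane Matrix MatrixGroups ModularGroup CongruenceSubgroup

section

open Real ENNReal

instance smulInvariantMeasure_SL (R : Type*) [CommRing R] [Algebra R ℝ] :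
    SMulInvariantMeasure SL(2, R) ℍ volume :=
  ⟨fun g _ hs => SMulInvariantMeasure.measure_preimage_smul
    (SpecialLinearGroup.mapGL ℝ g : GL (Fin 2) ℝ) hs⟩

lemma smul_eq_map_smul (g : SL(2, ℤ)) (z : ℍ) :
    g • z = (SpecialLinearGroup.map (Int.castRingHom ℝ) g : SL(2, ℝ)) • z := by
  rw [UpperHalfPlane.ext_iff, coe_specialLinearGroup_apply, coe_specialLinearGroup_apply]
  simp

instance isIsometricSMul_SLZ : IsIsometricSMul SL(2, ℤ) ℍ :=
  ⟨fun g => by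
    have : (fun z : ℍ => g • z) = fun z =>
        (SpecialLinearGroup.map (Int.castRingHom ℝ) g : SL(2, ℝ)) • z :=
      funext fun z => smul_eq_map_smul g z
    change Isometry (fun z : ℍ => g • z)
    rw [this]
    exact isometry_smul _ _⟩

lemma measurePreserving_vadd_real (t : ℝ) : MeasurePreserving (fun z : ℍ => t +ᵥ z) := by
  let g : SL(2, ℝ) := ⟨!![1, t; 0, 1], by simp⟩
  have : (fun z : ℍ => t +ᵥ z) = fun z => g • z := by
    funext z
    rw [UpperHalfPlane.ext_iff, coe_vadd, coe_specialLinearGroup_apply]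
    simp [g, add_comm]
  rw [this]
  exact measurePreserving_smul g volume

lemma finite_setOf_smul_mem {K L : Set ℍ} (hK : IsCompact K) (hL : IsCompact L) :
    {g : SL(2, ℤ) | ∃ z ∈ K, g • z ∈ L}.Finite := by
  have h := ProperlyDiscontinuousSMul.finite_disjoint_inter_image (Γ := 𝒮ℒ) hK hL
  let f : SL(2, ℤ) → 𝒮ℒ := fun g => ⟨SpecialLinearGroup.mapGL ℝ g, g, rfl⟩
  have hf : Function.Injective f := fun a b hab => by
    have := congrArg Subtype.val hab
    exact SpecialLinearGroup.mapGL_injective this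
  refine (h.preimage hf.injOn).subset ?_
  rintro g ⟨z, hz, hgz⟩
  exact (show ((fun x : ℍ => f g • x) '' K ∩ L).Nonempty from ⟨g • z, ⟨z, hz, rfl⟩, hgz⟩)

/-- Volumes of regions in the half-plane cut into horizontal slices. -/
lemma volume_le_of_slices {S : Set ℍ} (hS : MeasurableSet S) {η s C : ℝ} (hη : 0 < η) (hs : s < 1)
    (hC : 0 ≤ C) (him : ∀ z ∈ S, η ≤ z.im)
    (hsl : ∀ y, η ≤ y → volume {x : ℝ | ∃ z ∈ S, z.re = x ∧ z.im = y} ≤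
      ENNReal.ofReal (C * y ^ s)) :
    volume S ≤ ENNReal.ofReal (C * η ^ (s - 1) / (1 - s)) := by
  rw [volume_eq_lintegral]
  have hSm := measurableEmbedding_coe.measurableSet_image.mpr hS
  have hmp := Complex.volume_preserving_equiv_real_prod.symm
  rw [← hmp.setLIntegral_comp_preimage_emb Complex.measurableEquivRealProd.symm.measurableEmbedding,
    ← lintegral_indicator (Complex.measurableEquivRealProd.symm.measurable hSm)]
  have hm : Measurable (((Complex.measurableEquivRealProd.symm) ⁻¹'
    (UpperHalfPlane.coe '' S)).indicator
      fun p : ℝ × ℝ =>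
        (((1 / ‖(Complex.measurableEquivRealProd.symm p).im‖₊) ^ 2 : NNReal) : ℝ≥0∞)) := by
    refine Measurable.indicator ?_ (Complex.measurableEquivRealProd.symm.measurable hSm)
    fun_prop
  rw [Measure.volume_eq_prod, lintegral_prod_symm _ hm.aemeasurable]
  calc _ ≤ ∫⁻ y : ℝ, (Set.Ioi η).indicator (fun y => ENNReal.ofReal (C * y ^ (s - 2))) y := by
        refine lintegral_mono_ae ?_
        have hne : ∀ᵐ y : ℝ, y ≠ η := Measure.ae_ne volume η
        filter_upwards [hne] with y hy
        by_cases h : η < y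
        · rw [Set.indicator_of_mem (Set.mem_Ioi.mpr h)]
          have hy0 : 0 < y := hη.trans h
          calc _ ≤ ∫⁻ x : ℝ, {x : ℝ | ∃ z ∈ S, z.re = x ∧ z.im = y}.indicator
                (fun _ => ENNReal.ofReal (y ^ (-2 : ℝ))) x := by
                refine lintegral_mono fun x => ?_
                by_cases hx : (x, y) ∈ Complex.measurableEquivRealProd.symm ⁻¹'
                  (UpperHalfPlane.coe '' S)
                · have hx' := hx
                  obtain ⟨z, hz, he⟩ := hx
                  have h1 : z.re = x := by
                    have := congrArg Complex.re he
                    simpa using this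
                  have h2 : z.im = y := by
                    have := congrArg Complex.im he
                    simpa using this
                  rw [Set.indicator_of_mem hx', Set.indicator_of_mem
                    (show x ∈ {x : ℝ | ∃ z ∈ S, z.re = x ∧ z.im = y} from ⟨z, hz, h1, h2⟩),
                    Real.rpow_neg hy0.le, Real.rpow_two, ← ENNReal.ofReal_coe_nnreal]
                  refine ofReal_le_ofReal ?_
                  simp
                · rw [Set.indicator_of_notMem hx]; exact zero_le
            _ ≤ ENNReal.ofReal (y ^ (-2 : ℝ)) * volume {x : ℝ | ∃ z ∈ S, z.re = x ∧ z.im = y} :=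
                lintegral_indicator_const_le _ _
            _ ≤ ENNReal.ofReal (y ^ (-2 : ℝ)) * ENNReal.ofReal (C * y ^ s) := by
                gcongr; exact hsl y h.le
            _ = _ := by
                rw [← ENNReal.ofReal_mul (by positivity)]
                congr 1
                rw [sub_eq_add_neg, rpow_add hy0]; ring
        · rw [Set.indicator_of_notMem (by simpa using h)]
          refine (lintegral_eq_zero_of_ae_eq_zero (.of_forall fun x => ?_)).le
          refine Set.indicator_of_notMem ?_ _
          rintro ⟨z, hz, he⟩
          have h2 : z.im = y := by
            have := congrArg Complex.im he
            simpa using this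
          exact h (lt_of_le_of_ne (h2 ▸ him z hz) hy.symm)
    _ = ENNReal.ofReal (∫ y in Set.Ioi η, C * y ^ (s - 2)) := by
        rw [lintegral_indicator measurableSet_Ioi, ofReal_integral_eq_lintegral_ofReal]
        · exact ((integrableOn_Ioi_rpow_of_lt (by linarith) hη).const_mul C)
        · refine (ae_restrict_mem measurableSet_Ioi).mono fun y hy => ?_
          have : 0 < y := hη.trans hy
          positivity
    _ ≤ _ := by
        refine ofReal_le_ofReal (le_of_eq ?_)
        rw [integral_const_mul, integral_Ioi_rpow_of_lt (by linarith) hη]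
        have e1 : s - 2 + 1 = -(1 - s) := by ring
        have e2 : s - 1 = -(1 - s) := by ring
        rw [e1, e2]
        have : (1 - s) ≠ 0 := by linarith
        field_simp

lemma measurable_re : Measurable fun z : ℍ => z.re := continuous_re.measurable

lemma measurable_im : Measurable fun z : ℍ => z.im := continuous_im.measurable

lemma measurableSet_strip {η : ℝ} : MeasurableSet {z : ℍ | 0 ≤ z.re ∧ z.re < 1 ∧ η ≤ z.im} :=
  (measurableSet_le measurable_const measurable_re).inter
    ((measurableSet_lt measurable_re measurable_const).inter
      (measurableSet_le measurable_const measurable_im))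

lemma volume_strip_le {η : ℝ} (hη : 0 < η) :
    volume {z : ℍ | 0 ≤ z.re ∧ z.re < 1 ∧ η ≤ z.im} ≤ ENNReal.ofReal (1 / η) := by
  refine (volume_le_of_slices measurableSet_strip hη zero_lt_one zero_le_one (fun z hz => hz.2.2)
    fun y _ => ?_).trans (ENNReal.ofReal_le_ofReal ?_)
  · refine (measure_mono (t := Set.Ico 0 1) ?_).trans ?_
    · rintro x ⟨z, ⟨h1, h2, h3⟩, rfl, rfl⟩
      exact ⟨h1, h2⟩
    · simp
  · simp [Real.rpow_neg_one]

lemma measurableSet_lens {η c : ℝ} :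
    MeasurableSet {z : ℍ | η ≤ z.im ∧ η * c ^ 2 * Complex.normSq z ≤ z.im} :=
  (measurableSet_le measurable_const measurable_im).inter (measurableSet_le
    ((Complex.continuous_normSq.comp continuous_coe).measurable.const_mul _) measurable_im)

lemma volume_lens_le {η c : ℝ} (hη : 0 < η) (hc : 0 < c) :
    volume {z : ℍ | η ≤ z.im ∧ η * c ^ 2 * Complex.normSq z ≤ z.im} ≤
      ENNReal.ofReal (4 / (c * η)) := by
  refine (volume_le_of_slices (s := 1 / 2) (C := 2 / (c * √η)) measurableSet_lens hη (by norm_num)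
    (by positivity) (fun z hz => hz.1) fun y hy => ?_).trans
      (ENNReal.ofReal_le_ofReal (le_of_eq ?_))
  · have hy0 : 0 < y := hη.trans_le hy
    refine (measure_mono (t := Set.Icc (-(√y / (c * √η))) (√y / (c * √η))) ?_).trans ?_
    · rintro x ⟨z, ⟨h1, h2⟩, rfl, rfl⟩
      rw [Set.mem_Icc, ← abs_le]
      rw [Complex.normSq_apply] at h2
      have h3 : η * c ^ 2 * z.re ^ 2 ≤ z.im := by
        refine le_trans ?_ h2
        have : 0 ≤ z.im * z.im := mul_self_nonneg _
        have h4 : 0 ≤ η * c ^ 2 := by positivity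
        simp only [coe_re, coe_im]
        nlinarith
      rw [le_div_iff₀ (by positivity)]
      refine Real.le_sqrt_of_sq_le ?_
      rw [mul_pow, mul_pow, Real.sq_sqrt hη.le, sq_abs]
      linarith
    · rw [Real.volume_Icc, ← Real.sqrt_eq_rpow]
      refine ENNReal.ofReal_le_ofReal (le_of_eq ?_)
      ring
  · have : (1 / 2 - 1 : ℝ) = -(1 / 2) := by norm_num
    rw [this, Real.rpow_neg hη.le, ← Real.sqrt_eq_rpow]
    have h := Real.mul_self_sqrt hη.le
    have hs : √η ≠ 0 := (Real.sqrt_pos.mpr hη).ne'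
    field_simp
    rw [Real.sq_sqrt hη.le]
    ring

/-- A hyperbolic ball of radius `r ≤ 1` has volume at least `r ^ 2 / 4`. -/
lemma le_volume_closedBall (z : ℍ) {r : ℝ} (hr0 : 0 < r) (hr : r ≤ 1) :
    ENNReal.ofReal (r ^ 2 / 4) ≤ volume (Metric.closedBall z r) := by
  have hy := z.im_pos
  rw [volume_eq_lintegral, image_coe_closedBall]
  have hs : r ≤ Real.sinh r := Real.self_le_sinh_iff.mpr hr0.le
  calc ENNReal.ofReal (r ^ 2 / 4)
      ≤ ENNReal.ofReal ((z.im * Real.exp r) ^ (-2 : ℤ)) * (ENNReal.ofReal (z.im * Real.sinh r) ^ 2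
          * NNReal.pi) := by
        rw [← ENNReal.ofReal_pow (by positivity), ← ENNReal.ofReal_coe_nnreal,
          ← ENNReal.ofReal_mul (by positivity), ← ENNReal.ofReal_mul (by positivity)]
        refine ofReal_le_ofReal ?_
        have e : (z.im * exp r) ^ (-2 : ℤ) * ((z.im * sinh r) ^ 2 * (NNReal.pi : ℝ))
            = sinh r ^ 2 * π / exp r ^ 2 := by
          rw [NNReal.coe_real_pi, _root_.zpow_neg]
          have := exp_ne_zero r
          have := hy.ne'
          field_simp
        rw [e, div_le_div_iff₀ (by norm_num) (by positivity)]
        have h1 : exp r ^ 2 ≤ 9 := by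
          have h2 : exp r ≤ 3 := (exp_le_exp.mpr hr).trans exp_one_lt_three.le
          nlinarith [exp_pos r]
        have h3 : r ^ 2 ≤ sinh r ^ 2 := by gcongr
        have h4 := pi_gt_three
        nlinarith [sq_nonneg r, mul_nonneg (sq_nonneg (sinh r)) (by linarith : 0 ≤ π - 3)]
    _ = ∫⁻ _ in Metric.closedBall (↑(z.center r) : ℂ) (z.im * sinh r),
          ENNReal.ofReal ((z.im * Real.exp r) ^ (-2 : ℤ)) := by
        rw [setLIntegral_const, Complex.volume_closedBall]
    _ ≤ _ := by
        refine setLIntegral_mono' Metric.isClosed_closedBall.measurableSet fun w hw => ?_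
        rw [← image_coe_closedBall] at hw
        obtain ⟨u, hu, rfl⟩ := hw
        rw [← ofReal_coe_nnreal]
        refine ofReal_le_ofReal ?_
        have h1 : u.im ≤ z.im * exp r := (im_le_im_mul_exp_dist u z).trans (by
          gcongr; exact hu)
        have h2 := u.im_pos
        push_cast
        rw [coe_im, norm_of_nonneg h2.le, _root_.zpow_neg, one_div, inv_pow]
        gcongr
        norm_cast
        gcongr

end

section

open Real Complex ENNReal ComplexConjugate

/-- The additive character `e(x) = exp(2πix)`. -/
def ee (x : ℝ) : ℂ := exp ((2 * π * x : ℝ) * Complex.I)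

lemma norm_ee (x : ℝ) : ‖ee x‖ = 1 := Complex.norm_exp_ofReal_mul_I _

lemma ee_add (x y : ℝ) : ee (x + y) = ee x * ee y := by
  rw [ee, ee, ee, ← Complex.exp_add]; congr 1; push_cast; ring

lemma ee_int (n : ℤ) : ee n = 1 := by
  rw [ee, ← exp_int_mul_two_pi_mul_I n]; congr 1; push_cast; ring

lemma conj_ee (x : ℝ) : conj (ee x) = ee (-x) := by
  rw [ee, ee, ← exp_conj]; congr 1
  rw [map_mul, conj_I, conj_ofReal]; push_cast; ring

lemma continuous_ee : Continuous ee := by unfold ee; fun_prop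

lemma norm_ee_sub_le (x y : ℝ) : ‖ee x - ee y‖ ≤ 2 * π * |x - y| := by
  have h : ee x - ee y = ee y * (exp (Complex.I * (2 * π * (x - y) : ℝ)) - 1) := by
    rw [mul_sub, mul_one, ee, ee, ← Complex.exp_add]; congr 2; push_cast; ring
  rw [h, norm_mul, norm_ee, one_mul]
  refine (norm_exp_I_mul_ofReal_sub_one_le).trans (le_of_eq ?_)
  rw [norm_eq_abs, abs_mul, abs_of_pos two_pi_pos]

/-- A measurable cutoff function supported in `[η, H]`. -/
structure IsProfile (f : ℝ → ℝ) (η H : ℝ) : Prop where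
  measurable : Measurable f
  abs_le : ∀ y, |f y| ≤ 1
  supp : ∀ y, f y ≠ 0 → η ≤ y ∧ y ≤ H

/-- The wave `f(y) e(qx)` on the upper half-plane. -/
def wave (f : ℝ → ℝ) (q : ℤ) (z : ℍ) : ℂ := f z.im * ee (q * z.re)

/-- The wave `f(y) e(qx)` cut off to the strip `0 ≤ x < 1`. -/
def wave₀ (f : ℝ → ℝ) (q : ℤ) (z : ℍ) : ℂ :=
  if 0 ≤ z.re ∧ z.re < 1 then wave f q z else 0

lemma T_zpow_re (n : ℤ) (z : ℍ) : (T ^ n • z).re = n + z.re := by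
  rw [modular_T_zpow_smul, vadd_re]

lemma T_zpow_im (n : ℤ) (z : ℍ) : (T ^ n • z).im = z.im := by
  rw [modular_T_zpow_smul, vadd_im]

variable {f : ℝ → ℝ} {η H : ℝ} {q : ℤ}

lemma wave_T (n : ℤ) (z : ℍ) : wave f q (T ^ n • z) = wave f q z := by
  rw [wave, wave, T_zpow_re, T_zpow_im, mul_add, ee_add]
  have := ee_int (q * n)
  push_cast at this
  rw [this, one_mul]

lemma wave_vadd (t : ℝ) (z : ℍ) : wave f q (t +ᵥ z) = ee (q * t) * wave f q z := by
  rw [wave, wave, vadd_re, vadd_im, mul_add, ee_add]; ring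

lemma norm_wave₀_le_norm_wave (z : ℍ) : ‖wave₀ f q z‖ ≤ ‖wave f q z‖ := by
  rw [wave₀]; split_ifs <;> simp

lemma wave₀_T (m : ℤ) (z : ℍ) : wave₀ f q (T ^ m • z) = if m = -⌊z.re⌋ then wave f q z else 0 := by
  rw [wave₀, wave_T, T_zpow_re]
  have : (0 ≤ (m : ℝ) + z.re ∧ (m : ℝ) + z.re < 1) ↔ m = -⌊z.re⌋ := by
    rw [eq_neg_iff_add_eq_zero, add_comm m, ← eq_neg_iff_add_eq_zero, Int.floor_eq_iff]
    push_cast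
    constructor <;> rintro ⟨h1, h2⟩ <;> constructor <;> linarith
  simp only [this]

namespace IsProfile

lemma measurable_wave (hf : IsProfile f η H) : Measurable (wave f q) := by
  exact (Complex.measurable_ofReal.comp (hf.measurable.comp measurable_im)).mul
    (continuous_ee.measurable.comp (RootEquidist.measurable_re.const_mul _))

lemma measurable_wave₀ (hf : IsProfile f η H) : Measurable (wave₀ f q) := by
  have h1 := RootEquidist.measurable_re
  exact Measurable.ite ((measurableSet_le measurable_const h1).inter
    (measurableSet_lt h1 measurable_const)) hf.measurable_wave measurable_const

lemma norm_wave_le (hf : IsProfile f η H) (z : ℍ) : ‖wave f q z‖ ≤ 1 := by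
  rw [wave, norm_mul, norm_ee, mul_one, norm_real]
  exact hf.abs_le _

lemma norm_wave₀_le (hf : IsProfile f η H) (z : ℍ) : ‖wave₀ f q z‖ ≤ 1 :=
  (norm_wave₀_le_norm_wave z).trans (hf.norm_wave_le z)

lemma of_wave_ne_zero (hf : IsProfile f η H) {z : ℍ} (h : wave f q z ≠ 0) : η ≤ z.im ∧ z.im ≤ H :=
  hf.supp _ fun h0 => h (by rw [wave, h0]; simp)

lemma of_wave₀_ne_zero (hf : IsProfile f η H) {z : ℍ} (h : wave₀ f q z ≠ 0) :
    (0 ≤ z.re ∧ z.re < 1) ∧ η ≤ z.im ∧ z.im ≤ H := by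
  rw [wave₀] at h
  split_ifs at h with h1
  · exact ⟨h1, hf.of_wave_ne_zero h⟩
  · exact absurd rfl h

end IsProfile

/-- A compact box in the upper half-plane. -/
def hbox (η H : ℝ) : Set ℍ := {z | (0 ≤ z.re ∧ z.re ≤ 1) ∧ η ≤ z.im ∧ z.im ≤ H}

lemma isCompact_hbox (hη : 0 < η) : IsCompact (hbox η H) := by
  rw [UpperHalfPlane.isOpenEmbedding_coe.isEmbedding.isInducing.isCompact_iff]
  have : UpperHalfPlane.coe '' hbox η H = Set.Icc 0 1 ×ℂ Set.Icc η H := by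
    ext w
    constructor
    · rintro ⟨z, ⟨⟨h1, h2⟩, h3, h4⟩, rfl⟩
      exact ⟨⟨h1, h2⟩, h3, h4⟩
    · rintro ⟨⟨h1, h2⟩, h3, h4⟩
      exact ⟨⟨w, hη.trans_le h3⟩, ⟨⟨h1, h2⟩, h3, h4⟩, rfl⟩
  rw [this]
  exact isCompact_Icc.reProdIm isCompact_Icc

lemma norm_integral_le_of_support {S : Set ℍ} (hS : MeasurableSet S) {B : ℝ} (hB : 0 ≤ B)
    (hv : volume S ≤ ENNReal.ofReal B) {ψ : ℍ → ℂ}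
    (h1 : ∀ z, ‖ψ z‖ ≤ 1) (h0 : ∀ z, ψ z ≠ 0 → z ∈ S) :
    ‖∫ z, ψ z‖ ≤ B := by
  have h : ∫⁻ z, ‖ψ z‖ₑ ≤ ENNReal.ofReal B := by
    calc ∫⁻ z, ‖ψ z‖ₑ ≤ ∫⁻ z, S.indicator 1 z := by
          refine lintegral_mono fun z => ?_
          by_cases hz : z ∈ S
          · rw [Set.indicator_of_mem hz, ← ofReal_norm]
            exact ofReal_le_one.mpr (h1 z)
          · rw [Set.indicator_of_notMem hz, not_not.mp (mt (h0 z) hz), enorm_zero]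
      _ = volume S := lintegral_indicator_one hS
      _ ≤ _ := hv
  have h2 := (enorm_integral_le_lintegral_enorm ψ).trans h
  rw [← ofReal_norm] at h2
  exact (ofReal_le_ofReal_iff hB).mp h2

lemma integrable_of_support {S : Set ℍ} (hS : MeasurableSet S) (hv : volume S ≠ ⊤) {ψ : ℍ → ℂ}
    (hm : Measurable ψ) (h1 : ∀ z, ‖ψ z‖ ≤ 1) (h0 : ∀ z, ψ z ≠ 0 → z ∈ S) : Integrable ψ := by
  refine Integrable.mono' (g := S.indicator 1) ((integrable_indicator_iff hS).mpr ?_)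
    hm.aestronglyMeasurable (.of_forall fun z => ?_)
  · exact integrableOn_const hv
  · by_cases hz : z ∈ S
    · rw [Set.indicator_of_mem hz]; exact h1 z
    · rw [Set.indicator_of_notMem hz, not_not.mp (mt (h0 z) hz), norm_zero]

end

section

open ENNReal ComplexConjugate

lemma sl_ext_of_ne_zero {g h : SL(2, ℤ)} (h0 : g 1 0 ≠ 0) (e10 : g 1 0 = h 1 0)
    (e00 : g 0 0 = h 0 0)
    (e11 : g 1 1 = h 1 1) : g = h := by
  have dg := g.det_coe
  have dh := h.det_coe
  rw [Matrix.det_fin_two] at dg dh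
  have e01 : g 0 1 = h 0 1 := by
    have : g 0 1 * g 1 0 = h 0 1 * g 1 0 := by
      rw [← e10, ← e00, ← e11] at dh; linarith
    exact mul_right_cancel₀ h0 this
  ext i j
  fin_cases i <;> fin_cases j <;> assumption

lemma dvd_val_mul_val_sub_one (c : ℕ) [NeZero c] (u : (ZMod c)ˣ) :
    (c : ℤ) ∣ (u.1.val : ℤ) * ((u⁻¹).1.val : ℤ) - 1 := by
  rw [← ZMod.intCast_zmod_eq_zero_iff_dvd]
  push_cast
  rw [ZMod.natCast_zmod_val, ZMod.natCast_zmod_val, Units.mul_inv, sub_self]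

/-- Representatives of the double cosets of translations with lower left entry `c`. -/
def cell (c : ℕ) [NeZero c] (u : (ZMod c)ˣ) : SL(2, ℤ) :=
  ⟨!![(u.1.val : ℤ), ((u.1.val : ℤ) * ((u⁻¹).1.val : ℤ) - 1) / c; (c : ℤ), ((u⁻¹).1.val : ℤ)], by
    rw [Matrix.det_fin_two_of, Int.ediv_mul_cancel (dvd_val_mul_val_sub_one c u)]; ring⟩

lemma cell_00 (c : ℕ) [NeZero c] (u : (ZMod c)ˣ) : cell c u 0 0 = u.1.val := rfl
lemma cell_10 (c : ℕ) [NeZero c] (u : (ZMod c)ˣ) : cell c u 1 0 = c := rfl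
lemma cell_11 (c : ℕ) [NeZero c] (u : (ZMod c)ˣ) : cell c u 1 1 = (u⁻¹).1.val := rfl

/-- Bruhat decomposition with respect to translations. -/
def bruhat (c : ℕ) [NeZero c] (p : (ZMod c)ˣ × (ℤ × ℤ)) : SL(2, ℤ) :=
  T ^ p.2.1 * cell c p.1 * T ^ p.2.2

lemma T_mul_mul_T (m n : ℤ) (g : SL(2, ℤ)) :
    (T ^ m * g * T ^ n : SL(2, ℤ)) 0 0 = g 0 0 + m * g 1 0 ∧
    (T ^ m * g * T ^ n : SL(2, ℤ)) 1 0 = g 1 0 ∧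
    (T ^ m * g * T ^ n : SL(2, ℤ)) 1 1 = g 1 1 + n * g 1 0 := by
  have key : ((T ^ m * g * T ^ n : SL(2, ℤ)) : Matrix (Fin 2) (Fin 2) ℤ)
      = !![1, m; 0, 1] * (g : Matrix (Fin 2) (Fin 2) ℤ) * !![1, n; 0, 1] := by
    rw [Matrix.SpecialLinearGroup.coe_mul, Matrix.SpecialLinearGroup.coe_mul, coe_T_zpow,
      coe_T_zpow]
  refine ⟨(congrFun₂ key 0 0).trans ?_, (congrFun₂ key 1 0).trans ?_,
    (congrFun₂ key 1 1).trans ?_⟩ <;>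
  · simp [Matrix.mul_apply, Fin.sum_univ_two, Matrix.vecMul, dotProduct]
    try ring

lemma bruhat_injective (c : ℕ) [NeZero c] : Function.Injective (bruhat c) := by
  have hc : (c : ℤ) ≠ 0 := mod_cast NeZero.ne c
  rintro ⟨u, m, n⟩ ⟨u', m', n'⟩ h
  obtain ⟨a0, a1, a2⟩ := T_mul_mul_T m n (cell c u)
  obtain ⟨b0, b1, b2⟩ := T_mul_mul_T m' n' (cell c u')
  have h' : (T ^ m * cell c u * T ^ n : SL(2, ℤ)) = T ^ m' * cell c u' * T ^ n' := h
  rw [h', b0] at a0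
  rw [h', b2] at a2
  rw [cell_00, cell_10, cell_00, cell_10] at a0
  rw [cell_11, cell_10, cell_11, cell_10] at a2
  have hu : u = u' := by
    have := congrArg (Int.cast : ℤ → ZMod c) a0
    push_cast at this
    rw [ZMod.natCast_self, mul_zero, add_zero, mul_zero, add_zero, ZMod.natCast_zmod_val,
      ZMod.natCast_zmod_val] at this
    exact Units.ext this.symm
  subst hu
  have e1 : m = m' := by
    have : (m' : ℤ) * c = m * c := by linarith
    exact (mul_right_cancel₀ hc this).symm
  have e2 : n = n' := by
    have : (n' : ℤ) * c = n * c := by linarith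
    exact (mul_right_cancel₀ hc this).symm
  rw [e1, e2]

lemma range_bruhat (c : ℕ) [NeZero c] : Set.range (bruhat c) = {g : SL(2, ℤ) | g 1 0 = c} := by
  have hc : (c : ℤ) ≠ 0 := mod_cast NeZero.ne c
  ext g
  constructor
  · rintro ⟨⟨u, m, n⟩, rfl⟩
    exact (T_mul_mul_T m n (cell c u)).2.1.trans (cell_10 c u)
  · intro hg
    have hg : g 1 0 = c := hg
    have dg := g.det_coe
    rw [Matrix.det_fin_two, hg] at dg
    have d' := congrArg (Int.cast : ℤ → ZMod c) dg
    push_cast at d'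
    rw [ZMod.natCast_self, mul_zero, sub_zero] at d'
    let u : (ZMod c)ˣ := ⟨(g 0 0 : ZMod c), (g 1 1 : ZMod c), d', by rw [mul_comm]; exact d'⟩
    have h1 : (c : ℤ) ∣ g 0 0 - (u.1.val : ℤ) := by
      rw [← ZMod.intCast_zmod_eq_zero_iff_dvd]
      push_cast
      rw [ZMod.natCast_zmod_val]; simp [u]
    have h2 : (c : ℤ) ∣ g 1 1 - ((u⁻¹).1.val : ℤ) := by
      rw [← ZMod.intCast_zmod_eq_zero_iff_dvd]
      push_cast
      rw [ZMod.natCast_zmod_val]; simp [u]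
    obtain ⟨m, hm⟩ := h1
    obtain ⟨n, hn⟩ := h2
    refine ⟨⟨u, m, n⟩, ?_⟩
    obtain ⟨a0, a1, a2⟩ := T_mul_mul_T m n (cell c u)
    refine sl_ext_of_ne_zero (g := bruhat c (u, m, n)) ?_ ?_ ?_ ?_
    · rw [bruhat, a1, cell_10]; exact hc
    · rw [bruhat, a1, cell_10, hg]
    · rw [bruhat, a0, cell_10, cell_00]; linarith
    · rw [bruhat, a2, cell_10, cell_11]; linarith

variable {f : ℝ → ℝ} {η H : ℝ} {q : ℤ}

/-- The correlation of a strip wave with its translate. -/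
def corr (f : ℝ → ℝ) (q : ℤ) (g : SL(2, ℤ)) : ℂ :=
  ∫ z : ℍ, wave₀ f q z * conj (wave₀ f q (g • z))

/-- The finitely many group elements moving the box to meet itself. -/
def boxSet (η H : ℝ) : Set SL(2, ℤ) := {g | ∃ z ∈ hbox η H, g • z ∈ hbox η H}

lemma boxSet_finite (hη : 0 < η) : (boxSet η H).Finite :=
  finite_setOf_smul_mem (isCompact_hbox hη) (isCompact_hbox hη)

lemma wave₀_mul_eq_zero (hf : IsProfile f η H) {g : SL(2, ℤ)} (hg : g ∉ boxSet η H) (z : ℍ) :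
    wave₀ f q z * conj (wave₀ f q (g • z)) = 0 := by
  by_contra h
  have h1 : wave₀ f q z ≠ 0 := left_ne_zero_of_mul h
  have h2 : wave₀ f q (g • z) ≠ 0 := fun h' => h (by rw [h', map_zero, mul_zero])
  obtain ⟨⟨a1, a2⟩, a3⟩ := hf.of_wave₀_ne_zero h1
  obtain ⟨⟨b1, b2⟩, b3⟩ := hf.of_wave₀_ne_zero h2
  exact hg ⟨z, ⟨⟨a1, a2.le⟩, a3⟩, ⟨⟨b1, b2.le⟩, b3⟩⟩

lemma corr_eq_zero (hf : IsProfile f η H) {g : SL(2, ℤ)} (hg : g ∉ boxSet η H) :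
    corr f q g = 0 := by
  rw [corr]
  simp only [wave₀_mul_eq_zero hf hg, integral_zero]

lemma norm_mul_conj_le (hf : IsProfile f η H) (z w : ℍ) :
    ‖wave₀ f q z * conj (wave₀ f q w)‖ ≤ 1 := by
  rw [norm_mul, RCLike.norm_conj]
  exact mul_le_one₀ (hf.norm_wave₀_le _) (norm_nonneg _) (hf.norm_wave₀_le _)

lemma integrable_corr (hη : 0 < η) (hf : IsProfile f η H) (g : SL(2, ℤ)) :
    Integrable fun z : ℍ => wave₀ f q z * conj (wave₀ f q (g • z)) := by
  refine integrable_of_support measurableSet_strip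
    (ne_top_of_le_ne_top ofReal_ne_top (volume_strip_le hη))
    (hf.measurable_wave₀.mul (Complex.continuous_conj.measurable.comp
      (hf.measurable_wave₀.comp (measurable_const_smul g)))) (fun z => norm_mul_conj_le hf _ _)
    fun z hz => ?_
  obtain ⟨⟨a1, a2⟩, a3⟩ := hf.of_wave₀_ne_zero (left_ne_zero_of_mul hz)
  exact ⟨a1, a2, a3.1⟩

lemma norm_corr_le (hη : 0 < η) (hf : IsProfile f η H) (g : SL(2, ℤ)) : ‖corr f q g‖ ≤ 1 / η := by
  refine norm_integral_le_of_support measurableSet_strip (by positivity) (volume_strip_le hη)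
    (fun z => norm_mul_conj_le hf _ _) fun z hz => ?_
  obtain ⟨⟨a1, a2⟩, a3⟩ := hf.of_wave₀_ne_zero (left_ne_zero_of_mul hz)
  exact ⟨a1, a2, a3.1⟩

lemma corr_neg (g : SL(2, ℤ)) : corr f q (-g) = corr f q g := by
  simp only [corr, SL_neg_smul]

/-- The involution `z ↦ -1/(c²z)`. -/
def flip (c : ℕ) [NeZero c] (z : ℍ) : ℍ :=
  ⟨-1 / ((c : ℂ) ^ 2 * z), by
    have hc : (0 : ℝ) < c := mod_cast (NeZero.ne c).pos
    have : (-1 / ((c : ℂ) ^ 2 * z)) = ((1 / (c : ℝ) ^ 2 : ℝ) : ℂ) * (-(z : ℂ))⁻¹ := by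
      have := z.ne_zero
      have h2 : (c : ℂ) ≠ 0 := mod_cast hc.ne'
      push_cast; field_simp
    rw [this, Complex.im_ofReal_mul]
    exact mul_pos (by positivity) z.im_inv_neg_coe_pos⟩

end

section

open Finset Complex ENNReal ComplexConjugate

variable {f : ℝ → ℝ} {η H : ℝ} {q : ℤ}

lemma cell_smul (c : ℕ) [NeZero c] (u : (ZMod c)ˣ) (z : ℍ) :
    cell c u • ((-((u⁻¹).1.val / c : ℝ)) +ᵥ z) = ((u.1.val / c : ℝ)) +ᵥ flip c z := by
  have hc : (c : ℂ) ≠ 0 := mod_cast NeZero.ne c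
  have hz := z.ne_zero
  rw [UpperHalfPlane.ext_iff, coe_vadd, coe_specialLinearGroup_apply, coe_vadd, cell_00, cell_10,
    cell_11]
  obtain ⟨b, hb⟩ := dvd_val_mul_val_sub_one c u
  have h01 : cell c u 0 1 = b := by
    change ((u.1.val : ℤ) * ((u⁻¹).1.val : ℤ) - 1) / c = b
    rw [hb, Int.mul_ediv_cancel_left]
    exact_mod_cast NeZero.ne c
  have hb' : (u.1.val : ℂ) * ((u⁻¹).1.val : ℂ) - 1 = c * b := mod_cast hb
  rw [h01]
  change _ = _ + -1 / ((c : ℂ) ^ 2 * z)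
  simp only [algebraMap_int_eq, Int.coe_castRingHom]
  push_cast
  have : (c : ℂ) * (-(((u⁻¹).1.val : ℂ) / c) + z) + ((u⁻¹).1.val : ℂ) = c * z := by
    field_simp; ring
  rw [this]
  field_simp
  linear_combination (-1 : ℂ) * hb'

/-- The scaled orbital integral attached to the lower left entry `c`. -/
def orb (f : ℝ → ℝ) (q : ℤ) (c : ℕ) [NeZero c] : ℂ :=
  ∫ z : ℍ, wave f q z * conj (wave f q (flip c z))

lemma integral_wave_cell (c : ℕ) [NeZero c] (u : (ZMod c)ˣ) :
    ∫ z : ℍ, wave f q z * conj (wave f q (cell c u • z))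
      = ee (-(q * (u.1.val + (u⁻¹).1.val) / c)) * orb f q c := by
  rw [← (measurePreserving_vadd_real (-((u⁻¹).1.val / c : ℝ))).integral_comp
    (isometry_real_vadd _).isClosedEmbedding.measurableEmbedding, orb, ← integral_const_mul]
  refine integral_congr_ae (.of_forall fun z => ?_)
  simp only
  rw [cell_smul, wave_vadd, wave_vadd, map_mul, conj_ee]
  have : ee (-(q * (u.1.val + (u⁻¹).1.val) / c))
      = ee (q * -((u⁻¹).1.val / c)) * ee (-(q * (u.1.val / c))) := by
    rw [← ee_add]; congr 1; ring
  rw [this]; ring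

lemma norm_orb_le (hη : 0 < η) (hf : IsProfile f η H) (c : ℕ) [NeZero c] :
    ‖orb f q c‖ ≤ 4 / (c * η) := by
  have hc : (0 : ℝ) < c := mod_cast (NeZero.ne c).pos
  have hm : MeasurableSet {z : ℍ | η ≤ z.im ∧ η * (c : ℝ) ^ 2 * normSq z ≤ z.im} := by
    have h1 : Measurable fun z : ℍ => normSq z :=
      (continuous_normSq.comp continuous_coe).measurable
    have h2 : Measurable fun z : ℍ => z.im := continuous_im.measurable
    exact (measurableSet_le measurable_const h2).inter (measurableSet_le (h1.const_mul _) h2)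
  refine norm_integral_le_of_support hm (by positivity) (volume_lens_le hη hc) (fun z => ?_)
    fun z hz => ?_
  · rw [norm_mul, RCLike.norm_conj]
    exact mul_le_one₀ (hf.norm_wave_le _) (norm_nonneg _) (hf.norm_wave_le _)
  · refine ⟨(hf.of_wave_ne_zero (left_ne_zero_of_mul hz)).1, ?_⟩
    have h2 : wave f q (flip c z) ≠ 0 := fun h => hz (by rw [h]; simp)
    have h3 := (hf.of_wave_ne_zero h2).1
    have hn : 0 < normSq z := normSq_pos.mpr z.ne_zero
    have e : (flip c z).im = z.im / (c ^ 2 * normSq z) := by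
      change (-1 / ((c : ℂ) ^ 2 * z)).im = _
      rw [div_im]
      have : ((c : ℂ) ^ 2 * z) = (((c : ℝ) ^ 2 : ℝ) : ℂ) * z := by push_cast; ring
      rw [this, im_ofReal_mul, map_mul, normSq_ofReal]
      simp
      field_simp
    rw [e, le_div_iff₀ (by positivity)] at h3
    linarith

lemma tsum_corr_bruhat (hη : 0 < η) (hf : IsProfile f η H) (c : ℕ) [NeZero c] :
    ∑' p, corr f q (bruhat c p) = conj (klo q c) * orb f q c := by
  have hfin : (Function.support fun p => corr f q (bruhat c p)).Finite := by
    refine ((boxSet_finite (H := H) hη).preimage (bruhat_injective c).injOn).subset fun p hp => ?_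
    exact by_contra fun h => hp (corr_eq_zero hf h)
  have hs : Summable fun p => corr f q (bruhat c p) := summable_of_hasFiniteSupport hfin
  rw [hs.tsum_prod, tsum_fintype, klo_eq, kloos, map_sum, sum_mul]
  refine sum_congr rfl fun u _ => ?_
  have h1 : conj ((ZMod.stdAddChar.mulShift (q : ZMod c)) (u.1 + (u⁻¹).1))
      = ee (-(q * (u.1.val + (u⁻¹).1.val) / c)) := by
    rw [AddChar.mulShift_apply, ← conj_ee]
    congr 1
    have : (q : ZMod c) * (u.1 + (u⁻¹).1) = ((q * (u.1.val + (u⁻¹).1.val) : ℤ) : ZMod c) := by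
      push_cast
      rw [ZMod.natCast_zmod_val, ZMod.natCast_zmod_val]
    rw [this, ZMod.stdAddChar_coe, ee]
    congr 1
    push_cast; ring
  rw [h1, ← integral_wave_cell]
  let γ := cell c u
  have hinj : Function.Injective fun p : ℤ × ℤ => bruhat c (u, p) := fun a b h => by
    have := bruhat_injective c h
    exact (Prod.ext_iff.mp this).2
  have hfin' : (boxSet η H).Finite := boxSet_finite hη
  let P : Finset (ℤ × ℤ) := (hfin'.preimage hinj.injOn).toFinset
  have hP : ∀ p : ℤ × ℤ, p ∉ P → bruhat c (u, p) ∉ boxSet η H := fun p hp => by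
    simpa [P] using hp
  rw [tsum_eq_sum (s := P) fun p hp => corr_eq_zero hf (hP p hp)]
  have hb : ∀ (p : ℤ × ℤ) (z : ℍ), bruhat c (u, p) • T ^ (-p.2) • z = T ^ p.1 • γ • z :=
    fun p z => by
      rw [bruhat, mul_smul, mul_smul, smul_smul (T ^ p.2), ← _root_.zpow_add, add_neg_cancel,
        zpow_zero, one_smul]
  have e1 : ∀ p : ℤ × ℤ, corr f q (bruhat c (u, p))
      = ∫ z : ℍ, wave₀ f q (T ^ (-p.2) • z) * conj (wave₀ f q (T ^ p.1 • γ • z)) := by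
    intro p
    rw [corr, ← (measurePreserving_smul (T ^ (-p.2) : SL(2, ℤ)) (volume : Measure ℍ)).integral_comp
      (measurableEmbedding_const_smul _)]
    refine integral_congr_ae (.of_forall fun z => ?_)
    simp only
    rw [hb]
  have hi : ∀ p : ℤ × ℤ, Integrable fun z : ℍ =>
      wave₀ f q (T ^ (-p.2) • z) * conj (wave₀ f q (T ^ p.1 • γ • z)) := by
    intro p
    have h := integrable_corr (q := q) hη hf (bruhat c (u, p))
    rw [← (measurePreserving_smul (T ^ (-p.2) : SL(2, ℤ)) (volume : Measure ℍ)).integrable_comp_emb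
      (measurableEmbedding_const_smul _)] at h
    refine h.congr (.of_forall fun z => ?_)
    simp only [Function.comp_apply]
    rw [hb]
  simp only [e1]
  rw [← integral_finsetSum _ fun p _ => hi p]
  refine integral_congr_ae (.of_forall fun z => ?_)
  simp only
  let p₀ : ℤ × ℤ := (-⌊(γ • z).re⌋, ⌊z.re⌋)
  have hterm : ∀ p : ℤ × ℤ, wave₀ f q (T ^ (-p.2) • z) * conj (wave₀ f q (T ^ p.1 • γ • z))
      = if p = p₀ then wave f q z * conj (wave f q (γ • z)) else 0 := by
    intro p
    rw [wave₀_T, wave₀_T]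
    by_cases h2 : p.2 = ⌊z.re⌋
    · by_cases h1 : p.1 = -⌊(γ • z).re⌋
      · rw [if_pos (by rw [h2]), if_pos h1, if_pos (Prod.ext h1 h2)]
      · rw [if_neg h1, map_zero, mul_zero, if_neg]
        rintro rfl; exact h1 rfl
    · rw [if_neg (fun h => h2 (neg_injective h)), zero_mul, if_neg]
      rintro rfl; exact h2 rfl
  rw [sum_congr rfl fun p _ => hterm p, sum_ite_eq']
  split_ifs with h
  · rfl
  · rw [eq_comm]
    have h3 := hP p₀ h
    have h4 := wave₀_mul_eq_zero (q := q) hf h3 (T ^ (-p₀.2) • z)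
    rw [hb] at h4
    have h5 := hterm p₀
    rw [if_pos rfl] at h5
    exact h5.symm.trans h4

end

section

open Finset ENNReal ComplexConjugate

variable {f : ℝ → ℝ} {η H : ℝ} {q : ℤ}

lemma mem_Gamma0_iff_dvd {N : ℕ} {g : SL(2, ℤ)} : g ∈ Gamma0 N ↔ (N : ℤ) ∣ g 1 0 := by
  rw [Gamma0_mem, ZMod.intCast_zmod_eq_zero_iff_dvd]

lemma abs_lower_left_mul_le (hη : 0 < η) {g : SL(2, ℤ)} (hg : g ∈ boxSet η H) :
    |(g 1 0 : ℝ)| * η ≤ 1 := by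
  obtain ⟨z, hz, hgz⟩ := hg
  have h1 : η ≤ z.im := hz.2.1
  have h2 : η ≤ (g • z).im := hgz.2.1
  have hc : ((g 1 0 : ℝ) * z.im) ^ 2 ≤ Complex.normSq (denom g z) := by
    have := c_mul_im_sq_le_normSq_denom (g : GL (Fin 2) ℝ) z
    simpa using this
  rw [ModularGroup.im_smul_eq_div_normSq] at h2
  have hz0 := z.im_pos
  have hn : 0 < Complex.normSq (denom g z) := by
    by_contra h
    have : Complex.normSq (denom g z) = 0 := le_antisymm (not_lt.mp h) (Complex.normSq_nonneg _)
    have h2' : η ≤ z.im / 0 := this ▸ h2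
    have h3 : z.im / (0 : ℝ) = 0 := div_zero _
    linarith
  rw [le_div_iff₀ hn] at h2
  have h3 : η * ((g 1 0 : ℝ) * z.im) ^ 2 ≤ z.im := (mul_le_mul_of_nonneg_left hc hη.le).trans h2
  have h4 : (η * (g 1 0 : ℝ) ^ 2 * z.im) * z.im ≤ 1 * z.im := by linarith [h3]
  have h5 := le_of_mul_le_mul_right h4 hz0
  have h6 : η * (g 1 0 : ℝ) ^ 2 * η ≤ 1 :=
    (mul_le_mul_of_nonneg_left h1 (by positivity)).trans h5
  rw [← abs_of_pos hη, ← abs_mul]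
  rw [← sq_le_one_iff_abs_le_one]
  nlinarith [h6]

/-- The elements of `boxSet` as a finset. -/
def boxFinset (hη : 0 < η) (H : ℝ) : Finset SL(2, ℤ) :=
  (boxSet_finite (H := H) hη).toFinset

lemma mem_boxFinset (hη : 0 < η) {g : SL(2, ℤ)} : g ∈ boxFinset hη H ↔ g ∈ boxSet η H :=
  Set.Finite.mem_toFinset _

lemma sum_corr_eq (hη : 0 < η) (hf : IsProfile f η H) (c : ℕ) [NeZero c] :
    ∑ g ∈ boxFinset hη H with g 1 0 = (c : ℤ), corr f q g = conj (klo q c) * orb f q c := by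
  rw [← tsum_corr_bruhat hη hf, sum_filter]
  have h1 : ∀ p, corr f q (bruhat c p)
      = (fun g : SL(2, ℤ) => if g 1 0 = (c : ℤ) then corr f q g else 0) (bruhat c p) := by
    intro p
    have : bruhat c p ∈ {g : SL(2, ℤ) | g 1 0 = c} := by
      rw [← range_bruhat]; exact Set.mem_range_self _
    exact (if_pos this).symm
  rw [tsum_congr h1, (bruhat_injective c).tsum_eq
    (f := fun g : SL(2, ℤ) => if g 1 0 = (c : ℤ) then corr f q g else 0)]
  · rw [tsum_eq_sum (s := boxFinset hη H)]
    intro g hg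
    rw [mem_boxFinset] at hg
    rw [corr_eq_zero hf hg, ite_self]
  · intro g hg
    rw [range_bruhat]
    by_contra h
    exact hg (if_neg h)

lemma neg_mem_boxSet {g : SL(2, ℤ)} : -g ∈ boxSet η H ↔ g ∈ boxSet η H := by
  simp only [boxSet, Set.mem_ofPred_eq, SL_neg_smul]

lemma sum_corr_neg_eq (hη : 0 < η) (hf : IsProfile f η H) (c : ℕ) [NeZero c] :
    ∑ g ∈ boxFinset hη H with g 1 0 = -(c : ℤ), corr f q g = conj (klo q c) * orb f q c := by
  rw [← sum_corr_eq hη hf]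
  refine sum_nbij' (fun g => -g) (fun g => -g) ?_ ?_ ?_ ?_ ?_
  · intro g hg
    rw [mem_filter, mem_boxFinset] at hg ⊢
    exact ⟨neg_mem_boxSet.mpr hg.1, by
      change -(g 1 0) = _
      rw [hg.2, neg_neg]⟩
  · intro g hg
    rw [mem_filter, mem_boxFinset] at hg ⊢
    exact ⟨neg_mem_boxSet.mpr hg.1, by
      change -(g 1 0) = -(c : ℤ)
      rw [hg.2]⟩
  · intro g _; exact neg_neg g
  · intro g _; exact neg_neg g
  · intro g _; exact (corr_neg g).symm

lemma eq_one_or_neg_one_of_wave (hf : IsProfile f η H) {g : SL(2, ℤ)} (hg : g 1 0 = 0)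
    (h : corr f q g ≠ 0) : g = 1 ∨ g = -1 := by
  have key : ∀ m : ℤ, corr f q (T ^ m) ≠ 0 → m = 0 := by
    intro m hm
    by_contra h0
    apply hm
    rw [corr]
    have : ∀ z : ℍ, wave₀ f q z * conj (wave₀ f q (T ^ m • z)) = 0 := by
      intro z
      by_contra h
      obtain ⟨⟨a1, a2⟩, a3⟩ := hf.of_wave₀_ne_zero (left_ne_zero_of_mul h)
      have h2 : wave₀ f q (T ^ m • z) ≠ 0 := fun h' => h (by rw [h', map_zero, mul_zero])
      rw [wave₀_T] at h2
      have hfl : ⌊z.re⌋ = 0 := Int.floor_eq_zero_iff.mpr ⟨a1, a2⟩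
      rw [hfl, neg_zero, if_neg h0] at h2
      exact h2 rfl
    simp only [this, integral_zero]
  have dg := g.det_coe
  rw [Matrix.det_fin_two, hg, mul_zero, sub_zero] at dg
  have hT : ∀ m : ℤ, ((T ^ m : SL(2, ℤ)) : Matrix (Fin 2) (Fin 2) ℤ) = !![1, m; 0, 1] := coe_T_zpow
  rcases Int.eq_one_or_neg_one_of_mul_eq_one' dg with ⟨ha, hd⟩ | ⟨ha, hd⟩
  · left
    have : g = T ^ (g 0 1) := by
      ext i j
      rw [hT]
      fin_cases i <;> fin_cases j <;> simp [ha, hd, hg]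
    rw [this] at h ⊢
    rw [key _ h, zpow_zero]
  · right
    have : g = -T ^ (-(g 0 1)) := by
      ext i j
      change g i j = -((T ^ (-(g 0 1)) : SL(2, ℤ)) : Matrix (Fin 2) (Fin 2) ℤ) i j
      rw [hT]
      fin_cases i <;> fin_cases j <;> simp [ha, hd, hg]
    rw [this, corr_neg] at h
    rw [this, key _ h, zpow_zero]

lemma norm_sum_corr_zero_le (hη : 0 < η) (hf : IsProfile f η H) :
    ‖∑ g ∈ boxFinset hη H with g 1 0 = 0, corr f q g‖ ≤ 2 / η := by
  have h1 : ∑ g ∈ boxFinset hη H with g 1 0 = 0, ‖corr f q g‖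
      ≤ ∑ g ∈ ({1, -1} : Finset SL(2, ℤ)), ‖corr f q g‖ := by
    rw [← sum_filter_ne_zero]
    refine sum_le_sum_of_subset_of_nonneg (fun g hg => ?_) fun _ _ _ => norm_nonneg _
    rw [mem_filter, mem_filter] at hg
    have := eq_one_or_neg_one_of_wave hf hg.1.2 (norm_ne_zero_iff.mp hg.2)
    simpa using this
  refine (norm_sum_le _ _).trans (h1.trans ?_)
  calc ∑ g ∈ ({1, -1} : Finset SL(2, ℤ)), ‖corr f q g‖
      ≤ ∑ g ∈ ({1, -1} : Finset SL(2, ℤ)), 1 / η := sum_le_sum fun g _ => norm_corr_le hη hf g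
    _ ≤ 2 / η := by
        rw [sum_const, nsmul_eq_mul]
        have : ((card ({1, -1} : Finset SL(2, ℤ)) : ℕ) : ℝ) ≤ 2 := by
          exact_mod_cast card_le_two
        rw [← mul_one_div (2 : ℝ)]
        exact mul_le_mul_of_nonneg_right this (by positivity)

lemma wave₀_mul_conj_tsum (hη : 0 < η) (hf : IsProfile f η H) (N : ℕ) (z : ℍ) :
    wave₀ f q z * conj (∑' g : Gamma0 N, wave₀ f q (g • z))
      = ∑ g ∈ boxFinset hη H with g ∈ Gamma0 N, wave₀ f q z * conj (wave₀ f q (g • z)) := by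
  by_cases hz : wave₀ f q z = 0
  · simp [hz]
  have e1 : ∑' g : Gamma0 N, wave₀ f q (g • z)
      = ∑ g ∈ boxFinset hη H with g ∈ Gamma0 N, wave₀ f q (g • z) := by
    change ∑' g : (Gamma0 N : Set SL(2, ℤ)), (fun g : SL(2, ℤ) => wave₀ f q (g • z)) g = _
    rw [tsum_subtype (Gamma0 N : Set SL(2, ℤ)) fun g : SL(2, ℤ) => wave₀ f q (g • z),
      sum_filter, tsum_eq_sum (s := boxFinset hη H)]
    · rfl
    · intro g hg
      rw [mem_boxFinset] at hg
      have := wave₀_mul_eq_zero (q := q) hf hg z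
      have h2 : wave₀ f q (g • z) = 0 := by
        simpa using (mul_eq_zero.mp this).resolve_left hz
      by_cases h3 : g ∈ (Gamma0 N : Set SL(2, ℤ))
      · rw [Set.indicator_of_mem h3]; exact h2
      · rw [Set.indicator_of_notMem h3]
  rw [e1, map_sum, mul_sum]

lemma integrable_wave₀_mul_conj_tsum (hη : 0 < η) (hf : IsProfile f η H) (N : ℕ) :
    Integrable fun z : ℍ => wave₀ f q z * conj (∑' g : Gamma0 N, wave₀ f q (g • z)) := by
  simp only [wave₀_mul_conj_tsum hη hf]
  exact integrable_finsetSum _ fun g _ => integrable_corr hη hf g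

lemma finite_support_wave₀ (hη : 0 < η) (hf : IsProfile f η H) (N : ℕ) (z : ℍ) :
    (Function.support fun g : Gamma0 N => wave₀ f q (g • z)).Finite := by
  have h := finite_setOf_smul_mem (isCompact_singleton (x := z)) (isCompact_hbox (H := H) hη)
  refine (h.preimage (Subtype.val_injective (p := fun g => g ∈ Gamma0 N)).injOn).subset
    fun g hg => ?_
  obtain ⟨⟨a1, a2⟩, a3⟩ := hf.of_wave₀_ne_zero hg
  exact ⟨z, rfl, ⟨a1, a2.le⟩, a3⟩

/-- The `L²` norm of an incomplete Poincaré series is controlled by Kloosterman sums. -/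
lemma norm_poincare_le (hη : 0 < η) (hf : IsProfile f η H) {N : ℕ} (hN : 0 < N) {M : ℕ}
    (hM : 1 < N * (M + 1) * η) :
    ‖∫ z : ℍ, wave₀ f q z * conj (∑' g : Gamma0 N, wave₀ f q (g • z))‖
      ≤ 2 / η + 8 / η * ∑ j ∈ Icc 1 M, ‖klo q (N * j)‖ / ((N * j : ℕ) : ℝ) := by
  simp only [wave₀_mul_conj_tsum hη hf]
  rw [integral_finsetSum _ fun g _ => integrable_corr hη hf g]
  change ‖∑ g ∈ boxFinset hη H with g ∈ Gamma0 N, corr f q g‖ ≤ _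
  have hmaps : ∀ g ∈ (boxFinset hη H).filter (· ∈ Gamma0 N),
      (g 1 0).natAbs / N ∈ range (M + 1) := by
    intro g hg
    rw [mem_filter, mem_boxFinset] at hg
    have h1 := abs_lower_left_mul_le hη hg.1
    rw [mem_range, Nat.div_lt_iff_lt_mul hN]
    by_contra hcon
    have h2 : ((M + 1 : ℕ) * N : ℝ) ≤ |(g 1 0 : ℝ)| := by
      rw [← Int.cast_abs, ← Int.natCast_natAbs]
      exact_mod_cast not_lt.mp hcon
    have h3 := mul_le_mul_of_nonneg_right h2 hη.le
    push_cast at h3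
    nlinarith
  rw [← sum_fiberwise_of_maps_to hmaps, sum_range_succ']
  refine (norm_add_le _ _).trans ?_
  rw [add_comm]
  have hfil0 : ((boxFinset hη H).filter (· ∈ Gamma0 N)).filter (fun g => (g 1 0).natAbs / N = 0)
      = (boxFinset hη H).filter (fun g => g 1 0 = 0) := by
    ext g
    simp only [mem_filter, mem_Gamma0_iff_dvd]
    constructor
    · rintro ⟨⟨h1, h2⟩, h3⟩
      refine ⟨h1, ?_⟩
      have h2' : N ∣ (g 1 0).natAbs := Int.natCast_dvd.mp h2
      obtain ⟨j, hj⟩ := h2'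
      rw [hj, Nat.mul_div_cancel_left _ hN] at h3
      rw [h3, mul_zero] at hj
      exact Int.natAbs_eq_zero.mp hj
    · rintro ⟨h1, h2⟩
      rw [h2]; simp [h1]
  refine add_le_add ?_ ?_
  · rw [hfil0]; exact norm_sum_corr_zero_le hη hf
  · refine (norm_sum_le _ _).trans ?_
    have hr : Icc 1 M = (range M).map (addRightEmbedding 1) := by
      ext j; simp only [mem_Icc, mem_map, mem_range, addRightEmbedding_apply]
      constructor
      · rintro ⟨h1, h2⟩; exact ⟨j - 1, by omega, by omega⟩
      · rintro ⟨i, h1, rfl⟩; omega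
    rw [hr, sum_map, mul_sum]
    refine sum_le_sum fun i _ => ?_
    rw [addRightEmbedding_apply]
    have : NeZero (N * (i + 1)) := ⟨by positivity⟩
    have hfil : ((boxFinset hη H).filter (· ∈ Gamma0 N)).filter
        (fun g => (g 1 0).natAbs / N = i + 1)
        = (boxFinset hη H).filter (fun g => g 1 0 = ((N * (i + 1) : ℕ) : ℤ))
          ∪ (boxFinset hη H).filter (fun g => g 1 0 = -((N * (i + 1) : ℕ) : ℤ)) := by
      ext g
      simp only [mem_filter, mem_Gamma0_iff_dvd, mem_union]
      constructor
      · rintro ⟨⟨h1, h2⟩, h3⟩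
        obtain ⟨j, hj⟩ : N ∣ (g 1 0).natAbs := Int.natCast_dvd.mp h2
        rw [hj, Nat.mul_div_cancel_left _ hN] at h3
        rw [h3] at hj
        rcases Int.natAbs_eq_iff.mp hj with h | h
        · exact Or.inl ⟨h1, h⟩
        · exact Or.inr ⟨h1, h⟩
      · rintro (⟨h1, h2⟩ | ⟨h1, h2⟩)
        · refine ⟨⟨h1, by rw [h2]; push_cast; exact dvd_mul_right _ _⟩, ?_⟩
          rw [h2, Int.natAbs_natCast, Nat.mul_div_cancel_left _ hN]
        · refine ⟨⟨h1, by rw [h2]; push_cast; exact (dvd_mul_right _ _).neg_right⟩, ?_⟩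
          rw [h2, Int.natAbs_neg, Int.natAbs_natCast, Nat.mul_div_cancel_left _ hN]
    have hdisj : Disjoint ((boxFinset hη H).filter (fun g => g 1 0 = ((N * (i + 1) : ℕ) : ℤ)))
        ((boxFinset hη H).filter (fun g => g 1 0 = -((N * (i + 1) : ℕ) : ℤ))) := by
      rw [disjoint_filter]
      intro g _ h1 h2
      have : 0 < N * (i + 1) := by positivity
      omega
    rw [hfil, sum_union hdisj, sum_corr_eq hη hf, sum_corr_neg_eq hη hf]
    refine (norm_add_le _ _).trans ?_
    rw [norm_mul, RCLike.norm_conj]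
    have h4 := norm_orb_le (q := q) hη hf (N * (i + 1))
    have h5 := mul_le_mul_of_nonneg_left h4 (norm_nonneg (klo q (N * (i + 1))))
    have hpos : (0 : ℝ) < ((N * (i + 1) : ℕ) : ℝ) := mod_cast (by positivity)
    calc _ ≤ ‖klo q (N * (i + 1))‖ * (4 / (((N * (i + 1) : ℕ) : ℝ) * η))
          + ‖klo q (N * (i + 1))‖ * (4 / (((N * (i + 1) : ℕ) : ℝ) * η)) := add_le_add h5 h5
      _ = _ := by field_simp; ring

instance countable_SLZ : Countable SL(2, ℤ) := by
  have : Countable (Matrix (Fin 2) (Fin 2) ℤ) := inferInstanceAs (Countable (Fin 2 → Fin 2 → ℤ))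
  exact Subtype.countable

instance countable_Gamma0 (N : ℕ) : Countable (Gamma0 N) := Subtype.countable

lemma exists_isWeight_Gamma0 (N : ℕ) : ∃ w : ℍ → ℝ, IsWeight (Gamma0 N) w := by
  refine exists_isWeight (fun z : ℍ => dist z UpperHalfPlane.I)
    (continuous_id.dist continuous_const).measurable fun x R => ?_
  have h := finite_setOf_smul_mem (isCompact_singleton (x := x))
    (ProperSpace.isCompact_closedBall UpperHalfPlane.I R)
  refine (h.preimage (Subtype.val_injective (p := fun g => g ∈ Gamma0 N)).injOn).subset
    fun g hg => ?_
  exact ⟨x, rfl, hg⟩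

end

section

open Real

/-- The point `z` of the upper half-plane is the root of the positive definite form
`A z² - 2 B z + C` of determinant `D`. -/
structure IsRoot (D : ℕ) (A B C : ℤ) (z : ℍ) : Prop where
  pos : 0 < A
  disc : A * C - B ^ 2 = D
  eq : (A : ℂ) * z = B + √D * Complex.I

namespace IsRoot

variable {D : ℕ} {A B C A' B' C' : ℤ} {z z' : ℍ}

lemma re_eq (h : IsRoot D A B C z) : A * z.re = B := by
  have := congrArg Complex.re h.eq
  simpa using this

lemma im_eq (h : IsRoot D A B C z) : A * z.im = √D := by
  have := congrArg Complex.im h.eq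
  simpa using this

lemma ext (h : IsRoot D A B C z) (h' : IsRoot D A B C' z') : z = z' := by
  rw [UpperHalfPlane.ext_iff]
  have hA : (A : ℂ) ≠ 0 := mod_cast h.pos.ne'
  exact mul_left_cancel₀ hA (h.eq.trans h'.eq.symm)

lemma disc_pos (h : IsRoot D A B C z) : 0 < D := by
  have h1 := h.im_eq
  have h2 : 0 < √D := by
    rw [← h1]; exact mul_pos (mod_cast h.pos) z.im_pos
  exact_mod_cast sqrt_pos.mp h2

lemma smul (h : IsRoot D A B C z) (g : SL(2, ℤ)) :
    IsRoot D (A * g 1 1 ^ 2 + 2 * B * g 1 1 * g 1 0 + C * g 1 0 ^ 2)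
      (g 0 0 * g 1 0 * C + (g 0 0 * g 1 1 + g 0 1 * g 1 0) * B + g 0 1 * g 1 1 * A)
      (C * g 0 0 ^ 2 + 2 * B * g 0 0 * g 0 1 + A * g 0 1 ^ 2) (g • z) := by
  have hdet := g.det_coe
  rw [Matrix.det_fin_two] at hdet
  have hd := h.disc
  refine ⟨?_, ?_, ?_⟩
  · have hD : (0 : ℤ) < D := mod_cast h.disc_pos
    have key : A * (A * g 1 1 ^ 2 + 2 * B * g 1 1 * g 1 0 + C * g 1 0 ^ 2)
        = (A * g 1 1 + g 1 0 * B) ^ 2 + D * g 1 0 ^ 2 := by rw [← hd]; ring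
    have : 0 < A * (A * g 1 1 ^ 2 + 2 * B * g 1 1 * g 1 0 + C * g 1 0 ^ 2) := by
      rw [key]
      by_cases hc : g 1 0 = 0
      · have h11 : g 1 1 ≠ 0 := fun h0 => by rw [h0, hc] at hdet; simp at hdet
        have := h.pos.ne'
        rw [hc]
        have : 0 < (A * g 1 1) ^ 2 := by positivity
        simpa using this
      · positivity
    exact (mul_pos_iff_of_pos_left h.pos).mp this
  · rw [← hd]
    have : (g 0 0 * g 1 1 - g 0 1 * g 1 0) ^ 2 = 1 := by rw [hdet]; norm_num
    linear_combination (A * C - B ^ 2) * this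
  · have hs : ((√D : ℝ) : ℂ) ^ 2 = A * C - B ^ 2 := by
      rw [← Complex.ofReal_pow, sq_sqrt (Nat.cast_nonneg _)]
      exact_mod_cast hd.symm
    have hA : (A : ℂ) ≠ 0 := mod_cast h.pos.ne'
    have hden : ((g 1 0 : ℤ) : ℂ) * z + (g 1 1 : ℤ) ≠ 0 := by
      have := denom_ne_zero (g : GL (Fin 2) ℝ) z
      simpa [denom_apply] using this
    rw [coe_specialLinearGroup_apply]
    simp only [algebraMap_int_eq, Int.coe_castRingHom, Complex.ofReal_intCast]
    rw [mul_div_assoc', div_eq_iff hden]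
    have hdc : ((g 0 0 : ℤ) : ℂ) * (g 1 1 : ℤ) - (g 0 1 : ℤ) * (g 1 0 : ℤ) = 1 := by
      exact_mod_cast hdet
    have hI := Complex.I_sq
    apply mul_left_cancel₀ hA
    have e := h.eq
    set s : ℂ := ((√D : ℝ) : ℂ)
    push_cast
    generalize ((g 0 0 : ℤ) : ℂ) = α at *
    generalize ((g 0 1 : ℤ) : ℂ) = β at *
    generalize ((g 1 0 : ℤ) : ℂ) = γ at *
    generalize ((g 1 1 : ℤ) : ℂ) = δ at *
    linear_combination (((A : ℂ) * δ ^ 2 + 2 * B * δ * γ + C * γ ^ 2) * α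
      - ((α * γ * C + (α * δ + β * γ) * B + β * δ * A) + s * Complex.I) * γ) * e
      + (s * Complex.I * (δ * A + γ * B) + γ * (B ^ 2 - A * C)) * hdc
      - γ * (Complex.I ^ 2 * hs + (A * C - B ^ 2) * hI)

lemma two_mul_cosh (h : IsRoot D A B C z) (h' : IsRoot D A' B' C' z') :
    2 * D * (cosh (dist z z') - 1) = ((A * C' + A' * C - 2 * B * B' - 2 * D : ℤ) : ℝ) := by
  rw [UpperHalfPlane.cosh_dist, Complex.dist_eq, ← Complex.normSq_eq_norm_sq, Complex.normSq_apply]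
  have hA : (0 : ℝ) < A := mod_cast h.pos
  have hA' : (0 : ℝ) < A' := mod_cast h'.pos
  have hd : (A : ℝ) * C - B ^ 2 = D := mod_cast h.disc
  have hd' : (A' : ℝ) * C' - B' ^ 2 = D := mod_cast h'.disc
  have hs : √D ^ 2 = D := sq_sqrt (Nat.cast_nonneg _)
  have hD : (0 : ℝ) < D := mod_cast h.disc_pos
  have e1 : z.re = B / A := by rw [eq_div_iff hA.ne', ← h.re_eq]; ring
  have e2 : z.im = √D / A := by rw [eq_div_iff hA.ne', ← h.im_eq]; ring
  have e3 : z'.re = B' / A' := by rw [eq_div_iff hA'.ne', ← h'.re_eq]; ring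
  have e4 : z'.im = √D / A' := by rw [eq_div_iff hA'.ne', ← h'.im_eq]; ring
  have e5 : (C : ℝ) = (D + B ^ 2) / A := by rw [eq_div_iff hA.ne']; linarith
  have e6 : (C' : ℝ) = (D + B' ^ 2) / A' := by rw [eq_div_iff hA'.ne']; linarith
  simp only [Complex.sub_re, Complex.sub_im, coe_re, coe_im]
  have hs0 : √D ≠ 0 := (sqrt_pos.mpr hD).ne'
  have e7 : 2 * z.im * z'.im = 2 * D / (A * A') := by
    rw [e2, e4]
    calc 2 * (√D / A) * (√D / A') = 2 * √D ^ 2 / (A * A') := by ring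
      _ = _ := by rw [hs]
  rw [e7, e1, e3]
  have e8 : (z.im - z'.im) * (z.im - z'.im) = D * (1 / A - 1 / A') ^ 2 := by
    rw [e2, e4]
    calc _ = √D ^ 2 * (1 / A - 1 / A') ^ 2 := by ring
      _ = _ := by rw [hs]
  rw [e8]
  push_cast
  rw [e5, e6]
  field_simp
  ring

end IsRoot

lemma shift_sq_le {D A B C A' B' C' : ℤ} (hA : 0 < A) (hA' : 0 < A')
    (h : A * C - B ^ 2 = D) (h' : A' * C' - B' ^ 2 = D) (hD : 0 < D)
    (hu : A * C' + A' * C - 2 * B * B' - 2 * D ≤ 2 * D) (hB : 4 * B ^ 2 ≤ A ^ 2)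
    (hAD : 3 * A ^ 2 ≤ 4 * D) : B' ^ 2 ≤ 36 * D := by
  set u := A * C' + A' * C - 2 * B * B' - 2 * D with hu'
  have key : u * (A * A') = D * (A - A') ^ 2 + (A * B' - A' * B) ^ 2 := by
    have e1 : A * (A * A') * C' = A ^ 2 * (D + B' ^ 2) := by rw [← h']; ring
    have e2 : A' * (A * A') * C = A' ^ 2 * (D + B ^ 2) := by rw [← h]; ring
    rw [hu']; linear_combination e1 + e2
  have hAA : 0 < A * A' := mul_pos hA hA'
  have h1 : u * (A * A') ≤ 2 * D * (A * A') := mul_le_mul_of_nonneg_right hu hAA.le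
  have h2 : D * (A - A') ^ 2 ≤ D * (2 * (A * A')) := by nlinarith [sq_nonneg (A * B' - A' * B)]
  have h3 := le_of_mul_le_mul_left h2 hD
  have h4 : A' ≤ 4 * A := by
    by_contra hcon
    nlinarith [mul_pos hA' (sub_pos.mpr (not_le.mp hcon)), sq_nonneg A]
  have h5 : (A * B' - A' * B) ^ 2 ≤ 2 * D * (A * A') := by
    have : 0 ≤ D * (A - A') ^ 2 := by positivity
    linarith
  have h6 : 2 * D * (A * A') ≤ 8 * D * A ^ 2 := by
    have : A * A' ≤ 4 * A ^ 2 := by nlinarith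
    nlinarith
  have h7 : (A' * B) ^ 2 ≤ 16 * A ^ 2 * B ^ 2 := by
    rw [mul_pow]
    have : A' ^ 2 ≤ 16 * A ^ 2 := by nlinarith
    exact mul_le_mul_of_nonneg_right this (sq_nonneg B)
  have h8 : (A * B') ^ 2 ≤ 2 * (A' * B) ^ 2 + 2 * (A * B' - A' * B) ^ 2 := by
    nlinarith [sq_nonneg (A' * B - (A * B' - A' * B))]
  have h9 : A ^ 2 * B' ^ 2 ≤ A ^ 2 * (32 * B ^ 2 + 16 * D) := by nlinarith
  have h10 := le_of_mul_le_mul_left h9 (by positivity)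
  nlinarith

lemma eq_of_disp_eq_zero {D A B C A' B' C' : ℤ} (hA : 0 < A) (h : A * C - B ^ 2 = D)
    (h' : A' * C' - B' ^ 2 = D) (hD : 0 < D)
    (hu : A * C' + A' * C - 2 * B * B' - 2 * D = 0) : A = A' ∧ B = B' := by
  have key : (A * C' + A' * C - 2 * B * B' - 2 * D) * (A * A')
      = D * (A - A') ^ 2 + (A * B' - A' * B) ^ 2 := by
    have e1 : A * (A * A') * C' = A ^ 2 * (D + B' ^ 2) := by rw [← h']; ring
    have e2 : A' * (A * A') * C = A' ^ 2 * (D + B ^ 2) := by rw [← h]; ring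
    linear_combination e1 + e2
  rw [hu, zero_mul] at key
  have h1 : 0 ≤ D * (A - A') ^ 2 := by positivity
  have h2 := sq_nonneg (A * B' - A' * B)
  have h3 : D * (A - A') ^ 2 = 0 := by linarith
  have h4 : A = A' := by
    have := (mul_eq_zero.mp h3).resolve_left hD.ne'
    nlinarith [pow_eq_zero_iff (two_ne_zero) |>.mp this]
  refine ⟨h4, ?_⟩
  have h5 : (A * B' - A' * B) ^ 2 = 0 := by linarith
  rw [← h4, ← mul_sub] at h5
  have h6 := pow_eq_zero_iff (two_ne_zero) |>.mp h5
  have := (mul_eq_zero.mp h6).resolve_left hA.ne'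
  linarith

end

section

open Finset Real

lemma int_dvd_of_squarefree {d : ℕ} (hd : Squarefree d) {x : ℤ}
    (h : ∀ p : ℕ, p.Prime → p ∣ d → (p : ℤ) ∣ x) : (d : ℤ) ∣ x := by
  rw [← Nat.prod_primeFactors_of_squarefree hd, Int.natCast_dvd]
  refine prod_primes_dvd _ (fun p hp => (Nat.prime_of_mem_primeFactors hp).prime)
    fun p hp => Int.natCast_dvd.mp (h p (Nat.prime_of_mem_primeFactors hp)
      (Nat.dvd_of_mem_primeFactors hp))

lemma dvd_cross_of_roots {a h d : ℕ} (hh : Squarefree h) (hd : Squarefree d) (had : a.Coprime d)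
    {A B C α γ α' γ' l l' : ℤ} (hD : A * C - B ^ 2 = (a * h : ℕ))
    (h1 : (d : ℤ) ∣ A * α - B * γ - l * γ) (h2 : (d : ℤ) ∣ C * γ - B * α + l * α)
    (h1' : (d : ℤ) ∣ A * α' - B * γ' - l' * γ') (h2' : (d : ℤ) ∣ C * γ' - B * α' + l' * α')
    (hl : (d : ℤ) ∣ l - l') (hx : (2 : ℤ) ∣ α * γ' - α' * γ) :
    (d : ℤ) ∣ α * γ' - α' * γ := by
  refine int_dvd_of_squarefree hd fun p hp hpd => ?_
  rcases hp.eq_two_or_odd with rfl | hodd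
  · exact hx
  have hpd' : (p : ℤ) ∣ d := mod_cast hpd
  have hpp : Prime (p : ℤ) := Nat.prime_iff_prime_int.mp hp
  set x := α * γ' - α' * γ with hxdef
  by_contra hcon
  have k1 := hpd'.trans h1
  have k2 := hpd'.trans h2
  have k1' := hpd'.trans h1'
  have k2' := hpd'.trans h2'
  have kl := hpd'.trans hl
  have hAx : (p : ℤ) ∣ A * x := by
    have : A * x = (A * α - B * γ - l * γ) * γ' - (A * α' - B * γ' - l' * γ') * γ
        + (l - l') * (γ * γ') := by rw [hxdef]; ring
    rw [this]
    exact ((k1.mul_right _).sub (k1'.mul_right _)).add (kl.mul_right _)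
  have hCx : (p : ℤ) ∣ C * x := by
    have : C * x = (C * γ' - B * α' + l' * α') * α - (C * γ - B * α + l * α) * α'
        + (l - l') * (α * α') := by rw [hxdef]; ring
    rw [this]
    exact ((k2'.mul_right _).sub (k2.mul_right _)).add (kl.mul_right _)
  have hBx : (p : ℤ) ∣ 2 * B * x := by
    have : 2 * B * x = (A * α - B * γ - l * γ) * α' - (A * α' - B * γ' - l' * γ') * α
        - (C * γ - B * α + l * α) * γ' + (C * γ' - B * α' + l' * α') * γ
        + (l - l') * (α * γ' + α' * γ) := by
      rw [hxdef]; ring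
    rw [this]
    exact ((((k1.mul_right _).sub (k1'.mul_right _)).sub (k2.mul_right _)).add
      (k2'.mul_right _)).add (kl.mul_right _)
  have hA := (hpp.dvd_or_dvd hAx).resolve_right hcon
  have hC := (hpp.dvd_or_dvd hCx).resolve_right hcon
  have hB2 := (hpp.dvd_or_dvd hBx).resolve_right hcon
  have hB : (p : ℤ) ∣ B := by
    refine (hpp.dvd_or_dvd hB2).resolve_left fun h2 => ?_
    have : p ∣ 2 := mod_cast h2
    have := (Nat.prime_dvd_prime_iff_eq hp Nat.prime_two).mp this
    omega
  have hsq : (p : ℤ) * p ∣ (a * h : ℕ) := by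
    rw [← hD, sq]
    exact (mul_dvd_mul hA hC).sub (mul_dvd_mul hB hB)
  have hsq' : p * p ∣ a * h := mod_cast hsq
  have hpa : Nat.Coprime p a := (had.coprime_dvd_right hpd).symm
  have := (Nat.Coprime.mul_left hpa hpa).dvd_of_dvd_mul_left hsq'
  exact hp.one_lt.ne' (Nat.isUnit_iff.mp (hh p this))

/-- Heegner points of level `a d` attached to the congruence `a ν² + h ≡ 0`. -/
def heeg (a h d : ℕ) : Set ℍ :=
  {z | ∃ A B C : ℤ, IsRoot (a * h) A B C z ∧ ((a * d : ℕ) : ℤ) ∣ A ∧ (a : ℤ) ∣ B}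

lemma smul_mem_heeg {a h d : ℕ} {z : ℍ} (hz : z ∈ heeg a h d) {g : SL(2, ℤ)}
    (hg : g ∈ Gamma0 (a * d)) : g • z ∈ heeg a h d := by
  obtain ⟨A, B, C, hr, hA, hB⟩ := hz
  rw [mem_Gamma0_iff_dvd] at hg
  have ha : (a : ℤ) ∣ ((a * d : ℕ) : ℤ) := by push_cast; exact dvd_mul_right _ _
  refine ⟨_, _, _, hr.smul g, ?_, ?_⟩
  · rw [sq (g 1 0)]
    exact ((hA.mul_right _).add (hg.mul_left _)).add ((hg.mul_right _).mul_left _)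
  · exact ((((ha.trans hg).mul_left _).mul_right _).add (hB.mul_left _)).add
      ((ha.trans hA).mul_left _)

/-- Pairs `(B, A)` with `A ∣ D + B²` and `B² ≤ 36 D`. -/
def forms (D : ℕ) : Finset (Σ _ : ℤ, ℕ) :=
  (Icc (-(Nat.sqrt (36 * D) : ℤ)) (Nat.sqrt (36 * D))).sigma
    fun B => (D + B ^ 2 : ℤ).natAbs.divisors

lemma mem_forms {D : ℕ} {A B C : ℤ} (hD : 0 < D) (hA : 0 < A) (h : A * C - B ^ 2 = D)
    (hB : B ^ 2 ≤ 36 * D) : (⟨B, A.toNat⟩ : Σ _ : ℤ, ℕ) ∈ forms D := by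
  rw [forms, mem_sigma, mem_Icc, Nat.mem_divisors]
  have h1 : B.natAbs ≤ Nat.sqrt (36 * D) := by
    rw [Nat.le_sqrt', ← Int.ofNat_le]; push_cast; rw [sq_abs]; exact hB
  refine ⟨⟨by simp only; omega, by simp only; omega⟩, ?_, ?_⟩
  · rw [← Int.natCast_dvd, Int.toNat_of_nonneg hA.le]
    exact ⟨C, by simp only; linarith⟩
  · simp only
    have : (0 : ℤ) < D + B ^ 2 := by positivity
    omega

lemma card_forms_le {D T Z : ℕ} (hD : 0 < D) (hT : ∀ n, n ≠ 0 → n ≤ Z → tau n ≤ T)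
    (hZ : 37 * D ≤ Z) : (#(forms D) : ℝ) ≤ 13 * √D * T := by
  have h1 : #(forms D) ≤ (2 * Nat.sqrt (36 * D) + 1) * T := by
    rw [forms, card_sigma]
    calc _ ≤ ∑ B ∈ Icc (-(Nat.sqrt (36 * D) : ℤ)) (Nat.sqrt (36 * D)), T := by
          refine sum_le_sum fun B hB => hT _ ?_ ?_
          · have : (0 : ℤ) < D + B ^ 2 := by positivity
            omega
          · rw [mem_Icc] at hB
            have h2 : B.natAbs ≤ Nat.sqrt (36 * D) := by omega
            rw [Nat.le_sqrt', ← Int.ofNat_le] at h2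
            push_cast at h2
            rw [sq_abs] at h2
            have : (D : ℤ) + B ^ 2 ≤ Z := by
              have : ((37 * D : ℕ) : ℤ) ≤ Z := mod_cast hZ
              push_cast at this; linarith
            have h0 : (0 : ℤ) < D + B ^ 2 := by positivity
            generalize (D : ℤ) + B ^ 2 = e at *
            omega
      _ = _ := by
        rw [sum_const, Int.card_Icc, smul_eq_mul]
        congr 1
        omega
  have h2 : (Nat.sqrt (36 * D) : ℝ) ≤ 6 * √D := by
    have := nat_sqrt_le_real_sqrt (a := 36 * D)
    rw [Nat.cast_mul, sqrt_mul (by positivity)] at this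
    have h36 : √((36 : ℕ) : ℝ) = 6 := by
      rw [show ((36 : ℕ) : ℝ) = 6 ^ 2 by norm_num]; exact sqrt_sq (by norm_num)
    rwa [h36] at this
  have h3 : 1 ≤ √D := by
    rw [one_le_sqrt]; exact_mod_cast hD
  calc (#(forms D) : ℝ) ≤ (2 * Nat.sqrt (36 * D) + 1) * T := mod_cast h1
    _ ≤ 13 * √D * T := mul_le_mul_of_nonneg_right (by linarith) (by positivity)

/-- The invariant `2 D (cosh dist - 1)` of two forms, in terms of coefficients. -/
def disp (D : ℕ) (F F' : Σ _ : ℤ, ℕ) : ℤ :=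
  F.2 * ((D + F'.1 ^ 2) / F'.2) + F'.2 * ((D + F.1 ^ 2) / F.2) - 2 * F.1 * F'.1 - 2 * D

/-- Invariants of close pairs of Heegner points. -/
def pairKeys (a h d : ℕ) :
    Finset (((Σ _ : ℤ, ℕ) × (Σ _ : ℤ, ℕ)) × (ZMod (2 * a) × ZMod (2 * a)) × ℕ) :=
  if ha : a = 0 then ∅ else
    have : NeZero (2 * a) := ⟨by omega⟩
    ((forms (a * h) ×ˢ forms (a * h)).filter fun F => (0 ≤ disp (a * h) F.1 F.2 ∧
      disp (a * h) F.1 F.2 ≤ 2 * (a * h : ℕ)) ∧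
      (d : ℤ) ∣ disp (a * h) F.1 F.2 * (disp (a * h) F.1 F.2 + 4 * (a * h : ℕ))) ×ˢ
      (univ ×ˢ rts 1 (a * h : ℕ) d)

end

section

open Finset Real

lemma eq_of_disp {D : ℕ} {F F' : Σ _ : ℤ, ℕ} (hD : 0 < D) (hF : F ∈ forms D) (hF' : F' ∈ forms D)
    (h : disp D F F' = 0) : F' = F := by
  obtain ⟨B, A⟩ := F
  obtain ⟨B', A'⟩ := F'
  have key : ∀ {B : ℤ} {A : ℕ}, (⟨B, A⟩ : Σ _ : ℤ, ℕ) ∈ forms D → 0 < (A : ℤ) ∧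
      (A : ℤ) * ((D + B ^ 2) / A) - B ^ 2 = D := fun {B A} hm => by
    rw [forms, mem_sigma] at hm
    have hm2 := Nat.mem_divisors.mp hm.2
    have h1 : (A : ℤ) ∣ D + B ^ 2 := Int.natCast_dvd.mpr hm2.1
    rw [Int.mul_ediv_cancel' h1]
    have : A ≠ 0 := fun h0 =>
      hm2.2 (by have := hm2.1; simp only [h0] at this; exact zero_dvd_iff.mp this)
    exact ⟨by omega, by ring⟩
  obtain ⟨hA, hd⟩ := key hF
  obtain ⟨hA', hd'⟩ := key hF'
  obtain ⟨e1, e2⟩ := eq_of_disp_eq_zero hA hd hd' (mod_cast hD) h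
  have e1' : A = A' := mod_cast e1
  rw [e1', e2]

lemma sum_card_pairKeys_le {a h T Z : ℕ} (ha : a ≠ 0) (hh : Squarefree h)
    (hT : ∀ n, n ≠ 0 → n ≤ Z → tau n ≤ T) (hZ : 37 * (a * h) ^ 2 ≤ Z) (𝒟 : Finset ℕ)
    (h𝒟 : ∀ d ∈ 𝒟, d ≠ 0 ∧ d ≤ Z) :
    (∑ d ∈ 𝒟, (#(pairKeys a h d) : ℝ)) ≤ 16 * a ^ 3 * T *
      (13 * √(a * h) * T * #𝒟 + 169 * (a * h) * T ^ 3) := by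
  have hD : 0 < a * h := Nat.mul_pos (by omega) hh.ne_zero.pos
  have hZ1 : 37 * (a * h) ≤ Z := by nlinarith
  set D := a * h with hDdef
  let P : ℕ → (Σ _ : ℤ, ℕ) × (Σ _ : ℤ, ℕ) → Prop := fun d F =>
    (0 ≤ disp D F.1 F.2 ∧ disp D F.1 F.2 ≤ 2 * (D : ℕ)) ∧
      (d : ℤ) ∣ disp D F.1 F.2 * (disp D F.1 F.2 + 4 * (D : ℕ))
  have h1 : ∀ d ∈ 𝒟, (pairKeys a h d).card ≤
      16 * a ^ 3 * T * (((forms D) ×ˢ (forms D)).filter (P d)).card := fun d hd => by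
    have hr := card_rts_one_le_mul (a := (a : ℤ)) (h := (h : ℤ)) (by omega)
      (by rw [Int.squarefree_natCast]; exact hh) (h𝒟 d hd).1
    have hτ := hT d (h𝒟 d hd).1 (h𝒟 d hd).2
    have : NeZero (2 * a) := ⟨by omega⟩
    rw [pairKeys, dif_neg ha, card_product, card_product, card_univ,
      Fintype.card_prod, ZMod.card]
    have hr' : #(rts 1 (a * h : ℕ) d) ≤ 4 * a * T := by
      push_cast at hr ⊢
      exact hr.trans (by simpa using Nat.mul_le_mul_left _ hτ)
    calc _ ≤ (((forms D) ×ˢ (forms D)).filter (P d)).card * (2 * a * (2 * a) * (4 * a * T)) := by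
          gcongr
      _ = _ := by ring
  have h2 : ∑ d ∈ 𝒟, (((forms D) ×ˢ (forms D)).filter (P d)).card ≤
      #(forms D) * #𝒟 + #(forms D) ^ 2 * T := by
    calc _ = ∑ F ∈ (forms D) ×ˢ (forms D), #(𝒟.filter fun d => P d F) := by
          simp only [card_filter]
          exact sum_comm
      _ ≤ ∑ F ∈ (forms D) ×ˢ (forms D), ((if F.2 = F.1 then #𝒟 else 0) + T) := by
          refine sum_le_sum fun F hF => ?_
          rw [mem_product] at hF
          by_cases h0 : disp D F.1 F.2 = 0
          · rw [if_pos (eq_of_disp hD hF.1 hF.2 h0)]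
            exact (card_filter_le _ _).trans (Nat.le_add_right _ _)
          · refine le_trans ?_ (Nat.le_add_left _ _)
            by_cases hb : 0 ≤ disp D F.1 F.2 ∧ disp D F.1 F.2 ≤ 2 * (D : ℕ)
            · obtain ⟨u, hu⟩ := Int.eq_ofNat_of_zero_le hb.1
              rw [hu] at hb h0
              have hu0 : u ≠ 0 := mod_cast h0
              have hu2 : u ≤ 2 * D := mod_cast hb.2
              refine le_trans (card_le_card (t := (u * (u + 4 * D)).divisors) ?_)
                (hT (u * (u + 4 * D)) (by positivity) ?_)
              · intro d hd
                rw [mem_filter] at hd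
                have := hd.2.2
                rw [hu] at this
                exact Nat.mem_divisors.mpr ⟨by exact_mod_cast this, by positivity⟩
              · nlinarith
            · rw [card_eq_zero.mpr (filter_eq_empty_iff.mpr fun d _ hP => hb hP.1)]
              exact Nat.zero_le _
      _ = _ := by
          rw [sum_add_distrib, sum_const, card_product, sum_product]
          simp only [sum_ite_eq']
          rw [sum_congr rfl (g := fun _ => #𝒟) (fun x hx => by simp [hx])]
          simp only [sum_const, smul_eq_mul]
          ring
  have h3 := card_forms_le hD hT hZ1
  have h4 : (∑ d ∈ 𝒟, (#(pairKeys a h d) : ℝ)) ≤ 16 * a ^ 3 * T *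
      (#(forms D) * #𝒟 + #(forms D) ^ 2 * T : ℕ) := by
    calc _ ≤ ∑ d ∈ 𝒟, ((16 * a ^ 3 * T * (((forms D) ×ˢ (forms D)).filter (P d)).card : ℕ) : ℝ) :=
          sum_le_sum fun d hd => by exact_mod_cast h1 d hd
      _ = 16 * a ^ 3 * T * (∑ d ∈ 𝒟, (((forms D) ×ˢ (forms D)).filter (P d)).card : ℕ) := by
          push_cast; rw [mul_sum]
      _ ≤ _ := by gcongr
  refine h4.trans (mul_le_mul_of_nonneg_left ?_ (by positivity))
  have hs : √D ^ 2 = a * h := by rw [sq_sqrt (by positivity), hDdef]; push_cast; ring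
  have hc : √((a : ℝ) * h) = √D := by rw [hDdef]; push_cast; rfl
  rw [hc]
  push_cast
  have h5 : (#(forms D) : ℝ) ^ 2 ≤ 169 * (a * h) * T ^ 2 := by
    calc (#(forms D) : ℝ) ^ 2 ≤ (13 * √D * T) ^ 2 := by gcongr
      _ = 169 * √D ^ 2 * T ^ 2 := by ring
      _ = _ := by rw [hs]
  calc _ ≤ 13 * √D * T * #𝒟 + (169 * (a * h) * T ^ 2) * T := by gcongr
    _ = _ := by ring

end

section

open Finset Real

lemma cosh_one_le_two : cosh 1 ≤ 2 := by
  have h1 := exp_one_lt_d9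
  have h2 : exp (-1) ≤ 1 := exp_le_one_iff.mpr (by norm_num)
  rw [cosh_eq]
  linarith

/-- `K` records the class of the pair `p` under simultaneous translation. -/
def IsKey (a h d : ℕ) (p : ℍ × ℍ)
    (K : ((Σ _ : ℤ, ℕ) × (Σ _ : ℤ, ℕ)) × (ZMod (2 * a) × ZMod (2 * a)) × ℕ) : Prop :=
  ∃ (g : SL(2, ℤ)) (A B C A' B' C' l : ℤ), IsRoot (a * h) A B C (g • p.1) ∧
    IsRoot (a * h) A' B' C' (g • p.2) ∧ (d : ℤ) ∣ A * g 0 0 - B * g 1 0 - l * g 1 0 ∧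
    (d : ℤ) ∣ C * g 1 0 - B * g 0 0 + l * g 0 0 ∧
    K = ((⟨B, A.toNat⟩, ⟨B', A'.toNat⟩), ((g 0 0 : ZMod (2 * a)), (g 1 0 : ZMod (2 * a))),
      (l % d).toNat)

lemma IsRoot.eq_of_toNat {D : ℕ} {A B C A' B' C' : ℤ} {z z' : ℍ} (h : IsRoot D A B C z)
    (h' : IsRoot D A' B' C' z') (hA : A.toNat = A'.toNat) (hB : B = B') :
    A = A' ∧ C = C' ∧ z = z' := by
  have h1 := h.pos
  have h2 := h'.pos
  have hA' : A = A' := by omega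
  subst hA' hB
  have : C = C' := mul_left_cancel₀ h1.ne' (by linarith [h.disc, h'.disc])
  subst this
  exact ⟨rfl, rfl, h.ext h'⟩

lemma IsKey.exists_smul {a h d : ℕ} (hh : Squarefree h) (hd : Squarefree d)
    (had : a.Coprime d) {p p' : ℍ × ℍ}
    {K : ((Σ _ : ℤ, ℕ) × (Σ _ : ℤ, ℕ)) × (ZMod (2 * a) × ZMod (2 * a)) × ℕ}
    (hK : IsKey a h d p K) (hK' : IsKey a h d p' K) :
    ∃ γ : Gamma0 (a * d), γ • p.1 = p'.1 ∧ γ • p.2 = p'.2 := by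
  obtain ⟨g, A, B, C, A', B', C', l, hr, hr', h1, h2, rfl⟩ := hK
  obtain ⟨g₂, A₂, B₂, C₂, A₂', B₂', C₂', l₂, hr₂, hr₂', h1₂, h2₂, e⟩ := hK'
  simp only [Prod.mk.injEq, Sigma.mk.injEq, heq_eq_eq] at e
  obtain ⟨⟨⟨e1, e2⟩, e3, e4⟩, ⟨e5, e6⟩, e7⟩ := e
  obtain ⟨rfl, rfl, e8⟩ := hr.eq_of_toNat hr₂ e2 e1
  obtain ⟨-, -, e9⟩ := hr'.eq_of_toNat hr₂' e4 e3
  subst e1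
  have hd0 : (0 : ℤ) < d := mod_cast hd.ne_zero.pos
  have hl : (d : ℤ) ∣ l - l₂ := by
    have n1 := Int.emod_nonneg l hd0.ne'
    have n2 := Int.emod_nonneg l₂ hd0.ne'
    have n3 : l₂ % d = l % d := by omega
    exact Int.ModEq.dvd n3
  rw [ZMod.intCast_eq_intCast_iff_dvd_sub] at e5 e6
  have h2a : ((2 * a : ℕ) : ℤ) ∣ g 0 0 * g₂ 1 0 - g₂ 0 0 * g 1 0 := by
    have : g 0 0 * g₂ 1 0 - g₂ 0 0 * g 1 0
        = (g₂ 1 0 - g 1 0) * g 0 0 - (g₂ 0 0 - g 0 0) * g 1 0 := by ring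
    rw [this]
    exact (e6.mul_right _).sub (e5.mul_right _)
  have hdx := dvd_cross_of_roots hh hd had hr.disc h1 h2 h1₂ h2₂ hl
    ((by push_cast; exact dvd_mul_right _ _ : (2 : ℤ) ∣ ((2 * a : ℕ) : ℤ)).trans h2a)
  have hax : (a : ℤ) ∣ g 0 0 * g₂ 1 0 - g₂ 0 0 * g 1 0 :=
    (by push_cast; exact dvd_mul_left _ _ : (a : ℤ) ∣ ((2 * a : ℕ) : ℤ)).trans h2a
  have hN : ((a * d : ℕ) : ℤ) ∣ (g₂⁻¹ * g : SL(2, ℤ)) 1 0 := by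
    have e : (g₂⁻¹ * g : SL(2, ℤ)) 1 0 = -(g 0 0 * g₂ 1 0 - g₂ 0 0 * g 1 0) := by
      rw [Matrix.SpecialLinearGroup.coe_mul, Matrix.mul_apply, Fin.sum_univ_two,
        Matrix.SpecialLinearGroup.coe_inv, Matrix.adjugate_fin_two]
      simp
      ring
    rw [e, dvd_neg]
    push_cast
    exact (Int.isCoprime_iff_gcd_eq_one.mpr (by simpa using had)).mul_dvd hax hdx
  refine ⟨⟨g₂⁻¹ * g, mem_Gamma0_iff_dvd.mpr hN⟩, ?_, ?_⟩
  · change (g₂⁻¹ * g) • p.1 = p'.1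
    rw [mul_smul, e8, inv_smul_smul]
  · change (g₂⁻¹ * g) • p.2 = p'.2
    rw [mul_smul, e9, inv_smul_smul]

lemma IsRoot.toNat_disp {D : ℕ} {A B C A' B' C' : ℤ} {z z' : ℍ} (h : IsRoot D A B C z)
    (h' : IsRoot D A' B' C' z') :
    disp D ⟨B, A.toNat⟩ ⟨B', A'.toNat⟩ = A * C' + A' * C - 2 * B * B' - 2 * D := by
  have h1 := h.pos
  have h2 := h'.pos
  have e1 : ((D : ℤ) + B ^ 2) / A = C := by
    rw [show (D : ℤ) + B ^ 2 = A * C by linarith [h.disc], Int.mul_ediv_cancel_left _ h1.ne']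
  have e2 : ((D : ℤ) + B' ^ 2) / A' = C' := by
    rw [show (D : ℤ) + B' ^ 2 = A' * C' by linarith [h'.disc], Int.mul_ediv_cancel_left _ h2.ne']
  simp only [disp, Int.toNat_of_nonneg h1.le, Int.toNat_of_nonneg h2.le]
  rw [e1, e2]

lemma exists_isKey {a h d : ℕ} (ha : a ≠ 0) (hd : d ≠ 0) {p : ℍ × ℍ}
    (h1 : p.1 ∈ heeg a h d) (h2 : p.2 ∈ heeg a h d) (hdist : dist p.1 p.2 ≤ 1) :
    ∃ K ∈ pairKeys a h d, IsKey a h d p K := by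
  obtain ⟨A, B, C, hr, hA, -⟩ := h1
  obtain ⟨A', B', C', hr', hA', -⟩ := h2
  obtain ⟨g, hg⟩ := exists_smul_mem_fd p.1
  have hs := hr.smul g
  have hs' := hr'.smul g
  have hdet := g.det_coe
  rw [Matrix.det_fin_two] at hdet
  have c1 := hr.two_mul_cosh hr'
  have c2 := hs.two_mul_cosh hs'
  rw [dist_smul, c1, Int.cast_inj] at c2
  have t1 := hs.toNat_disp hs'
  rw [← c2] at t1
  set D := a * h with hDdef
  set u := A * C' + A' * C - 2 * B * B' - 2 * D with hu
  have hD : 0 < D := hr.disc_pos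
  have hD' : (0 : ℝ) < D := mod_cast hD
  have u1 : 0 ≤ u := by
    have : (0 : ℝ) ≤ (u : ℝ) := by
      rw [← c1]
      exact mul_nonneg (by positivity) (sub_nonneg.mpr (one_le_cosh _))
    exact_mod_cast this
  have u2 : u ≤ 2 * D := by
    have : (u : ℝ) ≤ 2 * D := by
      rw [← c1]
      have : cosh (dist p.1 p.2) ≤ cosh 1 := by
        rw [cosh_le_cosh, abs_of_nonneg dist_nonneg]; simpa using hdist
      have := cosh_one_le_two
      nlinarith
    exact_mod_cast this
  have hdA : (d : ℤ) ∣ A := (Int.natCast_dvd_natCast.2 (d.dvd_mul_left a)).trans hA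
  have hdA' : (d : ℤ) ∣ A' :=
    (by push_cast; exact dvd_mul_left _ _ : (d : ℤ) ∣ ((a * d : ℕ) : ℤ)).trans hA'
  have u3 : (d : ℤ) ∣ u * (u + 4 * D) := by
    have e : u * (u + 4 * D) = A * (C' * (A * C' + A' * C - 2 * B * B') + (A' * C - 2 * B * B') * C'
        - 4 * C * (A' * C' - B' ^ 2) ) + A' * (C * (A' * C - 2 * B * B') - 2 * B * B' * C
        + 4 * C' * B ^ 2) := by
      have e1 := hr.disc
      have e2 := hr'.disc
      rw [hu]
      have : (D : ℤ) ^ 2 = (A * C - B ^ 2) * (A' * C' - B' ^ 2) := by rw [e1, e2, sq]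
      linear_combination -4 * this
    rw [e]
    exact (hdA.mul_right _).add (hdA'.mul_right _)
  obtain ⟨z1, z2⟩ := hg
  have hp1 := hs.pos
  have hp2 := hs'.pos
  have hre := hs.re_eq
  have him := hs.im_eq
  have hdisc := hs.disc
  have hdisc' := hs'.disc
  have hz : 3 ≤ 4 * (g • p.1).im ^ 2 := three_le_four_mul_im_sq_of_mem_fd ⟨z1, z2⟩
  have q1 : (d : ℤ) ∣ (A * g 1 1 ^ 2 + 2 * B * g 1 1 * g 1 0 + C * g 1 0 ^ 2) * g 0 0
      - (g 0 0 * g 1 0 * C + (g 0 0 * g 1 1 + g 0 1 * g 1 0) * B + g 0 1 * g 1 1 * A) * g 1 0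
      - B * g 1 0 := by
    have : (A * g 1 1 ^ 2 + 2 * B * g 1 1 * g 1 0 + C * g 1 0 ^ 2) * g 0 0
      - (g 0 0 * g 1 0 * C + (g 0 0 * g 1 1 + g 0 1 * g 1 0) * B + g 0 1 * g 1 1 * A) * g 1 0
      - B * g 1 0 = A * g 1 1 := by linear_combination (A * g 1 1 + B * g 1 0) * hdet
    rw [this]; exact hdA.mul_right _
  have q2 : (d : ℤ) ∣ (C * g 0 0 ^ 2 + 2 * B * g 0 0 * g 0 1 + A * g 0 1 ^ 2) * g 1 0
      - (g 0 0 * g 1 0 * C + (g 0 0 * g 1 1 + g 0 1 * g 1 0) * B + g 0 1 * g 1 1 * A) * g 0 0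
      + B * g 0 0 := by
    have : (C * g 0 0 ^ 2 + 2 * B * g 0 0 * g 0 1 + A * g 0 1 ^ 2) * g 1 0
      - (g 0 0 * g 1 0 * C + (g 0 0 * g 1 1 + g 0 1 * g 1 0) * B + g 0 1 * g 1 1 * A) * g 0 0
      + B * g 0 0 = -(A * g 0 1) := by linear_combination (-A * g 0 1 - B * g 0 0) * hdet
    rw [this]; exact (hdA.mul_right _).neg_right
  refine ⟨_, ?_, g, _, _, _, _, _, _, B, hs, hs', q1, q2, rfl⟩
  generalize A * g 1 1 ^ 2 + 2 * B * g 1 1 * g 1 0 + C * g 1 0 ^ 2 = a₁ at *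
  generalize g 0 0 * g 1 0 * C + (g 0 0 * g 1 1 + g 0 1 * g 1 0) * B + g 0 1 * g 1 1 * A = b₁ at *
  generalize C * g 0 0 ^ 2 + 2 * B * g 0 0 * g 0 1 + A * g 0 1 ^ 2 = c₁ at *
  have hb : 4 * b₁ ^ 2 ≤ a₁ ^ 2 := by
    have h1 : (b₁ : ℝ) ^ 2 = a₁ ^ 2 * (g • p.1).re ^ 2 := by rw [← hre]; ring
    have h2 : (g • p.1).re ^ 2 ≤ 1 / 4 := by
      rw [← sq_abs]; nlinarith [abs_nonneg (g • p.1).re]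
    have h3 : 4 * (b₁ : ℝ) ^ 2 ≤ a₁ ^ 2 := by rw [h1]; nlinarith [sq_nonneg (a₁ : ℝ)]
    exact_mod_cast h3
  have hc : 3 * a₁ ^ 2 ≤ 4 * (D : ℤ) := by
    have h1 : (a₁ : ℝ) ^ 2 * (g • p.1).im ^ 2 = D := by
      rw [← mul_pow, him, sq_sqrt hD'.le]
    have h3 : 3 * (a₁ : ℝ) ^ 2 ≤ 4 * D := by rw [← h1]; nlinarith [sq_nonneg (a₁ : ℝ)]
    exact_mod_cast h3
  have hDz : (0 : ℤ) < D := mod_cast hD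
  rw [pairKeys, dif_neg ha, mem_product, mem_filter, mem_product,
    mem_product]
  refine ⟨⟨⟨mem_forms hD hp1 hdisc (by linarith), mem_forms hD hp2 hdisc'
    (shift_sq_le hp1 hp2 hdisc hdisc' hDz (by rw [← c2]; exact u2) hb hc)⟩, ?_⟩, ?_⟩
  · simp only [← hDdef]
    rw [t1]
    exact ⟨⟨u1, u2⟩, u3⟩
  · refine ⟨?_, ?_⟩
    · have : NeZero (2 * a) := ⟨by omega⟩
      exact mem_univ _
    · rw [mem_rts]
      have hd0 : (0 : ℤ) < d := mod_cast hd.pos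
      have n1 := Int.emod_nonneg B hd0.ne'
      have n2 := Int.emod_lt_of_pos B hd0
      refine ⟨by simp only; omega, ?_⟩
      simp only [Int.toNat_of_nonneg n1]
      have hB : B % d = B - d * (B / d) := by rw [Int.emod_def]
      have : 1 * (B % d) ^ 2 + (a * h : ℕ) = A * C + d * ((B / d) * (d * (B / d) - 2 * B)) := by
        rw [hB, ← hDdef, ← hr.disc]; ring
      rw [this]
      exact (hdA.mul_right _).add (dvd_mul_right _ _)

end

section

open Real

/-- The height `√(h / a)`. -/
def hgt (a h : ℕ) : ℝ := √(h / a)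

lemma hgt_pos {a h : ℕ} (ha : 0 < a) (hh : 0 < h) : 0 < hgt a h :=
  sqrt_pos.mpr (by positivity)

lemma mul_hgt (a h : ℕ) (ha : 0 < a) : a * hgt a h = √((a * h : ℕ) : ℝ) := by
  have ha' : (0 : ℝ) < a := mod_cast ha
  rw [hgt, eq_comm, sqrt_eq_iff_mul_self_eq (by positivity) (by positivity), eq_comm]
  calc (a : ℝ) * √(h / a) * (a * √(h / a))
      = a ^ 2 * √(h / a) ^ 2 := by ring
    _ = a ^ 2 * (h / a) := by rw [sq_sqrt (by positivity)]
    _ = ((a * h : ℕ) : ℝ) := by push_cast; field_simp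

/-- The point `(ν + i √(h/a)) / n`. -/
def pt (a h n : ℕ) (ν : ℤ) : ℍ :=
  if hp : 0 < hgt a h / n then ⟨⟨ν / n, hgt a h / n⟩, hp⟩ else UpperHalfPlane.I

section

variable {a h n d : ℕ} {ν : ℤ}

lemma pt_re (ha : 0 < a) (hh : 0 < h) (hn : 0 < n) : (pt a h n ν).re = ν / n := by
  have : 0 < hgt a h / n := div_pos (hgt_pos ha hh) (mod_cast hn)
  rw [pt, dif_pos this]; rfl

lemma pt_im (ha : 0 < a) (hh : 0 < h) (hn : 0 < n) : (pt a h n ν).im = hgt a h / n := by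
  have : 0 < hgt a h / n := div_pos (hgt_pos ha hh) (mod_cast hn)
  rw [pt, dif_pos this]; rfl

lemma eq_pt_iff (ha : 0 < a) (hh : 0 < h) (hn : 0 < n) {z : ℍ} :
    z = pt a h n ν ↔ n * z.re = ν ∧ n * z.im = hgt a h := by
  have hn' : (n : ℝ) ≠ 0 := mod_cast hn.ne'
  constructor
  · rintro rfl
    rw [pt_re ha hh hn, pt_im ha hh hn]
    constructor <;> field_simp
  · rintro ⟨h1, h2⟩
    refine UpperHalfPlane.ext (Complex.ext ?_ ?_)
    · rw [coe_re, coe_re, pt_re ha hh hn, eq_div_iff hn', mul_comm, h1]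
    · rw [coe_im, coe_im, pt_im ha hh hn, eq_div_iff hn', mul_comm, h2]

lemma T_zpow_pt (ha : 0 < a) (hh : 0 < h) (hn : 0 < n) (m : ℤ) :
    T ^ m • pt a h n ν = pt a h n (ν + n * m) := by
  have hn' : (n : ℝ) ≠ 0 := mod_cast hn.ne'
  rw [eq_pt_iff ha hh hn, T_zpow_re, T_zpow_im, pt_re ha hh hn, pt_im ha hh hn]
  push_cast
  constructor <;> field_simp
  ring

lemma mem_heeg_iff (ha : 0 < a) (hh : 0 < h) {z : ℍ} : z ∈ heeg a h d ↔
    ∃ n : ℕ, ∃ ν : ℤ, 0 < n ∧ d ∣ n ∧ (n : ℤ) ∣ a * ν ^ 2 + h ∧ z = pt a h n ν := by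
  have haz : (a : ℤ) ≠ 0 := mod_cast ha.ne'
  have har : (a : ℝ) ≠ 0 := mod_cast ha.ne'
  constructor
  · rintro ⟨A, B, C, hr, hA, ν, rfl⟩
    have hpos := hr.pos
    obtain ⟨n, rfl⟩ : (a : ℤ) ∣ A :=
      (by push_cast; exact dvd_mul_right _ _ : (a : ℤ) ∣ ((a * d : ℕ) : ℤ)).trans hA
    have hn : 0 < n := pos_of_mul_pos_right hpos (by positivity)
    lift n to ℕ using hn.le
    have hn' : 0 < n := mod_cast hn
    refine ⟨n, ν, hn', ?_, ?_, ?_⟩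
    · push_cast at hA
      exact_mod_cast (mul_dvd_mul_iff_left haz).mp hA
    · refine ⟨C, mul_left_cancel₀ haz ?_⟩
      have := hr.disc
      push_cast at this
      linear_combination -this
    · rw [eq_pt_iff ha hh hn']
      have h1 := hr.re_eq
      have h2 := hr.im_eq
      rw [← mul_hgt a h ha] at h2
      push_cast at h1 h2
      exact ⟨mul_left_cancel₀ har (by linarith), mul_left_cancel₀ har (by linarith)⟩
  · rintro ⟨n, ν, hn, hd, ⟨C, hC⟩, rfl⟩
    have hn' : (n : ℂ) ≠ 0 := mod_cast hn.ne'
    refine ⟨a * n, a * ν, C, ⟨by positivity, ?_, ?_⟩, ?_, dvd_mul_right _ _⟩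
    · push_cast
      linear_combination -(a : ℤ) * hC
    · rw [← mul_hgt a h ha]
      have h1 := (eq_pt_iff (ν := ν) ha hh hn).mp rfl
      have e : ((pt a h n ν : ℍ) : ℂ) = (pt a h n ν).re + (pt a h n ν).im * Complex.I :=
        (Complex.re_add_im _).symm
      rw [e]
      have h2 : (n : ℂ) * (pt a h n ν).re = ν := mod_cast h1.1
      have h3 : (n : ℂ) * (pt a h n ν).im = hgt a h := mod_cast h1.2
      push_cast
      linear_combination (a : ℂ) * h2 + (a : ℂ) * Complex.I * h3
    · push_cast
      exact mul_dvd_mul_left _ (mod_cast hd)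

/-- Indices `(n, ν)` with `d ∣ n` and `ν` a root modulo `n`. -/
abbrev RootIdx (a h d : ℕ) : Type :=
  {i : ℕ × ℕ // 0 < i.1 ∧ d ∣ i.1 ∧ i.2 ∈ rts a h i.1}

/-- The Heegner points are the translates of those attached to roots `0 ≤ ν < n`. -/
def idxMap (ha : 0 < a) (hh : 0 < h) (i : RootIdx a h d × ℤ) : heeg a h d :=
  ⟨T ^ i.2 • pt a h i.1.1.1 i.1.1.2, (mem_heeg_iff ha hh).mpr ⟨i.1.1.1, i.1.1.2 + i.1.1.1 * i.2,
    i.1.2.1, i.1.2.2.1, by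
      have := (mem_rts.mp i.1.2.2.2).2
      obtain ⟨c, hc⟩ := this
      refine ⟨c + a * (2 * i.1.1.2 * i.2 + i.1.1.1 * i.2 ^ 2), ?_⟩
      linear_combination hc, T_zpow_pt ha hh i.1.2.1 _⟩⟩

lemma bijective_idxMap (ha : 0 < a) (hh : 0 < h) :
    Function.Bijective (idxMap (d := d) ha hh) := by
  constructor
  · rintro ⟨⟨⟨n, ν⟩, hn, hd, hν⟩, m⟩ ⟨⟨⟨n', ν'⟩, hn', hd', hν'⟩, m'⟩ e
    simp only [idxMap, Subtype.mk.injEq, T_zpow_pt ha hh hn, T_zpow_pt ha hh hn'] at e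
    have e1 := (eq_pt_iff ha hh hn').mp e
    rw [pt_re ha hh hn, pt_im ha hh hn] at e1
    have hg := hgt_pos ha hh
    have hnr : (0 : ℝ) < n := mod_cast hn
    have e2 : n' = n := by
      have := e1.2
      rw [mul_div_assoc', div_eq_iff hnr.ne', mul_comm] at this
      exact_mod_cast mul_left_cancel₀ hg.ne' this
    subst e2
    have e3 : (ν : ℤ) + n' * m = ν' + n' * m' := by
      have := e1.1
      rw [mul_div_cancel₀ _ hnr.ne'] at this
      exact_mod_cast this
    have l1 := (mem_rts.mp hν).1
    have l2 := (mem_rts.mp hν').1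
    have e4 : (ν : ℤ) = ν' := by
      have := congrArg (· % (n' : ℤ)) e3
      simp only [Int.add_mul_emod_self_left] at this
      rwa [Int.emod_eq_of_lt (by omega) (mod_cast l1),
        Int.emod_eq_of_lt (by omega) (mod_cast l2)] at this
    have e5 : ν = ν' := mod_cast e4
    subst e5
    have e6 : m = m' := by
      have hnz : (n' : ℤ) ≠ 0 := mod_cast hn.ne'
      exact mul_left_cancel₀ hnz (by linarith)
    subst e6
    rfl
  · rintro ⟨z, hz⟩
    obtain ⟨n, ν, hn, hd, hν, rfl⟩ := (mem_heeg_iff ha hh).mp hz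
    have hnz : (0 : ℤ) < n := mod_cast hn
    have n1 := Int.emod_nonneg ν hnz.ne'
    have n2 := Int.emod_lt_of_pos ν hnz
    have n3 := Int.toNat_of_nonneg n1
    have n4 := Int.emod_add_mul_ediv ν n
    refine ⟨⟨⟨⟨n, (ν % n).toNat⟩, hn, hd, mem_rts.mpr ⟨by simp only; omega, ?_⟩⟩, ν / n⟩, ?_⟩
    · simp only [n3]
      obtain ⟨c, hc⟩ := hν
      refine ⟨c - a * (2 * (ν % n) * (ν / n) + n * (ν / n) ^ 2), ?_⟩
      linear_combination hc - (a : ℤ) * (ν + (ν % n + n * (ν / n))) * (1 : ℤ) * (-(n4))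
    · simp only [idxMap, T_zpow_pt ha hh hn, n3, n4]

lemma countable_heeg (ha : 0 < a) (hh : 0 < h) : Countable (heeg a h d) :=
  (bijective_idxMap ha hh).surjective.countable

lemma finite_heeg_inter (ha : 0 < a) (hh : 0 < h) {K : Set ℍ} (hK : IsCompact K) :
    (heeg a h d ∩ K).Finite := by
  rcases K.eq_empty_or_nonempty with rfl | hne
  · simp
  obtain ⟨z₀, -, hz₀⟩ := hK.exists_isMinOn hne continuous_im.continuousOn
  obtain ⟨R, hR⟩ := hK.exists_bound_of_continuousOn (f := fun z : ℍ => z.re)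
    continuous_re.continuousOn
  have him := z₀.im_pos
  have hg := hgt_pos ha hh
  set Nn := ⌈hgt a h / z₀.im⌉₊
  set M := ⌈(Nn : ℝ) * R⌉
  refine ((Set.finite_Icc 0 Nn).prod (Set.finite_Icc (-M) M)).image
    (fun i : ℕ × ℤ => pt a h i.1 i.2) |>.subset ?_
  rintro z ⟨hz, hzK⟩
  obtain ⟨n, ν, hn, hd, hν, rfl⟩ := (mem_heeg_iff ha hh).mp hz
  have hnr : (0 : ℝ) < n := mod_cast hn
  have h1 := hz₀ hzK
  have h2 := hR _ hzK
  simp only [Set.mem_ofPred_eq, pt_im ha hh hn, pt_re ha hh hn] at h1 h2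
  have h3 : (n : ℝ) ≤ Nn := by
    refine le_trans ?_ (Nat.le_ceil _)
    rw [le_div_iff₀ him]
    rwa [le_div_iff₀ hnr, mul_comm] at h1
  have hR0 : 0 ≤ R := (norm_nonneg _).trans h2
  have h4 : |(ν : ℝ)| ≤ M := by
    refine le_trans ?_ (Int.le_ceil _)
    rw [norm_eq_abs, abs_div, abs_of_pos hnr, div_le_iff₀ hnr] at h2
    nlinarith
  rw [abs_le] at h4
  exact ⟨(n, ν), ⟨⟨Nat.zero_le _, by exact_mod_cast h3⟩, by exact_mod_cast h4.1,
    by exact_mod_cast h4.2⟩, rfl⟩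

end

end

section

open ENNReal Finset

/-- The normalised indicator function of a hyperbolic ball. -/
def bump (r : ℝ) (z u : ℍ) : ℝ :=
  if dist u z ≤ r then (volume.real (Metric.closedBall z r))⁻¹ else 0

variable {r : ℝ}

lemma bump_nonneg (z u : ℍ) : 0 ≤ bump r z u := by
  rw [bump]; split_ifs <;> positivity

lemma bump_eq_indicator (z : ℍ) : bump r z =
    (Metric.closedBall z r).indicator fun _ => (volume.real (Metric.closedBall z r))⁻¹ := by
  funext u
  simp only [bump, Set.indicator_apply, Metric.mem_closedBall]

lemma measurable_bump (z : ℍ) : Measurable (bump r z) := by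
  rw [bump_eq_indicator]
  exact measurable_const.indicator Metric.isClosed_closedBall.measurableSet

lemma volume_closedBall_ne_top (z : ℍ) : volume (Metric.closedBall z r) ≠ ⊤ :=
  (isCompact_closedBall z r).measure_lt_top.ne

lemma le_volume_real (hr : 0 < r) (hr1 : r ≤ 1) (z : ℍ) :
    r ^ 2 / 4 ≤ volume.real (Metric.closedBall z r) :=
  (ofReal_le_iff_le_toReal (volume_closedBall_ne_top z)).mp (le_volume_closedBall z hr hr1)

lemma bump_le (hr : 0 < r) (hr1 : r ≤ 1) (z u : ℍ) : bump r z u ≤ 4 / r ^ 2 := by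
  rw [bump]
  split_ifs
  · have h := le_volume_real hr hr1 z
    rw [show 4 / r ^ 2 = (r ^ 2 / 4)⁻¹ by rw [inv_div]]
    exact inv_anti₀ (by positivity) h
  · positivity

lemma integrable_bump (z : ℍ) : Integrable (bump r z) := by
  rw [bump_eq_indicator]
  exact (integrable_indicator_iff Metric.isClosed_closedBall.measurableSet).mpr
    (integrableOn_const (volume_closedBall_ne_top z))

lemma integral_bump (hr : 0 < r) (hr1 : r ≤ 1) (z : ℍ) : ∫ u, bump r z u = 1 := by
  have h := le_volume_real hr hr1 z
  have h2 : 0 < r ^ 2 / 4 := by positivity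
  rw [bump_eq_indicator, integral_indicator Metric.isClosed_closedBall.measurableSet,
    setIntegral_const, smul_eq_mul, mul_inv_cancel₀ (h2.trans_le h).ne']

lemma lintegral_bump (hr : 0 < r) (hr1 : r ≤ 1) (z : ℍ) :
    ∫⁻ u, ENNReal.ofReal (bump r z u) = 1 := by
  rw [← ofReal_integral_eq_lintegral_ofReal (integrable_bump z)
    (.of_forall fun u => bump_nonneg z u), integral_bump hr hr1, ofReal_one]

lemma bump_smul (g : SL(2, ℤ)) (z u : ℍ) : bump r (g • z) (g • u) = bump r z u := by
  have h : volume.real (Metric.closedBall (g • z) r) = volume.real (Metric.closedBall z r) := by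
    have e := Metric.preimage_smul_closedBall g (g • z) r
    rw [inv_smul_smul] at e
    rw [Measure.real, Measure.real, ← e, measure_preimage_smul]
  rw [bump, bump, dist_smul, h]

section

variable {a h d : ℕ}

/-- The automorphic kernel attached to the Heegner points. -/
def heegSum (a h d : ℕ) (r : ℝ) (u : ℍ) : ℝ := ∑' z : heeg a h d, bump r z u

lemma finite_support_bump (ha : 0 < a) (hh : 0 < h) (u : ℍ) :
    (Function.support fun z : heeg a h d => bump r z u).Finite := by
  refine ((finite_heeg_inter (d := d) ha hh (isCompact_closedBall u r)).preimage
    (Subtype.val_injective (p := fun z => z ∈ heeg a h d)).injOn).subset fun z hz => ⟨z.2, ?_⟩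
  by_contra hcon
  refine hz ?_
  rw [Metric.mem_closedBall, dist_comm] at hcon
  exact if_neg hcon

lemma heegSum_nonneg (u : ℍ) : 0 ≤ heegSum a h d r u := tsum_nonneg fun _ => bump_nonneg _ _

lemma measurable_heegSum (ha : 0 < a) (hh : 0 < h) : Measurable (heegSum a h d r) := by
  have := countable_heeg (d := d) ha hh
  exact Measurable.tsum fun z => measurable_bump _

lemma smul_mem_heeg_iff {g : SL(2, ℤ)} (hg : g ∈ Gamma0 (a * d)) {z : ℍ} :
    g • z ∈ heeg a h d ↔ z ∈ heeg a h d :=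
  ⟨fun hz => by simpa using smul_mem_heeg hz (inv_mem hg), fun hz => smul_mem_heeg hz hg⟩

lemma heegSum_smul (g : Gamma0 (a * d)) (u : ℍ) :
    heegSum a h d r (g • u) = heegSum a h d r u := by
  let e : heeg a h d ≃ heeg a h d := (MulAction.toPerm (g : SL(2, ℤ))).subtypeEquiv
    fun z => (smul_mem_heeg_iff g.2).symm
  rw [heegSum, heegSum, ← e.tsum_eq]
  exact tsum_congr fun z => bump_smul (g : SL(2, ℤ)) _ _

lemma ofReal_heegSum (ha : 0 < a) (hh : 0 < h) (u : ℍ) :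
    ENNReal.ofReal (heegSum a h d r u) = ∑' z : heeg a h d, ENNReal.ofReal (bump r z u) :=
  ENNReal.ofReal_tsum_of_nonneg (fun _ => bump_nonneg _ _)
    (summable_of_hasFiniteSupport (finite_support_bump ha hh u))

/-- Pairs of nearby Heegner points. -/
abbrev NearPair (a h d : ℕ) : Type :=
  {p : ℍ × ℍ // p.1 ∈ heeg a h d ∧ p.2 ∈ heeg a h d ∧ dist p.1 p.2 ≤ 1}

lemma tsum_nearPair_le (ha : a ≠ 0) (hh : Squarefree h) (hd : Squarefree d) (had : a.Coprime d) :
    ∃ P : (((Σ _ : ℤ, ℕ) × (Σ _ : ℤ, ℕ)) × (ZMod (2 * a) × ZMod (2 * a)) × ℕ) → ℍ × ℍ,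
      ∀ F : ℍ × ℍ → ENNReal, ∑' p : NearPair a h d, F p ≤
        ∑ K ∈ pairKeys a h d, ∑' g : Gamma0 (a * d), F (g • (P K).1, g • (P K).2) := by
  choose κ hκ hκ' using fun p : NearPair a h d =>
    exists_isKey ha hd.ne_zero p.2.1 p.2.2.1 p.2.2.2
  let P : (((Σ _ : ℤ, ℕ) × (Σ _ : ℤ, ℕ)) × (ZMod (2 * a) × ZMod (2 * a)) × ℕ) → ℍ × ℍ :=
    fun K => if hK : ∃ p : NearPair a h d, κ p = K then hK.choose.1 else (I, I)
  have hP : ∀ p : NearPair a h d, IsKey a h d (P (κ p)) (κ p) := fun p => by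
    have hK : ∃ p' : NearPair a h d, κ p' = κ p := ⟨p, rfl⟩
    have e := hκ' hK.choose
    rw [hK.choose_spec] at e
    simpa only [P, dif_pos hK] using e
  choose g hg1 hg2 using fun p : NearPair a h d => (hP p).exists_smul hh hd had (hκ' p)
  refine ⟨P, fun F => ?_⟩
  let ι : NearPair a h d → (pairKeys a h d) × Gamma0 (a * d) := fun p => (⟨κ p, hκ p⟩, g p)
  have hι : Function.Injective ι := fun p p' e => by
    simp only [ι, Prod.mk.injEq, Subtype.mk.injEq] at e
    refine Subtype.ext (Prod.ext ?_ ?_)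
    · rw [← hg1 p, ← hg1 p', e.1, e.2]
    · rw [← hg2 p, ← hg2 p', e.1, e.2]
  have h1 := ENNReal.tsum_comp_le_tsum_of_injective hι
    fun k => F (k.2 • (P k.1).1, k.2 • (P k.1).2)
  simp only [ι, hg1, hg2] at h1
  refine h1.trans (le_of_eq ?_)
  rw [ENNReal.tsum_prod (f := fun (K : pairKeys a h d) (g : Gamma0 (a * d)) =>
    F (g • (P K).1, g • (P K).2)), tsum_fintype]
  exact Finset.sum_coe_sort (pairKeys a h d)
    fun K => ∑' g : Gamma0 (a * d), F (g • (P K).1, g • (P K).2)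

lemma lintegral_heegSum_sq_le (ha : 0 < a) (hh : Squarefree h) (hd : Squarefree d)
    (had : a.Coprime d) (hr : 0 < r) (hr1 : 2 * r ≤ 1) {w : ℍ → ℝ}
    (hw : IsWeight (Gamma0 (a * d)) w) :
    ∫⁻ u, ENNReal.ofReal (w u) * ENNReal.ofReal (heegSum a h d r u) ^ 2 ≤
      ENNReal.ofReal (#(pairKeys a h d) * (4 / r ^ 2)) := by
  have hh0 := hh.ne_zero.pos
  obtain ⟨P, hP⟩ := tsum_nearPair_le ha.ne' hh hd had
  let F : ℍ → ℍ × ℍ → ENNReal := fun u p =>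
    ENNReal.ofReal (bump r p.1 u) * ENNReal.ofReal (bump r p.2 u)
  have hFm : ∀ p, Measurable fun u => F u p := fun p =>
    (measurable_bump _).ennreal_ofReal.mul (measurable_bump _).ennreal_ofReal
  have h1 : ∀ u, ENNReal.ofReal (heegSum a h d r u) ^ 2 ≤ ∑' p : NearPair a h d, F u p := by
    intro u
    rw [ofReal_heegSum ha hh0, sq, ← ENNReal.tsum_mul_right]
    simp only [← ENNReal.tsum_mul_left]
    rw [← ENNReal.tsum_prod (f := fun (z : heeg a h d) (z' : heeg a h d) =>
      ENNReal.ofReal (bump r z u) * ENNReal.ofReal (bump r z' u))]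
    have hι : Function.Injective fun p : NearPair a h d =>
        ((⟨p.1.1, p.2.1⟩, ⟨p.1.2, p.2.2.1⟩) : heeg a h d × heeg a h d) := fun p p' e => by
      simp only [Prod.mk.injEq, Subtype.mk.injEq] at e
      exact Subtype.ext (Prod.ext e.1 e.2)
    rw [← hι.tsum_eq]
    rintro ⟨⟨z, hz⟩, ⟨z', hz'⟩⟩ hs
    have hne := Function.mem_support.mp hs
    have b1 : dist u z ≤ r := by
      by_contra hcon
      exact hne (by simp only [bump, if_neg hcon]; simp)
    have b2 : dist u z' ≤ r := by
      by_contra hcon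
      exact hne (by simp only [bump, if_neg hcon]; simp)
    have : dist z z' ≤ 1 := by
      have := dist_triangle z u z'
      rw [dist_comm z u] at this
      linarith
    exact ⟨⟨(z, z'), hz, hz', this⟩, rfl⟩
  have hwm : Measurable fun u => ENNReal.ofReal (w u) := hw.measurable.ennreal_ofReal
  calc _ ≤ ∫⁻ u, ∑ K ∈ pairKeys a h d, ENNReal.ofReal (w u) *
        ∑' g : Gamma0 (a * d), F (g • u) (P K) := by
        refine lintegral_mono fun u => ?_
        rw [← Finset.mul_sum]
        refine mul_le_mul_right ((h1 u).trans ((hP (F u)).trans (le_of_eq ?_))) _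
        refine Finset.sum_congr rfl fun K _ => ?_
        rw [← (Equiv.inv (Gamma0 (a * d))).tsum_eq]
        refine tsum_congr fun g => ?_
        have e : ∀ z : ℍ, bump r ((Equiv.inv (Gamma0 (a * d)) g) • z) u = bump r z (g • u) := by
          intro z
          have := bump_smul (r := r) (g : SL(2, ℤ)) ((Equiv.inv (Gamma0 (a * d)) g) • z) u
          rw [← this]
          congr 1
          exact smul_inv_smul (g : SL(2, ℤ)) z
        simp only [F, e]
    _ = ∑ K ∈ pairKeys a h d, ∫⁻ u, F u (P K) := by
        rw [lintegral_finsetSum]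
        · exact Finset.sum_congr rfl fun K _ => (lintegral_unfold hw (hFm _)).symm
        · exact fun K _ => hwm.mul (Measurable.tsum fun g => (hFm _).comp (measurable_const_smul g))
    _ ≤ ∑ K ∈ pairKeys a h d, ENNReal.ofReal (4 / r ^ 2) := by
        refine Finset.sum_le_sum fun K _ => ?_
        calc _ ≤ ∫⁻ u, ENNReal.ofReal (bump r (P K).1 u) * ENNReal.ofReal (4 / r ^ 2) := by
              refine lintegral_mono fun u => ?_
              exact mul_le_mul_right (ENNReal.ofReal_le_ofReal (bump_le hr (by linarith) _ _)) _
          _ = _ := by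
              rw [lintegral_mul_const _ (measurable_bump _).ennreal_ofReal,
                lintegral_bump hr (by linarith), one_mul]
    _ = _ := by
        rw [sum_const, nsmul_eq_mul, ENNReal.ofReal_mul (by positivity), ENNReal.ofReal_natCast]

end

end

section

open Finset

variable {a h d : ℕ} {r η H : ℝ} {f : ℝ → ℝ} {q : ℤ}

/-- The kernel-smoothed value of a wave. -/
def smoothWave (f : ℝ → ℝ) (q : ℤ) (r : ℝ) (z : ℍ) : ℂ := ∫ u, wave f q u * bump r z u

lemma integrable_wave_mul_bump (hf : IsProfile f η H) (z : ℍ) :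
    Integrable fun u => wave f q u * bump r z u := by
  refine ((integrable_bump z).ofReal (𝕜 := ℂ)).bdd_mul (c := 1)
    hf.measurable_wave.aestronglyMeasurable ?_
  exact .of_forall hf.norm_wave_le

lemma integrable_wave₀_mul_bump (hf : IsProfile f η H) (z : ℍ) :
    Integrable fun u => wave₀ f q u * bump r z u := by
  refine ((integrable_bump z).ofReal (𝕜 := ℂ)).bdd_mul (c := 1)
    hf.measurable_wave₀.aestronglyMeasurable ?_
  exact .of_forall hf.norm_wave₀_le

lemma tsum_integral_translates (hf : IsProfile f η H) (z : ℍ) :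
    HasSum (fun m : ℤ => ∫ u, wave₀ f q u * bump r (T ^ m • z) u) (smoothWave f q r z) := by
  let S : ℤ → Set ℍ := fun m => {u | m = -⌊u.re⌋}
  have hS : ∀ m, MeasurableSet (S m) := fun m =>
    measurableSet_eq_fun measurable_const (Int.measurable_floor.comp continuous_re.measurable).neg
  have hd : Pairwise (Function.onFun Disjoint S) := fun m m' hne =>
    Set.disjoint_left.mpr fun u h1 h2 => hne (h1.trans h2.symm)
  have hU : ⋃ m, S m = Set.univ := Set.eq_univ_of_forall fun u => Set.mem_iUnion.mpr ⟨_, rfl⟩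
  have key := hasSum_integral_iUnion (f := fun u => wave f q u * bump r z u) (μ := volume) hS hd
    (integrable_wave_mul_bump hf z).integrableOn
  rw [hU, setIntegral_univ] at key
  have e : ∀ m, ∫ u, wave₀ f q u * bump r (T ^ m • z) u = ∫ u in S m, wave f q u * bump r z u := by
    intro m
    rw [← integral_indicator (hS m),
      ← (measurePreserving_smul (T ^ m) (volume : Measure ℍ)).integral_comp
        (measurableEmbedding_const_smul (T ^ m))]
    refine integral_congr_ae (.of_forall fun u => ?_)
    simp only [wave₀_T, bump_smul, Set.indicator_apply]
    change (if u ∈ S m then _ else _) * _ = _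
    split_ifs <;> simp
  simp only [e]
  exact key

lemma hasSum_wave₀_heegSum (ha : 0 < a) (hh : 0 < h) (hη : 0 < η) (hf : IsProfile f η H) :
    Integrable (fun u => wave₀ f q u * heegSum a h d r u) ∧
    HasSum (fun i : RootIdx a h d => smoothWave f q r (pt a h i.1.1 i.1.2))
      (∫ u, wave₀ f q u * heegSum a h d r u) := by
  have hc : IsCompact (Metric.cthickening r (hbox η H)) := (isCompact_hbox hη).cthickening
  have hfin : {z : heeg a h d | (z : ℍ) ∈ Metric.cthickening r (hbox η H)}.Finite :=
    ((finite_heeg_inter (d := d) ha hh hc).preimage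
      (Subtype.val_injective (p := fun z => z ∈ heeg a h d)).injOn).subset fun z hz => ⟨z.2, hz⟩
  have hz0 : ∀ z : heeg a h d, z ∉ hfin.toFinset → ∀ u, wave₀ f q u * bump r z u = 0 := by
    intro z hz u
    by_contra hne
    rw [mul_eq_zero, not_or] at hne
    obtain ⟨⟨h1, h2⟩, h3⟩ := hf.of_wave₀_ne_zero hne.1
    have hu : dist u z ≤ r := by
      by_contra hcon
      exact hne.2 (by simp only [bump, if_neg hcon, Complex.ofReal_zero])
    refine hz (hfin.mem_toFinset.mpr ?_)
    refine Metric.mem_cthickening_of_dist_le (z : ℍ) u r _ ⟨⟨h1, h2.le⟩, h3⟩ ?_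
    rwa [dist_comm]
  have e1 : (fun u => wave₀ f q u * heegSum a h d r u)
      = fun u => ∑ z ∈ hfin.toFinset, wave₀ f q u * bump r z u := by
    funext u
    rw [heegSum, Complex.ofReal_tsum, ← tsum_mul_left, tsum_eq_sum]
    exact fun z hz => hz0 z hz u
  have e2 : HasSum (fun z : heeg a h d => ∫ u, wave₀ f q u * bump r z u)
      (∫ u, wave₀ f q u * heegSum a h d r u) := by
    rw [e1, integral_finsetSum _ fun z _ => integrable_wave₀_mul_bump hf _]
    refine hasSum_sum_of_ne_finset_zero fun z hz => ?_
    simp only [hz0 z hz, integral_zero]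
  refine ⟨?_, ?_⟩
  · rw [e1]
    exact integrable_finsetSum _ fun z _ => integrable_wave₀_mul_bump hf _
  · have e3 : HasSum ((fun z : heeg a h d => ∫ u, wave₀ f q u * bump r z u) ∘ idxMap ha hh)
        (∫ u, wave₀ f q u * heegSum a h d r u) :=
      (Equiv.hasSum_iff (Equiv.ofBijective _ (bijective_idxMap (d := d) ha hh))
        (f := fun z : heeg a h d => ∫ u, wave₀ f q u * bump r z u)).mpr e2
    have e4 : ∀ i : RootIdx a h d, HasSum (fun m : ℤ => ((fun z : heeg a h d =>
        ∫ u, wave₀ f q u * bump r z u) ∘ idxMap ha hh) (i, m))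
        (smoothWave f q r (pt a h i.1.1 i.1.2)) := fun i =>
      tsum_integral_translates hf (pt a h i.1.1 i.1.2)
    generalize ((fun z : heeg a h d => ∫ u, wave₀ f q u * bump r z u) ∘ idxMap ha hh) = ψ at e3 e4
    exact e3.prod_fiberwise e4

/-- The smoothed wave has a bound by Cauchy--Schwarz on the modular curve. -/
lemma norm_tsum_smoothWave_sq_le (ha : 0 < a) (hh : Squarefree h) (hd : Squarefree d)
    (had : a.Coprime d) (hη : 0 < η) (hf : IsProfile f η H) (hr : 0 < r) (hr1 : 2 * r ≤ 1) :
    ‖∑' i : RootIdx a h d, smoothWave f q r (pt a h i.1.1 i.1.2)‖ ^ 2 ≤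
      ‖∫ z, wave₀ f q z * starRingEnd ℂ (∑' g : Gamma0 (a * d), wave₀ f q (g • z))‖ *
        (#(pairKeys a h d) * (4 / r ^ 2)) := by
  have hh0 := hh.ne_zero.pos
  obtain ⟨w, hw⟩ := exists_isWeight_Gamma0 (a * d)
  obtain ⟨h1, h2⟩ := hasSum_wave₀_heegSum (d := d) (r := r) (q := q) ha hh0 hη hf
  rw [h2.tsum_eq]
  exact norm_integral_sq_le hw hf.measurable_wave₀ (measurable_heegSum ha hh0) heegSum_nonneg
    heegSum_smul (finite_support_wave₀ hη hf _) h1 (integrable_wave₀_mul_conj_tsum hη hf _)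
    (by positivity) (lintegral_heegSum_sq_le ha hh hd had hr hr1 hw)

end

section

open Finset Real

/-- A Lipschitz cutoff function supported in `(-∞, Y]`. -/
structure IsCutoff (G : ℝ → ℝ) (L Y : ℝ) : Prop where
  abs_le : ∀ s, |G s| ≤ 1
  lip : ∀ s t, |G s - G t| ≤ L * |s - t|
  supp : ∀ s, Y < s → G s = 0

/-- The profile with value `G (ω / y)` at height `y`. -/
def prof (G : ℝ → ℝ) (ω y : ℝ) : ℝ := if 0 < y ∧ 1 / 2 ≤ ω / y then G (ω / y) else 0

variable {G : ℝ → ℝ} {L Y ω : ℝ}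

lemma IsCutoff.nonneg (hG : IsCutoff G L Y) : 0 ≤ L := by
  have := (abs_nonneg _).trans (hG.lip 1 0)
  simpa using this

lemma IsCutoff.measurable (hG : IsCutoff G L Y) : Measurable G := by
  refine (LipschitzWith.of_dist_le_mul (K := ⟨L, hG.nonneg⟩) fun s t => ?_).continuous.measurable
  exact hG.lip s t

lemma IsCutoff.isProfile_prof (hG : IsCutoff G L Y) (hY : 0 < Y) :
    IsProfile (prof G ω) (ω / Y) (2 * ω) where
  measurable := by
    have h1 : Measurable fun y : ℝ => ω / y := measurable_const.div measurable_id
    exact Measurable.ite ((measurableSet_lt measurable_const measurable_id).inter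
      (measurableSet_le measurable_const h1)) (hG.measurable.comp h1) measurable_const
  abs_le y := by
    rw [prof]; split_ifs
    · exact hG.abs_le _
    · simp
  supp y hy := by
    rw [prof] at hy
    split_ifs at hy with h
    · have h2 : ω / y ≤ Y := not_lt.mp fun hcon => hy (hG.supp _ hcon)
      rw [div_le_iff₀ h.1] at h2
      refine ⟨by rw [div_le_iff₀ hY]; linarith, ?_⟩
      have := (le_div_iff₀ h.1).mp h.2
      linarith
    · exact absurd rfl hy

lemma abs_sub_le_of_dist_le {r : ℝ} (hr : 0 < r) (hr1 : r ≤ 1) {u z : ℍ} (h : dist u z ≤ r) :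
    |u.re - z.re| ≤ 2 * r * z.im ∧ |u.im - z.im| ≤ 2 * r * z.im := by
  have h1 := dist_coe_le u z
  have h2 : exp (dist u z) - 1 ≤ 2 * r := by
    have := abs_exp_sub_one_sub_id_le (x := r) (by rw [abs_of_pos hr]; exact hr1)
    have h3 := (abs_le.mp this).2
    have h4 := exp_le_exp.mpr h
    nlinarith
  have h3 : dist (u : ℂ) z ≤ 2 * r * z.im := by nlinarith [z.im_pos]
  rw [Complex.dist_eq] at h3
  exact ⟨(Complex.abs_re_le_norm ((u : ℂ) - z)).trans h3,
    (Complex.abs_im_le_norm ((u : ℂ) - z)).trans h3⟩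

variable {a h n : ℕ} {ν q : ℤ} {r : ℝ}

lemma prof_of_dist_le (ha : 0 < a) (hh : 0 < h) (hn : 0 < n) (hr : 0 < r) (hr1 : r ≤ 1 / 4) {u : ℍ}
    (hu : dist u (pt a h n ν) ≤ r) :
    prof G (hgt a h) u.im = G (hgt a h / u.im) ∧ |hgt a h / u.im - n| ≤ 4 * r * n ∧
      (n : ℝ) ≤ 3 / 2 * (hgt a h / u.im) := by
  have hω := hgt_pos ha hh
  have hn' : (1 : ℝ) ≤ n := mod_cast hn
  obtain ⟨-, h2⟩ := abs_sub_le_of_dist_le hr (by linarith) hu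
  have hz := (pt a h n ν).im_pos
  have him : n * (pt a h n ν).im = hgt a h := ((eq_pt_iff (ν := ν) ha hh hn).mp rfl).2
  set y := (pt a h n ν).im
  have hu0 := u.im_pos
  rw [abs_le] at h2
  have h3 : y ≤ 2 * u.im := by nlinarith
  have h4 : u.im ≤ 3 / 2 * y := by nlinarith
  have h5 : (n : ℝ) ≤ 3 / 2 * (hgt a h / u.im) := by
    rw [← him, mul_div_assoc', le_div_iff₀ hu0]
    nlinarith
  refine ⟨if_pos ⟨hu0, by linarith⟩, ?_, h5⟩
  rw [← him]
  have : n * y / u.im - n = n * ((y - u.im) / u.im) := by field_simp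
  rw [this, abs_mul, Nat.abs_cast, abs_div, abs_of_pos hu0, mul_comm]
  refine mul_le_mul_of_nonneg_right ?_ (by positivity)
  rw [div_le_iff₀ hu0, abs_le]
  constructor <;> nlinarith

lemma smoothWave_eq_zero (hG : IsCutoff G L Y) (ha : 0 < a) (hh : 0 < h) (hn : 0 < n) (hr : 0 < r)
    (hr1 : r ≤ 1 / 4) (hnY : 2 * Y < n) (hY : 0 < Y) :
    smoothWave (prof G (hgt a h)) q r (pt a h n ν) = 0 := by
  rw [smoothWave]
  refine integral_eq_zero_of_ae (.of_forall fun u => ?_)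
  by_cases hu : dist u (pt a h n ν) ≤ r
  · obtain ⟨h1, -, h3⟩ := prof_of_dist_le (G := G) ha hh hn hr hr1 hu
    simp only [wave, h1, hG.supp _ (by linarith : Y < hgt a h / u.im)]
    simp
  · simp [bump, if_neg hu]

lemma norm_smoothWave_sub_le (hG : IsCutoff G L Y) (hY : 0 < Y) (ha : 0 < a) (hh : 0 < h)
    (hn : 0 < n) (hr : 0 < r) (hr1 : r ≤ 1 / 4) :
    ‖smoothWave (prof G (hgt a h)) q r (pt a h n ν) - G n * ee (q * (ν / n))‖ ≤
      r * (4 * L * n + 13 * |(q : ℝ)| * hgt a h / n) := by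
  set z := pt a h n ν with hz
  set B := r * (4 * L * n + 13 * |(q : ℝ)| * hgt a h / n) with hB
  have hω := hgt_pos ha hh
  have hL := hG.nonneg
  have hn' : (0 : ℝ) < n := mod_cast hn
  have hf := hG.isProfile_prof (ω := hgt a h) hY
  have e1 : (G n * ee (q * (ν / n)) : ℂ) = ∫ u, (G n * ee (q * (ν / n)) : ℂ) * bump r z u := by
    rw [integral_const_mul, integral_complex_ofReal, integral_bump hr (by linarith)]; simp
  have hib : Integrable fun u => ((bump r z u : ℝ) : ℂ) := (integrable_bump z).ofReal
  rw [smoothWave, e1, ← integral_sub (integrable_wave_mul_bump hf z) (hib.const_mul _)]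
  calc _ ≤ ∫ u, B * bump r z u := by
        refine norm_integral_le_of_norm_le ((integrable_bump z).const_mul _)
          (.of_forall fun u => ?_)
        rw [← sub_mul, norm_mul, Complex.norm_real, norm_eq_abs, abs_of_nonneg (bump_nonneg _ _)]
        by_cases hu : dist u z ≤ r
        · refine mul_le_mul_of_nonneg_right ?_ (bump_nonneg _ _)
          obtain ⟨h1, h2, -⟩ := prof_of_dist_le (G := G) ha hh hn hr hr1 hu
          have h3 := (abs_sub_le_of_dist_le hr (by linarith) hu).1
          rw [hz, pt_re ha hh hn, pt_im ha hh hn] at h3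
          rw [wave, h1]
          have e2 : (G (hgt a h / u.im) : ℂ) * ee (q * u.re) - G n * ee (q * (ν / n))
            = ((G (hgt a h / u.im) - G n : ℝ) : ℂ) * ee (q * u.re)
              + G n * (ee (q * u.re) - ee (q * (ν / n))) := by push_cast; ring
          rw [e2]
          refine (norm_add_le _ _).trans ?_
          rw [norm_mul, norm_mul, norm_ee, mul_one, Complex.norm_real, Complex.norm_real,
            norm_eq_abs, norm_eq_abs]
          have b1 : |G (hgt a h / u.im) - G n| ≤ L * (4 * r * n) :=
            (hG.lip _ _).trans (mul_le_mul_of_nonneg_left h2 hL)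
          have b2 : ‖ee (q * u.re) - ee (q * (ν / n))‖ ≤ 13 * |(q : ℝ)| * r * (hgt a h / n) := by
            refine (norm_ee_sub_le _ _).trans ?_
            rw [← mul_sub, abs_mul]
            have hpi : 2 * π ≤ 13 / 2 := by linarith [pi_lt_d2]
            calc _ ≤ 13 / 2 * (|(q : ℝ)| * (2 * r * (hgt a h / n))) := by gcongr
              _ = _ := by ring
          have b3 := mul_le_mul (hG.abs_le n) b2 (norm_nonneg _) zero_le_one
          have e3 : B = L * (4 * r * n) + 13 * |(q : ℝ)| * r * (hgt a h / n) := by rw [hB]; ring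
          rw [e3]
          linarith
        · simp [bump, if_neg hu]
    _ = B := by rw [integral_const_mul, integral_bump hr (by linarith), mul_one]

/-- The Weyl sum of level `d` with a smooth cutoff. -/
def weylSum (a h d : ℕ) (q : ℤ) (G : ℝ → ℝ) (N : ℕ) : ℂ :=
  ∑ n ∈ (Icc 1 N).filter (d ∣ ·), ∑ ν ∈ rts a h n, (G n : ℂ) * ee (q * (ν / n))

lemma tsum_smoothWave_eq {d N : ℕ} (hG : IsCutoff G L Y) (ha : 0 < a) (hh : 0 < h) (hr : 0 < r)
    (hr1 : r ≤ 1 / 4) (hY : 0 < Y) (hN : 2 * Y ≤ N) :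
    ∑' i : RootIdx a h d, smoothWave (prof G (hgt a h)) q r (pt a h i.1.1 i.1.2) =
      ∑ n ∈ (Icc 1 N).filter (d ∣ ·), ∑ ν ∈ rts a h n,
        smoothWave (prof G (hgt a h)) q r (pt a h n ν) := by
  let S : Finset (ℕ × ℕ) := (Icc 1 N ×ˢ range N).filter
    fun i => d ∣ i.1 ∧ i.2 ∈ rts a h i.1
  rw [← sum_finset_product (f := fun i : ℕ × ℕ =>
    smoothWave (prof G (hgt a h)) q r (pt a h i.1 i.2)) S]
  · change ∑' i : {i : ℕ × ℕ | 0 < i.1 ∧ d ∣ i.1 ∧ i.2 ∈ rts a h i.1},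
      (fun i : ℕ × ℕ => smoothWave (prof G (hgt a h)) q r (pt a h i.1 i.2)) i = _
    refine (tsum_subtype {i : ℕ × ℕ | 0 < i.1 ∧ d ∣ i.1 ∧ i.2 ∈ rts a h i.1} (fun i : ℕ × ℕ =>
      smoothWave (prof G (hgt a h)) q r (pt a h i.1 i.2))).trans ?_
    rw [tsum_eq_sum (s := S)]
    · refine sum_congr rfl fun i hi => Set.indicator_of_mem ?_ _
      rw [mem_filter, mem_product, mem_Icc] at hi
      exact ⟨hi.1.1.1, hi.2⟩
    · intro i hi
      by_cases hm : i ∈ {i : ℕ × ℕ | 0 < i.1 ∧ d ∣ i.1 ∧ i.2 ∈ rts a h i.1}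
      · rw [Set.indicator_of_mem hm]
        obtain ⟨h1, h2, h3⟩ := hm
        refine smoothWave_eq_zero hG ha hh h1 hr hr1 ?_ hY
        by_contra hcon
        have h4 : i.1 ≤ N := mod_cast (not_lt.mp hcon).trans hN
        have h5 := (mem_rts.mp h3).1
        exact hi (mem_filter.mpr ⟨mem_product.mpr ⟨mem_Icc.mpr ⟨h1, h4⟩,
          mem_range.mpr (by omega)⟩, h2, h3⟩)
      · exact Set.indicator_of_notMem hm _
  · intro p
    simp only [S, mem_filter, mem_product, mem_Icc, mem_range]
    constructor
    · rintro ⟨⟨h1, h2⟩, h3, h4⟩; exact ⟨⟨h1, h3⟩, h4⟩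
    · rintro ⟨⟨h1, h3⟩, h4⟩
      exact ⟨⟨h1, by have := (mem_rts.mp h4).1; omega⟩, h3, h4⟩

end

section

open Finset Real

/-- The number `U` dominates `a`, the logarithm of `Z` and the divisor function up to `Z`. -/
structure IsScale (a h Z : ℕ) (U : ℝ) : Prop where
  pos : 0 < a
  sqf : Squarefree h
  coprime : Int.gcd a h = 1
  le : (a : ℝ) ≤ U
  log_le : 1 + log Z ≤ U
  tau_le : ∀ n : ℕ, n ≠ 0 → n ≤ Z → (tau n : ℝ) ≤ U
  disc_le : 37 * (a * h) ^ 2 ≤ Z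

variable {a h Z N d : ℕ} {U L Y r : ℝ} {G : ℝ → ℝ} {q : ℤ}

namespace IsScale

lemma pos' (H : IsScale a h Z U) : 0 < h := H.sqf.ne_zero.pos

lemma one_le (H : IsScale a h Z U) : 1 ≤ U :=
  (mod_cast H.pos : (1 : ℝ) ≤ a).trans H.le

lemma inv_hgt_le (H : IsScale a h Z U) : 1 / hgt a h ≤ U := by
  have h1 := mul_hgt a h H.pos
  have h2 : (1 : ℝ) ≤ √((a * h : ℕ) : ℝ) := by
    rw [one_le_sqrt]
    exact_mod_cast Nat.mul_pos H.pos H.pos'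
  rw [div_le_iff₀ (hgt_pos H.pos H.pos')]
  calc 1 ≤ a * hgt a h := by rw [h1]; exact h2
    _ ≤ _ := mul_le_mul_of_nonneg_right H.le (hgt_pos H.pos H.pos').le

lemma norm_weylSum_sub_tsum_le (H : IsScale a h Z U) (hd : 0 < d) (hG : IsCutoff G L Y) (hY : 1 ≤ Y)
    (hN : 2 * Y ≤ N) (hN3 : N ≤ 3 * Y) (hNZ : N ≤ Z) (hL : L * Y ≤ U) (hq : |(q : ℝ)| * hgt a h ≤ Y)
    (hr : 0 < r) (hr1 : r ≤ 1 / 4) :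
    ‖weylSum a h d q G N -
      ∑' i : RootIdx a h d, smoothWave (prof G (hgt a h)) q r (pt a h i.1.1 i.1.2)‖ ≤
      200 * U ^ 2 * r * Y / d := by
  have hU := H.one_le
  have hY0 : 0 < Y := by linarith
  have hω := hgt_pos H.pos H.pos'
  have hL0 := hG.nonneg
  have hd' : (0 : ℝ) < d := mod_cast hd
  rw [tsum_smoothWave_eq hG H.pos H.pos' hr hr1 hY0 hN, weylSum, ← sum_sub_distrib]
  have hN1 : 1 ≤ N := by
    have : (1 : ℝ) ≤ N := by linarith
    exact_mod_cast this
  have step (n : ℕ) (hn : n ∈ (Icc 1 N).filter (d ∣ ·)) :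
      ‖∑ ν ∈ rts a h n, (G n : ℂ) * ee (q * (ν / n)) -
        ∑ ν ∈ rts a h n, smoothWave (prof G (hgt a h)) q r (pt a h n ν)‖ ≤
      4 * U * r * (4 * L * n + 13 * |(q : ℝ)| * hgt a h / n) := by
    rw [mem_filter, mem_Icc] at hn
    rw [← sum_sub_distrib]
    refine (norm_sum_le_of_le _ (f := fun ν : ℕ => _)
      (n := fun _ => r * (4 * L * n + 13 * |(q : ℝ)| * hgt a h / n)) fun ν _ => ?_).trans ?_
    · rw [norm_sub_rev]
      have h1 := norm_smoothWave_sub_le (q := q) (n := n) (ν := (ν : ℤ)) hG hY0 H.pos H.pos'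
        (by omega) hr hr1
      simpa only [Int.cast_natCast] using h1
    · rw [sum_const, nsmul_eq_mul]
      have h1 : (#(rts a h n) : ℝ) ≤ 4 * U := by
        have h2 := card_rts_le (a := a) (h := h) (n := n) (mod_cast H.pos)
          (Int.squarefree_natCast.mpr H.sqf) (by simpa using H.coprime) (by omega)
        have h3 := H.tau_le n (by omega) (by omega)
        calc (#(rts a h n) : ℝ) ≤ ((4 * tau n : ℕ) : ℝ) := mod_cast h2
          _ ≤ _ := by push_cast; linarith
      have h4 : 0 ≤ r * (4 * L * n + 13 * |(q : ℝ)| * hgt a h / n) := by positivity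
      calc _ ≤ 4 * U * (r * (4 * L * n + 13 * |(q : ℝ)| * hgt a h / n)) :=
            mul_le_mul_of_nonneg_right h1 h4
        _ = _ := by ring
  refine (norm_sum_le_of_le _ step).trans ?_
  rw [← mul_sum, sum_filter_dvd hd]
  have hM : ((N / d : ℕ) : ℝ) ≤ N / d := Nat.cast_div_le
  have s1 : ∑ m ∈ Icc 1 (N / d), 4 * L * ((d * m : ℕ) : ℝ) ≤ 36 * U * Y / d := by
    calc _ ≤ ∑ m ∈ Icc 1 (N / d), 4 * L * N := by
          refine sum_le_sum fun m hm => ?_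
          have : d * m ≤ N := by
            rw [mem_Icc] at hm
            exact (Nat.mul_le_mul_left d hm.2).trans (Nat.mul_div_le N d)
          gcongr
      _ = ((N / d : ℕ) : ℝ) * (4 * L * N) := by simp
      _ ≤ (3 * Y / d) * (4 * L * (3 * Y)) := by
          refine mul_le_mul (hM.trans ?_) (by gcongr) (by positivity) (by positivity)
          gcongr
      _ = 36 * (L * Y) * Y / d := by ring
      _ ≤ _ := by gcongr
  have s2 : ∑ m ∈ Icc 1 (N / d), 13 * |(q : ℝ)| * hgt a h / ((d * m : ℕ) : ℝ) ≤
      13 * U * Y / d := by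
    calc _ = (13 * (|(q : ℝ)| * hgt a h) / d) * ∑ m ∈ Icc 1 (N / d), (1 : ℝ) / m := by
          rw [mul_sum]
          refine sum_congr rfl fun m hm => ?_
          rw [mem_Icc] at hm
          have : (m : ℝ) ≠ 0 := mod_cast (by omega : m ≠ 0)
          push_cast; field_simp
      _ ≤ (13 * Y / d) * U := by
          refine mul_le_mul (by gcongr) ?_ (sum_nonneg fun _ _ => by positivity)
            (by positivity)
          refine (sum_inv_le _).trans (le_trans ?_ H.log_le)
          rcases Nat.eq_zero_or_pos (N / d) with h0 | h0
          · rw [h0]; simpa using log_natCast_nonneg Z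
          · have : N / d ≤ Z := (Nat.div_le_self N d).trans hNZ
            gcongr
      _ = _ := by ring
  rw [sum_add_distrib]
  calc _ ≤ 4 * U * r * (36 * U * Y / d + 13 * U * Y / d) := by gcongr
    _ = 196 * (U ^ 2 * r * Y / d) := by ring
    _ ≤ 200 * (U ^ 2 * r * Y / d) := by gcongr; norm_num
    _ = _ := by ring

lemma norm_poincare_le (H : IsScale a h Z U) (hd : Squarefree d) (had : a.Coprime d)
    (hG : IsCutoff G L Y) (hY : 1 ≤ Y) (hq : q ≠ 0) (hqZ : a * q.natAbs * Y ≤ Z)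
    (hdq : (d.gcd q.natAbs : ℝ) ≤ U) :
    ‖∫ z, wave₀ (prof G (hgt a h)) q z *
      starRingEnd ℂ (∑' g : Gamma0 (a * d), wave₀ (prof G (hgt a h)) q (g • z))‖ ≤
      2 * (Y / hgt a h) * (1 + 8 * U ^ 5 * √(Y / hgt a h) / d) := by
  have hU := H.one_le
  have hY0 : 0 < Y := by linarith
  have hω := hgt_pos H.pos H.pos'
  have hd0 := hd.ne_zero.pos
  have hd' : (0 : ℝ) < d := mod_cast hd0
  have ha' : (1 : ℝ) ≤ a := mod_cast H.pos
  set ω := hgt a h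
  set V := Y / ω with hV
  have hV0 : 0 < V := by positivity
  have hη : ω / Y = 1 / V := by rw [hV, one_div_div]
  set M := ⌊V / ((a * d : ℕ) : ℝ)⌋₊ with hM
  have hN0 : (0 : ℝ) < ((a * d : ℕ) : ℝ) := mod_cast Nat.mul_pos H.pos hd0
  have hMle : (M : ℝ) ≤ V / ((a * d : ℕ) : ℝ) := Nat.floor_le (by positivity)
  have hMV : a * d * (M : ℝ) ≤ V := by
    rw [le_div_iff₀ hN0] at hMle; push_cast at hMle; linarith
  have hVa : V ≤ a * Y := by
    have h1 : 1 ≤ a * ω := by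
      rw [mul_hgt a h H.pos, one_le_sqrt]
      exact_mod_cast Nat.mul_pos H.pos H.pos'
    rw [hV, div_le_iff₀ hω]
    calc Y = 1 * Y := (one_mul _).symm
      _ ≤ (a * ω) * Y := by gcongr
      _ = _ := by ring
  have hq1 : 1 ≤ q.natAbs := Int.natAbs_pos.mpr hq
  have hq1' : (1 : ℝ) ≤ q.natAbs := mod_cast hq1
  have hMZ : a * d * q.natAbs * M ≤ Z := by
    have : (a * d * q.natAbs * M : ℝ) ≤ Z := by
      calc (a * d * q.natAbs * M : ℝ) = q.natAbs * (a * d * M) := by ring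
        _ ≤ q.natAbs * (a * Y) := mul_le_mul_of_nonneg_left (hMV.trans hVa) (by positivity)
        _ ≤ _ := by linarith
    exact_mod_cast this
  have hMZ' : M ≤ Z := by
    refine le_trans ?_ hMZ
    exact Nat.le_mul_of_pos_left _ (Nat.mul_pos (Nat.mul_pos H.pos hd0) hq1)
  have hmain := RootEquidist.norm_poincare_le (q := q) (η := ω / Y) (H := 2 * ω) (by positivity)
    (hG.isProfile_prof hY0) (N := a * d) (Nat.mul_pos H.pos hd0) (M := M) (by
      have := Nat.lt_floor_add_one (V / ((a * d : ℕ) : ℝ))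
      rw [← hM, div_lt_iff₀ hN0] at this
      rw [hη, ← div_eq_mul_one_div, one_lt_div hV0]
      linarith)
  refine hmain.trans ?_
  have hk := sum_norm_klo_le hq H.pos.ne' hd had.symm M (T := U)
    (fun n h0 hn => H.tau_le n h0 (hn.trans hMZ))
  have hlog : 1 + log M ≤ U := by
    refine le_trans ?_ H.log_le
    rcases Nat.eq_zero_or_pos M with h0 | h0
    · rw [h0]; simpa using log_natCast_nonneg Z
    · gcongr
  have hlog0 := log_natCast_nonneg M
  have hs : √(M : ℝ) * √((d.gcd q.natAbs : ℕ) / (d : ℝ)) ≤ U * √V / d := by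
    rw [← sqrt_mul (by positivity)]
    refine sqrt_le_iff.mpr ⟨by positivity, ?_⟩
    rw [div_pow, mul_pow, sq_sqrt hV0.le]
    calc _ = (d * M) * (d.gcd q.natAbs : ℕ) / (d : ℝ) ^ 2 := by
          field_simp
      _ ≤ V * U / (d : ℝ) ^ 2 := by
          have : d * (M : ℝ) ≤ V := by
            refine le_trans ?_ hMV
            rw [mul_assoc]
            exact le_mul_of_one_le_left (by positivity) ha'
          gcongr
      _ ≤ U ^ 2 * V / (d : ℝ) ^ 2 := by
          rw [mul_comm V U]
          have : U ≤ U ^ 2 := by nlinarith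
          gcongr
  have hk2 : ∑ j ∈ Icc 1 M, ‖klo q (a * d * j)‖ / ((a * d * j : ℕ) : ℝ) ≤
      2 * U ^ 5 * √V / d := by
    refine hk.trans ?_
    calc _ = U ^ 3 * (1 + log M) * 2 * (√(M : ℝ) * √((d.gcd q.natAbs : ℕ) / (d : ℝ))) := by
          ring
      _ ≤ U ^ 3 * U * 2 * (U * √V / d) := by gcongr
      _ = _ := by ring
  rw [hη, div_div_eq_mul_div, div_div_eq_mul_div, div_one, div_one]
  calc _ ≤ 2 * V + 8 * V * (2 * U ^ 5 * √V / d) := by gcongr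
    _ = _ := by ring

/-- The smoothed sum at a single level, in terms of the number of pairs. -/
lemma norm_weylSum_le (H : IsScale a h Z U) (hd : Squarefree d) (had : a.Coprime d)
    (hG : IsCutoff G L Y) (hY : 1 ≤ Y) (hN : 2 * Y ≤ N) (hN3 : N ≤ 3 * Y) (hNZ : N ≤ Z)
    (hL : L * Y ≤ U) (hq0 : q ≠ 0) (hqZ : a * q.natAbs * Y ≤ Z)
    (hdq : (d.gcd q.natAbs : ℝ) ≤ U) (hq : |(q : ℝ)| * hgt a h ≤ Y)
    (hr : 0 < r) (hr1 : r ≤ 1 / 4) :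
    ‖weylSum a h d q G N‖ ≤ 200 * U ^ 2 * r * Y / d +
      2 / r * √(2 * (Y / hgt a h) * (1 + 8 * U ^ 5 * √(Y / hgt a h) / d)) *
        √(pairKeys a h d).card := by
  have hY0 : 0 < Y := by linarith
  have hω := hgt_pos H.pos H.pos'
  have h1 := H.norm_weylSum_sub_tsum_le (Nat.pos_of_ne_zero hd.ne_zero) hG hY hN hN3 hNZ hL hq hr
    hr1
  have h2 := norm_tsum_smoothWave_sq_le (q := q) H.pos H.sqf hd had (div_pos hω hY0)
    (hG.isProfile_prof (ω := hgt a h) hY0) hr (by linarith)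
  have h3 := H.norm_poincare_le hd had hG hY hq0 hqZ hdq
  set E := ∑' i : RootIdx a h d, smoothWave (prof G (hgt a h)) q r (pt a h i.1.1 i.1.2)
  have h4 : ‖E‖ ≤ 2 / r * √(2 * (Y / hgt a h) * (1 + 8 * U ^ 5 * √(Y / hgt a h) / d)) *
        √(pairKeys a h d).card := by
    have hU := H.one_le
    refine abs_le_of_sq_le_sq' (h2.trans ?_) (by positivity) |>.2
    rw [mul_pow, mul_pow, sq_sqrt (by positivity), sq_sqrt (by positivity)]
    calc _ ≤ 2 * (Y / hgt a h) * (1 + 8 * U ^ 5 * √(Y / hgt a h) / d) *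
          (#(pairKeys a h d) * (4 / r ^ 2)) := by gcongr
      _ = _ := by rw [div_pow]; ring
  calc _ = ‖(weylSum a h d q G N - E) + E‖ := by rw [sub_add_cancel]
    _ ≤ _ := (norm_add_le _ _).trans (add_le_add h1 h4)

/-- The smoothed sums on average over distinct levels. -/
lemma sum_norm_weylSum_le (H : IsScale a h Z U) {ι : Type*} (I : Finset ι) {δ : ι → ℕ}
    {k : ι → ℤ} {g : ι → ℝ → ℝ} {Δ : ℝ} (hΔ : 0 < Δ) (hinj : Set.InjOn δ I)
    (hδ : ∀ i ∈ I, Squarefree (δ i) ∧ a.Coprime (δ i) ∧ Δ ≤ δ i ∧ δ i ≤ Z)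
    (hg : ∀ i ∈ I, IsCutoff (g i) L Y) (hY : 1 ≤ Y) (hN : 2 * Y ≤ N) (hN3 : N ≤ 3 * Y)
    (hNZ : N ≤ Z) (hL : L * Y ≤ U)
    (hk : ∀ i ∈ I, k i ≠ 0 ∧ a * (k i).natAbs * Y ≤ Z ∧ ((δ i).gcd (k i).natAbs : ℝ) ≤ U ∧
      |(k i : ℝ)| * hgt a h ≤ Y) (hr : 0 < r) (hr1 : r ≤ 1 / 4) :
    ∑ i ∈ I, ‖weylSum a h (δ i) (k i) (g i) N‖ ≤ 200 * U ^ 2 * r * Y * #I / Δ +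
      416 * U ^ 7 / r *
        √(Y * I.card * (1 + √(Y / hgt a h) / Δ) * (I.card + hgt a h)) := by
  have hU := H.one_le
  have hω := hgt_pos H.pos H.pos'
  set ω := hgt a h with hωdef
  set V := Y / ω with hV
  have hVω : V * ω = Y := by rw [hV]; field_simp
  have hV0 : 0 < V := by positivity
  set P := 2 * V * (1 + 8 * U ^ 5 * √V / Δ) with hP
  have h1 : ∀ i ∈ I, ‖weylSum a h (δ i) (k i) (g i) N‖ ≤ 200 * U ^ 2 * r * Y / Δ +
      2 / r * √P * √(pairKeys a h (δ i)).card := by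
    intro i hi
    obtain ⟨d1, d2, d3, d4⟩ := hδ i hi
    obtain ⟨k1, k2, k3, k4⟩ := hk i hi
    refine (H.norm_weylSum_le d1 d2 (hg i hi) hY hN hN3 hNZ hL k1 k2 k3 k4 hr hr1).trans ?_
    rw [hP]
    gcongr
  have hcard : ∑ i ∈ I, (#(pairKeys a h (δ i)) : ℝ) ≤
      2704 * U ^ 9 * (ω * (#I + ω)) := by
    have hT : (⌊U⌋₊ : ℝ) ≤ U := Nat.floor_le (by linarith)
    have h2 := sum_card_pairKeys_le (a := a) (h := h) (T := ⌊U⌋₊) (Z := Z) H.pos.ne' H.sqf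
      (fun n h0 hn => Nat.le_floor (H.tau_le n h0 hn)) H.disc_le (I.image δ) (by
        intro d hd
        obtain ⟨i, hi, rfl⟩ := mem_image.mp hd
        exact ⟨(hδ i hi).1.ne_zero, (hδ i hi).2.2.2⟩)
    rw [sum_image hinj, card_image_of_injOn hinj] at h2
    refine h2.trans ?_
    have e1 : √((a : ℝ) * h) = a * ω := by rw [mul_hgt a h H.pos]; push_cast; rfl
    have e2 : ((a : ℝ) * h) = (a * ω) ^ 2 := by
      rw [← e1, sq_sqrt (by positivity)]
    rw [e1, e2]
    have haU := H.le
    calc _ ≤ 16 * U ^ 3 * U * (13 * (U * ω) * U * #I + 169 * (U * ω) ^ 2 * U ^ 3) := by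
          gcongr
      _ = 208 * (U ^ 6 * (ω * #I)) + 2704 * (U ^ 9 * ω ^ 2) := by ring
      _ ≤ 2704 * (U ^ 9 * (ω * #I)) + 2704 * (U ^ 9 * ω ^ 2) := by
          have : U ^ 6 ≤ U ^ 9 := pow_le_pow_right₀ hU (by norm_num)
          gcongr; norm_num
      _ = _ := by ring
  have hsq : ∑ i ∈ I, √(#(pairKeys a h (δ i)) : ℝ) ≤
      √(#I) * √(2704 * U ^ 9 * (ω * (#I + ω))) := by
    have h3 := sum_sqrt_mul_sqrt_le I (f := fun _ => 1)
      (g := fun i => (#(pairKeys a h (δ i)) : ℝ)) (fun _ => zero_le_one)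
      (fun _ => Nat.cast_nonneg _)
    simp only [sqrt_one, one_mul, sum_const, nsmul_eq_mul, mul_one] at h3
    exact h3.trans (by gcongr)
  refine (sum_le_sum h1).trans ?_
  rw [sum_add_distrib, sum_const, nsmul_eq_mul, ← mul_sum]
  refine add_le_add (le_of_eq (by ring)) ?_
  have key : √P * (√(#I) * √(2704 * U ^ 9 * (ω * (#I + ω)))) ≤
      208 * U ^ 7 * √(Y * #I * (1 + √V / Δ) * (#I + ω)) := by
    rw [← sqrt_mul (by positivity), ← sqrt_mul (by positivity)]
    refine sqrt_le_iff.mpr ⟨by positivity, ?_⟩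
    rw [mul_pow, sq_sqrt (by positivity)]
    have hb : 1 + 8 * U ^ 5 * √V / Δ ≤ 8 * U ^ 5 * (1 + √V / Δ) := by
      have : 1 ≤ U ^ 5 := one_le_pow₀ hU
      rw [mul_add, mul_one, mul_div_assoc]
      gcongr
      linarith
    calc P * (#I * (2704 * U ^ 9 * (ω * (#I + ω))))
        = 5408 * U ^ 9 * (V * ω) * #I * (#I + ω) * (1 + 8 * U ^ 5 * √V / Δ) := by
          rw [hP]; ring
      _ ≤ 5408 * U ^ 9 * Y * #I * (#I + ω) * (8 * U ^ 5 * (1 + √V / Δ)) := by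
          rw [hVω]; gcongr
      _ = _ := by ring
  calc _ ≤ 2 / r * √P * (√(#I) * √(2704 * U ^ 9 * (ω * (#I + ω)))) := by gcongr
    _ = 2 / r * (√P * (√(#I) * √(2704 * U ^ 9 * (ω * (#I + ω))))) := by ring
    _ ≤ 2 / r * (208 * U ^ 7 * √(Y * #I * (1 + √V / Δ) * (#I + ω))) := by gcongr
    _ = _ := by ring

end IsScale

end

end

section

open Finset

section

/-- The exponential sum over the roots of `a ν² + h` modulo `n`. -/
def rootSum (a h : ℕ) (k : ℤ) (n : ℕ) : ℂ := ∑ ν ∈ rts a h n, ee (k * (ν / n))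

/-- The part of `rootSum a h k (r * M)` coming from the roots congruent to `l` modulo `M`. -/
def classSum (a h : ℕ) (k : ℤ) (r M l : ℕ) : ℂ :=
  ∑ ν ∈ (rts a h (r * M)).filter (· % M = l), ee (k * (ν / (r * M : ℕ)))

variable {a h : ℕ} {k : ℤ}

lemma mod_mem_rts {n m ν : ℕ} (hm : 0 < m) (hmn : m ∣ n) (hν : ν ∈ rts a h n) :
    ν % m ∈ rts a h m := by
  rw [mem_rts] at hν ⊢
  refine ⟨Nat.mod_lt _ hm, ?_⟩
  have h1 : (m : ℤ) ∣ (a : ℤ) * (ν : ℤ) ^ 2 + h := (Int.natCast_dvd_natCast.mpr hmn).trans hν.2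
  have h2 : ((ν % m : ℕ) : ℤ) ≡ ν [ZMOD m] := by
    rw [Int.natCast_mod]; exact Int.mod_modEq _ _
  exact (Int.ModEq.dvd_iff ((h2.pow 2).mul_left _ |>.add_right _)).mpr h1

lemma rootSum_mul_eq {r M : ℕ} (hM : 0 < M) :
    rootSum a h k (r * M) = ∑ l ∈ rts a h M, classSum a h k r M l := by
  rw [rootSum, ← sum_fiberwise_of_maps_to (t := rts a h M) (g := (· % M))
    fun ν hν => mod_mem_rts hM (dvd_mul_left M r) hν]
  rfl

lemma ee_mod {n ν : ℕ} (hn : 0 < n) : ee (k * ((ν % n : ℕ) / n)) = ee (k * (ν / n)) := by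
  have hn' : (n : ℝ) ≠ 0 := mod_cast hn.ne'
  have h1 : (ν : ℝ) = (ν % n : ℕ) + n * (ν / n : ℕ) := mod_cast (Nat.mod_add_div ν n).symm
  have h2 : (k : ℝ) * (ν / n) = k * ((ν % n : ℕ) / n) + ((k * ((ν / n : ℕ) : ℤ) : ℤ) : ℝ) := by
    rw [h1, Int.cast_mul, Int.cast_natCast]; field_simp
  rw [h2, ee_add, ee_int, mul_one]

lemma sum_classSum_mul_conj {r s M : ℕ} (hM : 0 < M) (hr : 0 < r) (hs : 0 < s) (hrs : r.Coprime s) :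
    ∑ l ∈ rts a h M, classSum a h k r M l * starRingEnd ℂ (classSum a h k s M l) =
      rootSum a h (k * (s - r)) (r * s * M) := by
  have hrM : 0 < r * M := Nat.mul_pos hr hM
  have hsM : 0 < s * M := Nat.mul_pos hs hM
  have hlcm : (r * M).lcm (s * M) = r * s * M := by
    rw [Nat.lcm_mul_right, hrs.lcm_eq_mul]
  have d1 : r * M ∣ r * s * M := ⟨s, by ring⟩
  have d2 : s * M ∣ r * s * M := ⟨r, by ring⟩
  simp only [classSum, map_sum, sum_mul_sum, ← sum_product']
  rw [sum_sigma', rootSum]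
  symm
  refine sum_bij (fun ν _ => (⟨ν % M, (ν % (r * M), ν % (s * M))⟩ : (_ : ℕ) × (ℕ × ℕ)))
    ?_ ?_ ?_ ?_
  · intro ν hν
    simp only [mem_sigma, mem_product, mem_filter]
    exact ⟨mod_mem_rts hM (dvd_mul_left _ _) hν,
      ⟨mod_mem_rts hrM d1 hν, Nat.mod_mul_left_mod _ _ _⟩,
      mod_mem_rts hsM d2 hν, Nat.mod_mul_left_mod _ _ _⟩
  · intro ν hν ν' hν' heq
    simp only [Sigma.mk.injEq, heq_eq_eq, Prod.mk.injEq] at heq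
    have h1 : ν ≡ ν' [MOD r * s * M] := by
      rw [Nat.modEq_iff_dvd, ← hlcm, Int.natCast_dvd]
      exact Nat.lcm_dvd (Int.natCast_dvd.mp (Nat.modEq_iff_dvd.mp heq.2.1))
        (Int.natCast_dvd.mp (Nat.modEq_iff_dvd.mp heq.2.2))
    exact Nat.ModEq.eq_of_lt_of_lt h1 (mem_rts.mp hν).1 (mem_rts.mp hν').1
  · rintro ⟨l, ν₁, ν₂⟩ hx
    simp only [mem_sigma, mem_product, mem_filter] at hx
    obtain ⟨-, ⟨h1, e1⟩, h2, e2⟩ := hx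
    have hgcd : ν₁ ≡ ν₂ [MOD (r * M).gcd (s * M)] := by
      rw [Nat.gcd_mul_right, hrs.gcd_eq_one, one_mul]; exact e1.trans e2.symm
    obtain ⟨x, hx1, hx2⟩ := Nat.chineseRemainder' hgcd
    have b1 : x % (r * s * M) % (r * M) = ν₁ := by
      rw [Nat.mod_mod_of_dvd _ d1, hx1, Nat.mod_eq_of_lt (mem_rts.mp h1).1]
    have b2 : x % (r * s * M) % (s * M) = ν₂ := by
      rw [Nat.mod_mod_of_dvd _ d2, hx2, Nat.mod_eq_of_lt (mem_rts.mp h2).1]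
    have b3 : x % (r * s * M) % M = l := by
      rw [← e1, ← b1]; simp only [Nat.mod_mul_left_mod]
    refine ⟨x % (r * s * M), ?_, by rw [b1, b2, b3]⟩
    have key {n ν : ℕ} (hν : ν ∈ rts a h n) (hx : x ≡ ν [MOD n]) :
        (n : ℤ) ∣ (a : ℤ) * (x : ℤ) ^ 2 + h := by
      have h3 : (x : ℤ) ≡ ν [ZMOD n] := Int.natCast_modEq_iff.mpr hx
      exact (Int.ModEq.dvd_iff ((h3.pow 2).mul_left _ |>.add_right _)).mpr (mem_rts.mp hν).2
    have k1 := Int.natCast_dvd.mp (key h1 hx1)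
    have k2 := Int.natCast_dvd.mp (key h2 hx2)
    have k3 := Nat.lcm_dvd k1 k2
    rw [hlcm] at k3
    have hpos : 0 < r * s * M := by positivity
    rw [mem_rts]
    refine ⟨Nat.mod_lt _ hpos, ?_⟩
    have h4 : ((x % (r * s * M) : ℕ) : ℤ) ≡ x [ZMOD (r * s * M : ℕ)] := by
      rw [Int.natCast_mod]; exact Int.mod_modEq _ _
    exact (Int.ModEq.dvd_iff ((h4.pow 2).mul_left _ |>.add_right _)).mpr (Int.natCast_dvd.mpr k3)
  · intro ν _
    have hr' : (r : ℝ) ≠ 0 := mod_cast hr.ne'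
    have hs' : (s : ℝ) ≠ 0 := mod_cast hs.ne'
    have hM' : (M : ℝ) ≠ 0 := mod_cast hM.ne'
    change _ = ee (k * ((ν % (r * M) : ℕ) / (r * M : ℕ))) *
      starRingEnd ℂ (ee (k * ((ν % (s * M) : ℕ) / (s * M : ℕ))))
    rw [ee_mod hrM, ee_mod hsM, conj_ee, ← ee_add]
    congr 1
    push_cast
    field_simp
    ring

end

section

open Real Complex

variable {a h : ℕ} {k : ℤ}

lemma weylSum_eq {d N : ℕ} (hd : 0 < d) (G : ℝ → ℝ) :
    weylSum a h d k G N =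
      ∑ m ∈ Icc 1 (N / d), (G (d * m : ℕ) : ℂ) * rootSum a h k (d * m) := by
  rw [← sum_filter_dvd hd N (fun n => (G n : ℂ) * rootSum a h k n), weylSum]
  simp only [rootSum, mul_sum]

lemma norm_rootSum_le (n : ℕ) : ‖rootSum a h k n‖ ≤ #(rts a h n) := by
  refine (norm_sum_le _ _).trans ?_
  simp [norm_ee]

lemma sum_norm_classSum_sq_le {r M : ℕ} (hM : 0 < M) :
    ∑ l ∈ rts a h M, ‖classSum a h k r M l‖ ^ 2 ≤ (#(rts a h (r * M)) : ℝ) ^ 2 := by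
  have h1 (l : ℕ) : ‖classSum a h k r M l‖ ≤ (((rts a h (r * M)).filter (· % M = l)).card : ℝ) := by
    refine (norm_sum_le _ _).trans ?_
    simp [norm_ee]
  have h2 := card_eq_sum_card_fiberwise (f := (· % M)) (s := rts a h (r * M)) (t := rts a h M)
    fun ν hν => mod_mem_rts hM (dvd_mul_left M r) hν
  calc _ ≤ ∑ l ∈ rts a h M, (((rts a h (r * M)).filter (· % M = l)).card : ℝ) *
        #(rts a h (r * M)) := by
        refine sum_le_sum fun l _ => ?_
        rw [sq]
        refine mul_le_mul (h1 l) ((h1 l).trans ?_) (norm_nonneg _) (Nat.cast_nonneg _)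
        exact_mod_cast card_filter_le _ _
    _ = _ := by
        rw [← sum_mul, sq]
        congr 1
        exact_mod_cast h2.symm

/-- The bilinear form in `r ∈ Q` and `M ≤ K` is controlled by the sums along products of two
distinct elements of `Q`. -/
lemma norm_bilinear_sq_le {Q : Finset ℕ} (hQ : ∀ r ∈ Q, r.Prime) (K : ℕ) (α : ℕ → ℝ) {g : ℝ → ℝ}
    (hg : ∀ s, |g s| ≤ 1) :
    ‖∑ r ∈ Q, ∑ M ∈ Icc 1 K, ((α M * g (r * M : ℕ) : ℝ) : ℂ) * rootSum a h k (r * M)‖ ^ 2 ≤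
      (∑ M ∈ Icc 1 K, #(rts a h M) * α M ^ 2) *
      (∑ r ∈ Q, ∑ M ∈ Icc 1 K, (#(rts a h (r * M)) : ℝ) ^ 2 +
        ∑ x ∈ Q.offDiag, ‖∑ M ∈ Icc 1 K,
          ((g (x.1 * M : ℕ) * g (x.2 * M : ℕ) : ℝ) : ℂ) *
            rootSum a h (k * (x.2 - x.1)) (x.1 * x.2 * M)‖) := by
  let c (M l : ℕ) : ℂ := ∑ r ∈ Q, (g (r * M : ℕ) : ℂ) * classSum a h k r M l
  have e1 : ∑ r ∈ Q, ∑ M ∈ Icc 1 K, ((α M * g (r * M : ℕ) : ℝ) : ℂ) * rootSum a h k (r * M) =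
      ∑ x ∈ (Icc 1 K).sigma fun M => rts a h M, (α x.1 : ℂ) * c x.1 x.2 := by
    rw [sum_comm, sum_sigma]
    refine sum_congr rfl fun M hM => ?_
    simp only [c, mul_sum]
    rw [sum_comm]
    refine sum_congr rfl fun r _ => ?_
    rw [rootSum_mul_eq (mem_Icc.mp hM).1, mul_sum]
    refine sum_congr rfl fun l _ => ?_
    push_cast; ring
  have e2 : ∑ x ∈ (Icc 1 K).sigma fun M => rts a h M, |α x.1| ^ 2 =
      ∑ M ∈ Icc 1 K, #(rts a h M) * α M ^ 2 := by
    rw [sum_sigma]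
    simp
  have e3 : ((∑ x ∈ (Icc 1 K).sigma fun M => rts a h M, ‖c x.1 x.2‖ ^ 2 : ℝ) : ℂ) =
      ∑ r ∈ Q, ∑ s ∈ Q, ∑ M ∈ Icc 1 K, ((g (r * M : ℕ) * g (s * M : ℕ) : ℝ) : ℂ) *
        ∑ l ∈ rts a h M, classSum a h k r M l * starRingEnd ℂ (classSum a h k s M l) := by
    push_cast
    simp only [← mul_conj']
    rw [sum_sigma]
    have : ∀ M l, c M l * starRingEnd ℂ (c M l) = ∑ r ∈ Q, ∑ s ∈ Q,
        ((g (r * M : ℕ) * g (s * M : ℕ) : ℝ) : ℂ) *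
          (classSum a h k r M l * starRingEnd ℂ (classSum a h k s M l)) := by
      intro M l
      simp only [c, map_sum, sum_mul_sum]
      refine sum_congr rfl fun r _ => sum_congr rfl fun s _ => ?_
      rw [map_mul, conj_ofReal]
      push_cast; ring
    simp only [this]
    calc _ = ∑ M ∈ Icc 1 K, ∑ r ∈ Q, ∑ s ∈ Q, ((g (r * M : ℕ) * g (s * M : ℕ) : ℝ) : ℂ) *
        ∑ l ∈ rts a h M, classSum a h k r M l * starRingEnd ℂ (classSum a h k s M l) := by
          refine sum_congr rfl fun M _ => ?_
          rw [sum_comm]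
          refine sum_congr rfl fun r _ => ?_
          rw [sum_comm]
          simp only [mul_sum]
      _ = _ := by
          rw [sum_comm]
          refine sum_congr rfl fun r _ => ?_
          rw [sum_comm]
          push_cast; rfl
  have e4 : ∑ x ∈ (Icc 1 K).sigma fun M => rts a h M, ‖c x.1 x.2‖ ^ 2 ≤
      ∑ r ∈ Q, ∑ M ∈ Icc 1 K, (#(rts a h (r * M)) : ℝ) ^ 2 +
        ∑ x ∈ Q.offDiag, ‖∑ M ∈ Icc 1 K,
          ((g (x.1 * M : ℕ) * g (x.2 * M : ℕ) : ℝ) : ℂ) *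
            rootSum a h (k * (x.2 - x.1)) (x.1 * x.2 * M)‖ := by
    have e5 := congrArg norm e3
    rw [norm_real, norm_of_nonneg (by positivity)] at e5
    rw [e5, ← sum_product', ← diag_union_offDiag,
      sum_union (disjoint_diag_offDiag _), sum_diag]
    refine (norm_add_le _ _).trans (add_le_add ?_ ?_)
    · refine norm_sum_le_of_le _ fun r _ => norm_sum_le_of_le _ fun M hM => ?_
      rw [norm_mul, norm_real, norm_eq_abs, abs_mul]
      have hb : ‖∑ l ∈ rts a h M, classSum a h k r M l * starRingEnd ℂ (classSum a h k r M l)‖ ≤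
          (#(rts a h (r * M)) : ℝ) ^ 2 := by
        refine le_trans ?_ (sum_norm_classSum_sq_le (k := k) (mem_Icc.mp hM).1)
        refine norm_sum_le_of_le _ fun l _ => ?_
        rw [norm_mul, RCLike.norm_conj, sq]
      have := mul_le_one₀ (hg (r * M : ℕ)) (abs_nonneg _) (hg (r * M : ℕ))
      exact (mul_le_mul this hb (norm_nonneg _) zero_le_one).trans_eq (one_mul _)
    · refine norm_sum_le_of_le _ fun x hx => le_of_eq ?_
      rw [mem_offDiag] at hx
      congr 1
      refine sum_congr rfl fun M hM => ?_
      rw [sum_classSum_mul_conj (mem_Icc.mp hM).1 (hQ _ hx.1).pos (hQ _ hx.2.1).pos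
        ((Nat.coprime_primes (hQ _ hx.1) (hQ _ hx.2.1)).mpr hx.2.2)]
  rw [e1, ← e2]
  refine le_trans ?_ (mul_le_mul_of_nonneg_left e4 (by positivity))
  refine le_trans ?_ (sum_mul_sq_le_sq_mul_sq _ (fun x : (_ : ℕ) × ℕ => |α x.1|)
    (fun x => ‖c x.1 x.2‖))
  gcongr
  refine norm_sum_le_of_le _ fun x _ => ?_
  rw [norm_mul, norm_real, norm_eq_abs]

end

section

open Real

variable {a h Z : ℕ} {k : ℤ} {U X Lg : ℝ} {g : ℝ → ℝ}

lemma IsScale.card_rts_le (H : IsScale a h Z U) {n : ℕ} (hn : n ≠ 0) :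
    (#(rts a h n) : ℝ) ≤ 4 * tau n := by
  exact_mod_cast RootEquidist.card_rts_le (a := a) (h := h) (n := n) (mod_cast H.pos)
    (Int.squarefree_natCast.mpr H.sqf) (by simpa using H.coprime) hn

/-- The product of two dilates of a cutoff function. -/
lemma IsCutoff.dilate_mul (hg : IsCutoff g Lg X) {P r s : ℝ} (hP : 0 < P) (hr : P ≤ r) (hs : P ≤ s)
    (hs2 : s ≤ 2 * P) (hX : 0 ≤ X) :
    IsCutoff (fun t => g (t / s) * g (t / r)) (2 * Lg / P) (2 * P * X) where
  abs_le t := by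
    rw [abs_mul]; exact mul_le_one₀ (hg.abs_le _) (abs_nonneg _) (hg.abs_le _)
  lip t u := by
    have hL := hg.nonneg
    have key {x : ℝ} (hx : P ≤ x) : |g (t / x) - g (u / x)| ≤ Lg / P * |t - u| := by
      refine (hg.lip _ _).trans ?_
      rw [← sub_div, abs_div, abs_of_pos (hP.trans_le hx), div_mul_eq_mul_div, mul_div_assoc]
      gcongr
    calc _ = |g (t / s) * (g (t / r) - g (u / r)) +
          (g (t / s) - g (u / s)) * g (u / r)| := by ring_nf
      _ ≤ 1 * (Lg / P * |t - u|) + (Lg / P * |t - u|) * 1 := by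
          refine (abs_add_le _ _).trans ?_
          rw [abs_mul, abs_mul]
          gcongr
          · exact hg.abs_le _
          · exact key hr
          · exact key hs
          · exact hg.abs_le _
      _ = _ := by ring
  supp t ht := by
    have : X < t / s := by
      rw [lt_div_iff₀ (hP.trans_le hs)]
      refine lt_of_le_of_lt ?_ ht
      nlinarith
    simp [hg.supp _ this]

lemma injOn_mul_of_lt {Q : Finset ℕ} (hQ : ∀ r ∈ Q, r.Prime) :
    Set.InjOn (fun x : ℕ × ℕ => x.1 * x.2) (Q.offDiag.filter fun x => x.1 < x.2) := by
  rintro ⟨r, s⟩ hx ⟨r', s'⟩ hx' heq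
  simp only [coe_filter, mem_offDiag, Set.mem_ofPred_eq] at hx hx' heq
  have p1 := hQ _ hx.1.1
  have p2 := hQ _ hx.1.2.1
  have p1' := hQ _ hx'.1.1
  have p2' := hQ _ hx'.1.2.1
  rcases (p1.dvd_mul).mp (Dvd.intro _ heq) with hd | hd
  · obtain rfl := (Nat.prime_dvd_prime_iff_eq p1 p1').mp hd
    rw [Nat.mul_right_inj p1.ne_zero] at heq
    rw [heq]
  · obtain rfl := (Nat.prime_dvd_prime_iff_eq p1 p2').mp hd
    rw [mul_comm, Nat.mul_left_inj p1.ne_zero] at heq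
    omega

namespace IsScale

variable {P : ℕ} {Q : Finset ℕ}

lemma card_le_of_window (hQ : ∀ r ∈ Q, r.Prime ∧ P ≤ r ∧ r < 2 * P ∧ a.Coprime r) : #Q ≤ P := by
  have : Q ⊆ Ico P (2 * P) := fun r hr => mem_Ico.mpr ⟨(hQ r hr).2.1, (hQ r hr).2.2.1⟩
  simpa [two_mul] using card_le_card this

lemma sum_norm_offDiag_le (H : IsScale a h Z U) (hU : 2000 ≤ U) (hX : 1 ≤ X) (hg : IsCutoff g Lg X)
    (hLg : 4 * Lg * X ≤ U) (hk : k ≠ 0) (hkP : k.natAbs < P)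
    (hQ : ∀ r ∈ Q, r.Prime ∧ P ≤ r ∧ r < 2 * P ∧ a.Coprime r)
    (hP3 : P ^ 3 * U ^ 60 ≤ X) (hPω : P * hgt a h * U ^ 60 ≤ X) (hkω : k.natAbs * hgt a h ≤ X)
    (hZ : 6 * a * k.natAbs * P ^ 2 * X ≤ Z) (I : Finset (ℕ × ℕ)) (hI : I ⊆ Q.offDiag)
    (hinj : Set.InjOn (fun x : ℕ × ℕ => x.1 * x.2) I) :
    ∑ x ∈ I, ‖∑ M ∈ Icc 1 ⌊X / P⌋₊, ((g (x.1 * M : ℕ) * g (x.2 * M : ℕ) : ℝ) : ℂ) *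
      rootSum a h (k * (x.2 - x.1)) (x.1 * x.2 * M)‖ ≤ P * X / U := by
  have hP : 1 ≤ P := by omega
  have hP' : (1 : ℝ) ≤ P := mod_cast hP
  have hk1 : 1 ≤ k.natAbs := Int.natAbs_pos.mpr hk
  have hk1' : (1 : ℝ) ≤ k.natAbs := mod_cast hk1
  have ha' : (1 : ℝ) ≤ a := mod_cast H.pos
  have hω := hgt_pos H.pos H.pos'
  set ω := hgt a h
  set Y : ℝ := 2 * P * X with hYdef
  have hY : 1 ≤ Y := by nlinarith
  set N := ⌈2 * Y⌉₊
  have hN : 2 * Y ≤ N := Nat.le_ceil _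
  have hN3 : N ≤ 3 * Y := by
    have := Nat.ceil_lt_add_one (a := 2 * Y) (by linarith)
    linarith
  have hZ1 : 6 * (P : ℝ) ^ 2 * X ≤ Z := by
    have := le_mul_of_one_le_left (show 0 ≤ 6 * (P : ℝ) ^ 2 * X by positivity)
      (one_le_mul_of_one_le_of_one_le ha' hk1')
    linarith
  have hNZ : N ≤ Z := by
    have : (P : ℝ) ≤ P ^ 2 := le_self_pow₀ hP' two_ne_zero
    exact_mod_cast hN3.trans (le_trans (by nlinarith) hZ1)
  have hmem : ∀ x ∈ I, (x.1.Prime ∧ P ≤ x.1 ∧ x.1 < 2 * P ∧ a.Coprime x.1) ∧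
      (x.2.Prime ∧ P ≤ x.2 ∧ x.2 < 2 * P ∧ a.Coprime x.2) ∧ x.1 ≠ x.2 := by
    intro x hx
    have := mem_offDiag.mp (hI hx)
    exact ⟨hQ _ this.1, hQ _ this.2.1, this.2.2⟩
  have e1 : ∀ x ∈ I, ‖∑ M ∈ Icc 1 ⌊X / P⌋₊, ((g (x.1 * M : ℕ) * g (x.2 * M : ℕ) : ℝ) : ℂ) *
      rootSum a h (k * (x.2 - x.1)) (x.1 * x.2 * M)‖ =
      ‖weylSum a h (x.1 * x.2) (k * (x.2 - x.1)) (fun t => g (t / x.2) * g (t / x.1)) N‖ := by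
    intro x hx
    obtain ⟨⟨p1, l1, u1, -⟩, ⟨p2, l2, u2, -⟩, -⟩ := hmem x hx
    have hpos : 0 < x.1 * x.2 := Nat.mul_pos p1.pos p2.pos
    have c1 : (x.1 : ℝ) ≠ 0 := mod_cast p1.ne_zero
    have c2 : (x.2 : ℝ) ≠ 0 := mod_cast p2.ne_zero
    have f1 (M : ℕ) : ((x.1 * x.2 * M : ℕ) : ℝ) / x.2 = (x.1 * M : ℕ) := by push_cast; field_simp
    have f2 (M : ℕ) : ((x.1 * x.2 * M : ℕ) : ℝ) / x.1 = (x.2 * M : ℕ) := by push_cast; field_simp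
    rw [weylSum_eq hpos]
    simp only [f1, f2]
    congr 1
    refine sum_subset (fun M hM => ?_) fun M _ hM => ?_
    · rw [mem_Icc] at hM ⊢
      refine ⟨hM.1, (Nat.le_div_iff_mul_le hpos).mpr ?_⟩
      have h1 : (M : ℝ) ≤ X / P := (Nat.cast_le.mpr hM.2).trans (Nat.floor_le (by positivity))
      have h2 : ((M * (x.1 * x.2) : ℕ) : ℝ) ≤ N := by
        refine le_trans ?_ hN
        have u1' : (x.1 : ℝ) ≤ 2 * P := mod_cast u1.le
        have u2' : (x.2 : ℝ) ≤ 2 * P := mod_cast u2.le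
        push_cast
        calc (M : ℝ) * (x.1 * x.2) ≤ X / P * (2 * P * (2 * P)) := by gcongr
          _ = 2 * Y := by rw [hYdef]; field_simp
      exact_mod_cast h2
    · have h3 : ∀ y : ℕ, P ≤ y → g (y * M : ℕ) = 0 := by
        intro y hy
        refine hg.supp _ ?_
        by_contra hcon
        refine hM (mem_Icc.mpr ⟨?_, Nat.le_floor ?_⟩)
        · rename_i hM'; exact (mem_Icc.mp hM').1
        · rw [le_div_iff₀ (by positivity)]
          refine le_trans ?_ (not_lt.mp hcon)
          push_cast
          rw [mul_comm]
          gcongr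
      rw [h3 _ l1]; simp
  rw [sum_congr rfl e1]
  set ρ : ℝ := 1 / (800 * U ^ 3) with hρ
  have hcard : (#I : ℝ) ≤ P ^ 2 := by
    rw [sq]
    refine mod_cast (card_le_card hI).trans ?_
    rw [offDiag_card]
    exact (Nat.sub_le _ _).trans (Nat.mul_le_mul (card_le_of_window hQ) (card_le_of_window hQ))
  have hdiff : ∀ x ∈ I, ((x.2 : ℤ) - x.1).natAbs ≤ P ∧ ((x.2 : ℤ) - x.1) ≠ 0 := by
    intro x hx
    have := hmem x hx
    omega
  have main := H.sum_norm_weylSum_le (N := N) (r := ρ) (Y := Y) (L := 2 * Lg / P) I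
    (δ := fun x => x.1 * x.2)
    (k := fun x => k * (x.2 - x.1)) (g := fun x t => g (t / x.2) * g (t / x.1)) (Δ := (P : ℝ) ^ 2)
    (by positivity) hinj ?_ ?_ hY hN hN3 hNZ ?_ ?_ (by positivity) ?_
  · refine main.trans ?_
    have hUp : 0 < U := by linarith
    set V := Y / ω with hV
    have hVω : V * ω = Y := by rw [hV]; field_simp
    have hV0 : 0 < V := by positivity
    have hVU : V ≤ U * Y := by
      rw [hV, div_eq_mul_one_div, mul_comm]
      gcongr
      exact H.inv_hgt_le
    have t1 : 200 * U ^ 2 * ρ * Y * #I / (P : ℝ) ^ 2 ≤ P * X / (2 * U) := by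
      calc _ ≤ 200 * U ^ 2 * ρ * Y * (P : ℝ) ^ 2 / (P : ℝ) ^ 2 := by gcongr
        _ = P * X / (2 * U) := by rw [hρ, hYdef]; field_simp; ring
    have t2 : √(Y * #I * (1 + √V / (P : ℝ) ^ 2) * (#I + ω)) ≤ 4 * (P * X) / U ^ 13 := by
      refine sqrt_le_iff.mpr ⟨by positivity, ?_⟩
      have b1 : (P : ℝ) ^ 3 ≤ X / U ^ 60 := by rw [le_div_iff₀ (by positivity)]; exact hP3
      have b2 : P * ω ≤ X / U ^ 60 := by rw [le_div_iff₀ (by positivity)]; exact hPω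
      have b0 : X / U ^ 60 ≤ X / U ^ 28 := by gcongr <;> linarith
      have b3 : P * √V ≤ 2 * (X / U ^ 28) := by
        refine le_of_sq_le_sq ?_ (by positivity)
        rw [mul_pow, sq_sqrt hV0.le]
        calc (P : ℝ) ^ 2 * V ≤ P ^ 2 * (U * Y) := by gcongr
          _ = 2 * U * X * P ^ 3 := by rw [hYdef]; ring
          _ ≤ 2 * U * X * (X / U ^ 60) := by gcongr
          _ = 2 * (X ^ 2 / U ^ 59) := by field_simp
          _ ≤ 4 * (X ^ 2 / U ^ 56) := by gcongr <;> linarith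
          _ = _ := by field_simp; norm_num
      have b4 : √V * ω ≤ 2 * (P * (X / U ^ 28)) := by
        refine le_of_sq_le_sq ?_ (by positivity)
        rw [mul_pow, sq_sqrt hV0.le]
        calc V * ω ^ 2 = 2 * X * (P * ω) := by rw [sq, ← mul_assoc, hVω, hYdef]; ring
          _ ≤ 2 * X * (X / U ^ 60) := by gcongr
          _ = 2 * 1 * (X ^ 2 / U ^ 60) := by ring
          _ ≤ 4 * P ^ 2 * (X ^ 2 / U ^ 56) := by
              gcongr
              · norm_num
              · exact one_le_pow₀ hP'
              · linarith
              · norm_num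
          _ = _ := by field_simp; norm_num
      have b5 : #I * (1 + √V / (P : ℝ) ^ 2) ≤ P ^ 2 + √V := by
        calc _ ≤ (P : ℝ) ^ 2 * (1 + √V / (P : ℝ) ^ 2) := by gcongr
          _ = _ := by field_simp
      calc Y * #I * (1 + √V / (P : ℝ) ^ 2) * (#I + ω)
          = Y * (#I * (1 + √V / (P : ℝ) ^ 2)) * (#I + ω) := by ring
        _ ≤ Y * (P ^ 2 + √V) * (P ^ 2 + ω) := by gcongr
        _ = Y * (P * P ^ 3 + P * (P * ω) + P * (P * √V) + √V * ω) := by ring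
        _ ≤ Y * (P * (X / U ^ 28) + P * (X / U ^ 28) + P * (2 * (X / U ^ 28)) +
            2 * (P * (X / U ^ 28))) := by
          gcongr
          · exact b1.trans b0
          · exact b2.trans b0
        _ = 12 * (P * X) ^ 2 / U ^ 28 := by rw [hYdef]; ring
        _ ≤ 16 * (P * X) ^ 2 / U ^ 26 := by gcongr <;> linarith
        _ = _ := by field_simp; norm_num
    have t3 : 416 * U ^ 7 / ρ * (4 * (P * X) / U ^ 13) ≤ P * X / (2 * U) := by
      calc 416 * U ^ 7 / ρ * (4 * (P * X) / U ^ 13) = 1331200 * (P * X) / U ^ 3 := by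
            rw [hρ]; field_simp; norm_num
        _ ≤ _ := by
            rw [div_le_div_iff₀ (by positivity) (by positivity)]
            have : 2662400 ≤ U ^ 2 := by nlinarith
            calc 1331200 * (P * X) * (2 * U) = 2662400 * (P * X * U) := by ring
              _ ≤ U ^ 2 * (P * X * U) := by gcongr
              _ = _ := by ring
    calc _ ≤ P * X / (2 * U) + 416 * U ^ 7 / ρ * (4 * (P * X) / U ^ 13) := by gcongr
      _ ≤ P * X / (2 * U) + P * X / (2 * U) := by gcongr
      _ = _ := by field_simp; norm_num
  · intro x hx
    obtain ⟨⟨p1, l1, u1, c1⟩, ⟨p2, l2, u2, c2⟩, hne⟩ := hmem x hx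
    refine ⟨(Nat.squarefree_mul ((Nat.coprime_primes p1 p2).mpr hne)).mpr
      ⟨p1.prime.squarefree, p2.prime.squarefree⟩, c1.mul_right c2, ?_, ?_⟩
    · rw [sq]; exact_mod_cast Nat.mul_le_mul l1 l2
    · have h1 : x.1 * x.2 ≤ (2 * P) * (2 * P) := Nat.mul_le_mul u1.le u2.le
      have h2 : ((x.1 * x.2 : ℕ) : ℝ) ≤ Z := by
        refine (Nat.cast_le.mpr h1).trans (le_trans ?_ hZ1)
        push_cast
        nlinarith [sq_nonneg (P : ℝ)]
      exact_mod_cast h2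
  · intro x hx
    obtain ⟨⟨p1, l1, u1, c1⟩, ⟨p2, l2, u2, c2⟩, hne⟩ := hmem x hx
    exact hg.dilate_mul (by positivity) (mod_cast l1) (mod_cast l2)
      (mod_cast u2.le) (by linarith)
  · calc 2 * Lg / P * Y = 4 * Lg * X := by rw [hYdef]; field_simp; ring
      _ ≤ U := hLg
  · intro x hx
    obtain ⟨⟨p1, l1, u1, c1⟩, ⟨p2, l2, u2, c2⟩, hne⟩ := hmem x hx
    obtain ⟨d1, d2⟩ := hdiff x hx
    have d1' : (((x.2 : ℤ) - x.1).natAbs : ℝ) ≤ P := mod_cast d1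
    refine ⟨mul_ne_zero hk d2, ?_, ?_, ?_⟩
    · rw [Int.natAbs_mul]
      refine le_trans ?_ hZ
      push_cast
      calc (a : ℝ) * (k.natAbs * ((x.2 : ℤ) - x.1).natAbs) * Y ≤ a * (k.natAbs * P) * Y := by gcongr
        _ = 2 * (a * k.natAbs * P ^ 2 * X) := by rw [hYdef]; ring
        _ ≤ 6 * (a * k.natAbs * P ^ 2 * X) := by gcongr; norm_num
        _ = _ := by ring
    · have cop {p : ℕ} (pp : p.Prime) (hp : P ≤ p) (hd : ¬ (p : ℤ) ∣ x.2 - x.1) :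
          p.Coprime (k * ((x.2 : ℤ) - x.1)).natAbs := by
        rw [pp.coprime_iff_not_dvd, ← Int.natCast_dvd, (Nat.prime_iff_prime_int.mp pp).dvd_mul,
          Int.natCast_dvd]
        exact not_or.mpr ⟨fun hd => by have := Nat.le_of_dvd hk1 hd; omega, hd⟩
      have g1 := (cop p1 l1
        (by simpa [Int.natCast_dvd_natCast, Nat.prime_dvd_prime_iff_eq p1 p2])).mul_left (cop p2 l2
        (by simpa [Int.natCast_dvd_natCast, Nat.prime_dvd_prime_iff_eq p2 p1] using hne.symm))
      rw [Nat.Coprime.gcd_eq_one g1]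
      push_cast; linarith
    · rw [← Int.cast_abs, ← Int.natCast_natAbs, Int.cast_natCast, Int.natAbs_mul]
      push_cast
      calc (k.natAbs : ℝ) * ((x.2 : ℤ) - x.1).natAbs * ω ≤ k.natAbs * P * ω := by gcongr
        _ = P * (k.natAbs * ω) := by ring
        _ ≤ P * X := by gcongr
        _ ≤ Y := by rw [hYdef]; nlinarith
  · rw [hρ, div_le_div_iff₀ (by positivity) (by norm_num)]
    have : 1 ≤ U ^ 3 := one_le_pow₀ (by linarith)
    linarith

lemma norm_typeII_sq_le (H : IsScale a h Z U) (hU : 2000 ≤ U) (hg : IsCutoff g Lg X)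
    (hLg : 4 * Lg * X ≤ U) (hk : k ≠ 0) (hkP : k.natAbs < P) (hPX : P ≤ X)
    (hQ : ∀ r ∈ Q, r.Prime ∧ P ≤ r ∧ r < 2 * P ∧ a.Coprime r)
    (hP3 : P ^ 3 * U ^ 60 ≤ X) (hPω : P * hgt a h * U ^ 60 ≤ X) (hkω : k.natAbs * hgt a h ≤ X)
    (hZ : 6 * a * k.natAbs * P ^ 2 * X ≤ Z) {α : ℕ → ℝ} (hα : ∀ M ≠ 0, |α M| ≤ tau M) :
    ‖∑ r ∈ Q, ∑ M ∈ Icc 1 ⌊X / P⌋₊, ((α M * g (r * M : ℕ) : ℝ) : ℂ) *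
      rootSum a h k (r * M)‖ ^ 2 ≤ 264 * X ^ 2 * (1 + log X) ^ 10 * (1 / P + 1 / U) := by
  have hP' : (1 : ℝ) ≤ P := mod_cast (by omega : 1 ≤ P)
  have hX : 1 ≤ X := hP'.trans hPX
  set K := ⌊X / P⌋₊ with hK
  set l := 1 + log X with hl
  have hl1 : 1 ≤ l := by linarith [log_nonneg hX]
  have hKle : (K : ℝ) ≤ X / P := Nat.floor_le (by positivity)
  have hlK : 1 + log K ≤ l := by
    rcases Nat.eq_zero_or_pos K with h0 | h0
    · rw [h0]; simpa using hl1
    · have : (K : ℝ) ≤ X := hKle.trans (div_le_self (by linarith) hP')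
      have hK0 : (0 : ℝ) < K := mod_cast h0
      rw [hl]; gcongr
  have hlK0 : 0 ≤ 1 + log K := by linarith [log_natCast_nonneg K]
  have htau (j m : ℕ) (hm : 2 ^ j - 1 = m) :
      ∑ M ∈ Icc 1 K, (tau M : ℝ) ^ j ≤ X / P * l ^ m := by
    refine (sum_tau_pow_le j K).trans ?_
    rw [hm]; gcongr
  have s1 : ∑ M ∈ Icc 1 K, (#(rts a h M) : ℝ) * α M ^ 2 ≤ 4 * (X / P * l ^ 7) := by
    refine le_trans ?_ (mul_le_mul_of_nonneg_left (htau 3 7 (by norm_num)) (by norm_num))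
    rw [mul_sum]
    refine sum_le_sum fun M hM => ?_
    have hM0 : M ≠ 0 := by have := (mem_Icc.mp hM).1; omega
    have h1 := H.card_rts_le hM0
    have h2 : α M ^ 2 ≤ (tau M : ℝ) ^ 2 := by
      rw [← sq_abs]; exact pow_le_pow_left₀ (abs_nonneg _) (hα M hM0) 2
    calc _ ≤ 4 * (tau M : ℝ) * (tau M : ℝ) ^ 2 := by gcongr
      _ = _ := by ring
  have hQcard : (#Q : ℝ) ≤ P := mod_cast card_le_of_window hQ
  have s2 : ∑ r ∈ Q, ∑ M ∈ Icc 1 K, (#(rts a h (r * M)) : ℝ) ^ 2 ≤ 64 * (X * l ^ 3) := by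
    calc _ ≤ ∑ r ∈ Q, 64 * (X / P * l ^ 3) := by
          refine sum_le_sum fun r hr => ?_
          refine le_trans ?_ (mul_le_mul_of_nonneg_left (htau 2 3 (by norm_num)) (by norm_num))
          rw [mul_sum]
          refine sum_le_sum fun M hM => ?_
          have h1 := H.card_rts_le (n := r * M) (mul_ne_zero (hQ r hr).1.ne_zero
            (by have := (mem_Icc.mp hM).1; omega))
          have h2 : (tau (r * M) : ℝ) ≤ 2 * tau M := by
            refine mod_cast (tau_mul_le r M).trans (le_of_eq ?_)
            rw [tau, (hQ r hr).1.divisors, card_pair (hQ r hr).1.one_lt.ne]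
          have h3 : (#(rts a h (r * M)) : ℝ) ≤ 8 * tau M := by linarith
          calc _ ≤ (8 * (tau M : ℝ)) ^ 2 := by gcongr
            _ = _ := by ring
      _ = #Q * (64 * (X / P * l ^ 3)) := by simp
      _ ≤ P * (64 * (X / P * l ^ 3)) := by gcongr
      _ = _ := by field_simp
  have s3 : ∑ x ∈ Q.offDiag, ‖∑ M ∈ Icc 1 K, ((g (x.1 * M : ℕ) * g (x.2 * M : ℕ) : ℝ) : ℂ) *
      rootSum a h (k * (x.2 - x.1)) (x.1 * x.2 * M)‖ ≤ 2 * (P * X / U) := by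
    rw [← sum_filter_add_sum_filter_not _ (fun x : ℕ × ℕ => x.1 < x.2), two_mul]
    refine add_le_add ?_ ?_
    · exact H.sum_norm_offDiag_le hU hX hg hLg hk hkP hQ hP3 hPω hkω hZ _ (filter_subset _ _)
        (injOn_mul_of_lt fun r hr => (hQ r hr).1)
    · refine H.sum_norm_offDiag_le hU hX hg hLg hk hkP hQ hP3 hPω hkω hZ _ (filter_subset _ _) ?_
      intro x hx y hy hxy
      have hsw : ∀ x ∈ (Q.offDiag.filter fun x => ¬ x.1 < x.2),
          x.swap ∈ (Q.offDiag.filter fun x : ℕ × ℕ => x.1 < x.2) := by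
        intro x hx
        rw [mem_filter, mem_offDiag] at hx ⊢
        grind
      refine Prod.swap_injective (injOn_mul_of_lt (fun r hr => (hQ r hr).1) (hsw x hx)
        (hsw y hy) ?_)
      change x.2 * x.1 = y.2 * y.1
      rw [mul_comm x.2, mul_comm y.2]; exact hxy
  refine (norm_bilinear_sq_le (fun r hr => (hQ r hr).1) K α hg.abs_le).trans ?_
  calc _ ≤ (4 * (X / P * l ^ 7)) * (64 * (X * l ^ 3) + 2 * (P * X / U)) :=
        mul_le_mul s1 (add_le_add s2 s3)
          (add_nonneg (sum_nonneg fun _ _ => sum_nonneg fun _ _ => sq_nonneg _)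
            (sum_nonneg fun _ _ => norm_nonneg _)) (by positivity)
    _ = 256 * X ^ 2 * l ^ 10 * (1 / P) + 8 * X ^ 2 * l ^ 7 * (1 / U) := by
        have hP0 : (P : ℝ) ≠ 0 := by positivity
        have hU0 : U ≠ 0 := by positivity
        clear_value l
        generalize (P : ℝ) = p at hP0 ⊢
        clear * - hP0 hU0
        field_simp
        ring
    _ ≤ 264 * X ^ 2 * l ^ 10 * (1 / P) + 264 * X ^ 2 * l ^ 10 * (1 / U) := by
        have hl7 : l ^ 7 ≤ l ^ 10 := pow_le_pow_right₀ hl1 (by norm_num)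
        have hU0 : 0 < U := by linarith
        gcongr <;> norm_num
    _ = _ := by ring

end IsScale

end

section

open Real

variable {a h Z : ℕ} {k : ℤ} {U X Lg : ℝ} {g : ℝ → ℝ}

/-- A Weyl sum only sees the support of the cutoff function. -/
lemma IsCutoff.weylSum_eq_floor (hg : IsCutoff g Lg X) (d : ℕ) (k : ℤ) {N : ℕ} (hN : X ≤ N) :
    weylSum a h d k g N = weylSum a h d k g ⌊X⌋₊ := by
  unfold weylSum
  symm
  refine sum_subset ?_ ?_
  · intro n hn
    rw [mem_filter, mem_Icc] at hn ⊢
    exact ⟨⟨hn.1.1, hn.1.2.trans (Nat.floor_le_of_le hN)⟩, hn.2⟩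
  · intro n hn hn'
    rw [mem_filter, mem_Icc] at hn hn'
    have h1 : ⌊X⌋₊ < n := by
      by_contra hc
      exact hn' ⟨⟨hn.1.1, not_lt.mp hc⟩, hn.2⟩
    have h2 : g n = 0 := hg.supp _ (Nat.lt_of_floor_lt h1)
    simp [h2]

namespace IsScale

/-- Linear sums over the levels of a dyadic block. -/
lemma sum_norm_weylSum_block_le (H : IsScale a h Z U) (hU : 2000 ≤ U) (hX : 1 ≤ X)
    (hg : IsCutoff g Lg X) (hLg : Lg * X ≤ U) (hk : k ≠ 0) (hkU : (k.natAbs : ℝ) ≤ U)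
    (hkω : k.natAbs * hgt a h ≤ X) (hZ : 3 * a * k.natAbs * X ≤ Z) {R : ℝ} (hR1 : 1 ≤ R)
    (hR : R ^ 2 * U ^ 64 ≤ X) (hRω : R * hgt a h * U ^ 64 ≤ X) (I : Finset ℕ) {Δ : ℝ} (hΔ : 1 ≤ Δ)
    (hΔR : Δ ≤ R) (hI : ∀ l ∈ I, Squarefree l ∧ a.Coprime l ∧ Δ ≤ l ∧ (l : ℝ) ≤ R)
    (hcard : (#I : ℝ) ≤ Δ) :
    ∑ l ∈ I, ‖weylSum a h l k g ⌊X⌋₊‖ ≤ X / U ^ 2 := by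
  have hk1 : (1 : ℝ) ≤ k.natAbs := mod_cast Int.natAbs_pos.mpr hk
  have ha' : (1 : ℝ) ≤ a := mod_cast H.pos
  have hω := hgt_pos H.pos H.pos'
  have hωU := H.inv_hgt_le
  set ω := hgt a h
  set N := ⌈2 * X⌉₊
  have hN : 2 * X ≤ N := Nat.le_ceil _
  have hN3 : N ≤ 3 * X := by
    have := Nat.ceil_lt_add_one (a := 2 * X) (by linarith)
    linarith
  have hak : 1 ≤ (a : ℝ) * k.natAbs := by nlinarith
  have hXZ : 3 * X ≤ Z := by
    refine le_trans ?_ hZ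
    calc 3 * X = 1 * (3 * X) := by ring
      _ ≤ (a * k.natAbs) * (3 * X) := by gcongr
      _ = _ := by ring
  have hNZ : N ≤ Z := mod_cast hN3.trans hXZ
  have hU0 : 0 < U := by linarith
  have hRX : R ≤ X := by
    refine le_trans ?_ hR
    have : 1 ≤ U ^ 64 := one_le_pow₀ (by linarith)
    nlinarith
  set ρ : ℝ := 1 / (400 * U ^ 4) with hρ
  have hρ0 : 0 < ρ := by positivity
  have key := H.sum_norm_weylSum_le I (δ := fun l => l) (k := fun _ => k) (g := fun _ => g)
    (L := Lg) (Y := X) (N := N) (Δ := Δ) (r := ρ)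
    (by linarith) (fun _ _ _ _ e => e)
    (fun l hl => ⟨(hI l hl).1, (hI l hl).2.1, (hI l hl).2.2.1, by
      have := (hI l hl).2.2.2
      exact_mod_cast (show (l : ℝ) ≤ Z by linarith)⟩)
    (fun _ _ => hg) hX hN hN3 hNZ hLg
    (fun l hl => ⟨hk, by
      refine le_trans ?_ hZ
      have : 0 ≤ (a : ℝ) * k.natAbs * X := by positivity
      linarith, by
      refine le_trans ?_ hkU
      exact_mod_cast Nat.gcd_le_right _ (Int.natAbs_pos.mpr hk), by
      rw [← Int.cast_abs, ← Int.natCast_natAbs, Int.cast_natCast]; exact hkω⟩) hρ0 (by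
      rw [hρ, div_le_div_iff₀ (by positivity) (by norm_num)]
      have : 1 ≤ U ^ 4 := one_le_pow₀ (by linarith)
      linarith)
  have e1 : ∀ l ∈ I, ‖weylSum a h l k g ⌊X⌋₊‖ = ‖weylSum a h l k g N‖ := fun l _ => by
    rw [hg.weylSum_eq_floor l k (N := N) (by linarith)]
  rw [sum_congr rfl e1]
  refine key.trans ?_
  have t1 : 200 * U ^ 2 * ρ * X * #I / Δ ≤ X / (2 * U ^ 2) := by
    calc _ ≤ 200 * U ^ 2 * ρ * X * Δ / Δ := by gcongr
      _ = X / (2 * U ^ 2) := by rw [hρ]; field_simp; norm_num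
  set V := X / ω with hV
  have hVU : V ≤ X * U := by
    rw [hV, div_eq_mul_one_div]; gcongr
  have c1 : R ≤ √X / U ^ 32 := by
    rw [le_div_iff₀ (by positivity)]
    refine le_sqrt_of_sq_le ?_
    calc (R * U ^ 32) ^ 2 = R ^ 2 * U ^ 64 := by ring
      _ ≤ X := hR
  have b1 : R * R ≤ X / U ^ 31 := by
    rw [le_div_iff₀ (by positivity)]
    refine le_trans ?_ hR
    have : U ^ 31 ≤ U ^ 64 := pow_le_pow_right₀ (by linarith) (by norm_num)
    rw [← sq]; gcongr
  have b2 : R * ω ≤ X / U ^ 31 := by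
    rw [le_div_iff₀ (by positivity)]
    refine le_trans ?_ hRω
    have : U ^ 31 ≤ U ^ 64 := pow_le_pow_right₀ (by linarith) (by norm_num)
    gcongr
  have sV : √V ≤ √X * U := by
    refine sqrt_le_left (by positivity) |>.mpr ?_
    rw [mul_pow, sq_sqrt (by linarith)]
    have : U ≤ U ^ 2 := by nlinarith
    exact hVU.trans (by gcongr)
  have b3 : R * √V ≤ X / U ^ 31 := by
    calc R * √V ≤ (√X / U ^ 32) * (√X * U) := by gcongr
      _ = (√X * √X) / U ^ 31 := by field_simp
      _ = _ := by rw [mul_self_sqrt (by linarith)]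
  have b4 : √V * ω ≤ X / U ^ 31 := by
    have e : √V * ω = √(X * ω) := by
      rw [← sqrt_sq hω.le, ← sqrt_mul (by positivity), sqrt_sq hω.le, hV]
      congr 1; field_simp
    rw [e]
    have hω2 : ω ≤ X / U ^ 62 := by
      rw [le_div_iff₀ (by positivity)]
      refine le_trans ?_ hRω
      have : U ^ 62 ≤ U ^ 64 := pow_le_pow_right₀ (by linarith) (by norm_num)
      calc ω * U ^ 62 = 1 * ω * U ^ 62 := by ring
        _ ≤ R * ω * U ^ 64 := by gcongr
    refine sqrt_le_left (by positivity) |>.mpr ?_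
    calc X * ω ≤ X * (X / U ^ 62) := by gcongr
      _ = _ := by field_simp
  have b5 : #I * (1 + √V / Δ) ≤ R + √V := by
    calc _ ≤ Δ * (1 + √V / Δ) := by gcongr
      _ = Δ + √V := by field_simp
      _ ≤ _ := by gcongr
  have t2 : √(X * #I * (1 + √V / Δ) * (#I + ω)) ≤ 2 * X / U ^ 15 := by
    refine sqrt_le_left (by positivity) |>.mpr ?_
    calc X * #I * (1 + √V / Δ) * (#I + ω)
        = X * (#I * (1 + √V / Δ)) * (#I + ω) := by ring
      _ ≤ X * (R + √V) * (R + ω) := by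
          gcongr
          exact hcard.trans hΔR
      _ = X * (R * R + R * ω + R * √V + √V * ω) := by ring
      _ ≤ X * (X / U ^ 31 + X / U ^ 31 + X / U ^ 31 + X / U ^ 31) := by gcongr
      _ = 4 * X ^ 2 / U ^ 31 := by ring
      _ ≤ 4 * X ^ 2 / U ^ 30 := by gcongr <;> linarith
      _ = _ := by field_simp; norm_num
  have t3 : 416 * U ^ 7 / ρ * (2 * X / U ^ 15) ≤ X / (2 * U ^ 2) := by
    calc 416 * U ^ 7 / ρ * (2 * X / U ^ 15) = 332800 * X / U ^ 4 := by
          rw [hρ]; field_simp; norm_num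
      _ ≤ _ := by
          rw [div_le_div_iff₀ (by positivity) (by positivity)]
          have : 665600 ≤ U ^ 2 := by nlinarith
          calc 332800 * X * (2 * U ^ 2) = 665600 * (X * U ^ 2) := by ring
            _ ≤ U ^ 2 * (X * U ^ 2) := by gcongr
            _ = _ := by ring
  calc _ ≤ X / (2 * U ^ 2) + 416 * U ^ 7 / ρ * (2 * X / U ^ 15) := by gcongr
    _ ≤ X / (2 * U ^ 2) + X / (2 * U ^ 2) := by gcongr
    _ = _ := by field_simp; norm_num

/-- Linear sums on average over the levels. -/
lemma sum_norm_weylSum_typeI_le (H : IsScale a h Z U) (hU : 2000 ≤ U) (hX : 1 ≤ X)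
    (hg : IsCutoff g Lg X) (hLg : Lg * X ≤ U) (hk : k ≠ 0) (hkU : (k.natAbs : ℝ) ≤ U)
    (hkω : k.natAbs * hgt a h ≤ X) (hZ : 3 * a * k.natAbs * X ≤ Z) {R : ℝ} (hR1 : 1 ≤ R)
    (hR : R ^ 2 * U ^ 64 ≤ X) (hRω : R * hgt a h * U ^ 64 ≤ X) (hRZ : R ≤ Z) (I : Finset ℕ)
    (hI : ∀ l ∈ I, Squarefree l ∧ a.Coprime l ∧ (l : ℝ) ≤ R) :
    ∑ l ∈ I, ‖weylSum a h l k g ⌊X⌋₊‖ ≤ 2 * X / U := by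
  have hl0 : ∀ l ∈ I, l ≠ 0 := fun l hl => (hI l hl).1.ne_zero
  have hlZ : ∀ l ∈ I, l ≤ Z := fun l hl => by
    exact_mod_cast (hI l hl).2.2.trans hRZ
  rw [← sum_fiberwise_of_maps_to (t := range (Nat.log 2 Z + 1)) (g := fun l => Nat.log 2 l)
    (fun l hl => mem_range.mpr (Nat.lt_succ_of_le (Nat.log_mono_right (hlZ l hl))))]
  calc _ ≤ ∑ j ∈ range (Nat.log 2 Z + 1), X / U ^ 2 := by
        refine sum_le_sum fun j _ => ?_
        rcases (I.filter fun l => Nat.log 2 l = j).eq_empty_or_nonempty with h0 | ⟨l, hl⟩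
        · rw [h0, sum_empty]; positivity
        have hmem : ∀ l ∈ I.filter (fun l => Nat.log 2 l = j), 2 ^ j ≤ l ∧ l < 2 ^ (j + 1) := by
          intro l hl
          rw [mem_filter] at hl
          rw [← hl.2]
          exact ⟨Nat.pow_log_le_self 2 (hl0 l hl.1), Nat.lt_pow_succ_log_self (by norm_num) l⟩
        refine H.sum_norm_weylSum_block_le hU hX hg hLg hk hkU hkω hZ hR1 hR hRω _
          (Δ := 2 ^ j) (one_le_pow₀ (by norm_num)) ?_ ?_ ?_
        · refine le_trans ?_ (hI l (mem_filter.mp hl).1).2.2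
          exact_mod_cast (hmem l hl).1
        · intro l hl
          have h1 := hI l (mem_filter.mp hl).1
          exact ⟨h1.1, h1.2.1, by exact_mod_cast (hmem l hl).1, h1.2.2⟩
        · have h1 : #(I.filter fun l => Nat.log 2 l = j) ≤ (Ico (2 ^ j) (2 ^ (j + 1))).card :=
            card_le_card fun l hl => mem_Ico.mpr (hmem l hl)
          rw [Nat.card_Ico, pow_succ] at h1
          exact_mod_cast (show _ ≤ 2 ^ j by omega)
    _ = (Nat.log 2 Z + 1 : ℕ) * (X / U ^ 2) := by simp
    _ ≤ (2 * U) * (X / U ^ 2) := by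
        gcongr
        have h1 : (Nat.log 2 Z : ℝ) ≤ log Z / log 2 := by
          have := natLog_le_logb Z 2
          rwa [logb] at this
        have h2 := log_two_gt_d9
        have h3 := log_natCast_nonneg Z
        have h4 : log Z / log 2 ≤ 2 * log Z := by
          rw [div_le_iff₀ (by linarith)]; nlinarith
        have h5 := H.log_le
        push_cast
        linarith
    _ = _ := by field_simp

end IsScale

end

section

/-- All prime factors of `m` are at least `z`. -/
def Rough (z m : ℕ) : Prop := ∀ p, p.Prime → p ∣ m → z ≤ p

/-- The number of prime factors of `m` below `y`. -/
def smallOmega (y m : ℕ) : ℕ := #(m.primeFactors.filter (· < y))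

/-- The primes in `[w, y)`. -/
def primesIco (w y : ℕ) : Finset ℕ := (Ico w y).filter Nat.Prime

/-- `1` and the primes in `[y, v]`. -/
def sieveSet (y v : ℕ) : Finset ℕ := insert 1 ((Icc y v).filter Nat.Prime)

/-- The sign attached to an element of `sieveSet`. -/
def sieveSign (e : ℕ) : ℝ := if e = 1 then 1 else -1

/-- The sifting function: integers without prime factors below `z`, corrected by those with one
prime factor in `[y, v]`. -/
def sieveWt (y v z n : ℕ) : ℝ :=
  ∑ e ∈ sieveSet y v, if e ∣ n ∧ Rough z (n / e) then sieveSign e else 0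

/-- The coefficient of the bilinear sum in the sieve identity. -/
def sieveCoeff (y v w M : ℕ) : ℝ :=
  ∑ e ∈ sieveSet y v,
    if e ∣ M ∧ Rough w (M / e) then sieveSign e / (1 + smallOmega y (M / e)) else 0

variable {y v w n m r e : ℕ}

lemma mem_sieveSet : e ∈ sieveSet y v ↔ e = 1 ∨ (e.Prime ∧ y ≤ e ∧ e ≤ v) := by
  simp [sieveSet, and_comm]

lemma mem_primesIco : r ∈ primesIco w y ↔ r.Prime ∧ w ≤ r ∧ r < y := by
  simp [primesIco, and_comm]

lemma abs_sieveSign (e : ℕ) : |sieveSign e| = 1 := by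
  unfold sieveSign; split_ifs <;> simp

lemma card_sieveSet_filter_dvd_le (hn : n ≠ 0) : #((sieveSet y v).filter (· ∣ n)) ≤ tau n :=
  card_le_card fun _ he => Nat.mem_divisors.mpr ⟨(mem_filter.mp he).2, hn⟩

lemma abs_sieveSum_le (hn : n ≠ 0) (f : ℕ → ℝ) (hf : ∀ e, |f e| ≤ 1)
    (p : ℕ → Prop) : |∑ e ∈ sieveSet y v, if e ∣ n ∧ p e then f e else 0| ≤ tau n := by
  calc _ ≤ ∑ e ∈ sieveSet y v, if e ∣ n then (1 : ℝ) else 0 := by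
        refine (abs_sum_le_sum_abs _ _).trans (sum_le_sum fun e _ => ?_)
        by_cases h1 : e ∣ n <;> by_cases h2 : p e <;> simp [h1, h2, hf]
    _ = #((sieveSet y v).filter (· ∣ n)) := by rw [sum_ite]; simp
    _ ≤ tau n := mod_cast card_sieveSet_filter_dvd_le hn

lemma abs_sieveWt_le (hn : n ≠ 0) (z : ℕ) : |sieveWt y v z n| ≤ tau n :=
  abs_sieveSum_le hn _ (fun e => (abs_sieveSign e).le) _

lemma abs_sieveSign_div_le (e c : ℕ) : |sieveSign e / (1 + (c : ℝ))| ≤ 1 := by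
  rw [abs_div, abs_sieveSign, abs_of_nonneg (by positivity)]
  exact div_le_one_of_le₀ (by linarith [(Nat.cast_nonneg c : (0 : ℝ) ≤ c)]) (by positivity)

lemma abs_sieveCoeff_le {M : ℕ} (hM : M ≠ 0) : |sieveCoeff y v w M| ≤ tau M :=
  abs_sieveSum_le hM _ (fun e => abs_sieveSign_div_le e _) _

lemma smallOmega_eq_zero_iff (hm : m ≠ 0) : smallOmega y m = 0 ↔ Rough y m := by
  rw [smallOmega, card_eq_zero, filter_eq_empty_iff]
  constructor
  · intro h p hp hd
    exact not_lt.mp (h (Nat.mem_primeFactors.mpr ⟨hp, hd, hm⟩))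
  · intro h p hp
    exact not_lt.mpr (h p (Nat.prime_of_mem_primeFactors hp) (Nat.dvd_of_mem_primeFactors hp))

/-- Ramaré's identity. -/
lemma rough_indicator_eq (hwy : w ≤ y) (hm : m ≠ 0) :
    (if Rough y m then (1 : ℝ) else 0) = (if Rough w m then 1 else 0) -
      ∑ r ∈ primesIco w y, if r ∣ m ∧ Rough w m then (1 : ℝ) / smallOmega y m else 0 := by
  by_cases hw : Rough w m
  · have e1 : #((primesIco w y).filter (· ∣ m)) = smallOmega y m := by
      unfold smallOmega
      congr 1
      ext r
      rw [mem_filter, mem_filter, mem_primesIco, Nat.mem_primeFactors]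
      exact ⟨fun h => ⟨⟨h.1.1, h.2, hm⟩, h.1.2.2⟩, fun h =>
        ⟨⟨h.1.1, hw r h.1.1 h.1.2.1, h.2⟩, h.1.2.1⟩⟩
    simp only [hw, and_true, if_true]
    rw [sum_ite, sum_const_zero, add_zero, sum_const, e1, nsmul_eq_mul]
    by_cases hy : Rough y m
    · rw [(smallOmega_eq_zero_iff hm).mpr hy]; simp [hy]
    · have : (smallOmega y m : ℝ) ≠ 0 := by
        exact_mod_cast fun h => hy ((smallOmega_eq_zero_iff hm).mp h)
      rw [if_neg hy]; field_simp; norm_num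
  · have : ¬ Rough y m := fun h => hw fun p hp hd => hwy.trans (h p hp hd)
    simp [hw, this]

lemma rough_mul_iff (hr : r.Prime) (hwr : w ≤ r) : Rough w (r * m) ↔ Rough w m := by
  refine ⟨fun h p hp hd => h p hp (hd.mul_left r), fun h p hp hd => ?_⟩
  rcases (hp.dvd_mul).mp hd with h1 | h1
  · rwa [(Nat.prime_dvd_prime_iff_eq hp hr).mp h1]
  · exact h p hp h1

lemma smallOmega_mul (hr : r.Prime) (hry : r < y) (hm : m ≠ 0) (hd : ¬ r ∣ m) :
    smallOmega y (r * m) = 1 + smallOmega y m := by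
  unfold smallOmega
  rw [Nat.primeFactors_mul hr.ne_zero hm, hr.primeFactors, filter_union,
    filter_singleton, if_pos hry, card_union_of_disjoint, card_singleton]
  rw [disjoint_singleton_left, mem_filter, Nat.mem_primeFactors]
  tauto

lemma smallOmega_pos (hr : r.Prime) (hry : r < y) (hm : m ≠ 0) : 1 ≤ smallOmega y (r * m) := by
  refine card_pos.mpr ⟨r, mem_filter.mpr ⟨?_, hry⟩⟩
  exact Nat.mem_primeFactors.mpr ⟨hr, dvd_mul_right _ _, mul_ne_zero hr.ne_zero hm⟩

/-- The sieve identity: removing the prime factors in `[w, y)` produces a bilinear sum, up to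
integers with a square factor. -/
lemma abs_sieveWt_sub_le (hwy : w ≤ y) (hn : n ≠ 0) :
    |sieveWt y v y n - (sieveWt y v w n -
      ∑ r ∈ primesIco w y, if r ∣ n then sieveCoeff y v w (n / r) else 0)| ≤
      ∑ r ∈ primesIco w y, if r ^ 2 ∣ n then (tau n : ℝ) else 0 := by
  have e1 : sieveWt y v y n = sieveWt y v w n - ∑ r ∈ primesIco w y, ∑ e ∈ sieveSet y v,
      if e ∣ n ∧ (r ∣ n / e ∧ Rough w (n / e)) then sieveSign e / smallOmega y (n / e) else 0 := by
    rw [sum_comm, sieveWt, sieveWt, ← sum_sub_distrib]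
    refine sum_congr rfl fun e _ => ?_
    by_cases he : e ∣ n
    · have h0 : n / e ≠ 0 := (Nat.div_pos (Nat.le_of_dvd (Nat.pos_of_ne_zero hn) he)
        (Nat.pos_of_dvd_of_pos he (Nat.pos_of_ne_zero hn))).ne'
      have := congrArg (sieveSign e * ·) (rough_indicator_eq hwy h0)
      simp only [mul_sub, mul_sum, mul_ite, mul_one, mul_zero, mul_one_div] at this
      simpa [he] using this
    · simp [he]
  rw [e1, sub_sub_sub_cancel_left, ← sum_sub_distrib]
  refine (abs_sum_le_sum_abs _ _).trans (sum_le_sum fun r hr => ?_)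
  obtain ⟨pr, hwr, hry⟩ := mem_primesIco.mp hr
  by_cases hd : r ∣ n
  · obtain ⟨M, rfl⟩ := hd
    have hM : M ≠ 0 := right_ne_zero_of_mul hn
    rw [if_pos (dvd_mul_right _ _), Nat.mul_div_cancel_left _ pr.pos, sieveCoeff,
      ← sum_sub_distrib]
    have e2 : ∀ e ∈ sieveSet y v, e ∣ M → (if e ∣ M ∧ Rough w (M / e) then
        sieveSign e / (1 + smallOmega y (M / e) : ℝ) else 0) - (if e ∣ r * M ∧
        (r ∣ r * M / e ∧ Rough w (r * M / e)) then sieveSign e / smallOmega y (r * M / e) else 0) =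
        if Rough w (M / e) then sieveSign e * (1 / (1 + smallOmega y (M / e) : ℝ) -
          1 / smallOmega y (r * (M / e))) else 0 := by
      intro e _ he
      rw [Nat.mul_div_assoc r he, rough_mul_iff pr hwr]
      by_cases hR : Rough w (M / e)
      · simp [he, hR, he.mul_left r]; ring
      · simp [hR]
    have e3 : ∀ e ∈ sieveSet y v, ¬ e ∣ M → (if e ∣ M ∧ Rough w (M / e) then
        sieveSign e / (1 + smallOmega y (M / e) : ℝ) else 0) - (if e ∣ r * M ∧
        (r ∣ r * M / e ∧ Rough w (r * M / e)) then sieveSign e / smallOmega y (r * M / e) else 0) =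
        0 := by
      intro e _ he
      rw [if_neg (fun h => he h.1), if_neg, sub_zero]
      rintro ⟨⟨c, hc⟩, hrd, -⟩
      have he0 : 0 < e := Nat.pos_of_ne_zero fun h0 => hn (by rw [hc, h0, zero_mul])
      rw [hc, Nat.mul_div_cancel_left _ he0] at hrd
      obtain ⟨c', rfl⟩ := hrd
      exact he ⟨c', Nat.eq_of_mul_eq_mul_left pr.pos (by rw [hc]; ring)⟩
    by_cases hr2 : r ^ 2 ∣ r * M
    · rw [if_pos hr2]
      have hb : ∀ e ∈ sieveSet y v, |(if e ∣ M ∧ Rough w (M / e) then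
        sieveSign e / (1 + smallOmega y (M / e) : ℝ) else 0) - (if e ∣ r * M ∧
        (r ∣ r * M / e ∧ Rough w (r * M / e)) then sieveSign e / smallOmega y (r * M / e) else 0)| ≤
        if e ∣ r * M then 1 else 0 := by
        intro e he
        by_cases heM : e ∣ M
        · rw [e2 e he heM, if_pos (heM.mul_left r)]
          split_ifs with hR
          · have h0 : M / e ≠ 0 := (Nat.div_pos (Nat.le_of_dvd (Nat.pos_of_ne_zero hM) heM)
              (Nat.pos_of_dvd_of_pos heM (Nat.pos_of_ne_zero hM))).ne'
            have h1 : (1 : ℝ) ≤ smallOmega y (r * (M / e)) := by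
              exact_mod_cast smallOmega_pos pr hry h0
            rw [abs_mul, abs_sieveSign, one_mul]
            have h2 : 1 / (1 + (smallOmega y (M / e) : ℝ)) ≤ 1 := by
              rw [div_le_one (by positivity)]
              linarith [(Nat.cast_nonneg (smallOmega y (M / e)) : (0 : ℝ) ≤ _)]
            have h3 : 1 / (smallOmega y (r * (M / e)) : ℝ) ≤ 1 := by
              rw [div_le_one (by linarith)]; exact h1
            exact abs_sub_le_of_nonneg_of_le (by positivity) h2 (by positivity) h3
          · simp
        · grind
      refine (abs_sum_le_sum_abs _ _).trans ((sum_le_sum hb).trans ?_)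
      rw [sum_ite, sum_const_zero, add_zero, sum_const, nsmul_eq_mul, mul_one]
      exact_mod_cast card_sieveSet_filter_dvd_le hn
    · rw [if_neg hr2, sum_eq_zero, abs_zero]
      intro e he
      by_cases heM : e ∣ M
      · have h0 : M / e ≠ 0 := (Nat.div_pos (Nat.le_of_dvd (Nat.pos_of_ne_zero hM) heM)
              (Nat.pos_of_dvd_of_pos heM (Nat.pos_of_ne_zero hM))).ne'
        rw [e2 e he heM, smallOmega_mul pr hry h0]
        · grind
        · intro hd
          apply hr2
          rw [sq]
          exact Nat.mul_dvd_mul_left r (hd.trans (Nat.div_dvd_of_dvd heM))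
      · grind
  · have h1 : ¬ r ^ 2 ∣ n := fun h => hd ((dvd_pow_self r two_ne_zero).trans h)
    rw [if_neg hd, if_neg h1, sum_eq_zero, sub_zero, abs_zero]
    intro e _
    rw [if_neg]
    rintro ⟨he, hrd, -⟩
    exact hd (hrd.trans (Nat.div_dvd_of_dvd he))

end

section

/-- The integer has only prime factors below `w` and is squarefree. -/
def SqfSmooth (w d : ℕ) : Prop := Squarefree d ∧ ∀ p, p.Prime → p ∣ d → p < w

/-- The squarefree integers up to `D` all of whose prime factors are below `w`. -/
def smoothSet (w D : ℕ) : Finset ℕ := (Icc 1 D).filter (SqfSmooth w)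

variable {y v w n m t : ℕ}

lemma two_pow_card_primeFactors_le (hn : n ≠ 0) : 2 ^ n.primeFactors.card ≤ tau n := by
  rw [tau, Nat.card_divisors hn]
  refine pow_card_le_prod _ _ _ fun p hp => ?_
  have := (Nat.mem_primeFactors.mp hp)
  have h1 := (this.1.dvd_iff_one_le_factorization hn).mp this.2.1
  omega

lemma filter_smooth_divisors_eq (hm : m ≠ 0) :
    m.divisors.filter (SqfSmooth w) = (∏ p ∈ m.primeFactors.filter (· < w), p).divisors := by
  have hpr : ∀ p ∈ m.primeFactors.filter (· < w), p.Prime := fun p hp =>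
    Nat.prime_of_mem_primeFactors (mem_filter.mp hp).1
  have h0 : ∏ p ∈ m.primeFactors.filter (· < w), p ≠ 0 :=
    prod_ne_zero_iff.mpr fun p hp => (hpr p hp).ne_zero
  have hsq : Squarefree (∏ p ∈ m.primeFactors.filter (· < w), p) := by
    refine squarefree_prod_of_pairwise_isCoprime (fun p hp q hq hpq => ?_)
      fun p hp => (hpr p hp).prime.squarefree
    exact Nat.coprime_iff_isRelPrime.mp ((Nat.coprime_primes (hpr p hp) (hpr q hq)).mpr hpq)
  have hdm : ∏ p ∈ m.primeFactors.filter (· < w), p ∣ m :=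
    (prod_dvd_prod_of_subset _ _ _ (filter_subset _ _)).trans
      (Nat.prod_primeFactors_dvd m)
  ext d
  rw [mem_filter, Nat.mem_divisors, Nat.mem_divisors]
  constructor
  · rintro ⟨⟨hd, -⟩, hs, hp⟩
    refine ⟨?_, h0⟩
    rw [← Nat.prod_primeFactors_of_squarefree hs]
    refine prod_dvd_prod_of_subset _ _ _ fun p hpd => ?_
    have h1 := Nat.mem_primeFactors.mp hpd
    exact mem_filter.mpr ⟨Nat.mem_primeFactors.mpr ⟨h1.1, h1.2.1.trans hd, hm⟩,
      hp p h1.1 h1.2.1⟩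
  · rintro ⟨hd, -⟩
    refine ⟨⟨hd.trans hdm, hm⟩, hsq.squarefree_of_dvd hd, fun p pp hp => ?_⟩
    obtain ⟨q, hq, hpq⟩ := (pp.prime.dvd_finsetProd_iff _).mp (hp.trans hd)
    rw [(Nat.prime_dvd_prime_iff_eq pp (hpr q hq)).mp hpq]
    exact (mem_filter.mp hq).2

/-- Legendre's identity. -/
lemma sum_moebius_smooth (hm : m ≠ 0) :
    ∑ d ∈ m.divisors.filter (SqfSmooth w), (ArithmeticFunction.moebius d : ℝ) =
      if Rough w m then 1 else 0 := by
  have hpr : ∀ p ∈ m.primeFactors.filter (· < w), p.Prime := fun p hp =>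
    Nat.prime_of_mem_primeFactors (mem_filter.mp hp).1
  have key : ((∏ p ∈ m.primeFactors.filter (· < w), p) = 1) ↔ Rough w m := by
    rw [← smallOmega_eq_zero_iff hm, smallOmega, card_eq_zero]
    constructor
    · intro h
      rw [eq_empty_iff_forall_notMem]
      intro p hp
      have := dvd_prod_of_mem (fun p => p) hp
      rw [h] at this
      exact (hpr p hp).one_lt.ne' (Nat.dvd_one.mp this)
    · intro h; rw [h, prod_empty]
  rw [filter_smooth_divisors_eq hm]
  have h1 := congrArg (fun f => f (∏ p ∈ m.primeFactors.filter (· < w), p))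
    ArithmeticFunction.moebius_mul_coe_zeta
  simp only [ArithmeticFunction.coe_mul_zeta_apply, ArithmeticFunction.one_apply, key] at h1
  exact_mod_cast h1

/-- A squarefree smooth integer that is large has many divisors. -/
lemma lt_tau_of_smooth (hw : w ≤ 2 ^ t) {d : ℕ} (hd : SqfSmooth w d) (hD : 2 ^ (t * t) < d) :
    2 ^ t < tau d := by
  have h0 : d ≠ 0 := hd.1.ne_zero
  refine lt_of_lt_of_le ?_ (two_pow_card_primeFactors_le h0)
  have h1 : d ≤ (2 ^ t) ^ d.primeFactors.card := by
    conv_lhs => rw [← Nat.prod_primeFactors_of_squarefree hd.1]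
    refine prod_le_pow_card _ _ _ fun p hp => ?_
    have := Nat.mem_primeFactors.mp hp
    exact (hd.2 p this.1 this.2.1).le.trans hw
  rw [← pow_mul] at h1
  have h2 := (Nat.pow_lt_pow_iff_right (by norm_num : 1 < 2)).mp (hD.trans_le h1)
  exact Nat.pow_lt_pow_right (by norm_num) (Nat.lt_of_mul_lt_mul_left h2)

lemma abs_rough_sub_sum_le (hw : w ≤ 2 ^ t) (hm : m ≠ 0) :
    |(if Rough w m then (1 : ℝ) else 0) - ∑ d ∈ smoothSet w (2 ^ (t * t)),
      if d ∣ m then (ArithmeticFunction.moebius d : ℝ) else 0| ≤ (tau m : ℝ) ^ 2 / 2 ^ t := by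
  rw [← sum_moebius_smooth hm, ← sum_filter,
    ← sum_filter_add_sum_filter_not (m.divisors.filter (SqfSmooth w)) (· ≤ 2 ^ (t * t))]
  have e1 : (m.divisors.filter (SqfSmooth w)).filter (· ≤ 2 ^ (t * t)) =
      (smoothSet w (2 ^ (t * t))).filter (· ∣ m) := by
    ext d
    simp only [smoothSet, mem_filter, Nat.mem_divisors, mem_Icc]
    constructor
    · rintro ⟨⟨⟨h1, -⟩, h2⟩, h3⟩
      exact ⟨⟨⟨h2.1.ne_zero.pos, h3⟩, h2⟩, h1⟩
    · rintro ⟨⟨⟨-, h3⟩, h2⟩, h1⟩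
      exact ⟨⟨⟨h1, hm⟩, h2⟩, h3⟩
  rw [e1, add_sub_cancel_left]
  set S := (m.divisors.filter (SqfSmooth w)).filter fun d => ¬ d ≤ 2 ^ (t * t) with hS
  have hcard : (#S : ℝ) ≤ tau m := by
    exact_mod_cast card_le_card
      ((filter_subset _ _).trans (filter_subset _ _))
  have h1 : |∑ d ∈ S, (ArithmeticFunction.moebius d : ℝ)| ≤ #S := by
    refine (abs_sum_le_sum_abs _ _).trans ?_
    calc _ ≤ ∑ d ∈ S, (1 : ℝ) := sum_le_sum fun d _ => by
          exact_mod_cast ArithmeticFunction.abs_moebius_le_one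
      _ = #S := by simp
  rcases S.eq_empty_or_nonempty with h0 | ⟨d, hd⟩
  · rw [h0, sum_empty, abs_zero]; positivity
  · simp only [hS, mem_filter, Nat.mem_divisors, not_le] at hd
    have h2 : (2 : ℝ) ^ t ≤ tau m := by
      exact_mod_cast (lt_tau_of_smooth hw hd.1.2 hd.2).le.trans (tau_le_of_dvd hm hd.1.1.1)
    rw [le_div_iff₀ (by positivity), sq]
    exact mul_le_mul (h1.trans hcard) h2 (by positivity) (by positivity)

/-- The sifting function for small primes is a divisor sum, up to integers with many divisors. -/
lemma abs_sieveWt_sub_divisorSum_le (hw : w ≤ 2 ^ t) (hn : n ≠ 0) :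
    |sieveWt y v w n - ∑ e ∈ sieveSet y v, ∑ d ∈ smoothSet w (2 ^ (t * t)),
      if e * d ∣ n then sieveSign e * (ArithmeticFunction.moebius d : ℝ) else 0| ≤
      (tau n : ℝ) ^ 3 / 2 ^ t := by
  rw [sieveWt, ← sum_sub_distrib]
  have hb : ∀ e ∈ sieveSet y v, |(if e ∣ n ∧ Rough w (n / e) then sieveSign e else 0) -
      ∑ d ∈ smoothSet w (2 ^ (t * t)),
        if e * d ∣ n then sieveSign e * (ArithmeticFunction.moebius d : ℝ) else 0| ≤
      if e ∣ n then (tau n : ℝ) ^ 2 / 2 ^ t else 0 := by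
    intro e _
    by_cases he : e ∣ n
    · have he0 := Nat.pos_of_dvd_of_pos he hn.pos
      obtain ⟨m, rfl⟩ := he
      have hm : m ≠ 0 := right_ne_zero_of_mul hn
      rw [Nat.mul_div_cancel_left _ he0, if_pos (dvd_mul_right _ _)]
      have e1 : ∀ d : ℕ, (e * d ∣ e * m) ↔ d ∣ m := fun d =>
        Nat.mul_dvd_mul_iff_left he0
      have e2 : (if e ∣ e * m ∧ Rough w m then sieveSign e else 0) -
          ∑ d ∈ smoothSet w (2 ^ (t * t)),
          (if e * d ∣ e * m then sieveSign e * (ArithmeticFunction.moebius d : ℝ) else 0) =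
          sieveSign e * ((if Rough w m then (1 : ℝ) else 0) - ∑ d ∈ smoothSet w (2 ^ (t * t)),
          if d ∣ m then (ArithmeticFunction.moebius d : ℝ) else 0) := by
        simp only [e1, mul_sub, mul_sum, mul_ite, mul_one, mul_zero, dvd_mul_right, true_and]
      rw [e2, abs_mul, abs_sieveSign, one_mul]
      refine (abs_rough_sub_sum_le hw hm).trans ?_
      have : (tau m : ℝ) ≤ tau (e * m) := by
        exact_mod_cast tau_le_of_dvd hn (dvd_mul_left m e)
      gcongr
    · rw [if_neg (fun h => he h.1), if_neg he, sum_eq_zero, sub_zero, abs_zero]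
      intro d _
      exact if_neg fun h => he ((dvd_mul_right e d).trans h)
  refine (abs_sum_le_sum_abs _ _).trans ((sum_le_sum hb).trans ?_)
  rw [sum_ite, sum_const_zero, add_zero, sum_const, nsmul_eq_mul]
  calc _ ≤ (tau n : ℝ) * ((tau n : ℝ) ^ 2 / 2 ^ t) := by
        gcongr; exact card_sieveSet_filter_dvd_le hn
    _ = _ := by ring

end

section

variable {y v w n m t N : ℕ}

lemma sieveWt_eq_zero_of_not_rough (h : ¬ Rough y n) : sieveWt y v y n = 0 := by
  refine sum_eq_zero fun e he => if_neg ?_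
  rintro ⟨hd, hr⟩
  refine h fun r pr hrn => ?_
  by_contra hlt
  have h1 : r ∣ e * (n / e) := by rwa [Nat.mul_div_cancel' hd]
  rcases (pr.dvd_mul).mp h1 with h2 | h2
  · rcases mem_sieveSet.mp he with rfl | ⟨pe, hye, -⟩
    · exact pr.one_lt.ne' (Nat.dvd_one.mp h2)
    · rw [(Nat.prime_dvd_prime_iff_eq pr pe).mp h2] at hlt; exact hlt hye
  · exact hlt (hr r pr h2)

lemma sieveWt_prime (hp : n.Prime) (hyn : y ≤ n) (hv : v < n) : sieveWt y v y n = 1 := by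
  rw [sieveWt, sum_eq_single 1]
  · rw [if_pos, sieveSign, if_pos rfl]
    refine ⟨one_dvd _, fun p pp hd => ?_⟩
    rw [Nat.div_one] at hd
    rwa [(Nat.prime_dvd_prime_iff_eq pp hp).mp hd]
  · intro e he h1
    refine if_neg fun h => ?_
    rcases mem_sieveSet.mp he with rfl | ⟨pe, -, hev⟩
    · exact h1 rfl
    · rw [(Nat.prime_dvd_prime_iff_eq pe hp).mp h.1] at hev; omega
  · intro h; exact absurd (mem_sieveSet.mpr (Or.inl rfl)) h

lemma sieveWt_mul_prime {p q : ℕ} (hp : p.Prime) (hq : q.Prime) (hyp : y ≤ p) (hpv : p ≤ v)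
    (hvq : v < q) : sieveWt y v y (p * q) = 0 := by
  have hR : Rough y (p * q) := by
    intro r pr hd
    rcases (pr.dvd_mul).mp hd with h | h
    · rwa [(Nat.prime_dvd_prime_iff_eq pr hp).mp h]
    · rw [(Nat.prime_dvd_prime_iff_eq pr hq).mp h]; omega
  rw [sieveWt, ← sum_subset (s₁ := {1, p})]
  · rw [sum_pair hp.one_lt.ne, Nat.div_one, Nat.mul_div_cancel_left _ hp.pos,
      if_pos ⟨one_dvd _, hR⟩, if_pos ⟨dvd_mul_right _ _, fun r pr hd => hR r pr (hd.mul_left p)⟩,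
      sieveSign, sieveSign, if_pos rfl, if_neg hp.one_lt.ne']
    norm_num
  · intro e he
    rw [mem_insert, mem_singleton] at he
    rcases he with rfl | rfl
    · exact mem_sieveSet.mpr (Or.inl rfl)
    · exact mem_sieveSet.mpr (Or.inr ⟨hp, hyp, hpv⟩)
  · intro e he hne
    rw [mem_insert, mem_singleton, not_or] at hne
    refine if_neg fun h => ?_
    rcases mem_sieveSet.mp he with rfl | ⟨pe, -, hev⟩
    · exact hne.1 rfl
    rcases (pe.dvd_mul).mp h.1 with h1 | h1
    · exact hne.2 ((Nat.prime_dvd_prime_iff_eq pe hp).mp h1)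
    · rw [(Nat.prime_dvd_prime_iff_eq pe hq).mp h1] at hev; omega

/-- The integers where the sifting function may fail to detect primes. -/
def IsExceptional (y v N n : ℕ) : Prop :=
  (∃ p q : ℕ, p.Prime ∧ q.Prime ∧ v < p ∧ p * p ≤ N ∧ n = p * q) ∨
    ∃ p q r : ℕ, p.Prime ∧ q.Prime ∧ r.Prime ∧ y ≤ p ∧ y ≤ q ∧ y ≤ r ∧ n = p * q * r

lemma IsExceptional.tau_le (h : IsExceptional y v N n) : tau n ≤ 8 := by
  have ht {p : ℕ} (hp : p.Prime) : tau p = 2 := by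
    rw [tau, hp.divisors, card_pair hp.one_lt.ne]
  rcases h with ⟨p, q, hp, hq, -, -, rfl⟩ | ⟨p, q, r, hp, hq, hr, -, -, -, rfl⟩
  · refine (tau_mul_le p q).trans ?_
    rw [ht hp, ht hq]; norm_num
  · refine (tau_mul_le (p * q) r).trans ?_
    have := tau_mul_le p q
    rw [ht hp, ht hq] at this
    rw [ht hr]; omega

lemma isExceptional_of_sieveWt_ne_zero (hy : 2 ≤ y) (hyv : y ≤ v) (hN : N < y ^ 4) (hn : v * v < n)
    (hnN : n ≤ N) (hp : ¬ n.Prime) (h0 : sieveWt y v y n ≠ 0) : IsExceptional y v N n := by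
  have hR : Rough y n := by
    by_contra h; exact h0 (sieveWt_eq_zero_of_not_rough h)
  have hvv : v ≤ v * v := Nat.le_mul_self v
  have hn1 : n ≠ 1 := by omega
  have hn0 : n ≠ 0 := by omega
  have pp := Nat.minFac_prime hn1
  set p := n.minFac with hpdef
  have hyp : y ≤ p := hR p pp (Nat.minFac_dvd n)
  obtain ⟨m, hm⟩ := Nat.minFac_dvd n
  rw [← hpdef] at hm
  have hRm : Rough y m := fun r pr hd => hR r pr (hm ▸ hd.mul_left p)
  have hm1 : m ≠ 1 := fun h => hp (by rw [hm, h, mul_one]; exact pp)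
  have hm0 : m ≠ 0 := fun h => hn0 (by rw [hm, h, mul_zero])
  by_cases pm : m.Prime
  · left
    have hpm : p ≤ m := Nat.minFac_le_of_dvd pm.two_le (hm ▸ dvd_mul_left m p)
    have hvm : v < m := by
      by_contra h
      have : p * m ≤ v * v := Nat.mul_le_mul (hpm.trans (not_lt.mp h)) (not_lt.mp h)
      omega
    refine ⟨p, m, pp, pm, ?_, ?_, hm⟩
    · by_contra h
      exact h0 (by rw [hm]; exact sieveWt_mul_prime pp pm hyp (not_lt.mp h) hvm)
    · exact (Nat.mul_le_mul_left p hpm).trans (by omega)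
  · right
    have pq := Nat.minFac_prime hm1
    set q := m.minFac with hqdef
    have hyq : y ≤ q := hRm q pq (Nat.minFac_dvd m)
    obtain ⟨l, hl⟩ := Nat.minFac_dvd m
    rw [← hqdef] at hl
    have hRl : Rough y l := fun r pr hd => hRm r pr (hl ▸ hd.mul_left q)
    have hl1 : l ≠ 1 := fun h => pm (by rw [hl, h, mul_one]; exact pq)
    have pl : l.Prime := by
      by_contra h
      have pr := Nat.minFac_prime hl1
      have hyr := hRl _ pr (Nat.minFac_dvd l)
      obtain ⟨j, hj⟩ := Nat.minFac_dvd l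
      have hj1 : j ≠ 1 := fun h' => h (by rw [hj, h', mul_one]; exact pr)
      have hyj : y ≤ j := by
        have ps := Nat.minFac_prime hj1
        have h1 := hRl _ ps ((Nat.minFac_dvd j).trans (hj ▸ dvd_mul_left j _))
        refine h1.trans (Nat.minFac_le (Nat.pos_of_ne_zero fun h' => hm0 ?_))
        rw [hl, hj, h', mul_zero, mul_zero]
      have : y ^ 4 ≤ n := by
        rw [hm, hl, hj]
        calc y ^ 4 = y * (y * (y * y)) := by ring
          _ ≤ _ := by gcongr
      omega
    exact ⟨p, q, l, pp, pq, pl, hyp, hyq, hRl l pl dvd_rfl, by rw [hm, hl, mul_assoc]⟩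

/-- Away from the exceptional integers, the sifting function is the indicator of the primes. -/
lemma abs_prime_sub_sieveWt_le (hy : 2 ≤ y) (hyv : y ≤ v) (hN : N < y ^ 4) (hn : n ≠ 0)
    (hnN : n ≤ N) : |(if n.Prime then (1 : ℝ) else 0) - sieveWt y v y n| * (4 * tau n) ≤
      (if n ≤ v * v then 8 * (tau n : ℝ) ^ 2 else 0) +
        if IsExceptional y v N n then (256 : ℝ) else 0 := by
  have h1 : (1 : ℝ) ≤ tau n := mod_cast one_le_tau hn
  have hF := abs_sieveWt_le (y := y) (v := v) hn y
  by_cases hnv : n ≤ v * v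
  · rw [if_pos hnv]
    have : |(if n.Prime then (1 : ℝ) else 0) - sieveWt y v y n| ≤ 2 * tau n := by
      refine (abs_sub _ _).trans ?_
      have : |(if n.Prime then (1 : ℝ) else 0)| ≤ 1 := by split_ifs <;> simp
      linarith
    calc _ ≤ 2 * (tau n : ℝ) * (4 * tau n) := by gcongr
      _ = 8 * (tau n : ℝ) ^ 2 := by ring
      _ ≤ _ := by
        refine le_add_of_nonneg_right ?_
        split_ifs <;> norm_num
  · have hvv : v ≤ v * v := Nat.le_mul_self v
    rw [if_neg hnv, zero_add]
    by_cases hp : n.Prime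
    · rw [if_pos hp, sieveWt_prime hp (by omega) (by omega), sub_self, abs_zero, zero_mul]
      split_ifs <;> norm_num
    · rw [if_neg hp, zero_sub, abs_neg]
      by_cases h0 : sieveWt y v y n = 0
      · rw [h0, abs_zero, zero_mul]; split_ifs <;> norm_num
      · have hE := isExceptional_of_sieveWt_ne_zero hy hyv hN (not_le.mp hnv) hnN hp h0
        have h8 : (tau n : ℝ) ≤ 8 := mod_cast hE.tau_le
        rw [if_pos hE]
        calc _ ≤ 8 * (4 * (8 : ℝ)) := by gcongr; exact hF.trans h8
          _ = _ := by norm_num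

end

section

open Real

variable {y v w t N : ℕ} {b : ℕ → ℂ} {T₁ T₂ : ℝ}

/-- The linear part of the sieve decomposition. -/
lemma sum_divisorSum_mul_eq (s₁ s₂ : Finset ℕ) (h₁ : ∀ e ∈ s₁, 0 < e) (h₂ : ∀ d ∈ s₂, 0 < d)
    (c₁ c₂ : ℕ → ℝ) (N : ℕ) (b : ℕ → ℂ) :
    ∑ n ∈ Icc 1 N, ((∑ e ∈ s₁, ∑ d ∈ s₂, if e * d ∣ n then c₁ e * c₂ d else 0 : ℝ) : ℂ) * b n =
      ∑ x ∈ s₁ ×ˢ s₂, ((c₁ x.1 * c₂ x.2 : ℝ) : ℂ) *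
        ∑ m ∈ Icc 1 (N / (x.1 * x.2)), b (x.1 * x.2 * m) := by
  simp only [← sum_product', Complex.ofReal_sum, sum_mul]
  rw [sum_product_right]
  refine sum_congr rfl fun x hx => ?_
  rw [mem_product] at hx
  rw [← sum_filter_dvd (Nat.mul_pos (h₁ _ hx.1) (h₂ _ hx.2)), mul_sum, sum_filter]
  refine sum_congr rfl fun n _ => ?_
  split_ifs <;> simp

/-- The bilinear part of the sieve decomposition. -/
lemma norm_sum_sieveCoeff_le (hyN : y ≤ N) (hb0 : ∀ n, N < n → b n = 0) (hT₂ : 0 ≤ T₂)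
    (hII : ∀ j, 2 ^ (j + 1) > w → 2 ^ j < y → ∀ α : ℕ → ℝ, (∀ M ≠ 0, |α M| ≤ tau M) →
      ‖∑ r ∈ (primesIco w y).filter (Nat.log 2 · = j), ∑ M ∈ Icc 1 (N / 2 ^ j),
        (α M : ℂ) * b (r * M)‖ ≤ T₂) :
    ‖∑ n ∈ Icc 1 N, ((∑ r ∈ primesIco w y,
      if r ∣ n then sieveCoeff y v w (n / r) else 0 : ℝ) : ℂ) * b n‖ ≤ (Nat.log 2 N + 1) * T₂ := by
  have e1 : ∑ n ∈ Icc 1 N, ((∑ r ∈ primesIco w y,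
      if r ∣ n then sieveCoeff y v w (n / r) else 0 : ℝ) : ℂ) * b n =
      ∑ j ∈ range (Nat.log 2 N + 1), ∑ r ∈ (primesIco w y).filter (Nat.log 2 · = j),
        ∑ M ∈ Icc 1 (N / 2 ^ j), (sieveCoeff y v w M : ℂ) * b (r * M) := by
    have e2 : ∀ r ∈ primesIco w y, ∑ n ∈ Icc 1 N,
        ((if r ∣ n then sieveCoeff y v w (n / r) else 0 : ℝ) : ℂ) * b n =
        ∑ M ∈ Icc 1 (N / 2 ^ Nat.log 2 r), (sieveCoeff y v w M : ℂ) * b (r * M) := by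
      intro r hr
      have pr := (mem_primesIco.mp hr).1
      have h1 := sum_filter_dvd pr.pos N fun n => ((sieveCoeff y v w (n / r) : ℝ) : ℂ) * b n
      rw [sum_filter] at h1
      calc _ = ∑ n ∈ Icc 1 N, if r ∣ n then ((sieveCoeff y v w (n / r) : ℝ) : ℂ) * b n else 0 :=
            sum_congr rfl fun n _ => by split_ifs <;> simp
        _ = ∑ M ∈ Icc 1 (N / r), (sieveCoeff y v w M : ℂ) * b (r * M) := by
            rw [h1]
            refine sum_congr rfl fun M _ => ?_
            rw [Nat.mul_div_cancel_left _ pr.pos]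
        _ = _ := by
            refine sum_subset ?_ ?_
            · refine Icc_subset_Icc_right (Nat.div_le_div_left ?_ (by positivity))
              exact Nat.pow_log_le_self 2 pr.ne_zero
            · intro M hM hM'
              rw [mem_Icc] at hM hM'
              have : N / r < M := by
                by_contra h; exact hM' ⟨hM.1, not_lt.mp h⟩
              rw [hb0 (r * M) (by rw [mul_comm]; exact (Nat.div_lt_iff_lt_mul pr.pos).mp this),
                mul_zero]
    simp only [Complex.ofReal_sum, sum_mul]
    rw [sum_comm, sum_congr rfl e2, ← sum_fiberwise_of_maps_to
      (t := range (Nat.log 2 N + 1)) (g := fun r : ℕ => Nat.log 2 r)]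
    · refine sum_congr rfl fun j _ => sum_congr rfl fun r hr => ?_
      rw [(mem_filter.mp hr).2]
    · intro r hr
      exact mem_range.mpr (Nat.lt_succ_of_le (Nat.log_mono_right
        ((mem_primesIco.mp hr).2.2.le.trans hyN)))
  rw [e1]
  calc _ ≤ ∑ j ∈ range (Nat.log 2 N + 1), T₂ := by
        refine norm_sum_le_of_le _ fun j _ => ?_
        rcases ((primesIco w y).filter (Nat.log 2 · = j)).eq_empty_or_nonempty with h0 | ⟨r, hr⟩
        · rw [h0, sum_empty, norm_zero]; exact hT₂
        · rw [mem_filter, mem_primesIco] at hr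
          obtain ⟨⟨pr, hwr, hry⟩, rfl⟩ := hr
          exact hII _ (hwr.trans_lt (Nat.lt_pow_succ_log_self (by norm_num) r))
            ((Nat.pow_log_le_self 2 pr.ne_zero).trans_lt hry) _
            fun M hM => abs_sieveCoeff_le hM
    _ = _ := by simp

/-- Integers divisible by the square of a large prime contribute little. -/
lemma sum_tau_sq_square_le (hw : 1 ≤ w) :
    ∑ n ∈ Icc 1 N, (∑ r ∈ primesIco w y, if r ^ 2 ∣ n then (tau n : ℝ) else 0) * (4 * tau n) ≤
      72 * N * (1 + log N) ^ 3 / w := by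
  have hL : 0 ≤ 1 + log N := by linarith [log_natCast_nonneg N]
  simp only [sum_mul]
  rw [sum_comm]
  calc _ ≤ ∑ r ∈ primesIco w y, 36 * N * (1 + log N) ^ 3 * ((r : ℝ) ^ 2)⁻¹ := by
        refine sum_le_sum fun r hr => ?_
        have pr := (mem_primesIco.mp hr).1
        have h1 := sum_filter_dvd (pow_pos pr.pos 2) N fun n => (tau n : ℝ) * (4 * tau n)
        rw [sum_filter] at h1
        calc _ = ∑ n ∈ Icc 1 N, if r ^ 2 ∣ n then (tau n : ℝ) * (4 * tau n) else 0 :=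
              sum_congr rfl fun n _ => by split_ifs <;> simp
          _ = _ := h1
          _ ≤ ∑ m ∈ Icc 1 (N / r ^ 2), 36 * (tau m : ℝ) ^ 2 := by
              refine sum_le_sum fun m _ => ?_
              have h2 : (tau (r ^ 2 * m) : ℝ) ≤ 3 * tau m := by
                have := tau_mul_le (r ^ 2) m
                rw [tau, tau, Nat.divisors_prime_pow pr, card_map, card_range] at this
                exact_mod_cast this
              calc _ ≤ (3 * (tau m : ℝ)) * (4 * (3 * tau m)) := by gcongr
                _ = _ := by ring
          _ ≤ 36 * (((N / r ^ 2 : ℕ) : ℝ) * (1 + log (N / r ^ 2 : ℕ)) ^ 3) := by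
              rw [← mul_sum]
              gcongr
              exact sum_tau_pow_le 2 _
          _ ≤ 36 * ((N / (r : ℝ) ^ 2) * (1 + log N) ^ 3) := by
              have h3 : ((N / r ^ 2 : ℕ) : ℝ) ≤ N / (r : ℝ) ^ 2 := by
                have := @Nat.cast_div_le ℝ _ _ _ N (r ^ 2)
                push_cast at this; exact this
              have h4 : 0 ≤ 1 + log (N / r ^ 2 : ℕ) := by
                linarith [log_natCast_nonneg (N / r ^ 2)]
              have h5 : log (N / r ^ 2 : ℕ) ≤ log N := by
                rcases Nat.eq_zero_or_pos (N / r ^ 2) with h0 | h0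
                · rw [h0]; simpa using log_natCast_nonneg N
                · exact log_le_log (mod_cast h0) (mod_cast Nat.div_le_self _ _)
              gcongr
          _ = _ := by field_simp
    _ ≤ ∑ r ∈ Ioo (w - 1) y, 36 * N * (1 + log N) ^ 3 * ((r : ℝ) ^ 2)⁻¹ := by
        refine sum_le_sum_of_subset_of_nonneg ?_ fun _ _ _ => by positivity
        intro r hr
        have := mem_primesIco.mp hr
        exact mem_Ioo.mpr ⟨by omega, this.2.2⟩
    _ ≤ 36 * N * (1 + log N) ^ 3 * (2 / w) := by
        rw [← mul_sum]
        gcongr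
        have := sum_Ioo_inv_sq_le (α := ℝ) (w - 1) y
        rwa [Nat.cast_sub hw, Nat.cast_one, sub_add_cancel] at this
    _ = _ := by ring

/-- The sieve bound for a sum over primes in terms of linear and bilinear sums. -/
theorem norm_sum_prime_le (hw1 : 1 ≤ w) (hwt : w ≤ 2 ^ t) (hwy : w ≤ y) (hy : 2 ≤ y) (hyv : y ≤ v)
    (hvN : v * v ≤ N) (hN : N < y ^ 4) (hb : ∀ n ≠ 0, ‖b n‖ ≤ 4 * tau n)
    (hb0 : ∀ n, N < n → b n = 0) (hT₂ : 0 ≤ T₂)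
    (hI : ∑ x ∈ sieveSet y v ×ˢ smoothSet w (2 ^ (t * t)),
      ‖∑ m ∈ Icc 1 (N / (x.1 * x.2)), b (x.1 * x.2 * m)‖ ≤ T₁)
    (hII : ∀ j, 2 ^ (j + 1) > w → 2 ^ j < y → ∀ α : ℕ → ℝ, (∀ M ≠ 0, |α M| ≤ tau M) →
      ‖∑ r ∈ (primesIco w y).filter (Nat.log 2 · = j), ∑ M ∈ Icc 1 (N / 2 ^ j),
        (α M : ℂ) * b (r * M)‖ ≤ T₂) :
    ‖∑ n ∈ Icc 1 N, if n.Prime then b n else 0‖ ≤ T₁ + (Nat.log 2 N + 1) * T₂ +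
      72 * N * (1 + log N) ^ 3 / w + 4 * N * (1 + log N) ^ 15 / 2 ^ t +
      8 * ((v * v : ℕ) : ℝ) * (1 + log N) ^ 3 +
      256 * #((Icc 1 N).filter (IsExceptional y v N)) := by
  set S : ℕ → ℝ := fun n => ∑ e ∈ sieveSet y v, ∑ d ∈ smoothSet w (2 ^ (t * t)),
      if e * d ∣ n then sieveSign e * (ArithmeticFunction.moebius d : ℝ) else 0 with hS
  set B : ℕ → ℝ := fun n => ∑ r ∈ primesIco w y,
    if r ∣ n then sieveCoeff y v w (n / r) else 0 with hB
  have hn0 : ∀ n ∈ Icc 1 N, n ≠ 0 := fun n hn => by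
    have := (mem_Icc.mp hn).1; omega
  have e1 : ∑ n ∈ Icc 1 N, (if n.Prime then b n else 0) =
      ∑ n ∈ Icc 1 N, (S n : ℂ) * b n - ∑ n ∈ Icc 1 N, (B n : ℂ) * b n +
      (∑ n ∈ Icc 1 N, ((sieveWt y v y n - (sieveWt y v w n - B n) : ℝ) : ℂ) * b n +
      ∑ n ∈ Icc 1 N, ((sieveWt y v w n - S n : ℝ) : ℂ) * b n +
      ∑ n ∈ Icc 1 N, (((if n.Prime then 1 else 0) - sieveWt y v y n : ℝ) : ℂ) * b n) := by
    rw [← sum_sub_distrib, ← sum_add_distrib, ← sum_add_distrib,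
      ← sum_add_distrib]
    refine sum_congr rfl fun n _ => ?_
    split_ifs <;> push_cast <;> ring
  have b1 : ‖∑ n ∈ Icc 1 N, (S n : ℂ) * b n‖ ≤ T₁ := by
    rw [hS]
    rw [sum_divisorSum_mul_eq _ _ (fun e he => ?_) (fun d hd => ?_)]
    · refine (norm_sum_le _ _).trans ((sum_le_sum fun x _ => ?_).trans hI)
      rw [norm_mul, Complex.norm_real, norm_eq_abs, abs_mul, abs_sieveSign, one_mul]
      refine mul_le_of_le_one_left (norm_nonneg _) ?_
      exact_mod_cast ArithmeticFunction.abs_moebius_le_one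
    · rcases mem_sieveSet.mp he with rfl | h
      · norm_num
      · exact h.1.pos
    · exact (mem_Icc.mp (mem_filter.mp hd).1).1
  have b2 := norm_sum_sieveCoeff_le (v := v) (by nlinarith : y ≤ N) hb0 hT₂ hII
  have gen (f : ℕ → ℝ) (c : ℕ → ℝ) (hf : ∀ n ∈ Icc 1 N, |f n| * (4 * tau n) ≤ c n) :
      ‖∑ n ∈ Icc 1 N, (f n : ℂ) * b n‖ ≤ ∑ n ∈ Icc 1 N, c n := by
    refine norm_sum_le_of_le _ fun n hn => ?_
    rw [norm_mul, Complex.norm_real, norm_eq_abs]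
    exact (mul_le_mul_of_nonneg_left (hb n (hn0 n hn)) (abs_nonneg _)).trans (hf n hn)
  have b3 := (gen _ _ fun n hn => mul_le_mul_of_nonneg_right
    (abs_sieveWt_sub_le (v := v) hwy (hn0 n hn)) (by positivity)).trans
    (sum_tau_sq_square_le (N := N) (y := y) hw1)
  have b4 := gen _ _ fun n hn => mul_le_mul_of_nonneg_right
    (abs_sieveWt_sub_divisorSum_le (y := y) (v := v) hwt (hn0 n hn)) (by positivity)
  have b4' : ∑ n ∈ Icc 1 N, (tau n : ℝ) ^ 3 / 2 ^ t * (4 * tau n) ≤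
      4 * N * (1 + log N) ^ 15 / 2 ^ t := by
    have h1 := sum_tau_pow_le 4 N
    calc _ = 4 / 2 ^ t * ∑ n ∈ Icc 1 N, (tau n : ℝ) ^ 4 := by
          rw [mul_sum]; exact sum_congr rfl fun n _ => by ring
      _ ≤ 4 / 2 ^ t * (N * (1 + log N) ^ (2 ^ 4 - 1)) := by gcongr
      _ = _ := by norm_num; ring
  have b5 := gen _ _ fun n hn => abs_prime_sub_sieveWt_le (v := v) hy hyv hN (hn0 n hn)
    (mem_Icc.mp hn).2
  have b5' : ∑ n ∈ Icc 1 N, ((if n ≤ v * v then 8 * (tau n : ℝ) ^ 2 else 0) +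
      if IsExceptional y v N n then (256 : ℝ) else 0) ≤
      8 * ((v * v : ℕ) : ℝ) * (1 + log N) ^ 3 +
      256 * #((Icc 1 N).filter (IsExceptional y v N)) := by
    rw [sum_add_distrib]
    refine add_le_add ?_ ?_
    · rw [← sum_filter, ← mul_sum, mul_assoc]
      have h1 : (Icc 1 N).filter (· ≤ v * v) = Icc 1 (v * v) := by
        ext n; simp only [mem_filter, mem_Icc]; omega
      rw [h1]
      refine mul_le_mul_of_nonneg_left ((sum_tau_pow_le 2 _).trans ?_) (by norm_num)
      have h2 : 0 ≤ 1 + log (v * v : ℕ) := by linarith [log_natCast_nonneg (v * v)]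
      have h3 : log (v * v : ℕ) ≤ log N :=
        log_le_log (mod_cast (by nlinarith : 0 < v * v)) (mod_cast hvN)
      refine mul_le_mul_of_nonneg_left ?_ (by positivity)
      norm_num only
      exact pow_le_pow_left₀ h2 (by linarith) 3
    · rw [← sum_filter, sum_const, nsmul_eq_mul, mul_comm]
  rw [e1]
  have n1 := norm_sub_le (∑ n ∈ Icc 1 N, (S n : ℂ) * b n) (∑ n ∈ Icc 1 N, (B n : ℂ) * b n)
  refine (norm_add_le _ _).trans ?_
  refine (add_le_add n1 (norm_add₃_le)).trans ?_
  linarith [b1, b2, b3, b4, b4', b5, b5']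

end

section

open Real

variable {y v A B N x : ℕ}

/-- The primes in `[A, B]`. -/
def primesIcc (A B : ℕ) : Finset ℕ := (Icc A B).filter Nat.Prime

lemma mem_primesIcc {p : ℕ} : p ∈ primesIcc A B ↔ (A ≤ p ∧ p ≤ B) ∧ p.Prime := by
  simp [primesIcc]

lemma card_primesIcc_one (x : ℕ) : #(primesIcc 1 x) = Nat.primeCounting x := by
  rw [Nat.primeCounting, Nat.primeCounting', Nat.count_eq_card_filter_range]
  congr 1
  ext p
  simp only [mem_primesIcc, mem_filter, mem_range]
  exact ⟨fun h => ⟨by omega, h.2⟩, fun h => ⟨⟨h.2.one_lt.le, by omega⟩, h.2⟩⟩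

lemma card_primesIcc_one_le (hA : 2 ≤ A) (hAx : A ≤ x) :
    (#(primesIcc 1 x) : ℝ) ≤ 5 * x / log A := by
  have hA' : (2 : ℝ) ≤ A := mod_cast hA
  have hx : (A : ℝ) ≤ x := mod_cast hAx
  have hlA : 0 < log A := log_pos (by linarith)
  have hl : log A ≤ log x := log_le_log (by linarith) hx
  have h1 := Chebyshev.pi_le_log4_mul_div (x := x) (by linarith)
  rw [Nat.floor_natCast, log_sqrt (by positivity)] at h1
  have h2 : log 4 ≤ 1.4 := by
    rw [show (4 : ℝ) = 2 ^ 2 by norm_num, log_pow]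
    push_cast; linarith [log_two_lt_d9]
  have hs : 0 < √(x : ℝ) := sqrt_pos.mpr (by linarith)
  have h3 : log x ≤ 2 * √(x : ℝ) := by
    have := log_le_sub_one_of_pos hs
    rw [log_sqrt (by positivity)] at this
    linarith
  have h4 : √(x : ℝ) ≤ 2 * x / log x := by
    rw [le_div_iff₀ (by linarith)]
    nlinarith [mul_self_sqrt (Nat.cast_nonneg x : (0 : ℝ) ≤ x)]
  have h5 : log 4 * x / (log x / 2) ≤ 2.8 * x / log x := by
    rw [div_le_div_iff₀ (by linarith) (by linarith)]
    nlinarith [mul_nonneg (sub_nonneg.mpr h2) (by positivity : 0 ≤ (x : ℝ) * log x)]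
  rw [card_primesIcc_one]
  calc (Nat.primeCounting x : ℝ) ≤ 2.8 * x / log x + 2 * x / log x := by linarith
    _ = 4.8 * x / log x := by ring
    _ ≤ 5 * x / log x := by gcongr; linarith
    _ ≤ _ := by gcongr

lemma sum_inv_primesIcc_le (hA : 2 ≤ A) (hAB : A ≤ B) :
    ∑ p ∈ primesIcc A B, (1 / p : ℝ) ≤ 20 * (1 + (log B - log A)) / log A := by
  have hA' : (2 : ℝ) ≤ A := mod_cast hA
  have hlA : 0 < log A := log_pos (by linarith)
  have hmaps : ∀ p ∈ primesIcc A B, Nat.log 2 p ∈ Icc (Nat.log 2 A) (Nat.log 2 B) :=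
    fun p hp => mem_Icc.mpr ⟨Nat.log_mono_right (mem_primesIcc.mp hp).1.1,
      Nat.log_mono_right (mem_primesIcc.mp hp).1.2⟩
  rw [← sum_fiberwise_of_maps_to hmaps]
  have hblock : ∀ j ∈ Icc (Nat.log 2 A) (Nat.log 2 B),
      ∑ p ∈ (primesIcc A B).filter (fun p => Nat.log 2 p = j), (1 / p : ℝ) ≤ 10 / log A := by
    intro j hj
    have hAj : A ≤ 2 ^ (j + 1) := (Nat.lt_pow_succ_log_self (by norm_num) A).le.trans
      (Nat.pow_le_pow_right (by norm_num) (by have := (mem_Icc.mp hj).1; omega))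
    have h1 : ∀ p ∈ (primesIcc A B).filter (fun p => Nat.log 2 p = j), (1 / p : ℝ) ≤ 1 / 2 ^ j := by
      intro p hp
      obtain ⟨hpm, rfl⟩ := mem_filter.mp hp
      have := Nat.pow_log_le_self 2 (mem_primesIcc.mp hpm).2.ne_zero
      gcongr
      exact_mod_cast this
    have h2 : (primesIcc A B).filter (fun p => Nat.log 2 p = j) ⊆ primesIcc 1 (2 ^ (j + 1)) := by
      intro p hp
      obtain ⟨hpm, rfl⟩ := mem_filter.mp hp
      have hp := mem_primesIcc.mp hpm
      exact mem_primesIcc.mpr ⟨⟨hp.2.one_lt.le, (Nat.lt_pow_succ_log_self (by norm_num) p).le⟩,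
        hp.2⟩
    refine (sum_le_card_nsmul _ _ _ h1).trans ?_
    rw [nsmul_eq_mul]
    have h3 : (#((primesIcc A B).filter (fun p => Nat.log 2 p = j)) : ℝ) ≤
        5 * (2 ^ (j + 1) : ℕ) / log A :=
      le_trans (mod_cast card_le_card h2) (card_primesIcc_one_le hA hAj)
    calc _ ≤ 5 * (2 ^ (j + 1) : ℕ) / log A * (1 / 2 ^ j) := by gcongr
      _ = _ := by push_cast; field_simp; ring
  refine (sum_le_card_nsmul _ _ _ hblock).trans ?_
  rw [nsmul_eq_mul, Nat.card_Icc]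
  have hm : Nat.log 2 A ≤ Nat.log 2 B := Nat.log_mono_right hAB
  have hB' : (A : ℝ) ≤ B := mod_cast hAB
  have g1 : (Nat.log 2 B : ℝ) * log 2 ≤ log B := by
    rw [← log_pow]
    exact log_le_log (by positivity)
      (mod_cast Nat.pow_log_le_self 2 (by omega : B ≠ 0))
  have g2 : log A ≤ (Nat.log 2 A + 1) * log 2 := by
    rw [← Nat.cast_add_one, ← log_pow]
    exact log_le_log (by linarith)
      (mod_cast (Nat.lt_pow_succ_log_self (by norm_num) A).le)
  have hL : log A ≤ log B := log_le_log (by linarith) hB'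
  have hc : ((Nat.log 2 B + 1 - Nat.log 2 A : ℕ) : ℝ) ≤ 2 * (1 + (log B - log A)) := by
    rw [Nat.cast_sub (by omega)]
    push_cast
    by_contra hcon
    push Not at hcon
    nlinarith [log_two_gt_d9]
  calc _ ≤ 2 * (1 + (log B - log A)) * (10 / log A) := by gcongr
    _ = _ := by ring

lemma card_exceptional_le (hy : 2 ≤ y) (hyv : y ≤ v) :
    (#((Icc 1 N).filter (IsExceptional y v N)) : ℝ) ≤
      5 * N / log v * ∑ p ∈ primesIcc v (Nat.sqrt N), (1 / p : ℝ) +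
      5 * N / log y * (∑ p ∈ primesIcc y (N / (y * y)), (1 / p : ℝ)) ^ 2 := by
  have count : ∀ {z m : ℕ}, 2 ≤ z → m ≠ 0 → z * m ≤ N →
      (#(primesIcc 1 (N / m)) : ℝ) ≤ 5 * N / log z * (1 / m) := by
    intro z m hz hm hzm
    have h0 : (0 : ℝ) < log z := log_pos (mod_cast hz)
    refine (card_primesIcc_one_le hz ((Nat.le_div_iff_mul_le (by omega)).mpr hzm)).trans ?_
    calc 5 * ((N / m : ℕ) : ℝ) / log z ≤ 5 * (N / m) / log z := by
          gcongr; exact Nat.cast_div_le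
      _ = _ := by ring
  set S₁ := (primesIcc v (Nat.sqrt N)).biUnion fun p => (primesIcc 1 (N / p)).image (p * ·)
  set P := (primesIcc y (N / (y * y)) ×ˢ primesIcc y (N / (y * y))).filter
    fun x : ℕ × ℕ => y * (x.1 * x.2) ≤ N
  set S₂ := P.biUnion fun x => (primesIcc 1 (N / (x.1 * x.2))).image (x.1 * x.2 * ·)
  have hsub : (Icc 1 N).filter (IsExceptional y v N) ⊆ S₁ ∪ S₂ := by
    intro n hn
    obtain ⟨hn, he⟩ := mem_filter.mp hn
    have hn := (mem_Icc.mp hn).2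
    rw [mem_union]
    rcases he with ⟨p, q, hp, hq, hvp, hpN, rfl⟩ | ⟨p, q, r, hp, hq, hr, hyp, hyq, hyr, rfl⟩
    · refine Or.inl (mem_biUnion.mpr ⟨p, mem_primesIcc.mpr
        ⟨⟨hvp.le, Nat.le_sqrt.mpr hpN⟩, hp⟩, mem_image.mpr ⟨q, mem_primesIcc.mpr
        ⟨⟨hq.one_lt.le, ?_⟩, hq⟩, rfl⟩⟩)
      rw [Nat.le_div_iff_mul_le hp.pos, mul_comm]; exact hn
    · have h1 : y * (p * q) ≤ N := (Nat.mul_le_mul_right _ hyr).trans (by linarith)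
      have h2 : p ≤ N / (y * y) := by
        rw [Nat.le_div_iff_mul_le (by positivity)]
        calc p * (y * y) ≤ p * (q * y) := by gcongr
          _ ≤ N := by linarith
      have h3 : q ≤ N / (y * y) := by
        rw [Nat.le_div_iff_mul_le (by positivity)]
        calc q * (y * y) ≤ q * (p * y) := by gcongr
          _ ≤ N := by linarith
      refine Or.inr (mem_biUnion.mpr ⟨(p, q), mem_filter.mpr
        ⟨mem_product.mpr ⟨mem_primesIcc.mpr ⟨⟨hyp, h2⟩, hp⟩,
          mem_primesIcc.mpr ⟨⟨hyq, h3⟩, hq⟩⟩, h1⟩, mem_image.mpr ⟨r, mem_primesIcc.mpr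
          ⟨⟨hr.one_lt.le, ?_⟩, hr⟩, rfl⟩⟩)
      rw [Nat.le_div_iff_mul_le (Nat.mul_pos hp.pos hq.pos), mul_comm]; exact hn
  have c1 : (#S₁ : ℝ) ≤ 5 * N / log v * ∑ p ∈ primesIcc v (Nat.sqrt N), (1 / p : ℝ) := by
    rw [mul_sum]
    refine (Nat.cast_le.mpr card_biUnion_le).trans ?_
    rw [Nat.cast_sum]
    refine sum_le_sum fun p hp => (Nat.cast_le.mpr card_image_le).trans ?_
    have hp := mem_primesIcc.mp hp
    exact count (by omega) hp.2.ne_zero ((Nat.mul_le_mul_right _ hp.1.1).trans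
      (Nat.le_sqrt.mp hp.1.2))
  have c2 : (#S₂ : ℝ) ≤
      5 * N / log y * (∑ p ∈ primesIcc y (N / (y * y)), (1 / p : ℝ)) ^ 2 := by
    rw [sq, sum_mul_sum, ← sum_product', mul_sum]
    refine (Nat.cast_le.mpr card_biUnion_le).trans ?_
    rw [Nat.cast_sum]
    have h0 : (0 : ℝ) < log y := log_pos (mod_cast hy)
    refine le_trans (sum_le_sum fun x hx => (Nat.cast_le.mpr card_image_le).trans
      (count hy ?_ (mem_filter.mp hx).2)) (le_trans (sum_le_sum_of_subset_of_nonneg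
        (filter_subset _ _) fun x _ _ => by positivity) (sum_le_sum fun x _ => ?_))
    · have hx := mem_product.mp (mem_filter.mp hx).1
      exact mul_ne_zero (mem_primesIcc.mp hx.1).2.ne_zero (mem_primesIcc.mp hx.2).2.ne_zero
    · rw [Nat.cast_mul, one_div_mul_one_div]
  calc _ ≤ (#(S₁ ∪ S₂) : ℝ) := mod_cast card_le_card hsub
    _ ≤ #S₁ + #S₂ := mod_cast card_union_le _ _
    _ ≤ _ := add_le_add c1 c2

lemma card_exceptional_le_mul_div_log {κ : ℝ} (hy : 2 ≤ y) (hyv : y ≤ v) (hvN : v * v ≤ N)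
    (hyN : y * y * y ≤ N) (hN : N < y ^ 4)
    (h₁ : 1 + log N / 2 - log v ≤ κ * log N)
    (h₂ : 1 + log N - 3 * log y ≤ κ * log N) :
    (#((Icc 1 N).filter (IsExceptional y v N)) : ℝ) ≤
      (1600 * κ + 128000 * κ ^ 2) * (N / log N) := by
  have hy' : (2 : ℝ) ≤ y := mod_cast hy
  have hv' : (y : ℝ) ≤ v := mod_cast hyv
  have hN0 : 0 < N := lt_of_lt_of_le (by positivity) hyN
  have hN' : (1 : ℝ) ≤ N := mod_cast hN0
  have hly : 0 < log y := log_pos (by linarith)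
  have hlyv : log y ≤ log v := log_le_log (by linarith) hv'
  have hl4 : log N ≤ 4 * log y := by
    have := log_le_log (by linarith) (show (N : ℝ) ≤ (y : ℝ) ^ 4 by exact_mod_cast hN.le)
    rwa [log_pow, Nat.cast_ofNat] at this
  have hl3 : 3 * log y ≤ log N := by
    have := log_le_log (by positivity) (show (y : ℝ) ^ 3 ≤ N by
      rw [pow_succ, sq]; exact_mod_cast hyN)
    rwa [log_pow, Nat.cast_ofNat] at this
  have hL : 0 < log N := by linarith
  have hyM : y ≤ N / (y * y) := (Nat.le_div_iff_mul_le (by positivity)).mpr (by linarith)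
  have hvs : v ≤ Nat.sqrt N := Nat.le_sqrt.mpr hvN
  have s1 := sum_inv_primesIcc_le (by omega : 2 ≤ v) hvs
  have s2 := sum_inv_primesIcc_le hy hyM
  have e1 : log (Nat.sqrt N) ≤ log N / 2 := by
    have := log_le_log (mod_cast (by positivity : 0 < Nat.sqrt N ^ 2))
      (show ((Nat.sqrt N ^ 2 : ℕ) : ℝ) ≤ N from mod_cast Nat.sqrt_le' N)
    rw [Nat.cast_pow, log_pow, Nat.cast_ofNat] at this
    linarith
  have e2 : log (N / (y * y) : ℕ) ≤ log N - 2 * log y := by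
    have h0 : 0 < N / (y * y) := by omega
    have := log_le_log (mod_cast h0) (Nat.cast_div_le (α := ℝ) (m := N) (n := y * y))
    rw [log_div (by linarith) (by positivity), Nat.cast_mul, log_mul (by linarith)
      (by linarith)] at this
    linarith
  have hκ : 0 < κ * log N := by linarith
  have hκ0 : 0 < κ := by
    by_contra h
    nlinarith [mul_nonneg (sub_nonneg.mpr (not_lt.mp h)) hL.le]
  have b1 : ∑ p ∈ primesIcc v (Nat.sqrt N), (1 / p : ℝ) ≤ 80 * κ := by
    refine s1.trans ?_
    rw [div_le_iff₀ (by linarith)]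
    nlinarith
  have b2 : ∑ p ∈ primesIcc y (N / (y * y)), (1 / p : ℝ) ≤ 80 * κ := by
    refine s2.trans ?_
    rw [div_le_iff₀ (by linarith)]
    nlinarith
  have q : ∀ z : ℝ, log N ≤ 4 * z → 5 * (N : ℝ) / z ≤ 20 * (N / log N) := by
    intro z hz
    have hz0 : 0 < z := by linarith
    rw [← mul_div_assoc, div_le_div_iff₀ hz0 hL]
    nlinarith
  have hNL : 0 < N / log N := by positivity
  refine (card_exceptional_le hy hyv).trans ?_
  have n1 : 0 ≤ ∑ p ∈ primesIcc v (Nat.sqrt N), (1 / p : ℝ) := sum_nonneg fun _ _ => by positivity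
  have n2 : 0 ≤ ∑ p ∈ primesIcc y (N / (y * y)), (1 / p : ℝ) := sum_nonneg fun _ _ => by positivity
  have m1 := mul_le_mul (q (log v) (by linarith)) b1 n1 (by positivity)
  have m2 := mul_le_mul (q (log y) hl4) (pow_le_pow_left₀ n2 b2 2) (by positivity) (by positivity)
  linarith

end

end

section

open Finset Real

variable {a h y v w D N Z : ℕ} {k : ℤ} {g : ℝ → ℝ} {T U X : ℝ}

lemma rootSum_eq_zero (hah : Int.gcd a h = 1) {n : ℕ} (hn : ¬ a.Coprime n) :
    rootSum a h k n = 0 := by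
  refine sum_eq_zero fun ν hν => absurd ?_ hn
  exact (Nat.isCoprime_iff_coprime.mp (coprime_of_mem_rts hah hν)).symm

lemma mem_smoothSet {d : ℕ} : d ∈ smoothSet w D ↔ (1 ≤ d ∧ d ≤ D) ∧ SqfSmooth w d := by
  simp [smoothSet]

/-- The linear sums of the sieve are indexed without repetition by squarefree moduli. -/
lemma sum_sieveSet_smoothSet_le (hah : Int.gcd a h = 1) (hwy : w ≤ y) (hv : 1 ≤ v)
    (hT : ∀ I : Finset ℕ, (∀ l ∈ I, Squarefree l ∧ a.Coprime l ∧ l ≤ v * D) →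
      ∑ l ∈ I, ‖weylSum a h l k g N‖ ≤ T) :
    ∑ x ∈ sieveSet y v ×ˢ smoothSet w D, ‖∑ m ∈ Icc 1 (N / (x.1 * x.2)),
      (g (x.1 * x.2 * m : ℕ) : ℂ) * rootSum a h k (x.1 * x.2 * m)‖ ≤ T := by
  have key : ∀ {e d p : ℕ}, e ∈ sieveSet y v → p.Prime → p ∣ e → d ∈ smoothSet w D → ¬ p ∣ d := by
    intro e d p he hp hpe hd hpd
    have h1 := (mem_smoothSet.mp hd).2.2 p hp hpd
    rcases mem_sieveSet.mp he with rfl | ⟨he, h2, -⟩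
    · exact hp.one_lt.ne' (Nat.dvd_one.mp hpe)
    · rw [(Nat.prime_dvd_prime_iff_eq hp he).mp hpe] at h1; omega
  have hcop : ∀ {e d : ℕ}, e ∈ sieveSet y v → d ∈ smoothSet w D → e.Coprime d := fun he hd =>
    Nat.coprime_of_dvd fun p hp hpe hpd => key he hp hpe hd hpd
  have hinj : Set.InjOn (fun x : ℕ × ℕ => x.1 * x.2) ↑(sieveSet y v ×ˢ smoothSet w D) := by
    rintro ⟨e, d⟩ hx ⟨e', d'⟩ hx' hxx
    simp only [coe_product, Set.mem_prod, mem_coe] at hx hx' hxx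
    have d1 : d ∣ d' := ((hcop hx'.1 hx.2).symm).dvd_of_dvd_mul_left (hxx ▸ Dvd.intro_left e rfl)
    have d2 : d' ∣ d := ((hcop hx.1 hx'.2).symm).dvd_of_dvd_mul_left (hxx ▸ Dvd.intro_left e' rfl)
    obtain rfl := Nat.dvd_antisymm d1 d2
    have := (mem_smoothSet.mp hx.2).1.1
    exact Prod.ext (Nat.eq_of_mul_eq_mul_right (by omega) hxx) rfl
  set J := sieveSet y v ×ˢ smoothSet w D with hJ
  refine le_trans (le_of_eq ?_) (hT ((J.image fun x => x.1 * x.2).filter a.Coprime) ?_)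
  · rw [sum_filter, sum_image hinj]
    refine sum_congr rfl fun x hx => ?_
    have hx := mem_product.mp hx
    have hx2 := (mem_smoothSet.mp hx.2).1.1
    have hx1 : 0 < x.1 := by
      rcases mem_sieveSet.mp hx.1 with h | ⟨h, -⟩
      · omega
      · exact h.pos
    split_ifs with hc
    · rw [weylSum_eq (Nat.mul_pos hx1 hx2)]
    · rw [sum_eq_zero, norm_zero]
      intro m _
      rw [rootSum_eq_zero hah fun h => hc (Nat.Coprime.coprime_mul_right_right h), mul_zero]
  · intro l hl
    obtain ⟨hl, hc⟩ := mem_filter.mp hl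
    obtain ⟨x, hx, rfl⟩ := mem_image.mp hl
    have hx := mem_product.mp hx
    have hx2 := mem_smoothSet.mp hx.2
    have h1 : Squarefree x.1 ∧ x.1 ≤ v := by
      rcases mem_sieveSet.mp hx.1 with h | ⟨h, -, h'⟩
      · rw [h]; exact ⟨squarefree_one, hv⟩
      · exact ⟨h.prime.squarefree, h'⟩
    exact ⟨(Nat.squarefree_mul (hcop hx.1 hx.2)).mpr ⟨h1.1, hx2.2.1⟩, hc,
      Nat.mul_le_mul h1.2 hx2.1.2⟩

/-- The bilinear sums of the sieve are controlled by `IsScale.norm_typeII_sq_le`. -/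
lemma IsScale.norm_sum_primesIco_sq_le (H : IsScale a h Z U) (hU : 2000 ≤ U) {Lg : ℝ}
    (hg : IsCutoff g Lg X) (hLg : 4 * Lg * X ≤ U) (hk : k ≠ 0) {j : ℕ} (hkP : k.natAbs < 2 ^ j)
    (hP3 : (2 ^ j) ^ 3 * U ^ 60 ≤ X) (hPω : 2 ^ j * hgt a h * U ^ 60 ≤ X)
    (hPX : 2 ^ j ≤ X) (hkω : k.natAbs * hgt a h ≤ X)
    (hZ : 6 * a * k.natAbs * (2 ^ j) ^ 2 * X ≤ Z) {α : ℕ → ℝ} (hα : ∀ M ≠ 0, |α M| ≤ tau M) :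
    ‖∑ r ∈ (primesIco w y).filter (Nat.log 2 · = j), ∑ M ∈ Icc 1 (⌊X⌋₊ / 2 ^ j),
      (α M : ℂ) * ((g (r * M : ℕ) : ℂ) * rootSum a h k (r * M))‖ ^ 2 ≤
      264 * X ^ 2 * (1 + log X) ^ 10 * (1 / 2 ^ j + 1 / U) := by
  have h1 := H.norm_typeII_sq_le (P := 2 ^ j) (X := X)
    (Q := ((primesIco w y).filter (Nat.log 2 · = j)).filter a.Coprime) hU hg hLg hk hkP
    (by push_cast; exact hPX) (fun r hr => by
      obtain ⟨hr, hc⟩ := mem_filter.mp hr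
      obtain ⟨hr', rfl⟩ := mem_filter.mp hr
      have hp := (mem_primesIco.mp hr').1
      refine ⟨hp, Nat.pow_log_le_self 2 hp.ne_zero, ?_, hc⟩
      rw [← pow_succ']
      exact Nat.lt_pow_succ_log_self (by norm_num) r)
    (by push_cast; exact hP3) (by push_cast; exact hPω) hkω (by push_cast; exact hZ) hα
  push_cast at h1
  refine le_trans (le_of_eq ?_) h1
  congr 2
  rw [sum_filter a.Coprime]
  refine sum_congr rfl fun r _ => ?_
  rw [show ⌊X / 2 ^ j⌋₊ = ⌊X⌋₊ / 2 ^ j by rw [← Nat.floor_div_natCast]; push_cast; rfl]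
  split_ifs with hc
  · exact sum_congr rfl fun M _ => by push_cast; ring
  · refine sum_eq_zero fun M _ => ?_
    rw [rootSum_eq_zero H.coprime fun h => hc (Nat.Coprime.coprime_mul_right_right h)]
    ring

/-- The cutoff equal to `1` up to `(1 - κ) X` and decreasing linearly to `0` at `X`. -/
def ramp (κ X s : ℝ) : ℝ := max 0 (min 1 ((X - s) / (κ * X)))

lemma ramp_nonneg (κ X s : ℝ) : 0 ≤ ramp κ X s := le_max_left _ _

lemma ramp_le_one (κ X s : ℝ) : ramp κ X s ≤ 1 := max_le zero_le_one (min_le_left _ _)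

lemma ramp_eq_one {κ s : ℝ} (h : 0 < κ * X) (hs : s ≤ X - κ * X) : ramp κ X s = 1 := by
  rw [ramp, min_eq_left ((one_le_div h).mpr (by linarith)), max_eq_right zero_le_one]

lemma isCutoff_ramp {κ : ℝ} (h : 0 < κ * X) : IsCutoff (ramp κ X) (1 / (κ * X)) X where
  abs_le s := abs_le.mpr ⟨by linarith [ramp_nonneg κ X s], ramp_le_one _ _ _⟩
  supp s hs := max_eq_left ((min_le_right _ _).trans
    (div_nonpos_of_nonpos_of_nonneg (by linarith) h.le))
  lip s t := by
    have h' := mul_nonneg (one_div_pos.mpr h).le (abs_nonneg (s - t))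
    refine (abs_max_sub_max_le_max _ _ _ _).trans (max_le (by rwa [sub_self, abs_zero]) ?_)
    refine (abs_min_sub_min_le_max _ _ _ _).trans
      (max_le (by rwa [sub_self, abs_zero]) (le_of_eq ?_))
    rw [← sub_div, abs_div, abs_of_pos h, show X - s - (X - t) = -(s - t) by ring, abs_neg]
    ring

/-- Passing from the smooth cutoff to the sharp one. -/
lemma IsScale.norm_sum_prime_sub_le (H : IsScale a h Z U) {κ : ℝ} (h0 : 0 < κ * X)
    (hX : κ * X ≤ X) :
    ‖(∑ n ∈ Icc 1 ⌊X⌋₊, if n.Prime then rootSum a h k n else 0) -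
      ∑ n ∈ Icc 1 ⌊X⌋₊, if n.Prime then (ramp κ X n : ℂ) * rootSum a h k n else 0‖ ≤
      8 * (κ * X + 1) := by
  rw [← sum_sub_distrib]
  have hpt : ∀ n ∈ Icc 1 ⌊X⌋₊, ‖(if n.Prime then rootSum a h k n else 0) -
      (if n.Prime then (ramp κ X n : ℂ) * rootSum a h k n else 0)‖ ≤
      if n ∈ Ioc ⌊X - κ * X⌋₊ ⌊X⌋₊ then (8 : ℝ) else 0 := by
    intro n hn
    have hn := mem_Icc.mp hn
    by_cases hp : n.Prime
    · simp only [if_pos hp]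
      rw [← one_sub_mul, norm_mul]
      split_ifs with hm
      · have h1 : ‖rootSum a h k n‖ ≤ 8 := by
          refine (norm_rootSum_le n).trans ((H.card_rts_le hp.ne_zero).trans ?_)
          have : tau n = 2 := by rw [tau, hp.divisors, card_pair hp.one_lt.ne]
          rw [this]; norm_num
        have h2 : ‖(1 : ℂ) - (ramp κ X n : ℂ)‖ ≤ 1 := by
          rw [← Complex.ofReal_one, ← Complex.ofReal_sub, Complex.norm_real, norm_eq_abs,
            abs_le]
          constructor <;> linarith [ramp_nonneg κ X n, ramp_le_one κ X n]
        nlinarith [norm_nonneg (rootSum a h k n)]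
      · have h3 : n ≤ ⌊X - κ * X⌋₊ := by
          by_contra h
          exact hm (mem_Ioc.mpr ⟨by omega, hn.2⟩)
        rw [ramp_eq_one h0 ((Nat.cast_le.mpr h3).trans (Nat.floor_le (by linarith)))]
        simp
    · simp only [if_neg hp, sub_zero, norm_zero]
      split_ifs <;> norm_num
  refine (norm_sum_le_of_le _ hpt).trans ?_
  rw [← sum_filter, sum_const, nsmul_eq_mul, mul_comm]
  have hc : (#((Icc 1 ⌊X⌋₊).filter (· ∈ Ioc ⌊X - κ * X⌋₊ ⌊X⌋₊)) : ℝ) ≤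
      ((⌊X⌋₊ - ⌊X - κ * X⌋₊ : ℕ) : ℝ) := by
    rw [← Nat.card_Ioc]
    exact_mod_cast card_le_card fun n hn => (mem_filter.mp hn).2
  rw [Nat.cast_sub (Nat.floor_le_floor (by linarith))] at hc
  have h1 := Nat.floor_le (show 0 ≤ X by linarith)
  have h2 := Nat.lt_floor_add_one (X - κ * X)
  linarith

end

section

open Real Filter

/-- `X` is large compared with `M`, in a form suited to the sieve of level `X ^ (1 / 2 - σ)`. -/
structure IsLarge (σ M X : ℝ) : Prop where
  pos : 0 < σ
  le : σ ≤ 1 / 100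
  M_ge : 2000 ≤ M
  inv_le : 200 / σ ≤ M
  X_pos : 0 < X
  le_log : M ≤ 1 + log X
  pow_le : (1 + log X) ^ 20 ≤ X ^ (σ / 100)
  log_sq_le : 900 * log (1 + log X) ^ 2 ≤ σ / 100 * log X

lemma exists_isLarge {σ M : ℝ} (h0 : 0 < σ) (h1 : σ ≤ 1 / 100) (hM : 2000 ≤ M)
    (hM' : 200 / σ ≤ M) : ∃ X₀, ∀ X ≥ X₀, IsLarge σ M X := by
  have hlog := tendsto_log_atTop
  have hl : Tendsto (fun X => 1 + log X) atTop atTop :=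
    tendsto_atTop_add_const_left _ _ hlog
  have e2 := (isLittleO_log_rpow_atTop (by positivity : 0 < σ / 2000)).bound
    (by norm_num : (0 : ℝ) < 1 / 2)
  have e3 := hl.eventually ((isLittleO_pow_log_id_atTop (n := 2)).bound
    (by positivity : 0 < σ / 200000))
  obtain ⟨X₀, hX₀⟩ := eventually_atTop.mp
    ((e2.and e3).and ((hl.eventually_ge_atTop M).and (eventually_gt_atTop 0)))
  refine ⟨X₀, fun X hX => ?_⟩
  obtain ⟨⟨h2, h3⟩, h4, h5⟩ := hX₀ X hX
  have hL : 1999 ≤ log X := by linarith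
  refine ⟨h0, h1, hM, hM', h5, h4, ?_, ?_⟩
  · rw [norm_eq_abs, norm_eq_abs, abs_of_nonneg (by linarith),
      abs_of_nonneg (by positivity)] at h2
    calc (1 + log X) ^ 20 ≤ (X ^ (σ / 2000)) ^ 20 :=
          pow_le_pow_left₀ (by linarith) (by linarith) 20
      _ = X ^ (σ / 100) := by
          rw [← rpow_natCast, ← rpow_mul h5.le]; congr 1; push_cast; ring
  · rw [norm_eq_abs, norm_eq_abs, id, abs_of_nonneg (by positivity),
      abs_of_nonneg (by linarith)] at h3
    nlinarith

/-- A convenient size for auxiliary parameters. -/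
def topScale (X : ℝ) : ℕ := ⌈X ^ 10⌉₊

namespace IsLarge

variable {σ M X : ℝ}

lemma two_thousand_le (L : IsLarge σ M X) : 2000 ≤ X := by
  have := log_le_sub_one_of_pos L.X_pos
  linarith [L.le_log, L.M_ge]

lemma pow_le_topScale : X ^ 10 ≤ topScale X := Nat.le_ceil _

lemma topScale_le (L : IsLarge σ M X) : (topScale X : ℝ) ≤ X ^ 11 := by
  have hX := L.two_thousand_le
  have h1 := (Nat.ceil_lt_add_one (show 0 ≤ X ^ 10 by positivity)).le
  have h2 : 1 ≤ X ^ 10 := one_le_pow₀ (by linarith)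
  rw [topScale]
  nlinarith

lemma isScale (L : IsLarge σ M X) {C : ℝ} (hCM : C ≤ M)
    (hC : ∀ n : ℕ, n ≠ 0 → (tau n : ℝ) ≤ C * (n : ℝ) ^ (σ / 4000)) {a h : ℕ} (ha0 : 0 < a)
    (hsq : Squarefree h) (hcop : Int.gcd a h = 1) (ha : (a : ℝ) ≤ X ^ (σ / 100))
    (hh : (h : ℝ) ≤ X ^ (1 + σ / 100)) : IsScale a h (topScale X) (X ^ (σ / 100)) := by
  have hX := L.two_thousand_le
  have hσ := L.pos
  have hσ1 := L.le
  have hM := L.M_ge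
  have hℓ := L.le_log
  have hX1 : 1 ≤ X := by linarith
  have hZ0 : (0 : ℝ) < topScale X := lt_of_lt_of_le (by positivity) pow_le_topScale
  refine ⟨ha0, hsq, hcop, ha, ?_, fun n hn hnZ => ?_, ?_⟩
  · have h1 := log_le_log hZ0 L.topScale_le
    rw [log_pow, Nat.cast_ofNat] at h1
    have h2 : (1 + log X) ^ 2 ≤ (1 + log X) ^ 20 :=
      pow_le_pow_right₀ (by linarith) (by norm_num)
    nlinarith [L.pow_le]
  · have hsq2 : (X ^ (σ / 200)) ^ 2 = X ^ (σ / 100) := by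
      rw [← rpow_natCast, ← rpow_mul L.X_pos.le]; congr 1; push_cast; ring
    have h1 : (1 + log X) ^ 10 ≤ X ^ (σ / 200) := by
      refine le_of_sq_le_sq ?_ (by positivity)
      rw [hsq2, ← pow_mul]; exact L.pow_le
    have h2 : C ≤ X ^ (σ / 200) :=
      (hCM.trans hℓ).trans ((le_self_pow₀ (by linarith) (by norm_num)).trans h1)
    have h3 : (n : ℝ) ^ (σ / 4000) ≤ X ^ (σ / 200) := by
      calc (n : ℝ) ^ (σ / 4000) ≤ (X ^ 11) ^ (σ / 4000) :=
            rpow_le_rpow (by positivity)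
              ((Nat.cast_le.mpr hnZ).trans L.topScale_le) (by positivity)
        _ = X ^ (11 * (σ / 4000)) := by
            rw [← rpow_natCast, ← rpow_mul L.X_pos.le]; norm_num
        _ ≤ X ^ (σ / 200) := rpow_le_rpow_of_exponent_le hX1 (by linarith)
    calc (tau n : ℝ) ≤ C * (n : ℝ) ^ (σ / 4000) := hC n hn
      _ ≤ X ^ (σ / 200) * X ^ (σ / 200) := mul_le_mul h2 h3 (by positivity) (by positivity)
      _ = X ^ (σ / 100) := by rw [← hsq2, sq]
  · have h1 : (a * h : ℝ) ≤ X ^ 3 := by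
      calc (a * h : ℝ) ≤ X ^ (σ / 100) * X ^ (1 + σ / 100) := by gcongr
        _ = X ^ (σ / 100 + (1 + σ / 100)) := (rpow_add L.X_pos _ _).symm
        _ ≤ X ^ (3 : ℝ) := rpow_le_rpow_of_exponent_le hX1 (by linarith)
        _ = X ^ 3 := by norm_cast
    have h2 : ((37 * (a * h) ^ 2 : ℕ) : ℝ) ≤ topScale X := by
      push_cast
      calc 37 * ((a : ℝ) * h) ^ 2 ≤ X * (X ^ 3) ^ 2 := by gcongr; linarith
        _ = X ^ 7 := by ring
        _ ≤ X ^ 10 := pow_le_pow_right₀ hX1 (by norm_num)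
        _ ≤ _ := pow_le_topScale
    exact_mod_cast h2

lemma hgt_le (L : IsLarge σ M X) {a h : ℕ} (ha0 : 0 < a) (hh : (h : ℝ) ≤ X ^ (1 + σ / 100)) :
    hgt a h ≤ X ^ (1 / 2 + σ / 200) := by
  rw [hgt]
  refine sqrt_le_iff.mpr ⟨rpow_nonneg L.X_pos.le _, ?_⟩
  rw [← rpow_natCast, ← rpow_mul L.X_pos.le]
  refine (div_le_self (by positivity) (mod_cast ha0)).trans (hh.trans (le_of_eq ?_))
  congr 1; push_cast; ring

end IsLarge

end

section

open Real Finset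

variable {σ M X : ℝ} {a h : ℕ} {k : ℤ}

lemma half_le_floor {x : ℝ} (hx : 1 ≤ x) : x / 2 ≤ ⌊x⌋₊ := by
  have h1 := Nat.lt_floor_add_one x
  have h2 : (1 : ℝ) ≤ ⌊x⌋₊ := mod_cast (Nat.one_le_floor_iff x).mpr hx
  linarith

lemma log_sub_le_log_floor {X : ℝ} {s : ℝ} (hX : 1 ≤ X) (hs : 0 ≤ s) :
    s * log X - 1 ≤ log ⌊X ^ s⌋₊ := by
  have h0 : 0 < X ^ s := rpow_pos_of_pos (by linarith) _
  have h1 := log_le_log (by positivity) (half_le_floor (one_le_rpow hX hs))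
  rw [log_div h0.ne' (by norm_num), log_rpow (by linarith)] at h1
  linarith [log_two_lt_d9]

/-- The size of the prime factors removed by the sieve. -/
def smallExp (X : ℝ) : ℕ := ⌊30 * log (1 + log X)⌋₊

namespace IsLarge

lemma one_le_log_ell (L : IsLarge σ M X) : 1 ≤ log (1 + log X) := by
  have := L.M_ge.trans L.le_log
  rw [le_log_iff_exp_le (by linarith)]
  linarith [exp_one_lt_d9]

lemma pow_le_two_pow_smallExp (L : IsLarge σ M X) :
    (1 + log X) ^ 20 ≤ 2 ^ smallExp X := by
  have h1 := L.one_le_log_ell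
  have h2 := L.M_ge.trans L.le_log
  have h3 := Nat.lt_floor_add_one (30 * log (1 + log X))
  rw [← log_le_log_iff (by positivity) (by positivity), log_pow, log_pow]
  have : (smallExp X : ℝ) = ⌊30 * log (1 + log X)⌋₊ := rfl
  push_cast
  nlinarith [log_two_gt_d9]

lemma two_pow_sq_smallExp_le (L : IsLarge σ M X) :
    (2 : ℝ) ^ (smallExp X * smallExp X) ≤ X ^ (σ / 100) := by
  have h1 := L.one_le_log_ell
  have h3 : (smallExp X : ℝ) ≤ 30 * log (1 + log X) := Nat.floor_le (by linarith)
  rw [← log_le_log_iff (by positivity) (rpow_pos_of_pos L.X_pos _), log_pow,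
    log_rpow L.X_pos]
  refine le_trans ?_ L.log_sq_le
  push_cast
  have h4 := mul_self_le_mul_self (Nat.cast_nonneg _) h3
  nlinarith [log_two_lt_d9, mul_self_nonneg (smallExp X : ℝ)]

lemma mul_le_rpow (L : IsLarge σ M X) {x y r s : ℝ} (hx : x ≤ X ^ r) (hy : y ≤ X ^ s)
    (hy0 : 0 ≤ y := by positivity) : x * y ≤ X ^ (r + s) :=
  (mul_le_mul hx hy hy0 (rpow_nonneg L.X_pos.le r)).trans_eq (rpow_add L.X_pos _ _).symm

lemma pow_le_rpow (L : IsLarge σ M X) {x r : ℝ} (hx : x ≤ X ^ r) (n : ℕ)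
    (hx0 : 0 ≤ x := by positivity) : x ^ n ≤ X ^ (r * n) :=
  (pow_le_pow_left₀ hx0 hx n).trans_eq (rpow_mul_natCast L.X_pos.le r n).symm

lemma rpow_le_self (L : IsLarge σ M X) {r : ℝ} (hr : r ≤ 1) : X ^ r ≤ X :=
  (rpow_le_rpow_of_exponent_le (by linarith [L.two_thousand_le]) hr).trans_eq (rpow_one X)

/-- The exceptional integers contribute a small proportion of the primes. -/
lemma card_exceptional_le (L : IsLarge σ M X) :
    (((Icc 1 ⌊X⌋₊).filter
      (IsExceptional ⌊X ^ (1 / 3 - σ)⌋₊ ⌊X ^ (1 / 2 - σ)⌋₊ ⌊X⌋₊)).card : ℝ) ≤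
      53760 * σ * (X / log X) ∧ ⌊X⌋₊ < ⌊X ^ (1 / 3 - σ)⌋₊ ^ 4 := by
  have hX := L.two_thousand_le
  have hσ := L.pos
  have hσ1 := L.le
  have hlX : 1999 ≤ log X := by linarith [L.M_ge, L.le_log]
  have hσL : 100 ≤ σ * log X := by
    have := L.inv_le.trans L.le_log
    rw [div_le_iff₀ hσ] at this
    nlinarith
  have hX1 : 1 ≤ X := by linarith
  have hN := half_le_floor hX1
  have hNX : (⌊X⌋₊ : ℝ) ≤ X := Nat.floor_le L.X_pos.le
  have hlN : log ⌊X⌋₊ ≤ log X := log_le_log (by linarith) hNX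
  have hlN' : log X - 1 ≤ log ⌊X⌋₊ := by
    simpa using log_sub_le_log_floor (s := 1) hX1 zero_le_one
  have hly := log_sub_le_log_floor (s := 1 / 3 - σ) hX1 (by linarith)
  have hlv := log_sub_le_log_floor (s := 1 / 2 - σ) hX1 (by linarith)
  have hy2 : 2 ≤ ⌊X ^ (1 / 3 - σ)⌋₊ := by
    by_contra hcon
    have h1 : log ⌊X ^ (1 / 3 - σ)⌋₊ ≤ 0 :=
      log_nonpos (by positivity) (mod_cast (by omega : ⌊X ^ (1 / 3 - σ)⌋₊ ≤ 1))
    nlinarith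
  have hy0 : (0 : ℝ) < ⌊X ^ (1 / 3 - σ)⌋₊ := mod_cast (by omega)
  have hyv : ⌊X ^ (1 / 3 - σ)⌋₊ ≤ ⌊X ^ (1 / 2 - σ)⌋₊ :=
    Nat.floor_le_floor (rpow_le_rpow_of_exponent_le hX1 (by linarith))
  have hy4 : ⌊X⌋₊ < ⌊X ^ (1 / 3 - σ)⌋₊ ^ 4 := by
    by_contra hcon
    have h1 := log_le_log (by positivity)
      (show (⌊X ^ (1 / 3 - σ)⌋₊ : ℝ) ^ 4 ≤ ⌊X⌋₊ by exact_mod_cast not_lt.mp hcon)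
    rw [log_pow] at h1
    push_cast at h1
    nlinarith
  have hf : ∀ s : ℝ, (⌊X ^ s⌋₊ : ℝ) ≤ X ^ s := fun s => Nat.floor_le (rpow_nonneg L.X_pos.le _)
  have hvv : ⌊X ^ (1 / 2 - σ)⌋₊ * ⌊X ^ (1 / 2 - σ)⌋₊ ≤ ⌊X⌋₊ := by
    refine Nat.le_floor ?_
    push_cast
    exact (L.mul_le_rpow (hf _) (hf _)).trans (L.rpow_le_self (by linarith))
  have hyyy : ⌊X ^ (1 / 3 - σ)⌋₊ * ⌊X ^ (1 / 3 - σ)⌋₊ * ⌊X ^ (1 / 3 - σ)⌋₊ ≤ ⌊X⌋₊ := by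
    refine Nat.le_floor ?_
    push_cast
    exact (L.mul_le_rpow (L.mul_le_rpow (hf _) (hf _)) (hf _)).trans (L.rpow_le_self (by linarith))
  refine ⟨?_, hy4⟩
  refine (card_exceptional_le_mul_div_log (κ := 4 * σ) hy2 hyv hvv hyyy hy4 (by nlinarith)
    (by nlinarith)).trans ?_
  have h1 : (⌊X⌋₊ : ℝ) / log ⌊X⌋₊ ≤ 2 * (X / log X) := by
    rw [← mul_div_assoc, div_le_div_iff₀ (by linarith) (by linarith)]
    nlinarith
  calc _ ≤ (26880 * σ) * (2 * (X / log X)) :=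
        mul_le_mul (by nlinarith) h1 (div_nonneg (by linarith) (by linarith)) (by positivity)
    _ = _ := by ring

set_option maxHeartbeats 1000000 in
theorem norm_sum_prime_rootSum_le (L : IsLarge σ M X) {C : ℝ} (hCM : C ≤ M)
    (hC : ∀ n : ℕ, n ≠ 0 → (tau n : ℝ) ≤ C * (n : ℝ) ^ (σ / 4000)) (hk : k ≠ 0)
    (hkM : 2 * (k.natAbs : ℝ) ≤ M) (ha0 : 0 < a) (hsq : Squarefree h)
    (hcop : Int.gcd a h = 1) (ha : (a : ℝ) ≤ X ^ (σ / 100)) (hh : (h : ℝ) ≤ X ^ (1 + σ / 100)) :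
    ‖∑ n ∈ Icc 1 ⌊X⌋₊, if n.Prime then rootSum a h k n else 0‖ ≤
      20000000 * σ * (X / log X) := by
  have H := L.isScale hCM hC ha0 hsq hcop ha hh
  have hω := L.hgt_le ha0 hh
  have hω0 : 0 < hgt a h := hgt_pos ha0 H.pos'
  have hX := L.two_thousand_le
  have hX0 := L.X_pos
  have hX1 : 1 ≤ X := by linarith
  have hσ := L.pos
  have hσ1 := L.le
  have hwℓ := L.pow_le_two_pow_smallExp
  have htU := L.two_pow_sq_smallExp_le
  obtain ⟨hexc, hy4⟩ := L.card_exceptional_le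
  have hU20 := L.pow_le
  have hℓM := L.le_log
  have hMge := L.M_ge
  have hMinv := L.inv_le
  have hZge := pow_le_topScale (X := X)
  have hXr : ∀ {r s : ℝ}, r ≤ s → X ^ r ≤ X ^ s := fun h => rpow_le_rpow_of_exponent_le hX1 h
  set ℓ := 1 + log X with hℓ
  set U := X ^ (σ / 100) with hU
  set t := smallExp X with ht
  set y := ⌊X ^ (1 / 3 - σ)⌋₊ with hy
  set v := ⌊X ^ (1 / 2 - σ)⌋₊ with hv
  set Z := topScale X with hZ
  have hℓ1 : 1 ≤ ℓ := by linarith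
  have hℓU : ℓ ≤ U := (le_self_pow₀ hℓ1 (by norm_num)).trans hU20
  have hU2 : 2000 ≤ U := by linarith
  have hU0 : 0 < U := by linarith
  have hZp : ∀ {n}, n ≤ 10 → X ^ n ≤ Z := fun h => (pow_le_pow_right₀ hX1 h).trans hZge
  have hyX : (y : ℝ) ≤ X ^ (1 / 3 - σ) := Nat.floor_le (rpow_nonneg hX0.le _)
  have hvX : (v : ℝ) ≤ X ^ (1 / 2 - σ) := Nat.floor_le (rpow_nonneg hX0.le _)
  have hκ : 0 < 4 / U * X := by positivity
  have hg := isCutoff_ramp hκ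
  have hLg : 4 * (1 / (4 / U * X)) * X = U := by field_simp
  have hkU : (k.natAbs : ℝ) ≤ U := by linarith [(Nat.cast_nonneg k.natAbs : (0 : ℝ) ≤ _)]
  have hkω : k.natAbs * hgt a h ≤ X :=
    (L.mul_le_rpow hkU hω).trans (L.rpow_le_self (by linarith))
  have hUX : U ≤ X := L.rpow_le_self (by linarith)
  have ht1 : 1 ≤ t := by
    by_contra h0
    rw [show t = 0 by omega, pow_zero] at hwℓ
    have := le_self_pow₀ hℓ1 (show 20 ≠ 0 by norm_num)
    linarith
  have hwy : 2 ^ t ≤ y := by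
    refine Nat.le_floor ?_
    push_cast
    calc (2 : ℝ) ^ t ≤ 2 ^ (t * t) := pow_le_pow_right₀ (by norm_num) (Nat.le_mul_of_pos_left t ht1)
      _ ≤ U := htU
      _ ≤ X ^ (1 / 3 - σ) := hXr (by linarith)
  have hy2 : 2 ≤ y := le_trans (le_trans (by norm_num) (Nat.pow_le_pow_right (by norm_num) ht1)) hwy
  have hyv : y ≤ v := Nat.floor_le_floor (hXr (by linarith))
  have hvv : (v : ℝ) * v ≤ X / U := (le_div_iff₀ hU0).mpr <|
    (L.mul_le_rpow (L.mul_le_rpow hvX hvX) hU.le).trans (L.rpow_le_self (by linarith))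
  have hvv' : v * v ≤ ⌊X⌋₊ := by
    refine Nat.le_floor ?_
    push_cast
    exact hvv.trans (div_le_self hX0.le (by linarith))
  have hT1 : ∑ x ∈ sieveSet y v ×ˢ smoothSet (2 ^ t) (2 ^ (t * t)),
      ‖∑ m ∈ Icc 1 (⌊X⌋₊ / (x.1 * x.2)), (ramp (4 / U) X (x.1 * x.2 * m : ℕ) : ℂ) *
        rootSum a h k (x.1 * x.2 * m)‖ ≤ 2 * X / U := by
    refine sum_sieveSet_smoothSet_le hcop hwy (by omega) fun I hI => ?_
    have hRb : (v : ℝ) * 2 ^ (t * t) ≤ X ^ (1 / 2 - σ + σ / 100) := by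
      rw [rpow_add hX0]; gcongr
    have hR1 : (1 : ℝ) ≤ v * 2 ^ (t * t) :=
      one_le_mul_of_one_le_of_one_le (mod_cast (by omega : 1 ≤ v))
        (one_le_pow₀ (by norm_num))
    refine H.sum_norm_weylSum_typeI_le hU2 hX1 hg (by linarith) hk hkU hkω ?_ hR1 ?_ ?_ ?_ I
      fun l hl => ⟨(hI l hl).1, (hI l hl).2.1, by exact_mod_cast (hI l hl).2.2⟩
    · calc 3 * (a : ℝ) * k.natAbs * X ≤ X * X * X * X := by gcongr <;> linarith
        _ = X ^ 4 := by ring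
        _ ≤ Z := hZp (by norm_num)
    · exact (L.mul_le_rpow (L.pow_le_rpow hRb 2) (L.pow_le_rpow hU.le 64)).trans
        (L.rpow_le_self (by push_cast; linarith))
    · exact (L.mul_le_rpow (L.mul_le_rpow hRb hω) (L.pow_le_rpow hU.le 64)).trans
        (L.rpow_le_self (by push_cast; linarith))
    · exact hRb.trans ((L.rpow_le_self (by linarith)).trans
        (by simpa using hZp (n := 1) (by norm_num)))
  have hT2 : ∀ j, 2 ^ (j + 1) > 2 ^ t → 2 ^ j < y → ∀ α : ℕ → ℝ, (∀ M ≠ 0, |α M| ≤ tau M) →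
      ‖∑ r ∈ (primesIco (2 ^ t) y).filter (Nat.log 2 · = j), ∑ M ∈ Icc 1 (⌊X⌋₊ / 2 ^ j),
        (α M : ℂ) * ((ramp (4 / U) X (r * M : ℕ) : ℂ) * rootSum a h k (r * M))‖ ≤
        30 * X / ℓ ^ 5 := by
    intro j hj hjy α hα
    have hPy : (2 : ℝ) ^ j ≤ X ^ (1 / 3 - σ) := le_trans (mod_cast hjy.le) hyX
    have hjt : (2 : ℝ) ^ t ≤ 2 * 2 ^ j := by rw [← pow_succ']; exact_mod_cast hj.le
    have hℓP : ℓ ^ 20 ≤ 2 * 2 ^ j := hwℓ.trans hjt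
    have hkP : k.natAbs < 2 ^ j := by
      have h1 : ℓ ^ 2 ≤ ℓ ^ 20 := pow_le_pow_right₀ hℓ1 (by norm_num)
      have h3 : ℓ * 2 ≤ ℓ * ℓ := mul_le_mul_of_nonneg_left (by linarith) (by linarith)
      have h2 : (k.natAbs : ℝ) < 2 ^ j := by rw [sq] at h1; linarith
      exact_mod_cast h2
    have hPX : (2 : ℝ) ^ j ≤ X := hPy.trans (L.rpow_le_self (by linarith))
    have key := H.norm_sum_primesIco_sq_le (w := 2 ^ t) (y := y) hU2 hg hLg.le hk hkP ?_ ?_ hPX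
      hkω ?_ hα
    · refine le_of_sq_le_sq (key.trans ?_) (by positivity)
      have e1 : 1 / (2 : ℝ) ^ j ≤ 2 / ℓ ^ 20 := by
        rw [div_le_div_iff₀ (by positivity) (by positivity)]; linarith
      calc _ ≤ 264 * X ^ 2 * ℓ ^ 10 * (2 / ℓ ^ 20 + 1 / ℓ ^ 20) := by gcongr
        _ = 792 * X ^ 2 / ℓ ^ 10 := by field_simp; ring
        _ ≤ 900 * X ^ 2 / ℓ ^ 10 := by gcongr; norm_num
        _ = _ := by rw [div_pow]; ring
    · exact (L.mul_le_rpow (L.pow_le_rpow hPy 3) (L.pow_le_rpow hU.le 60)).trans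
        (L.rpow_le_self (by push_cast; linarith))
    · exact (L.mul_le_rpow (L.mul_le_rpow hPy hω) (L.pow_le_rpow hU.le 60)).trans
        (L.rpow_le_self (by push_cast; linarith))
    · calc 6 * (a : ℝ) * k.natAbs * (2 ^ j) ^ 2 * X ≤ X * X * X * X ^ 2 * X := by
            gcongr <;> linarith
        _ = X ^ 6 := by ring
        _ ≤ Z := hZp (by norm_num)
  have hmain := norm_sum_prime_le (w := 2 ^ t) (t := t) (y := y) (v := v) (N := ⌊X⌋₊)
    (b := fun n => (ramp (4 / U) X n : ℂ) * rootSum a h k n) Nat.one_le_two_pow le_rfl hwy hy2 hyv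
    hvv' hy4 (fun n hn => ?_) (fun n hn => ?_) (by positivity) hT1 hT2
  · have hs := H.norm_sum_prime_sub_le (k := k) hκ (by
      rw [div_mul_eq_mul_div, div_le_iff₀ hU0, mul_comm X]
      exact mul_le_mul_of_nonneg_right (by linarith) hX0.le)
    have hNX : (⌊X⌋₊ : ℝ) ≤ X := Nat.floor_le hX0.le
    have hN1 : (1 : ℝ) ≤ ⌊X⌋₊ := mod_cast (Nat.one_le_floor_iff X).mpr hX1
    have hlN : 1 + log ⌊X⌋₊ ≤ ℓ := by linarith [log_le_log (by linarith) hNX]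
    have hlN0 : 0 ≤ 1 + log ⌊X⌋₊ := by linarith [log_nonneg hN1]
    have hXU : X / U ≤ X / ℓ ^ 20 := by gcongr
    have hdec : ∀ {i m : ℕ}, i + 4 ≤ m → X * ℓ ^ i / ℓ ^ m ≤ X / ℓ ^ 4 := by
      intro i m him
      rw [div_le_div_iff₀ (by positivity) (by positivity), mul_assoc, ← pow_add]
      gcongr
    have d0 : X / U ≤ X / ℓ ^ 4 := hXU.trans (by simpa using hdec (i := 0) (m := 20) (by norm_num))
    have d1 : 2 * X / U = 2 * (X / U) := by ring
    have d2 : (Nat.log 2 ⌊X⌋₊ + 1) * (30 * X / ℓ ^ 5) ≤ 60 * (X / ℓ ^ 4) := by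
      have h1 : (Nat.log 2 ⌊X⌋₊ : ℝ) * log 2 ≤ log ⌊X⌋₊ := by
        rw [← log_pow]
        exact log_le_log (by positivity)
          (mod_cast Nat.pow_log_le_self 2 (Nat.one_le_iff_ne_zero.mp (Nat.one_le_cast.mp hN1)))
      have h2 : (Nat.log 2 ⌊X⌋₊ + 1 : ℝ) ≤ 2 * ℓ := by
        have h3 := mul_le_mul_of_nonneg_left log_two_gt_d9.le (Nat.cast_nonneg (Nat.log 2 ⌊X⌋₊))
        linarith
      calc _ ≤ (2 * ℓ) * (30 * X / ℓ ^ 5) := by gcongr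
        _ = _ := by field_simp; ring
    have d3 : 72 * (⌊X⌋₊ : ℝ) * (1 + log ⌊X⌋₊) ^ 3 / (2 ^ t : ℕ) ≤ 72 * (X / ℓ ^ 4) := by
      push_cast
      calc _ ≤ 72 * X * ℓ ^ 3 / ℓ ^ 20 := by gcongr
        _ = 72 * (X * ℓ ^ 3 / ℓ ^ 20) := by ring
        _ ≤ _ := by linarith [hdec (i := 3) (m := 20) (by norm_num)]
    have d4 : 4 * (⌊X⌋₊ : ℝ) * (1 + log ⌊X⌋₊) ^ 15 / 2 ^ t ≤ 4 * (X / ℓ ^ 4) := by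
      calc _ ≤ 4 * X * ℓ ^ 15 / ℓ ^ 20 := by gcongr
        _ = 4 * (X * ℓ ^ 15 / ℓ ^ 20) := by ring
        _ ≤ _ := by linarith [hdec (i := 15) (m := 20) (by norm_num)]
    have d5 : 8 * ((v * v : ℕ) : ℝ) * (1 + log ⌊X⌋₊) ^ 3 ≤ 8 * (X / ℓ ^ 4) := by
      push_cast
      calc _ ≤ 8 * (X / ℓ ^ 20) * ℓ ^ 3 := by gcongr; exact hvv.trans hXU
        _ = 8 * (X * ℓ ^ 3 / ℓ ^ 20) := by ring
        _ ≤ _ := by linarith [hdec (i := 3) (m := 20) (by norm_num)]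
    have d6 : 8 * (4 / U * X + 1) ≤ 40 * (X / U) := by
      have : 1 ≤ X / U := (one_le_div hU0).mpr hUX
      have e : 4 / U * X = 4 * (X / U) := by ring
      rw [e]; linarith
    have d7 : 186 * (X / ℓ ^ 4) ≤ σ * (X / log X) := by
      have h1 := hMinv.trans hℓM
      rw [div_le_iff₀ hσ] at h1
      have h2 : 0 < log X := by linarith
      rw [← mul_div_assoc, ← mul_div_assoc, div_le_div_iff₀ (by positivity) h2]
      have h3 := le_self_pow₀ hℓ1 (show 3 ≠ 0 by norm_num)
      have h4 : log X ≤ ℓ ^ 3 := by linarith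
      calc 186 * X * log X ≤ (ℓ * σ) * X * ℓ ^ 3 := by gcongr; linarith
        _ = _ := by ring
    have htri := norm_add_le
      ((∑ n ∈ Icc 1 ⌊X⌋₊, if n.Prime then rootSum a h k n else 0) -
      ∑ n ∈ Icc 1 ⌊X⌋₊, if n.Prime then (ramp (4 / U) X n : ℂ) * rootSum a h k n else 0)
      (∑ n ∈ Icc 1 ⌊X⌋₊, if n.Prime then (ramp (4 / U) X n : ℂ) * rootSum a h k n else 0)
    rw [sub_add_cancel] at htri
    have hpos : 0 ≤ σ * (X / log X) := mul_nonneg hσ.le (div_nonneg hX0.le (by linarith))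
    linarith
  · rw [norm_mul, Complex.norm_real]
    calc _ ≤ 1 * (4 * tau n : ℝ) := mul_le_mul (hg.abs_le n)
          ((norm_rootSum_le n).trans (H.card_rts_le hn)) (norm_nonneg _) zero_le_one
      _ = _ := one_mul _
  · have h1 : X < n := (Nat.floor_lt hX0.le).mp hn
    simp only [hg.supp n h1, Complex.ofReal_zero, zero_mul]

end IsLarge

end

section

open Finset ComplexConjugate Complex

variable {J : ℕ} {θ E : ℝ} {ι : Type*} {I : Finset ι} {x : ι → ℝ}

lemma four_mul_le_norm_ee_sub_one {y : ℝ} (hθ : 0 ≤ θ) (h1 : θ ≤ |y|) (h2 : |y| ≤ 1 - θ) :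
    4 * θ ≤ ‖ee y - 1‖ := by
  have e : ee y = exp (Complex.I * (2 * Real.pi * y : ℝ)) := by rw [ee, mul_comm]
  have hs : |Real.sin (Real.pi * y)| = |Real.sin (Real.pi * |y|)| := by
    rcases abs_choice y with h | h <;> simp [h]
  rw [e, norm_exp_I_mul_ofReal_sub_one, norm_mul, Real.norm_eq_abs, Real.norm_eq_abs,
    show 2 * Real.pi * y / 2 = Real.pi * y by ring, hs, abs_two]
  have hp := Real.pi_pos
  suffices 2 * θ ≤ Real.sin (Real.pi * |y|) by linarith [le_abs_self (Real.sin (Real.pi * |y|))]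
  rcases le_total |y| (1 / 2) with h | h
  · have := Real.mul_le_sin (x := Real.pi * |y|) (by positivity) (by nlinarith)
    rw [show 2 / Real.pi * (Real.pi * |y|) = 2 * |y| by field_simp] at this
    linarith
  · rw [← Real.sin_pi_sub]
    have := Real.mul_le_sin (x := Real.pi - Real.pi * |y|)
      (by nlinarith [mul_nonneg hp.le (by linarith : 0 ≤ 1 - |y|)])
      (by nlinarith)
    rw [show 2 / Real.pi * (Real.pi - Real.pi * |y|) = 2 * (1 - |y|) by field_simp] at this
    nlinarith [abs_nonneg y]

lemma ee_nat_mul (n : ℕ) (y : ℝ) : ee (n * y) = ee y ^ n := by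
  rw [ee, ee, ← exp_nat_mul]; congr 1; push_cast; ring

lemma sum_ee_eq_zero {k : ℤ} (hk : k ≠ 0) (hkJ : |k| < J) :
    ∑ j ∈ range J, ee (k * (j / J : ℝ)) = 0 := by
  have hJ : (0 : ℝ) < J := mod_cast (abs_nonneg k).trans_lt hkJ
  have hk1 : (1 : ℝ) ≤ |(k : ℝ)| := mod_cast Int.one_le_abs hk
  have hk2 : |(k : ℝ)| + 1 ≤ J := mod_cast hkJ
  have h1 : ee (k / J) ≠ 1 := fun h => by
    have := four_mul_le_norm_ee_sub_one (θ := 1 / J) (y := k / J) (by positivity)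
      (by rw [abs_div, abs_of_pos hJ]; gcongr)
      (by rw [abs_div, abs_of_pos hJ, le_sub_iff_add_le, ← add_div, div_le_one hJ]; exact hk2)
    rw [h, sub_self, norm_zero] at this
    have : 0 < 4 * (1 / (J : ℝ)) := by positivity
    linarith
  rw [sum_congr rfl fun (j : ℕ) _ => show ee (k * (j / J : ℝ)) = ee (k / J) ^ j by
    rw [← ee_nat_mul]; congr 1; ring, geom_sum_eq h1, ← ee_nat_mul, mul_div_cancel₀ _ hJ.ne',
    ee_int, sub_self, zero_div]

/-- The normalised Fejér kernel. -/
def fejer (J : ℕ) (y : ℝ) : ℝ := ‖∑ n ∈ range J, ee (n * y)‖ ^ 2 / J ^ 2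

lemma fejer_nonneg (y : ℝ) : 0 ≤ fejer J y := by unfold fejer; positivity

lemma fejer_eq (y : ℝ) : (fejer J y : ℂ) =
    (∑ m ∈ range J, ∑ n ∈ range J, ee (((m : ℤ) - n : ℤ) * y)) / J ^ 2 := by
  rw [fejer]
  push_cast
  rw [← mul_conj', map_sum, sum_mul_sum]
  congr 1
  refine sum_congr rfl fun m _ => sum_congr rfl fun n _ => ?_
  rw [conj_ee, ← ee_add]; congr 1; ring

lemma abs_sub_lt {m n : ℕ} (hm : m ∈ range J) (hn : n ∈ range J) : |(m : ℤ) - n| < J := by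
  rw [mem_range] at hm hn; rw [abs_lt]; omega

lemma sum_fejer (hJ : 0 < J) (x : ℝ) : ∑ j ∈ range J, fejer J (x - j / J) = 1 := by
  have h : ∀ m ∈ range J, ∀ n ∈ range J,
      ∑ j ∈ range J, ee (((m : ℤ) - n : ℤ) * (x - j / J)) = if m = n then (J : ℂ) else 0 := by
    intro m hm n hn
    split_ifs with hmn
    · subst hmn
      rw [sub_self]
      simpa using congrArg ((J : ℂ) * ·) (ee_int 0)
    · rw [sum_congr rfl fun (j : ℕ) _ => show ee (((m : ℤ) - n : ℤ) * (x - j / J)) =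
        ee (((m : ℤ) - n : ℤ) * x) * ee (((n : ℤ) - m : ℤ) * (j / J : ℝ)) by
        rw [← ee_add]; congr 1; push_cast; ring, ← mul_sum,
        sum_ee_eq_zero (by omega) (abs_sub_lt hn hm), mul_zero]
  have hJ' : (J : ℂ) ≠ 0 := mod_cast hJ.ne'
  apply ofReal_injective
  push_cast
  simp_rw [fejer_eq]
  rw [← sum_div, sum_comm, sum_congr rfl fun m hm => by
    rw [sum_comm, sum_congr rfl fun n hn => h m hm n hn, sum_ite_eq, if_pos hm]]
  rw [sum_const, card_range, nsmul_eq_mul]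
  field_simp

lemma sum_fejer_sub_le (hJ : 0 < J) (hE : 0 ≤ E)
    (h : ∀ k : ℤ, k ≠ 0 → |k| < J → ‖∑ i ∈ I, ee (k * x i)‖ ≤ E) (c : ℝ) :
    ∑ i ∈ I, fejer J (x i - c) ≤ #I / J + E := by
  have hJ' : (0 : ℝ) < J := mod_cast hJ
  have e : ∑ i ∈ I, (fejer J (x i - c) : ℂ) = (∑ m ∈ range J, ∑ n ∈ range J,
      ee (-(((m : ℤ) - n : ℤ) * c)) * ∑ i ∈ I, ee (((m : ℤ) - n : ℤ) * x i)) / J ^ 2 := by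
    simp_rw [fejer_eq]
    rw [← sum_div, sum_comm]
    congr 1
    refine sum_congr rfl fun m _ => ?_
    rw [sum_comm]
    refine sum_congr rfl fun n _ => ?_
    rw [mul_sum]
    refine sum_congr rfl fun i _ => ?_
    rw [← ee_add]; congr 1; ring
  have hb : ∀ m ∈ range J, ∀ n ∈ range J,
      ‖ee (-(((m : ℤ) - n : ℤ) * c)) * ∑ i ∈ I, ee (((m : ℤ) - n : ℤ) * x i)‖ ≤
        (if m = n then (#I : ℝ) else 0) + E := by
    intro m hm n hn
    rw [norm_mul, norm_ee, one_mul]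
    split_ifs with hmn
    · refine (norm_sum_le _ _).trans ?_
      simp only [norm_ee, sum_const, nsmul_eq_mul, mul_one]
      linarith
    · linarith [h ((m : ℤ) - n) (by omega) (abs_sub_lt hm hn)]
  have h1 : ∑ i ∈ I, fejer J (x i - c) = ‖∑ i ∈ I, (fejer J (x i - c) : ℂ)‖ := by
    rw [← ofReal_sum, norm_real, Real.norm_of_nonneg
      (sum_nonneg fun i _ => fejer_nonneg _)]
  rw [h1, e, norm_div, norm_pow, norm_natCast]
  calc _ ≤ (∑ m ∈ range J, ∑ n ∈ range J, ((if m = n then (#I : ℝ) else 0) + E)) / J ^ 2 := by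
        gcongr
        exact (norm_sum_le _ _).trans (sum_le_sum fun m hm => (norm_sum_le _ _).trans
          (sum_le_sum fun n hn => hb m hm n hn))
    _ = _ := by
        rw [sum_congr rfl fun m hm => by
          rw [sum_add_distrib, sum_ite_eq, if_pos hm, sum_const, card_range, nsmul_eq_mul]]
        rw [sum_const, card_range, nsmul_eq_mul]
        field_simp

lemma fejer_le (hJ : 0 < J) (hθ : 0 < θ) {y : ℝ} (h1 : θ ≤ |y|) (h2 : |y| ≤ 1 - θ) :
    fejer J y ≤ 1 / (4 * J ^ 2 * θ ^ 2) := by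
  have h := four_mul_le_norm_ee_sub_one hθ.le h1 h2
  have hn : ‖∑ n ∈ range J, ee (n * y)‖ ≤ 1 / (2 * θ) := by
    rw [sum_congr rfl fun n _ => ee_nat_mul n y, geom_sum_eq fun h' => by
      rw [h', sub_self, norm_zero] at h; linarith, ← ee_nat_mul, norm_div]
    have : ‖ee (J * y) - 1‖ ≤ 2 := (norm_sub_le _ _).trans (by rw [norm_ee, norm_one]; norm_num)
    calc _ ≤ 2 / (4 * θ) := by gcongr
      _ = _ := by ring
  calc fejer J y ≤ (1 / (2 * θ)) ^ 2 / J ^ 2 := by unfold fejer; gcongr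
    _ = _ := by ring

lemma card_filter_range_le {u v : ℝ} (huv : u ≤ v) (hv : 0 ≤ v) :
    (#((range J).filter fun j : ℕ => u ≤ (j : ℝ) ∧ (j : ℝ) ≤ v) : ℝ) ≤ v - u + 1 := by
  have hs : ((range J).filter fun j : ℕ => u ≤ (j : ℝ) ∧ (j : ℝ) ≤ v) ⊆ Icc ⌈u⌉₊ ⌊v⌋₊ := by
    intro j hj
    rw [mem_filter] at hj
    exact mem_Icc.mpr ⟨Nat.ceil_le.mpr hj.2.1, Nat.le_floor hj.2.2⟩
  have h := card_le_card hs
  rw [Nat.card_Icc] at h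
  have h1 := Nat.floor_le hv
  have h2 := Nat.le_ceil u
  rcases le_total ⌈u⌉₊ (⌊v⌋₊ + 1) with h3 | h3
  · have : (#((range J).filter fun j : ℕ => u ≤ (j : ℝ) ∧ (j : ℝ) ≤ v) : ℝ) + ⌈u⌉₊ ≤ ⌊v⌋₊ + 1 := by
      exact_mod_cast (by omega : _ + ⌈u⌉₊ ≤ ⌊v⌋₊ + 1)
    linarith
  · rw [Nat.sub_eq_zero_of_le h3, Nat.le_zero] at h
    rw [h]; push_cast; linarith

lemma card_filter_le_of_norm_sum_le {α β : ℝ}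
    (hJ : 1 / θ ^ 3 ≤ J) (hθ : 0 < θ) (hθ' : θ ≤ 1 / 2)
    (hE : 0 ≤ E) (hx : ∀ i ∈ I, 0 ≤ x i ∧ x i ≤ 1)
    (h : ∀ k : ℤ, k ≠ 0 → |k| < J → ‖∑ i ∈ I, ee (k * x i)‖ ≤ E)
    (hα : 0 ≤ α) (hαβ : α ≤ β) :
    (#{i ∈ I | α ≤ x i ∧ x i ≤ β} : ℝ) ≤ (β - α + 6 * θ) * #I + J * E := by
  have hJ1 : (0 : ℝ) < J := lt_of_lt_of_le (by positivity) hJ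
  have hJ0 : 0 < J := mod_cast hJ1
  rw [div_le_iff₀ (by positivity)] at hJ
  set A := ((range J).filter fun j : ℕ => (α - θ) * J ≤ (j : ℝ) ∧ (j : ℝ) ≤ (β + θ) * J) ∪
    (((range J).filter fun j : ℕ => 0 ≤ (j : ℝ) ∧ (j : ℝ) ≤ θ * J) ∪
      ((range J).filter fun j : ℕ => (1 - θ) * J ≤ (j : ℝ) ∧ (j : ℝ) ≤ J)) with hA
  have hAr : A ⊆ range J :=
    union_subset (filter_subset _ _) (union_subset (filter_subset _ _) (filter_subset _ _))
  have hcA : (#A : ℝ) ≤ (β - α + 5 * θ) * J := by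
    have h1 := card_filter_range_le (J := J) (u := (α - θ) * J) (v := (β + θ) * J)
      (by gcongr; linarith) (mul_nonneg (by linarith) hJ1.le)
    have h2 := card_filter_range_le (J := J) (u := 0) (v := θ * J) (by positivity) (by positivity)
    have h3 := card_filter_range_le (J := J) (u := (1 - θ) * J) (v := J)
      (by nlinarith) hJ1.le
    have h4 : (#A : ℝ) ≤ _ := Nat.cast_le.mpr ((card_union_le _ _).trans
      (Nat.add_le_add_left (card_union_le _ _) _))
    push_cast at h4
    have h5 : 3 ≤ θ * J := by
      nlinarith [mul_nonneg (mul_nonneg hθ.le hJ1.le) (by nlinarith : 0 ≤ 1 / 4 - θ ^ 2)]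
    linarith
  have hfar : ∀ i ∈ {i ∈ I | α ≤ x i ∧ x i ≤ β}, ∀ j ∈ range J, j ∉ A →
      fejer J (x i - j / J) ≤ 1 / (4 * J ^ 2 * θ ^ 2) := by
    intro i hi j hj hjA
    obtain ⟨hi, h1, h2⟩ := mem_filter.mp hi
    obtain ⟨h3, h4⟩ := hx i hi
    have hjJ : (j : ℝ) ≤ J := mod_cast (mem_range.mp hj).le
    simp only [hA, mem_union, mem_filter, hj, true_and, hjJ, and_true, Nat.cast_nonneg,
      ← div_le_iff₀ hJ1, ← le_div_iff₀ hJ1] at hjA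
    push Not at hjA
    obtain ⟨h5, h6, h7⟩ := hjA
    refine fejer_le hJ0 hθ ?_ (abs_le.mpr ⟨by linarith, by linarith⟩)
    rcases le_total (α - θ) (j / J : ℝ) with h8 | h8
    · linarith [h5 h8, neg_le_abs (x i - j / J)]
    · linarith [le_abs_self (x i - j / J)]
  have hone : ∀ i ∈ {i ∈ I | α ≤ x i ∧ x i ≤ β},
      (1 : ℝ) ≤ ∑ j ∈ A, fejer J (x i - j / J) + θ := by
    intro i hi
    rw [← sum_fejer hJ0 (x i), ← sum_sdiff hAr, add_comm]
    gcongr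
    calc _ ≤ ∑ j ∈ range J \ A, 1 / (4 * (J : ℝ) ^ 2 * θ ^ 2) := sum_le_sum fun j hj =>
          hfar i hi j (mem_sdiff.mp hj).1 (mem_sdiff.mp hj).2
      _ ≤ ∑ j ∈ range J, 1 / (4 * (J : ℝ) ^ 2 * θ ^ 2) :=
          sum_le_sum_of_subset_of_nonneg sdiff_subset fun _ _ _ => by positivity
      _ = 1 / (4 * (J : ℝ) * θ ^ 2) := by
          rw [sum_const, card_range, nsmul_eq_mul]; field_simp
      _ ≤ θ := by rw [div_le_iff₀ (by positivity)]; nlinarith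
  have hsub := filter_subset (fun i => α ≤ x i ∧ x i ≤ β) I
  calc (#{i ∈ I | α ≤ x i ∧ x i ≤ β} : ℝ)
      = ∑ i ∈ I with α ≤ x i ∧ x i ≤ β, (1 : ℝ) := by simp
    _ ≤ ∑ i ∈ I with α ≤ x i ∧ x i ≤ β, (∑ j ∈ A, fejer J (x i - j / J) + θ) :=
        sum_le_sum hone
    _ ≤ ∑ i ∈ I, (∑ j ∈ A, fejer J (x i - j / J) + θ) :=
        sum_le_sum_of_subset_of_nonneg hsub fun i _ _ =>
          add_nonneg (sum_nonneg fun _ _ => fejer_nonneg _) hθ.le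
    _ = ∑ j ∈ A, ∑ i ∈ I, fejer J (x i - j / J) + θ * #I := by
        rw [sum_add_distrib, sum_comm, sum_const, nsmul_eq_mul, mul_comm (#I : ℝ)]
    _ ≤ #A * (#I / J + E) + θ * #I := by
        gcongr
        exact (sum_le_sum fun j _ => sum_fejer_sub_le hJ0 hE h _).trans
          (by rw [sum_const, nsmul_eq_mul])
    _ ≤ (β - α + 5 * θ) * J * (#I / J) + J * E + θ * #I := by
        have : (#A : ℝ) ≤ J := by
          simpa using Nat.cast_le (α := ℝ).mpr (card_le_card hAr)
        rw [mul_add]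
        gcongr
    _ = _ := by field_simp; ring

/-- A quantitative Weyl criterion. -/
theorem abs_card_filter_sub_le {α β : ℝ}
    (hJ : 1 / θ ^ 3 ≤ J) (hθ : 0 < θ) (hθ' : θ ≤ 1 / 2)
    (hE : 0 ≤ E) (hx : ∀ i ∈ I, 0 ≤ x i ∧ x i ≤ 1)
    (h : ∀ k : ℤ, k ≠ 0 → |k| < J → ‖∑ i ∈ I, ee (k * x i)‖ ≤ E)
    (hα : 0 ≤ α) (hαβ : α ≤ β) (hβ : β ≤ 1) :
    |(#{i ∈ I | α < x i ∧ x i ≤ β} : ℝ) - (β - α) * #I| ≤ 12 * θ * #I + 2 * (J * E) := by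
  have H := fun {u v : ℝ} => card_filter_le_of_norm_sum_le hJ hθ hθ' hE hx h (α := u) (β := v)
  have h1 := H hα hαβ
  have h2 := H le_rfl hα
  have h3 := H (hα.trans hαβ) hβ
  have h4 : (#{i ∈ I | α < x i ∧ x i ≤ β} : ℝ) ≤ #{i ∈ I | α ≤ x i ∧ x i ≤ β} :=
    Nat.cast_le.mpr (card_le_card (monotone_filter_right _ fun i _ hi => ⟨hi.1.le, hi.2⟩))
  have h5 : (#I : ℝ) ≤ #{i ∈ I | α < x i ∧ x i ≤ β} +
      (#{i ∈ I | 0 ≤ x i ∧ x i ≤ α} + #{i ∈ I | β ≤ x i ∧ x i ≤ 1}) := by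
    have : I ⊆ {i ∈ I | α < x i ∧ x i ≤ β} ∪
        ({i ∈ I | 0 ≤ x i ∧ x i ≤ α} ∪ {i ∈ I | β ≤ x i ∧ x i ≤ 1}) := fun i hi => by
      obtain ⟨h6, h7⟩ := hx i hi
      simp only [mem_union, mem_filter, hi, true_and, h6, h7, and_true]
      rcases le_or_gt (x i) α with h8 | h8 <;> rcases le_total (x i) β with h9 | h9 <;> tauto
    exact_mod_cast (card_le_card this).trans ((card_union_le _ _).trans
      (Nat.add_le_add_left (card_union_le _ _) _))
  have h6 : 0 ≤ θ * #I := by positivity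
  rw [abs_le]
  constructor <;> nlinarith

end

section

open Finset

lemma rhoDensity_eq_card_rts (a h : ℤ) {k : ℕ} (hk : k ≠ 0) : rhoDensity a h k = #(rts a h k) := by
  have : NeZero k := ⟨hk⟩
  have key (ν : ℕ) : (a : ZMod k) * (ν : ZMod k) ^ 2 + h = 0 ↔ (k : ℤ) ∣ a * (ν : ℤ) ^ 2 + h := by
    rw [← ZMod.intCast_zmod_eq_zero_iff_dvd]; push_cast; rfl
  rw [rhoDensity, Nat.card_eq_fintype_card, Fintype.card_subtype]
  refine card_bij (fun ν _ => ν.val) (fun ν hν => ?_) (fun _ _ _ _ h => ZMod.val_injective k h)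
    fun ν hν => ?_
  · rw [mem_filter] at hν
    exact mem_rts.mpr ⟨ν.val_lt, (key _).mp (by rw [ZMod.natCast_zmod_val]; exact hν.2)⟩
  · rw [mem_rts] at hν
    exact ⟨ν, mem_filter.mpr ⟨mem_univ _, (key ν).mpr hν.2⟩, ZMod.val_natCast_of_lt hν.1⟩

/-- The primes up to `X`. -/
def primesUpTo (X : ℝ) : Finset ℕ := (range (⌊X⌋₊ + 1)).filter Nat.Prime

lemma mem_primesUpTo {X : ℝ} (hX : 0 ≤ X) {p : ℕ} :
    p ∈ primesUpTo X ↔ p.Prime ∧ (p : ℝ) ≤ X := by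
  rw [primesUpTo, mem_filter, mem_range, Nat.lt_succ_iff, Nat.le_floor_iff hX, and_comm]

lemma div_log_le_card_primesUpTo {X : ℝ} (hX : 2000 ≤ X) :
    X / Real.log X ≤ 4 * #(primesUpTo X) := by
  have h0 : 0 < Real.log X := Real.log_pos (by linarith)
  have h1 := Chebyshev.pi_ge' (x := X) (by linarith)
  rw [Nat.primeCounting, Nat.primeCounting', Nat.count_eq_card_filter_range,
    div_le_iff₀ h0] at h1
  have h2 := Real.log_le_sub_one_of_pos (x := (X + 2) / 2 ^ 3) (by positivity)
  rw [Real.log_div (by positivity) (by positivity), Real.log_pow] at h2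
  push_cast at h2
  rw [div_le_iff₀ h0, primesUpTo]
  nlinarith [Real.log_two_gt_d9, Real.log_two_lt_d9]

/-- The pairs `(p, ν)` with `p ≤ X` prime and `ν` a root modulo `p`. -/
def rootPairs (a h : ℤ) (X : ℝ) : Finset (ℕ × ℕ) :=
  (primesUpTo X ×ˢ range (⌊X⌋₊ + 1)).filter fun q => q.2 ∈ rts a h q.1

lemma mem_rootPairs {a h : ℤ} {X : ℝ} {q : ℕ × ℕ} :
    q ∈ rootPairs a h X ↔ q.1 ∈ primesUpTo X ∧ q.2 ∈ rts a h q.1 := by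
  rw [rootPairs, mem_filter, mem_product]
  refine ⟨fun H => ⟨H.1.1, H.2⟩, fun H => ⟨⟨H.1, ?_⟩, H.2⟩⟩
  have h1 := mem_range.mp (mem_filter.mp H.1).1
  exact mem_range.mpr ((mem_rts.mp H.2).1.trans h1)

lemma card_rootPairs (a h : ℤ) (X : ℝ) :
    #(rootPairs a h X) = ∑ p ∈ primesUpTo X, rhoDensity a h p := by
  rw [card_eq_sum_ones, sum_finset_product _ _ _ fun q => mem_rootPairs]
  refine sum_congr rfl fun p hp => ?_
  rw [rhoDensity_eq_card_rts a h (mem_filter.mp hp).2.ne_zero, card_eq_sum_ones]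

variable {σ M X : ℝ} {a h : ℕ} {k : ℤ}

lemma IsLarge.abs_card_sub_le (L : IsLarge σ M X) {C : ℝ} (hCM : C ≤ M)
    (hC : ∀ n : ℕ, n ≠ 0 → (tau n : ℝ) ≤ C * (n : ℝ) ^ (σ / 4000)) (ha0 : 0 < a)
    (hsq : Squarefree h) (hcop : Int.gcd a h = 1) (ha : (a : ℝ) ≤ X ^ (σ / 100))
    (hh : (h : ℝ) ≤ X ^ (1 + σ / 100)) {θ : ℝ} {J : ℕ} (hJ : 1 / θ ^ 3 ≤ J) (hJM : 2 * J ≤ M)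
    (hθ : 0 < θ) (hθ' : θ ≤ 1 / 2) {α β : ℝ} (hα : 0 ≤ α) (hαβ : α ≤ β) (hβ : β ≤ 1) :
    |(#((rootPairs a h X).filter fun q => α < (q.2 / q.1 : ℝ) ∧ (q.2 / q.1 : ℝ) ≤ β) : ℝ) -
        (β - α) * #(rootPairs a h X)| ≤
      (96 * θ + 160000000 * (J * σ)) * #(primesUpTo X) := by
  have hX := L.two_thousand_le
  have hsum (k : ℤ) (hk : k ≠ 0) (hkJ : |k| < J) :
      ‖∑ q ∈ rootPairs a h X, ee (k * (q.2 / q.1 : ℝ))‖ ≤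
        80000000 * σ * #(primesUpTo X) := by
    have hk' : 2 * (k.natAbs : ℝ) ≤ M := by
      rw [Nat.cast_natAbs]
      have : ((|k| : ℤ) : ℝ) ≤ J := mod_cast hkJ.le
      linarith
    have h1 := L.norm_sum_prime_rootSum_le hCM hC hk hk' ha0 hsq hcop ha hh
    rw [sum_finset_product _ _ _ fun q => mem_rootPairs]
    have h2 : ∑ p ∈ primesUpTo X, ∑ ν ∈ rts a h p, ee (k * (ν / p : ℝ)) =
        ∑ n ∈ Icc 1 ⌊X⌋₊, if n.Prime then rootSum a h k n else 0 := by
      rw [← sum_filter]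
      refine sum_congr ?_ fun _ _ => rfl
      ext p
      simp only [primesUpTo, mem_filter, mem_range, mem_Icc, Nat.lt_succ_iff]
      exact ⟨fun H => ⟨⟨H.2.one_le, H.1⟩, H.2⟩, fun H => ⟨H.1.2, H.2⟩⟩
    rw [h2]
    refine h1.trans ?_
    have := mul_le_mul_of_nonneg_left (div_log_le_card_primesUpTo hX)
      (by linarith [L.pos] : 0 ≤ 20000000 * σ)
    linarith
  have hI : (#(rootPairs a h X) : ℝ) ≤ 8 * #(primesUpTo X) := by
    rw [card_rootPairs]
    push_cast
    rw [mul_comm, ← nsmul_eq_mul, ← sum_const]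
    refine sum_le_sum fun p hp => ?_
    have hp := (mem_filter.mp hp).2
    rw [rhoDensity_eq_card_rts _ _ hp.ne_zero]
    refine ((L.isScale hCM hC ha0 hsq hcop ha hh).card_rts_le hp.ne_zero).trans ?_
    rw [tau, hp.divisors, card_pair hp.one_lt.ne]
    norm_num
  have H := abs_card_filter_sub_le (I := rootPairs a h X) (x := fun q => (q.2 / q.1 : ℝ))
    (E := 80000000 * σ * #(primesUpTo X)) hJ hθ hθ'
    (mul_nonneg (by linarith [L.pos]) (Nat.cast_nonneg _)) (fun q hq => ⟨by positivity, ?_⟩) hsum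
    hα hαβ hβ
  · refine H.trans ?_
    have := mul_le_mul_of_nonneg_left hI hθ.le
    linarith
  · exact div_le_one_of_le₀ (mod_cast (mem_rts.mp (mem_rootPairs.mp hq).2).1.le)
      (Nat.cast_nonneg _)

end

end

end RootEquidist

/-- **Equidistribution of roots of quadratic congruences, uniformly in the shift.**
For every `ε > 0` there are `δ > 0` and `X₀` such that for all `X ≥ X₀`, squarefree
`1 ≤ h ≤ X^{1+δ}`, `1 ≤ a ≤ X^δ` with `gcd(a,h) = 1`, and all `0 ≤ α < β ≤ 1`:
`|#{(p,ν) : p ≤ X prime, 0 ≤ ν < p, p ∣ aν² + h, α < ν/p ≤ β} − (β−α)·Σ_{p ≤ X} ϱ_{a,h}(p)|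
  ≤ ε·π(X)`. -/
theorem stmt1 :
    ∀ ε : ℝ, 0 < ε → ∃ δ : ℝ, 0 < δ ∧ ∃ X₀ : ℝ, ∀ X : ℝ, X₀ ≤ X →
      ∀ h a : ℤ, Squarefree h → 1 ≤ h → (h : ℝ) ≤ X ^ (1 + δ) →
        1 ≤ a → (a : ℝ) ≤ X ^ δ → Int.gcd a h = 1 →
        ∀ α β : ℝ, 0 ≤ α → α < β → β ≤ 1 →
          |(Nat.card {pv : ℕ × ℕ // pv.1.Prime ∧ (pv.1 : ℝ) ≤ X ∧ pv.2 < pv.1 ∧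
              (pv.1 : ℤ) ∣ a * (pv.2 : ℤ) ^ 2 + h ∧
              α < (pv.2 : ℝ) / (pv.1 : ℝ) ∧ (pv.2 : ℝ) / (pv.1 : ℝ) ≤ β} : ℝ)
            - (β - α) * ∑ p ∈ (Finset.range (Nat.floor X + 1)).filter Nat.Prime,
                (rhoDensity a h p : ℝ)|
          ≤ ε * (Nat.card {p : ℕ // p.Prime ∧ (p : ℝ) ≤ X} : ℝ) := by
  intro ε hε
  obtain ⟨θ, hθ, hθε, hθ'⟩ : ∃ θ : ℝ, 0 < θ ∧ θ ≤ ε / 192 ∧ θ ≤ 1 / 2 :=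
    ⟨min (ε / 192) (1 / 2), by positivity, min_le_left _ _, min_le_right _ _⟩
  obtain ⟨J, hJ⟩ := exists_nat_ge (1 / θ ^ 3)
  have hJ0 : (0 : ℝ) < J := lt_of_lt_of_le (by positivity) hJ
  obtain ⟨σ, hσ, hσ1, hσJ⟩ : ∃ σ : ℝ, 0 < σ ∧ σ ≤ 1 / 100 ∧ σ ≤ ε / (320000000 * J) :=
    ⟨min (1 / 100) (ε / (320000000 * J)), by positivity, min_le_left _ _, min_le_right _ _⟩
  obtain ⟨C, -, hC⟩ := RootEquidist.exists_tau_le_rpow (show 0 < σ / 4000 by positivity)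
  obtain ⟨X₀, hX₀⟩ := RootEquidist.exists_isLarge (M := 2000 + 200 / σ + |C| + 2 * J) hσ hσ1
    (by linarith [abs_nonneg C, (by positivity : 0 ≤ 200 / σ)])
    (by linarith [abs_nonneg C])
  refine ⟨σ / 100, by positivity, X₀, fun X hX h a hsq hh1 hh ha1 ha hcop α β hα hαβ hβ => ?_⟩
  lift h to ℕ using by omega
  lift a to ℕ using by omega
  have L := hX₀ X hX
  have hX0 := L.X_pos.le
  have H := L.abs_card_sub_le
    (by linarith [le_abs_self C, (by positivity : 0 ≤ 200 / σ)]) hC (by omega)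
    (Int.squarefree_natCast.mp hsq) hcop (mod_cast ha) (mod_cast hh) hJ
    (by linarith [abs_nonneg C, (by positivity : 0 ≤ 200 / σ)]) hθ hθ' hα hαβ.le hβ
  rw [RootEquidist.card_rootPairs] at H
  push_cast at H
  rw [Nat.subtype_card (RootEquidist.primesUpTo X) fun p => RootEquidist.mem_primesUpTo hX0,
    Nat.subtype_card ((RootEquidist.rootPairs a h X).filter
      fun q => α < (q.2 / q.1 : ℝ) ∧ (q.2 / q.1 : ℝ) ≤ β) fun q => by
    rw [Finset.mem_filter, RootEquidist.mem_rootPairs, RootEquidist.mem_primesUpTo hX0,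
      RootEquidist.mem_rts]
    tauto]
  refine H.trans ?_
  rw [le_div_iff₀ (by positivity)] at hσJ
  gcongr
  linarith
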